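/- There is a constant τ > 0 such that for every bounded primitive integral Apollonian circle packing there exists X₀ with the property that for all X ≥ X₀, every subset S ⊆ {1, 2, …, X} with |S| ≥ (1−τ)·X contains at least one curvature of the packing, i.e. S ∩ K ≠ ∅. -/

import Mathlib

section
open Matrix Finset

/-- The Descartes quadratic form `Q(x₁,x₂,x₃,x₄) = 2(x₁²+x₂²+x₃²+x₄²) − (x₁+x₂+x₃+x₄)²`. -/
def descartesForm (v : Fin 4 → ℤ) : ℤ :=
  2 * ((v 0) ^ 2 + (v 1) ^ 2 + (v 2) ^ 2 + (v 3) ^ 2) - (v 0 + v 1 + v 2 + v 3) ^ 2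

def apS1 : Matrix (Fin 4) (Fin 4) ℤ := !![-1, 2, 2, 2; 0, 1, 0, 0; 0, 0, 1, 0; 0, 0, 0, 1]
def apS2 : Matrix (Fin 4) (Fin 4) ℤ := !![1, 0, 0, 0; 2, -1, 2, 2; 0, 0, 1, 0; 0, 0, 0, 1]
def apS3 : Matrix (Fin 4) (Fin 4) ℤ := !![1, 0, 0, 0; 0, 1, 0, 0; 2, 2, -1, 2; 0, 0, 0, 1]
def apS4 : Matrix (Fin 4) (Fin 4) ℤ := !![1, 0, 0, 0; 0, 1, 0, 0; 0, 0, 1, 0; 2, 2, 2, -1]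

/-- The Apollonian group, generated by `S₁, S₂, S₃, S₄` (each generator is an involution,
so the multiplicative closure coincides with the generated group). -/
def apollonianGroup : Submonoid (Matrix (Fin 4) (Fin 4) ℤ) :=
  Submonoid.closure {apS1, apS2, apS3, apS4}

/-- A root quadruple of a bounded primitive integral Apollonian circle packing. -/
def IsRootQuadruple (v : Fin 4 → ℤ) : Prop :=
  v 0 < 0 ∧ 0 ≤ v 1 ∧ v 1 ≤ v 2 ∧ v 2 ≤ v 3 ∧ v 3 ≤ v 0 + v 1 + v 2 ∧
    Int.gcd (Int.gcd (Int.gcd (v 0) (v 1)) (v 2)) (v 3) = 1 ∧ descartesForm v = 0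

/-- The set of curvatures of the packing with root quadruple `v`. -/
def curvatures (v : Fin 4 → ℤ) : Set ℤ :=
  { n | ∃ g ∈ apollonianGroup, ∃ i : Fin 4, g.mulVec v i = n }
end

notation:max "§" x:max => (x : ℝ)
notation "¶" => (by positivity)
notation "½" => (-(1/2) : ℝ)
notation "¼" => (-(1/4) : ℝ)
notation "⅛" => (1/8 : ℝ)
notation:max "¥" x:max => (x : ℤ)
notation "¤" => (by norm_num)
notation "£" => (by linarith)
notation "¢" => (by omega)
notation "◌" => ?_

section
open Matrix Finset Real

/-- some permutation of `(a,b,c,d)` lies in the orbit of `v`. -/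
def InOrb (v : Fin 4 → ℤ) (w : Fin 4 → ℤ) : Prop :=
  ∃ σ : Equiv.Perm (Fin 4), ∃ g ∈ apollonianGroup, g.mulVec v = w ∘ σ

theorem InOrb.perm {v w : Fin 4 → ℤ} (h : InOrb v w) (τ : Equiv.Perm (Fin 4)) :
    InOrb v (w ∘ τ) := by
  obtain ⟨σ, g, hg, h⟩ := h
  refine ⟨σ.trans τ.symm, g, hg, ◌⟩
  rw [h]; ext i; simp

theorem InOrb.cur {v w : Fin 4 → ℤ} (h : InOrb v w) (i : Fin 4) : w i ∈ curvatures v := by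
  obtain ⟨σ, g, hg, h⟩ := h
  exact ⟨g, hg, σ.symm i, by rw [h]; simp⟩

theorem InOrb.flip {v w : Fin 4 → ℤ} (h : InOrb v w) (j : Fin 4) :
    InOrb v (Function.update w j (2 * (∑ i, w i) - 3 * w j)) := by
  obtain ⟨σ, g, hg, h⟩ := h
  have key : ∀ k : Fin 4, ∃ S ∈ apollonianGroup, ∀ u : Fin 4 → ℤ,
      S.mulVec u = Function.update u k (2 * (∑ i, u i) - 3 * u k) := by
    intro k
    have hm : ∀ S ∈ ({apS1, apS2, apS3, apS4} : Set (Matrix (Fin 4) (Fin 4) ℤ)),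
        S ∈ apollonianGroup := fun S hS => Submonoid.subset_closure hS
    fin_cases k
    · refine ⟨apS1, hm _ (by simp), fun u => ◌⟩
      ext i; fin_cases i <;> simp [apS1, Matrix.mulVec, dotProduct, Fin.sum_univ_four]
      ring
    · refine ⟨apS2, hm _ (by simp), fun u => ◌⟩
      ext i; fin_cases i <;> simp [apS2, Matrix.mulVec, dotProduct, Fin.sum_univ_four]
      ring
    · refine ⟨apS3, hm _ (by simp), fun u => ◌⟩
      ext i; fin_cases i <;> simp [apS3, Matrix.mulVec, dotProduct, Fin.sum_univ_four]
      ring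
    · refine ⟨apS4, hm _ (by simp), fun u => ◌⟩
      ext i; fin_cases i <;> simp [apS4, Matrix.mulVec, dotProduct, Fin.sum_univ_four]
      ring
  obtain ⟨S, hS, hSu⟩ := key (σ.symm j)
  refine ⟨σ, S * g, mul_mem hS hg, ◌⟩
  rw [← Matrix.mulVec_mulVec, h, hSu]
  have hs : ∑ i, (w ∘ σ) i = ∑ i, w i := Equiv.sum_comp σ w
  rw [hs]
  ext i
  by_cases hi : i = σ.symm j
  · subst hi; simp
  · have : σ i ≠ j := fun hh => hi (by simp [← hh])
    simp [Function.update_of_ne hi, Function.update_of_ne this]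

theorem InOrb.r1 {v : Fin 4 → ℤ} {a b c d : ℤ} (h : InOrb v ![a, b, c, d]) :
    InOrb v ![b, a, c, d] := by
  convert h.perm (Equiv.swap 0 1) using 1
  ext i; fin_cases i <;> rfl
theorem InOrb.r2 {v : Fin 4 → ℤ} {a b c d : ℤ} (h : InOrb v ![a, b, c, d]) :
    InOrb v ![a, c, b, d] := by
  convert h.perm (Equiv.swap 1 2) using 1
  ext i; fin_cases i <;> rfl
theorem InOrb.r3 {v : Fin 4 → ℤ} {a b c d : ℤ} (h : InOrb v ![a, b, c, d]) :
    InOrb v ![a, b, d, c] := by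
  convert h.perm (Equiv.swap 2 3) using 1
  ext i; fin_cases i <;> rfl
theorem InOrb.f3 {v : Fin 4 → ℤ} {a b c d : ℤ} (h : InOrb v ![a, b, c, d]) :
    InOrb v ![a, b, c, 2 * (a + b + c) - d] := by
  convert h.flip 3 using 1
  ext i; fin_cases i <;> simp [Fin.sum_univ_four] ; ring

/-- quadruple in the orbit, Descartes relation, primitive -/
def Quad (v : Fin 4 → ℤ) (a b c d : ℤ) : Prop :=
  InOrb v ![a, b, c, d] ∧ 2 * (a^2+b^2+c^2+d^2) = (a+b+c+d)^2 ∧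
    ∀ p : ℤ, Prime p → ¬ (p ∣ a ∧ p ∣ b ∧ p ∣ c ∧ p ∣ d)

theorem Quad.r1 {v : Fin 4 → ℤ} {a b c d : ℤ} (h : Quad v a b c d) : Quad v b a c d :=
  ⟨h.1.r1, by linarith [h.2.1], fun p hp hh => h.2.2 p hp (by tauto)⟩
theorem Quad.r2 {v : Fin 4 → ℤ} {a b c d : ℤ} (h : Quad v a b c d) : Quad v a c b d :=
  ⟨h.1.r2, by linarith [h.2.1], fun p hp hh => h.2.2 p hp (by tauto)⟩
theorem Quad.r3 {v : Fin 4 → ℤ} {a b c d : ℤ} (h : Quad v a b c d) : Quad v a b d c :=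
  ⟨h.1.r3, by linarith [h.2.1], fun p hp hh => h.2.2 p hp (by tauto)⟩
theorem Quad.f3 {v : Fin 4 → ℤ} {a b c d : ℤ} (h : Quad v a b c d) :
    Quad v a b c (2 * (a + b + c) - d) := by
  refine ⟨h.1.f3, by linarith [h.2.1], fun p hp hh => h.2.2 p hp ⟨hh.1, hh.2.1, hh.2.2.1, ◌⟩⟩
  have : d = 2 * (a + b + c) - (2 * (a + b + c) - d) := by ring
  rw [this]
  exact dvd_sub (Dvd.dvd.mul_left (dvd_add (dvd_add hh.1 hh.2.1) hh.2.2.1) _) hh.2.2.2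

/-- Euclid on the pair `(x,y)`. The form attached to `(a;b,c,d)` is
`(a+b)x² + (d-a-b-c)... `-/
theorem Quad.euclid {v : Fin 4 → ℤ} (n : ℕ) : ∀ {a b c d x y : ℤ}, Quad v a b c d →
    IsCoprime x y → x.natAbs + y.natAbs ≤ n →
    ∃ c' d', Quad v a ((a+b)*x^2 + (d-a-b-c)*x*y + (a+c)*y^2 - a) c' d' := by
  induction n with
  | zero =>
    intro a b c d x y _ hxy hn
    have hx : x = 0 := by omega
    have hy : y = 0 := by omega
    subst hx hy
    exact absurd hxy (by rw [isCoprime_zero_left]; simp)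
  | succ n ih =>
    have pos : ∀ {a b c d x y : ℤ}, Quad v a b c d →
      IsCoprime x y → x.natAbs + y.natAbs ≤ n + 1 → 0 ≤ x → 0 ≤ y → 
      ∃ c' d', Quad v a ((a+b)*x^2 + (d-a-b-c)*x*y + (a+c)*y^2 - a) c' d' := by
      intro a b c d x y h hxy hn hx hy
      rcases eq_or_lt_of_le hx with hx0 | hx0
      · subst hx0
        have hu : IsUnit y := isCoprime_zero_left.1 hxy
        refine ⟨b, d, ◌⟩
        rcases Int.isUnit_iff.1 hu with rfl | rfl
        · convert h.r2 using 1; ring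
        · convert h.r2 using 1; ring
      rcases eq_or_lt_of_le hy with hy0 | hy0
      · subst hy0
        have hu : IsUnit x := isCoprime_zero_right.1 hxy
        refine ⟨c, d, ◌⟩
        rcases Int.isUnit_iff.1 hu with rfl | rfl
        · convert h using 1; ring
        · convert h using 1; ring
      rcases le_total y x with hle | hle
      · -- x -> x - y
        have h1 : Quad v a b (2*(a+b+d)-c) d := by
          have := h.r3.f3.r3
          exact this
        have h2 := ih h1.r3 (x := x - y) (y := y) (by
          have := hxy.add_mul_right_left (-1); simpa [sub_eq_add_neg] using this) ¢
        obtain ⟨c', d', h3⟩ := h2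
        refine ⟨c', d', ◌⟩
        convert h3 using 1
        ring
      · have h1 : Quad v a c (2*(a+c+d)-b) d := by
          have := h.r2.r3.f3.r3
          exact this
        have h2 := ih h1.r3 (x := y - x) (y := x) (by
          have := hxy.symm.add_mul_right_left (-1)
          simpa [sub_eq_add_neg] using this) ¢
        obtain ⟨c', d', h3⟩ := h2
        refine ⟨c', d', ◌⟩
        convert h3 using 1
        ring
    intro a b c d x y h hxy hn
    rcases le_total 0 (x * y) with hs | hs
    · have : ∃ e : ℤ, e^2 = 1 ∧ 0 ≤ e * x ∧ 0 ≤ e * y := by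
        rcases le_total 0 x with hx | hx <;> rcases le_total 0 y with hy | hy
        · exact ⟨1, by simp [hx, hy]⟩
        · rcases eq_or_lt_of_le hx with h0 | h0
          · exact ⟨-1, by simp [← h0, hy]⟩
          · exact ⟨1, by norm_num, by simpa, by nlinarith⟩
        · rcases eq_or_lt_of_le hy with h0 | h0
          · exact ⟨-1, by simp [← h0, hx]⟩
          · exact ⟨1, by norm_num, by nlinarith, by simpa⟩
        · exact ⟨-1, by simp [hx, hy]⟩
      obtain ⟨e, he, hex, hey⟩ := this
      have hu : IsUnit e := IsUnit.of_mul_eq_one e (by rw [← sq, he])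
      obtain ⟨c', d', h3⟩ := pos h (x := e * x) (y := e * y) (by
        rw [isCoprime_mul_unit_left hu]; exact hxy) (by
          rcases Int.isUnit_iff.1 hu with rfl | rfl <;> simpa using hn) hex hey
      refine ⟨c', d', ◌⟩
      convert h3 using 1
      linear_combination (-((a+b)*x^2 + (d-a-b-c)*x*y + (a+c)*y^2)) * he
    · have : ∃ e : ℤ, e^2 = 1 ∧ 0 ≤ e * x ∧ 0 ≤ -e * y := by
        rcases le_total 0 x with hx | hx <;> rcases le_total 0 y with hy | hy
        · rcases eq_or_lt_of_le hx with h0 | h0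
          · exact ⟨-1, by simp [← h0, hy]⟩
          · exact ⟨1, by norm_num, by simpa, by nlinarith⟩
        · exact ⟨1, by simp [hx, hy]⟩
        · exact ⟨-1, by simp [hx, hy]⟩
        · rcases eq_or_lt_of_le hx with h0 | h0
          · exact ⟨1, by simp [h0, hy]⟩
          · exact ⟨-1, by norm_num, by linarith, by nlinarith⟩
      obtain ⟨e, he, hex, hey⟩ := this
      have hu : IsUnit e := IsUnit.of_mul_eq_one e (by rw [← sq, he])
      obtain ⟨c', d', h3⟩ := pos h.f3 (x := e * x) (y := e * -y) (by
        rw [isCoprime_mul_unit_left hu]; exact hxy.neg_right) (by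
          rcases Int.isUnit_iff.1 hu with rfl | rfl <;> simpa using hn) hex £
      refine ⟨c', d', ◌⟩
      convert h3 using 1
      linear_combination (-((a+b)*x^2 + (d-a-b-c)*x*y + (a+c)*y^2)) * he
end

section
open Matrix Finset Real

theorem Quad.form {v : Fin 4 → ℤ} {a b c d : ℤ} (h : Quad v a b c d) :
    ∃ β : ℤ, d - a - b - c = 2 * β ∧ (a+b)*(a+c) - β^2 = a^2 ∧
      ∀ p : ℤ, Prime p → ¬ (p ∣ a + b ∧ p ∣ a + c ∧ p ∣ (a+b) + 2 * β + (a+c)) := by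
  have h1 : (d - a - b - c)^2 = 4 * (a*b+b*c+c*a) := by linarith [h.2.1]
  have h2 : Even (d - a - b - c) := by
    have : Even ((d - a - b - c)^2) := by rw [h1]; exact ⟨2 * (a*b+b*c+c*a), by ring⟩
    exact (Int.even_pow.1 this).1
  obtain ⟨β, hβ⟩ := h2
  have hβ' : d - a - b - c = 2 * β := by omega
  have hd : (a+b)*(a+c) - β^2 = a^2 := by rw [hβ'] at h1; linarith
  refine ⟨β, hβ', hd, ◌⟩
  rintro p hp ⟨h3, h4, h5⟩
  have h5' : p ∣ a + d := by convert h5 using 1; omega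
  have h6 : p ∣ 2 * a := by
    have hb : p ∣ 2 * β := by
      have := dvd_sub (dvd_sub h5 h3) h4
      have e : 2 * β = (a+b) + 2 * β + (a+c) - (a+b) - (a+c) := by ring
      rwa [e]
    rcases hp.dvd_or_dvd hb with hb | hb
    · exact Dvd.dvd.mul_right hb _
    · have : p ∣ a^2 := by rw [← hd]; exact dvd_sub (Dvd.dvd.mul_right h3 _) (dvd_pow hb two_ne_zero)
      exact Dvd.dvd.mul_left (hp.dvd_of_dvd_pow this) _
  rcases hp.dvd_or_dvd h6 with h7 | h7
  · -- p = 2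
    have h2p : ¥2 ∣ p := by
      have := (hp.irreducible.associated_of_dvd Int.prime_two.irreducible h7)
      exact this.symm.dvd
    have e1 := h2p.trans h3
    have e2 := h2p.trans h4
    have e3 := h2p.trans h5'
    rcases Int.even_or_odd a with ha | ha
    · exact h.2.2 2 Int.prime_two ⟨by obtain ⟨k, hk⟩ := ha; omega, by obtain ⟨k, hk⟩ := ha; omega, by obtain ⟨k, hk⟩ := ha; omega, by obtain ⟨k, hk⟩ := ha; omega⟩
    · obtain ⟨k, hk⟩ := ha
      obtain ⟨b', hb'⟩ : ∃ b', b = 2*b'+1 := ⟨(b-1)/2, by omega⟩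
      obtain ⟨c', hc'⟩ : ∃ b', c = 2*b'+1 := ⟨(c-1)/2, by omega⟩
      obtain ⟨d', hd'⟩ : ∃ b', d = 2*b'+1 := ⟨(d-1)/2, by omega⟩
      have := h.2.1
      subst hk hb' hc' hd'
      have e : ∀ t : ℤ, Even (t^2 + t) := fun t => by
        rw [sq, ← mul_add_one]; exact Int.even_mul_succ_self t
      obtain ⟨k2, hk2⟩ := e k
      obtain ⟨b2, hb2⟩ := e b'
      obtain ⟨c2, hc2⟩ := e c'
      obtain ⟨d2, hd2⟩ := e d'
      have key : (k+b'+c'+d'+2)^2 = 2 + 4 * (k2+b2+c2+d2) := by linarith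
      have : (k+b'+c'+d'+2)^2 % 4 = 2 := by rw [key]; omega
      rcases Int.even_or_odd (k+b'+c'+d'+2) with ⟨m, hm⟩ | ⟨m, hm⟩ <;> rw [hm] at this <;>
        ring_nf at this <;> omega
  · refine h.2.2 p hp ⟨h7, ◌, ◌, ◌⟩
    · simpa using dvd_sub h3 h7
    · simpa using dvd_sub h4 h7
    · simpa using dvd_sub h5' h7

theorem geom_aux {v : Fin 4 → ℤ} {a0 b0 c0 d0 β : ℤ} (hQ : Quad v a0 b0 c0 d0) (h0 : a0 < 0)
    (hk : 0 < a0 + b0) (hβ : d0 - a0 - b0 - c0 = 2 * β) (hdet : (a0+b0)*(a0+c0) - β^2 = a0^2)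
    (x y : ℤ) (hxy : IsCoprime x y) :
    ∃ A a B C : ℤ, A = (a0+b0)*x^2 + 2*β*x*y + (a0+c0)*y^2 ∧ a = A - a0 ∧
      A * C - B^2 = a^2 ∧ |2*B| ≤ A ∧ (∀ p : ℤ, Prime p → ¬ (p ∣ A ∧ p ∣ B ∧ p ∣ C)) ∧
      ∀ z w : ℤ, IsCoprime z w → A * z^2 + 2*B*z*w + C*w^2 - a ∈ curvatures v := by
  obtain ⟨c', d', hq⟩ := hQ.euclid _ hxy le_rfl
  rw [hβ] at hq
  have hApos : 0 < (a0 + b0) * x^2 + 2*β*x*y + (a0 + c0)*y^2 := by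
    obtain ⟨κ, hκ⟩ : ∃ κ, κ = a0 + b0 := ⟨_, rfl⟩
    obtain ⟨γ, hγ⟩ : ∃ κ, κ = a0 + c0 := ⟨_, rfl⟩
    rw [← hκ, ← hγ] at hdet ⊢; rw [← hκ] at hk
    have : κ * (κ * x^2 + 2*β*x*y + γ*y^2) = (κ*x + β * y)^2 + a0^2*y^2 := by
      linear_combination y^2 * hdet
    by_contra hc
    have h7 : κ * (κ * x^2 + 2*β*x*y + γ*y^2) ≤ 0 := mul_nonpos_of_nonneg_of_nonpos hk.le £
    have h9 := mul_nonneg (sq_nonneg a0) (sq_nonneg y)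
    have h10 := sq_nonneg (κ*x + β * y)
    have h8 : a0^2*y^2 = 0 := by linarith
    have hy : y = 0 := by
      rcases mul_eq_zero.1 h8 with h | h
      · have := pow_eq_zero_iff (two_ne_zero) |>.1 h; omega
      · exact pow_eq_zero_iff (two_ne_zero) |>.1 h
    have hx : x = 0 := by
      subst hy
      have : (κ*x + β * 0)^2 = 0 := by linarith
      have := pow_eq_zero_iff (two_ne_zero) |>.1 this
      rw [mul_zero, add_zero] at this
      rcases mul_eq_zero.1 this with h | h
      · omega
      · exact h
    subst hx hy
    exact absurd hxy (by rw [isCoprime_zero_left]; simp)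
  generalize hA : (a0 + b0) * x^2 + 2*β*x*y + (a0 + c0)*y^2 = A at hq hApos ⊢
  obtain ⟨a, ha⟩ : ∃ a, a = A - a0 := ⟨_, rfl⟩
  rw [← ha] at hq
  obtain ⟨B, hB, hdet', hprim'⟩ := hq.r1.form
  have hAa : a + a0 = A := by rw [ha]; ring
  rw [hAa] at hdet' hprim'
  -- shift
  obtain ⟨t, ht⟩ : ∃ t : ℤ, |2 * (B + t * A)| ≤ A := by
    refine ⟨-((2*B + A) / (2*A)), ◌⟩
    have h7 := Int.emod_nonneg (2*B+A) (show (2*A) ≠ 0 by omega)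
    have h8 := Int.emod_lt_of_pos (2*B+A) (show 0 < 2*A by omega)
    have h9 := Int.emod_add_mul_ediv (2*B+A) (2*A)
    rw [abs_le]; constructor <;> linarith
  refine ⟨A, a, B + t * A, (a + c') + 2*t*B + t^2*A, rfl, ha, by linear_combination hdet', ht, ◌, ◌⟩
  · rintro p hp ⟨p1, p2, p3⟩
    have q2 : p ∣ B := (Int.dvd_iff_dvd_of_dvd_add (p2)).2 (Dvd.dvd.mul_left p1 t)
    have q3 : p ∣ a + c' := by
      have := dvd_sub (dvd_sub p3 (Dvd.dvd.mul_left p1 (t^2))) (Dvd.dvd.mul_left q2 (2*t))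
      have e : a + c' = (a + c') + 2*t*B + t^2*A - t^2*A - 2*t*B := by ring
      rwa [e]
    exact hprim' p hp ⟨p1, q3, dvd_add (dvd_add p1 (Dvd.dvd.mul_left q2 _)) q3⟩
  · intro z w hzw
    obtain ⟨c2, d2, hq2⟩ := hq.r1.euclid _ (x := z + t * w) (y := w) (hzw.add_mul_right_left t) le_rfl
    have := hq2.1.cur 1
    have e : A * z^2 + 2*(B + t * A)*z*w + ((a + c') + 2*t*B + t^2*A)*w^2 - a =
        (a + a0) * (z + t * w)^2 + (d' - a - a0 - c') * (z + t * w) * w + (a + c') * w^2 - a := by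
      rw [hB, hAa]; ring
    rw [e]; exact this

theorem geom (v : Fin 4 → ℤ) (hv : IsRootQuadruple v) : ∃ κ β γ a0 : ℤ, 0 < κ ∧ 0 < γ ∧ a0 < 0 ∧
    κ * γ - β^2 = a0^2 ∧ (∀ p : ℤ, Prime p → ¬ (p ∣ κ ∧ p ∣ γ ∧ p ∣ κ + 2 * β + γ)) ∧
    ∀ x y : ℤ, IsCoprime x y → ∃ A a B C : ℤ, A = κ*x^2 + 2*β*x*y + γ*y^2 ∧ a = A - a0 ∧
      A * C - B^2 = a^2 ∧ |2*B| ≤ A ∧ (∀ p : ℤ, Prime p → ¬ (p ∣ A ∧ p ∣ B ∧ p ∣ C)) ∧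
      ∀ z w : ℤ, IsCoprime z w → A * z^2 + 2*B*z*w + C*w^2 - a ∈ curvatures v := by
  obtain ⟨h0, h1, h2, h3, h4, h5, h6⟩ := hv
  have hQ : Quad v (v 0) (v 1) (v 2) (v 3) := by
    refine ⟨⟨1, 1, one_mem _, ◌⟩, by unfold descartesForm at h6; linarith, ◌⟩
    · ext i; fin_cases i <;> simp
    · rintro p hp ⟨p0, p1, p2, p3⟩
      have := Int.dvd_coe_gcd (Int.dvd_coe_gcd (Int.dvd_coe_gcd p0 p1) p2) p3
      rw [h5] at this
      exact hp.not_isUnit (isUnit_of_dvd_one (by simpa using this))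
  obtain ⟨β, hβ, hdet, hprim⟩ := hQ.form
  have hk : 0 < v 0 + v 1 := by
    rcases eq_or_lt_of_le (show 0 ≤ v 0 + v 1 by linarith) with h | h
    · rw [← h] at hdet; nlinarith [sq_nonneg β]
    · exact h
  exact ⟨v 0 + v 1, β, v 0 + v 2, v 0, hk, by linarith, h0, hdet, hprim,
    fun x y hxy => geom_aux hQ h0 hk hβ hdet x y hxy⟩
end

section
open Finset Real

/-- binary quadratic form -/
def qf {R : Type*} [CommRing R] (A B C x y : R) : R := A*x^2 + 2*B*x*y + C*y^2

/-- Gauss sum of a binary form. -/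
noncomputable def GS {R : Type*} [CommRing R] [Fintype R] (ψ : AddChar R ℂ) (A B C b k l : R) : ℂ :=
  ∑ u : R × R, ψ (b * qf A B C u.1 u.2 + k * u.1 + l * u.2)

/-- kernel of `2F` -/
def ker2 {R : Type*} [CommRing R] [Fintype R] [DecidableEq R] (A B C : R) : Finset (R × R) :=
  univ.filter fun s => 2 * (A * s.1 + B * s.2) = 0 ∧ 2 * (B * s.1 + C * s.2) = 0

theorem GS_sq {R : Type*} [CommRing R] [Fintype R] [DecidableEq R] {ψ : AddChar R ℂ}
    (hψ : ψ.IsPrimitive) (A B C : R) (b : Rˣ) (k l : R) :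
    ‖GS ψ A B C b k l‖ ^ 2 ≤ (Fintype.card R : ℝ)^2 * (ker2 A B C).card := by
  have h1 : ((‖GS ψ A B C b k l‖ ^ 2 : ℝ) : ℂ) =
      ∑ s : R × R, ψ (b * qf A B C s.1 s.2 + k * s.1 + l * s.2) *
        ∑ u : R × R, ψ (u.1 * (b * (2 * (A * s.1 + B * s.2)))) * ψ (u.2 * (b * (2 * (B * s.1 + C * s.2)))) := by
    have : ((‖GS ψ A B C b k l‖ ^ 2 : ℝ) : ℂ) = GS ψ A B C b k l * starRingEnd ℂ (GS ψ A B C b k l) := by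
      rw [Complex.mul_conj, Complex.normSq_eq_norm_sq]
    rw [this, GS, map_sum, sum_mul_sum, sum_comm]
    have e1 : ∀ u : R × R, ∑ i : R × R, ψ (b * qf A B C i.1 i.2 + k * i.1 + l * i.2) *
        (starRingEnd ℂ) (ψ (b * qf A B C u.1 u.2 + k * u.1 + l * u.2)) =
        ∑ s : R × R, ψ (b * qf A B C s.1 s.2 + k * s.1 + l * s.2) *
          (ψ (u.1 * (b * (2 * (A * s.1 + B * s.2)))) * ψ (u.2 * (b * (2 * (B * s.1 + C * s.2))))) := by
      intro u
      rw [← Equiv.sum_comp (Equiv.addRight u)]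
      refine sum_congr rfl fun s _ => ◌
      rw [← AddChar.map_neg_eq_conj, ← AddChar.map_add_eq_mul, ← AddChar.map_add_eq_mul,
        ← AddChar.map_add_eq_mul]
      congr 1
      simp [qf]; ring
    rw [sum_congr rfl fun u _ => e1 u, sum_comm]
    simp_rw [mul_sum]
  have h2 : ∀ s : R × R, ∑ u : R × R, ψ (u.1 * (b * (2 * (A * s.1 + B * s.2)))) *
      ψ (u.2 * (b * (2 * (B * s.1 + C * s.2)))) =
      if s ∈ ker2 A B C then (Fintype.card R : ℂ)^2 else 0 := by
    intro s
    rw [Fintype.sum_prod_type]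
    simp_rw [← mul_sum, ← sum_mul]
    rw [AddChar.sum_mulShift _ hψ, AddChar.sum_mulShift _ hψ]
    simp only [Units.mul_right_eq_zero, ker2, mem_filter, mem_univ, true_and]
    by_cases hh : 2 * (A * s.1 + B * s.2) = 0 <;> by_cases hh' : 2 * (B * s.1 + C * s.2) = 0 <;>
      simp [hh, hh', sq]
  simp_rw [h2] at h1
  have h3 : ‖GS ψ A B C b k l‖ ^ 2 = ‖((‖GS ψ A B C b k l‖ ^ 2 : ℝ) : ℂ)‖ := by
    rw [Complex.norm_real]; simp
  rw [h3, h1]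
  refine (norm_sum_le _ _).trans ◌
  have : ∀ s : R × R, ‖ψ (b * qf A B C s.1 s.2 + k * s.1 + l * s.2) *
      (if s ∈ ker2 A B C then (Fintype.card R : ℂ)^2 else 0)‖ ≤
      if s ∈ ker2 A B C then (Fintype.card R : ℝ)^2 else 0 := by
    intro s; rw [norm_mul, AddChar.norm_apply, one_mul]; split_ifs <;> simp
  refine (sum_le_sum fun s _ => this s).trans ◌
  rw [← sum_filter]
  simp [mul_comm]

/-- data of a pair of forms with frequencies and shift -/
structure Dat (R : Type*) where
  (A B C k l A' B' C' k' l' h : R)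

def Dat.map {R S : Type*} (f : R → S) (D : Dat R) : Dat S :=
  ⟨f D.A, f D.B, f D.C, f D.k, f D.l, f D.A', f D.B', f D.C', f D.k', f D.l', f D.h⟩

def Dat.tw {R : Type*} [Mul R] (c : R) (D : Dat R) : Dat R :=
  ⟨D.A, D.B, D.C, c * D.k, c * D.l, D.A', D.B', D.C', c * D.k', c * D.l', D.h⟩

noncomputable def US {R : Type*} [CommRing R] [Fintype R] [DecidableEq R] (ψ : AddChar R ℂ) (D : Dat R) : ℂ :=
  ∑ b : Rˣ, ψ (-(D.h * b)) * (GS ψ D.A D.B D.C b D.k D.l *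
    starRingEnd ℂ (GS ψ D.A' D.B' D.C' b D.k' D.l'))

theorem GS_equiv {R S : Type*} [CommRing R] [Fintype R] [CommRing S]
    [Fintype S] (e : R ≃+* S) (ψ : AddChar S ℂ) (A B C b k l : R) :
    GS (ψ.compAddMonoidHom (e : R →+* S).toAddMonoidHom) A B C b k l = GS ψ (e A) (e B) (e C) (e b) (e k) (e l) := by
  unfold GS
  refine Fintype.sum_equiv (Equiv.prodCongr e.toEquiv e.toEquiv) _ _ fun u => ◌
  simp [qf, show e 2 = 2 from map_ofNat e 2]

theorem US_equiv {R S : Type*} [CommRing R] [Fintype R] [DecidableEq R] [CommRing S]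
    [Fintype S] [DecidableEq S] (e : R ≃+* S) (ψ : AddChar S ℂ) (D : Dat R) :
    US (ψ.compAddMonoidHom (e : R →+* S).toAddMonoidHom) D = US ψ (D.map e) := by
  unfold US
  refine Fintype.sum_equiv (Units.mapEquiv e.toMulEquiv).toEquiv _ _ fun b => ◌
  rw [GS_equiv, GS_equiv]
  simp [Dat.map]

theorem GS_prod {R S : Type*} [CommRing R] [Fintype R] [CommRing S] [Fintype S]
    (ψ : AddChar R ℂ) (φ : AddChar S ℂ) (χ : AddChar (R × S) ℂ)
    (hχ : ∀ x, χ x = ψ x.1 * φ x.2) (A B C b k l : R × S) :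
    GS χ A B C b k l = GS ψ A.1 B.1 C.1 b.1 k.1 l.1 * GS φ A.2 B.2 C.2 b.2 k.2 l.2 := by
  unfold GS
  rw [sum_mul_sum, ← Fintype.sum_prod_type']
  refine Fintype.sum_equiv (Equiv.prodProdProdComm R S R S) _ _ fun u => ◌
  rw [hχ]
  simp [qf]

theorem US_prod {R S : Type*} [CommRing R] [Fintype R] [DecidableEq R] [CommRing S] [Fintype S]
    [DecidableEq S]
    (ψ : AddChar R ℂ) (φ : AddChar S ℂ) (χ : AddChar (R × S) ℂ)
    (hχ : ∀ x, χ x = ψ x.1 * φ x.2) (D : Dat (R × S)) :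
    US χ D = US ψ (D.map Prod.fst) * US φ (D.map Prod.snd) := by
  unfold US
  rw [sum_mul_sum, ← Fintype.sum_prod_type']
  refine Fintype.sum_equiv MulEquiv.prodUnits.toEquiv _ _ fun b => ◌
  rw [hχ, GS_prod ψ φ χ hχ, GS_prod ψ φ χ hχ]
  simp [Dat.map, MulEquiv.prodUnits]
  ring

theorem US_tw {R : Type*} [CommRing R] [Fintype R] [DecidableEq R] (ψ : AddChar R ℂ) (D : Dat R) (c : Rˣ) :
    US (ψ.mulShift c) D = US ψ (D.tw c) := by
  unfold US
  refine Fintype.sum_equiv (Equiv.mulLeft c) _ _ fun b => ◌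
  have : ∀ A B C k l : R, GS (ψ.mulShift c) A B C b k l = GS ψ A B C ((c * b : Rˣ) : R) (c * k) (c * l) := by
    intro A B C k l
    unfold GS
    refine sum_congr rfl fun u _ => ◌
    rw [AddChar.mulShift_apply]
    congr 1
    push_cast; ring
  rw [this, this, AddChar.mulShift_apply]
  simp only [Dat.tw, Equiv.coe_mulLeft, Units.val_mul]
  congr 2
  ring
end

section
open Finset Real

/-- the exponential sum `U(q)` for integer data -/
noncomputable def UZ (q : ℕ) [NeZero q] (D : Dat ℤ) : ℂ :=
  US (ZMod.stdAddChar (N := q)) (D.map (fun x : ℤ => (x : ZMod q)))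

theorem UZ_mul (m n : ℕ) [NeZero m] [NeZero n] [NeZero (m*n)] (h : m.Coprime n) (D : Dat ℤ) :
    ∃ c d : ℤ, UZ (m * n) D = UZ m (D.tw c) * UZ n (D.tw d) := by
  have hm0 : (m:ℂ) ≠ 0 := mod_cast NeZero.ne m
  have hn0 : (n:ℂ) ≠ 0 := mod_cast NeZero.ne n
  obtain ⟨s, r, hrs⟩ : ∃ s r : ℤ, s * m + r * n = 1 := Nat.isCoprime_iff_coprime.2 h
  have hr : (r : ZMod m) * (n : ZMod m) = 1 := by
    have := congrArg (fun z : ℤ => (z : ZMod m)) hrs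
    simpa using this
  have hs : (s : ZMod n) * (m : ZMod n) = 1 := by
    have := congrArg (fun z : ℤ => (z : ZMod n)) hrs
    simpa using this
  set ur : (ZMod m)ˣ := Units.mkOfMulEqOne _ _ hr
  set us : (ZMod n)ˣ := Units.mkOfMulEqOne _ _ hs
  have hur : (ur : ZMod m) = (r : ZMod m) := rfl
  have hus : (us : ZMod n) = (s : ZMod n) := rfl
  refine ⟨r, s, ◌⟩
  let e := ZMod.chineseRemainder h
  let χ : AddChar (ZMod m × ZMod n) ℂ :=
    (ZMod.stdAddChar (N := m * n)).compAddMonoidHom ((e.symm : _ →+* _).toAddMonoidHom)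
  have h1 : ZMod.stdAddChar (N := m * n) = χ.compAddMonoidHom ((e : _ →+* _).toAddMonoidHom) := by
    ext x; simp [χ]
  have hχ : ∀ x, χ x = (ZMod.stdAddChar (N := m)).mulShift ur x.1 *
      (ZMod.stdAddChar (N := n)).mulShift us x.2 := by
    intro x
    obtain ⟨y, rfl⟩ := e.surjective x
    obtain ⟨j, rfl⟩ := ZMod.intCast_surjective y
    have e1 : χ (e (j : ZMod (m*n))) = ZMod.stdAddChar (j : ZMod (m*n)) := by simp [χ]
    have e2 : e (j : ZMod (m*n)) = ((j : ZMod m), (j : ZMod n)) := by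
      rw [map_intCast]; rfl
    rw [e1, e2, AddChar.mulShift_apply, AddChar.mulShift_apply, hur, hus]
    simp only
    rw [← Int.cast_mul, ← Int.cast_mul, ZMod.stdAddChar_coe, ZMod.stdAddChar_coe, ZMod.stdAddChar_coe,
      ← Complex.exp_add]
    congr 1
    have := congrArg (fun z : ℤ => (z : ℂ)) hrs
    push_cast at this ⊢
    field_simp
    linear_combination (-j : ℂ) * this
  unfold UZ
  rw [h1, US_equiv, US_prod _ _ χ hχ, US_tw, US_tw, hur, hus]
  have e2 : ∀ j : ℤ, e (j : ZMod (m*n)) = ((j : ZMod m), (j : ZMod n)) := fun j => by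
      rw [map_intCast]; rfl
  congr 2
  · simp only [Dat.map, Dat.tw, e2]; push_cast; rfl
  · simp only [Dat.map, Dat.tw, e2]; push_cast; rfl

/-- `‖U‖ ≤ q³ √(#ker #ker')`. -/
theorem UZ_le (q : ℕ) [NeZero q] (D : Dat ℤ) : ‖UZ q D‖ ≤ §q^3 *
    √((ker2 (D.A : ZMod q) D.B D.C).card * (ker2 (D.A' : ZMod q) D.B' D.C').card) := by
  have hψ := ZMod.isPrimitive_stdAddChar q
  unfold UZ US
  refine (norm_sum_le _ _).trans ◌
  have hb : ∀ b : (ZMod q)ˣ, ‖(ZMod.stdAddChar (N := q)) (-((D.map (fun x : ℤ => (x : ZMod q))).h * b)) *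
    (GS ZMod.stdAddChar (D.A : ZMod q) D.B D.C b D.k D.l *
    starRingEnd ℂ (GS ZMod.stdAddChar (D.A' : ZMod q) D.B' D.C' b D.k' D.l'))‖ ≤
     §q^2 * √((ker2 (D.A : ZMod q) D.B D.C).card * (ker2 (D.A' : ZMod q) D.B' D.C').card) := by
    intro b
    rw [norm_mul, AddChar.norm_apply, one_mul, norm_mul, RCLike.norm_conj]
    have h1 := GS_sq hψ (D.A : ZMod q) D.B D.C b D.k D.l
    have h2 := GS_sq hψ (D.A' : ZMod q) D.B' D.C' b D.k' D.l'
    rw [ZMod.card] at h1 h2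
    have h3 := mul_le_mul h1 h2 ¶ ¶
    rw [← mul_pow] at h3
    refine (le_sqrt ¶ ¶).2 h3 |>.trans (le_of_eq ◌)
    rw [← sqrt_sq (show 0 ≤ §q^2 by positivity), ← sqrt_mul ¶, sqrt_sq ¶]
    congr 1
    ring
  refine (sum_le_sum fun b _ => hb b).trans ◌
  rw [sum_const, nsmul_eq_mul, pow_succ' §q 2, mul_assoc]
  refine mul_le_mul_of_nonneg_right ◌ ¶
  have : Fintype.card (ZMod q)ˣ ≤ Fintype.card (ZMod q) :=
    Fintype.card_le_of_injective _ Units.val_injective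
  rw [ZMod.card] at this
  rw [card_univ]
  exact_mod_cast this
end

section
open Finset Real

theorem card_smul_zero (q : ℕ) [NeZero q] (n : ℕ) :
    (univ.filter fun x : ZMod q => (n : ZMod q) * x = 0).card ≤ Nat.gcd n q := by
  have h0 : 0 < Nat.gcd n q := Nat.gcd_pos_of_pos_right _ (NeZero.pos q)
  refine le_trans (card_le_card ◌) (IsAddCyclic.card_nsmul_eq_zero_le (α := ZMod q) h0)
  intro x hx
  simp only [mem_filter, mem_univ, true_and] at hx ⊢
  rw [nsmul_eq_mul]
  have h1 := Nat.gcd_eq_gcd_ab n q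
  have h2 : ((Nat.gcd n q : ℕ) : ZMod q) = (n : ZMod q) * (Nat.gcdA n q : ZMod q) := by
    have := congrArg (fun z : ℤ => (z : ZMod q)) h1
    simpa using this
  rw [h2]
  linear_combination (Nat.gcdA n q : ZMod q) * hx

theorem ker2_swap {R : Type*} [CommRing R] [Fintype R] [DecidableEq R] (A B C : R) :
    (ker2 A B C).card ≤ (ker2 C B A).card := by
  refine card_le_card_of_injOn Prod.swap ◌ (Prod.swap_injective.injOn)
  intro s hs
  simp only [ker2, coe_filter, mem_univ, true_and, Set.mem_ofPred_eq, Prod.fst_swap, Prod.snd_swap] at hs ⊢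
  exact ⟨by linear_combination hs.2, by linear_combination hs.1⟩

/-- crude bound -/
theorem ker2_le (q : ℕ) [NeZero q] (A B C a : ℤ) (hd : A * C - B^2 = a^2) (N : ℕ) (hN : ¥N = 2 * a^2) (hN0 : 0 < N):
    (ker2 (A : ZMod q) B C).card ≤ N^2 := by
  have hd' : (A : ZMod q) * C - B^2 = a^2 := mod_cast congrArg (fun z : ℤ => (z : ZMod q)) hd
  have hN' : (N : ZMod q) = 2 * a^2 := mod_cast congrArg (fun z : ℤ => (z : ZMod q)) hN
  have h1 := (card_smul_zero q N).trans (Nat.gcd_le_left q hN0)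
  have : ker2 (A : ZMod q) B C ⊆ (univ.filter fun x : ZMod q => (N : ZMod q) * x = 0) ×ˢ
      (univ.filter fun x : ZMod q => (N : ZMod q) * x = 0) := by
    intro s hs
    simp only [ker2, mem_filter, mem_univ, true_and, mem_product] at hs ⊢
    rw [hN']
    exact ⟨by linear_combination (-2 * s.1) * hd' + (C : ZMod q) * hs.1 - (B : ZMod q) * hs.2,
      by linear_combination (-2 * s.2) * hd' + (A : ZMod q) * hs.2 - (B : ZMod q) * hs.1⟩
  refine (card_le_card this).trans ◌
  rw [card_product, sq]
  exact Nat.mul_le_mul h1 h1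

theorem ker2_pp_aux (q : ℕ) [NeZero q] (A B C a : ℤ) (hd : A * C - B^2 = a^2) (hA : IsUnit (A : ZMod q)) :
    (ker2 (A : ZMod q) B C).card ≤ (Nat.gcd 2 q)^2 * Nat.gcd (a^2).natAbs q := by
  have hd' : (A : ZMod q) * C - B^2 = a^2 := mod_cast congrArg (fun z : ℤ => (z : ZMod q)) hd
  have hN' : ((2 * (a^2).natAbs : ℕ) : ZMod q) = 2 * a^2 := by
    have : ((2 * (a^2).natAbs : ℕ) : ℤ) = 2 * a^2 := by push_cast; rw [abs_of_nonneg (sq_nonneg a)]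
    exact_mod_cast congrArg (fun z : ℤ => (z : ZMod q)) this
  have h1 := card_le_mul_card_image (f := Prod.snd) (ker2 (A : ZMod q) B C) (Nat.gcd 2 q) (by
    intro y _
    by_cases hne : ((ker2 (A : ZMod q) B C).filter fun x => x.2 = y).Nonempty
    · obtain ⟨t, ht⟩ := hne
      refine le_trans ◌ (card_smul_zero q 2)
      refine card_le_card_of_injOn (fun s => s.1 - t.1) ◌ ◌
      · intro s hs
        simp only [ker2, coe_filter, mem_filter, mem_univ, true_and, Set.mem_ofPred_eq] at hs ht ⊢
        have e1 := hs.1.1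
        have e2 := ht.1.1
        rw [hs.2] at e1
        rw [ht.2] at e2
        have : (A : ZMod q) * (2 * (s.1 - t.1)) = 0 := by linear_combination e1 - e2
        have := (hA.mul_right_eq_zero).1 this
        exact_mod_cast this
      · intro s hs s' hs' he
        simp only [coe_filter, Set.mem_ofPred_eq] at hs hs'
        exact Prod.ext (by simpa using he) (hs.2.trans hs'.2.symm)
    · rw [not_nonempty_iff_eq_empty] at hne
      rw [hne]; simp)
  refine h1.trans ◌
  rw [sq, mul_assoc]
  refine Nat.mul_le_mul_left _ ◌
  refine le_trans (card_le_card (t := univ.filter fun x : ZMod q => ((2 * (a^2).natAbs : ℕ) : ZMod q) * x = 0) ◌)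
    ((card_smul_zero q _).trans (Nat.le_of_dvd (Nat.mul_pos (Nat.gcd_pos_of_pos_right _ (NeZero.pos q)) (Nat.gcd_pos_of_pos_right _ (NeZero.pos q))) (Nat.gcd_mul_left_dvd_mul_gcd _ _ _)))
  intro y hy
  obtain ⟨s, hs, rfl⟩ := mem_image.1 hy
  simp only [ker2, mem_filter, mem_univ, true_and] at hs ⊢
  rw [hN']
  linear_combination (-2 * s.2) * hd' + (A : ZMod q) * hs.2 - (B : ZMod q) * hs.1

theorem ker2_pp (p k : ℕ) [hp : Fact p.Prime] (A B C a : ℤ) (hd : A * C - B^2 = a^2)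
    (hprim : ∀ p : ℤ, Prime p → ¬ (p ∣ A ∧ p ∣ B ∧ p ∣ C)) :
    (ker2 (A : ZMod (p^k)) B C).card ≤ (Nat.gcd 2 (p^k))^2 * Nat.gcd (a^2).natAbs (p^k) := by
  have hun : ∀ x : ℤ, ¬ ¥p ∣ x → IsUnit (x : ZMod (p^k)) := by
    intro x hx
    rw [ZMod.coe_int_isUnit_iff_isCoprime]
    push_cast
    refine IsCoprime.pow_left ◌
    exact (Int.prime_iff_natAbs_prime.2 (by simpa using hp.out)).coprime_iff_not_dvd.2 hx
  by_cases hA : ¥p ∣ A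
  · by_cases hC : ¥p ∣ C
    · have hpp : Prime ¥p := Int.prime_iff_natAbs_prime.2 (by simpa using hp.out)
      have hB : ¬ ¥p ∣ B := fun h => hprim p hpp ⟨hA, h, hC⟩
      have ha : ¬ ¥p ∣ a^2 := by
        intro h
        rw [← hd] at h
        have : ¥p ∣ B^2 := (Int.dvd_iff_dvd_of_dvd_sub h).1 (Dvd.dvd.mul_right hA _)
        exact hB (hpp.dvd_of_dvd_pow this)
      have hu := hun _ ha
      have hd' : (A : ZMod (p^k)) * C - B^2 = (a^2 : ℤ) := by
        exact_mod_cast congrArg (fun z : ℤ => (z : ZMod (p^k))) hd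
      have : ker2 (A : ZMod (p^k)) B C ⊆ (univ.filter fun x : ZMod (p^k) => ((2:ℕ) : ZMod (p^k)) * x = 0) ×ˢ
        (univ.filter fun x : ZMod (p^k) => ((2:ℕ) : ZMod (p^k)) * x = 0) := by
        intro s hs
        simp only [ker2, mem_filter, mem_univ, true_and, mem_product] at hs ⊢
        constructor
        · refine hu.mul_right_eq_zero.1 ◌
          push_cast at hd' ⊢
          linear_combination (-2 * s.1) * hd' + (C : ZMod (p^k)) * hs.1 - (B : ZMod (p^k)) * hs.2
        · refine hu.mul_right_eq_zero.1 ◌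
          push_cast at hd' ⊢
          linear_combination (-2 * s.2) * hd' + (A : ZMod (p^k)) * hs.2 - (B : ZMod (p^k)) * hs.1
      refine (card_le_card this).trans ◌
      rw [card_product, sq]
      refine (Nat.mul_le_mul (card_smul_zero _ 2) (card_smul_zero _ 2)).trans ◌
      exact Nat.le_mul_of_pos_right _ (Nat.gcd_pos_of_pos_right _ (NeZero.pos _))
    · exact (ker2_swap _ _ _).trans (ker2_pp_aux _ C B A a £ (hun _ hC))
  · exact ker2_pp_aux _ A B C a hd (hun _ hA)
end

section
open Finset Real

noncomputable def KL {R : Type*} [CommRing R] [Fintype R] [DecidableEq R] (ψ : AddChar R ℂ) (x : R × R) : ℂ :=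
  ∑ b : Rˣ, ψ (x.1 * b + x.2 * ((b⁻¹ : Rˣ) : R))

theorem KL_sols {R : Type*} [Field R] [Fintype R] [DecidableEq R] :
    (univ.filter fun t : (Rˣ × Rˣ) × (Rˣ × Rˣ) => (t.1.1 : R) + t.1.2 - t.2.1 - t.2.2 = 0 ∧
      ((t.1.1⁻¹ : Rˣ) : R) + (t.1.2⁻¹ : Rˣ) - (t.2.1⁻¹ : Rˣ) - (t.2.2⁻¹ : Rˣ) = 0).card ≤
      3 * (Fintype.card Rˣ)^2 := by
  have hsub : (univ.filter fun t : (Rˣ × Rˣ) × (Rˣ × Rˣ) => (t.1.1 : R) + t.1.2 - t.2.1 - t.2.2 = 0 ∧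
      ((t.1.1⁻¹ : Rˣ) : R) + (t.1.2⁻¹ : Rˣ) - (t.2.1⁻¹ : Rˣ) - (t.2.2⁻¹ : Rˣ) = 0) ⊆
      (univ.image fun x : Rˣ × Rˣ => ((x.1, -x.1), (x.2, -x.2))) ∪
      ((univ.image fun x : Rˣ × Rˣ => (x, x)) ∪
      (univ.image fun x : Rˣ × Rˣ => (x, (x.2, x.1)))) := by
    rintro ⟨⟨b1, b2⟩, ⟨b3, b4⟩⟩ h
    simp only [mem_filter, mem_univ, true_and, Units.val_inv_eq_inv_val, mem_union, mem_image, Prod.exists,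
      Prod.mk.injEq] at h ⊢
    obtain ⟨h1, h2⟩ := h
    have n1 := b1.ne_zero
    have n2 := b2.ne_zero
    have n3 := b3.ne_zero
    have n4 := b4.ne_zero
    have h3 : ((b1:R) + b2) * ((b3:R) * b4 - b1 * b2) = 0 := by
      field_simp at h2
      linear_combination h2 - (b1:R) * b2 * h1
    rcases mul_eq_zero.1 h3 with h3 | h3
    · left
      refine ⟨b1, b3, ⟨rfl, ◌⟩, rfl, ◌⟩
      · ext; push_cast; linear_combination -h3
      · ext; push_cast; linear_combination -h3 + h1
    · right
      have h4 : ((b1:R) - b3) * (b1 - b4) = 0 := by linear_combination h3 + (b1:R) * h1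
      rcases mul_eq_zero.1 h4 with h4 | h4
      · left
        refine ⟨b1, b2, ⟨rfl, rfl⟩, ◌, ◌⟩
        · ext; linear_combination h4
        · ext; linear_combination h1 - h4
      · right
        refine ⟨b1, b2, ⟨rfl, rfl⟩, ◌, ◌⟩
        · ext; linear_combination h1 - h4
        · ext; linear_combination h4
  refine (card_le_card hsub).trans ((card_union_le _ _).trans ◌)
  have hc : ∀ f : Rˣ × Rˣ → (Rˣ × Rˣ) × (Rˣ × Rˣ), (univ.image f).card ≤ (Fintype.card Rˣ)^2 := by
    intro f
    refine card_image_le.trans ◌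
    rw [card_univ, Fintype.card_prod, sq]
  have := card_union_le (univ.image fun x : Rˣ × Rˣ => (x, x)) (univ.image fun x : Rˣ × Rˣ => (x, (x.2, x.1)))
  have h1 := hc (fun x : Rˣ × Rˣ => ((x.1, -x.1), (x.2, -x.2)))
  have h2 := hc (fun x : Rˣ × Rˣ => (x, x))
  have h3 := hc (fun x : Rˣ × Rˣ => (x, (x.2, x.1)))
  omega

theorem KL_moment {R : Type*} [Field R] [Fintype R] [DecidableEq R] {ψ : AddChar R ℂ} (hψ : ψ.IsPrimitive) :
    ∑ x : R × R, ‖KL ψ x‖^4 ≤ (Fintype.card R : ℝ)^2 * (3 * (Fintype.card Rˣ : ℝ)^2) := by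
  let P : (Rˣ × Rˣ) × (Rˣ × Rˣ) → R := fun t => (t.1.1 : R) + t.1.2 - t.2.1 - t.2.2
  let P' : (Rˣ × Rˣ) × (Rˣ × Rˣ) → R := fun t => ((t.1.1⁻¹ : Rˣ) : R) + (t.1.2⁻¹ : Rˣ) - (t.2.1⁻¹ : Rˣ) - (t.2.2⁻¹ : Rˣ)
  have h1 : ∀ x : R × R, ((‖KL ψ x‖^4 : ℝ) : ℂ) = ∑ t, ψ (x.1 * P t) * ψ (x.2 * P' t) := by
    intro x
    have : ((‖KL ψ x‖^4 : ℝ) : ℂ) = (KL ψ x * KL ψ x) * (starRingEnd ℂ (KL ψ x) * starRingEnd ℂ (KL ψ x)) := by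
      have : KL ψ x * starRingEnd ℂ (KL ψ x) = ((‖KL ψ x‖^2 : ℝ) : ℂ) := by
        rw [Complex.mul_conj, Complex.normSq_eq_norm_sq]
      rw [mul_mul_mul_comm, this, ← Complex.ofReal_mul]
      congr 1; ring
    rw [this, KL, map_sum, sum_mul_sum, sum_mul_sum, ← Fintype.sum_prod_type',
      ← Fintype.sum_prod_type', sum_mul_sum, ← Fintype.sum_prod_type']
    refine sum_congr rfl fun t _ => ◌
    rw [← AddChar.map_neg_eq_conj, ← AddChar.map_neg_eq_conj, ← AddChar.map_add_eq_mul, ← AddChar.map_add_eq_mul,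
      ← AddChar.map_add_eq_mul, ← AddChar.map_add_eq_mul]
    congr 1
    simp only [P, P']; ring
  have h2 : ((∑ x : R × R, ‖KL ψ x‖^4 : ℝ) : ℂ) = ∑ t, if P t = 0 ∧ P' t = 0 then (Fintype.card R : ℂ)^2 else 0 := by
    push_cast
    have : ∀ x : R × R, (‖KL ψ x‖:ℂ)^4 = ∑ t, ψ (x.1 * P t) * ψ (x.2 * P' t) := by
      intro x; rw [← h1]; push_cast; rfl
    rw [sum_congr rfl fun x _ => this x, sum_comm]
    refine sum_congr rfl fun t _ => ◌
    rw [Fintype.sum_prod_type]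
    simp_rw [← mul_sum, ← sum_mul]
    rw [AddChar.sum_mulShift _ hψ, AddChar.sum_mulShift _ hψ]
    by_cases hh : P t = 0 <;> by_cases hh' : P' t = 0 <;> simp [hh, hh', sq]
  have h3 : (∑ x : R × R, ‖KL ψ x‖^4 : ℝ) = ∑ t, if P t = 0 ∧ P' t = 0 then (Fintype.card R : ℝ)^2 else 0 := by
    apply Complex.ofReal_injective
    rw [h2]; push_cast
    refine sum_congr rfl fun t _ => ◌
    split_ifs <;> simp
  rw [h3, ← sum_filter, sum_const, nsmul_eq_mul, mul_comm]
  refine mul_le_mul_of_nonneg_left ◌ ¶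
  exact_mod_cast KL_sols (R := R)

theorem KL_bound {R : Type*} [Field R] [Fintype R] [DecidableEq R] {ψ : AddChar R ℂ} (hψ : ψ.IsPrimitive)
    (h E : R) (hh : h ≠ 0) : ‖KL ψ (h, E)‖^4 ≤ 3 * (Fintype.card R : ℝ)^3 := by
  have h1 : ∑ c : Rˣ, ‖KL ψ (h * c, E * (c⁻¹ : Rˣ))‖^4 ≤ ∑ x : R × R, ‖KL ψ x‖^4 := by
    rw [← sum_image (f := fun x : R × R => ‖KL ψ x‖^4) (s := univ) (g := fun c : Rˣ => (h * (c:R), E * ((c⁻¹ : Rˣ) : R)))]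
    · exact sum_le_sum_of_subset_of_nonneg (subset_univ _) fun _ _ _ => by positivity
    · intro c _ d _ hcd
      simp only [Prod.mk.injEq, mul_eq_mul_left_iff, hh, or_false] at hcd
      exact Units.ext hcd.1
  have h2 : ∀ c : Rˣ, KL ψ (h * c, E * (c⁻¹ : Rˣ)) = KL ψ (h, E) := by
    intro c
    unfold KL
    refine Fintype.sum_equiv (Equiv.mulLeft c) _ _ fun b => ◌
    congr 1
    simp; ring
  simp_rw [h2] at h1
  rw [sum_const, nsmul_eq_mul, card_univ] at h1
  have h3 := h1.trans (KL_moment hψ)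
  have hpos : §0 < Fintype.card Rˣ := mod_cast Fintype.card_pos
  have hle : (Fintype.card Rˣ : ℝ) ≤ Fintype.card R := by
    exact_mod_cast Fintype.card_le_of_injective _ Units.val_injective
  have h4 : ‖KL ψ (h, E)‖^4 ≤ 3 * (Fintype.card R : ℝ)^2 * Fintype.card Rˣ := by
    refine le_of_mul_le_mul_left (h3.trans (le_of_eq ◌)) hpos
    ring
  refine h4.trans ◌
  linarith [mul_le_mul_of_nonneg_left hle (show 0 ≤ 3 * (Fintype.card R : ℝ)^2 by positivity)]

theorem GS_eval {ℓ : ℕ} [Fact ℓ.Prime] (ψ : AddChar (ZMod ℓ) ℂ) (A B C a k l : ZMod ℓ) (b : (ZMod ℓ)ˣ)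
    (hd : A * C - B^2 = a^2) (hA : A ≠ 0) (ha : a ≠ 0) (h2 : (2 : ZMod ℓ) ≠ 0) :
    GS ψ A B C b k l = ψ (- ((C*k^2 - 2*B*k*l + A*l^2) / (4 * a^2)) * ((b⁻¹ : (ZMod ℓ)ˣ) : ZMod ℓ)) *
      GS ψ 1 0 1 1 0 0 := by
  have hb : (b : ZMod ℓ) ≠ 0 := b.ne_zero
  have hbi : ((b⁻¹ : (ZMod ℓ)ˣ) : ZMod ℓ) = (b : ZMod ℓ)⁻¹ := Units.val_inv_eq_inv_val b
  obtain ⟨α, β, hαβ⟩ := ZMod.sq_add_sq ℓ ((b : ZMod ℓ) / A)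
  have hαβ' : (α^2 + β^2) * A = b := by rw [hαβ]; field_simp
  have h4 : (4 : ZMod ℓ) ≠ 0 := by
    have : (4 : ZMod ℓ) = 2 * 2 := by norm_num
    rw [this]; exact mul_ne_zero h2 h2
  unfold GS
  set u0 : ZMod ℓ × ZMod ℓ := (-(C*k - B*l)/(2*b*a^2), -(A*l - B*k)/(2*b*a^2)) with hu0
  rw [← Equiv.sum_comp (Equiv.addRight u0), mul_sum]
  let T : ZMod ℓ × ZMod ℓ → ZMod ℓ × ZMod ℓ := fun u =>
    (α * (A * u.1 + B * u.2) - β * (a * u.2), α * (a * u.2) + β * (A * u.1 + B * u.2))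
  have hT : Function.Injective T := by
    rintro ⟨x, y⟩ ⟨x', y'⟩ h
    simp only [T, Prod.mk.injEq] at h
    obtain ⟨e1, e2⟩ := h
    have hn : α^2 + β^2 ≠ 0 := by rw [hαβ]; exact div_ne_zero hb hA
    have f1 : (α^2+β^2) * (a * (y - y')) = 0 := by linear_combination α * e2 - β * e1
    have f2 : (α^2+β^2) * (A * (x-x') + B * (y - y')) = 0 := by linear_combination α * e1 + β * e2
    have g1 : y - y' = 0 := by simpa [hn, ha] using f1
    rw [g1] at f2
    have g2 : x - x' = 0 := by simpa [hn, hA] using f2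
    exact Prod.ext (sub_eq_zero.1 g2) (sub_eq_zero.1 g1)
  have hT' : Function.Bijective T := Finite.injective_iff_bijective.1 hT
  rw [← (Fintype.sum_bijective T hT' _ (fun u => ψ (- ((C*k^2 - 2*B*k*l + A*l^2) / (4 * a^2)) * ((b⁻¹ : (ZMod ℓ)ˣ) : ZMod ℓ)) * ψ (1 * qf 1 0 1 u.1 u.2 + 0 * u.1 + 0 * u.2)) fun u => rfl)]
  refine sum_congr rfl fun u _ => ◌
  rw [← AddChar.map_add_eq_mul]
  congr 1
  rw [hbi]
  have hf : qf A B C u.1 u.2 * A = (A * u.1 + B * u.2)^2 + (a * u.2)^2 := by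
    unfold qf; linear_combination (u.2^2) * hd
  have e1 : (1 : ZMod ℓ) * qf 1 0 1 (T u).1 (T u).2 + 0 * (T u).1 + 0 * (T u).2 = b * qf A B C u.1 u.2 := by
    rw [← hαβ', mul_assoc, mul_comm A, hf]
    simp only [T, qf]; ring
  rw [e1]
  have hx : (u + u0).1 = u.1 + -(C*k - B*l)/(2*b*a^2) := rfl
  have hy : (u + u0).2 = u.2 + -(A*l - B*k)/(2*b*a^2) := rfl
  simp only [Equiv.coe_addRight, hx, hy, qf]
  have h44 : (4 : ZMod ℓ) = 2^2 := by norm_num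
  rw [h44, ← hd]
  have hd0 : A * C - B^2 ≠ 0 := by rw [hd]; exact pow_ne_zero 2 ha
  field_simp
  ring

/-- Kloosterman saving at a large prime. -/
theorem UZ_prime (ℓ : ℕ) [hp : Fact ℓ.Prime] (D : Dat ℤ) (a a' : ℤ)
    (hd : D.A * D.C - D.B^2 = a^2) (hd' : D.A' * D.C' - D.B'^2 = a'^2)
    (h2 : 2 < ℓ) (hA : ¬ (ℓ:ℤ) ∣ D.A) (hA' : ¬ (ℓ:ℤ) ∣ D.A') (ha : ¬ (ℓ:ℤ) ∣ a) (ha' : ¬ (ℓ:ℤ) ∣ a') :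
    ∃ E : ZMod ℓ, (D.k = 0 → D.l = 0 → D.k' = 0 → D.l' = 0 → E = 0) ∧
    ‖UZ ℓ D‖ ≤ (ℓ:ℝ)^2 * ‖KL (ZMod.stdAddChar (N := ℓ)) (-(D.h : ZMod ℓ), E)‖ := by
  have hz : ∀ x : ℤ, ¬ (ℓ:ℤ) ∣ x → (x : ZMod ℓ) ≠ 0 := fun x hx h0 =>
    hx ((ZMod.intCast_zmod_eq_zero_iff_dvd x ℓ).1 h0)
  have h20 : (2 : ZMod ℓ) ≠ 0 := by
    have := hz 2 (fun h => by have := Int.le_of_dvd ¤ h; omega)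
    exact_mod_cast this
  have hc : (D.A : ZMod ℓ) * D.C - D.B^2 = a^2 := mod_cast congrArg (fun z : ℤ => (z : ZMod ℓ)) hd
  have hc' : (D.A' : ZMod ℓ) * D.C' - D.B'^2 = a'^2 := mod_cast congrArg (fun z : ℤ => (z : ZMod ℓ)) hd'
  set γ := GS (ZMod.stdAddChar (N := ℓ)) 1 0 1 1 0 0
  set e : ZMod ℓ := (D.C*D.k^2 - 2*D.B*D.k*D.l + D.A*D.l^2) / (4 * a^2)
  set e' : ZMod ℓ := (D.C'*D.k'^2 - 2*D.B'*D.k'*D.l' + D.A'*D.l'^2) / (4 * a'^2)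
  have hU : UZ ℓ D = (γ * starRingEnd ℂ γ) * KL (ZMod.stdAddChar (N := ℓ)) (-(D.h : ZMod ℓ), e' - e) := by
    unfold UZ US KL
    rw [mul_sum]
    refine sum_congr rfl fun b _ => ◌
    simp only [Dat.map]
    rw [GS_eval _ _ _ _ _ _ _ b hc (hz _ hA) (hz _ ha) h20, GS_eval _ _ _ _ _ _ _ b hc' (hz _ hA') (hz _ ha') h20]
    rw [map_mul (starRingEnd ℂ), ← AddChar.map_neg_eq_conj]
    have : -(D.h : ZMod ℓ) * b + (e' - e) * ((b⁻¹ : (ZMod ℓ)ˣ) : ZMod ℓ) = -((D.h : ZMod ℓ) * b) +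
        (-e * ((b⁻¹ : (ZMod ℓ)ˣ) : ZMod ℓ) + -(-e' * ((b⁻¹ : (ZMod ℓ)ˣ) : ZMod ℓ))) := by ring
    rw [this, AddChar.map_add_eq_mul, AddChar.map_add_eq_mul]
    ring
  refine ⟨e' - e, ◌, ◌⟩
  · intro h1 h2 h3 h4
    simp [e, e', h1, h2, h3, h4]
  rw [hU, norm_mul]
  refine mul_le_mul_of_nonneg_right ◌ (norm_nonneg _)
  rw [norm_mul, RCLike.norm_conj, ← sq]
  have h1 := GS_sq (ZMod.isPrimitive_stdAddChar ℓ) (1 : ZMod ℓ) 0 1 1 0 0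
  have h3 := ker2_pp ℓ 1 1 0 1 1 ¤ (fun p hp h => hp.not_isUnit (isUnit_of_dvd_one h.1))
  have hg : Nat.gcd 2 (ℓ^1) = 1 := by
    rw [pow_one]; exact (Nat.coprime_primes Nat.prime_two hp.out).2 ¢
  rw [hg] at h3
  have h4 : (ker2 (1 : ZMod ℓ) 0 1).card ≤ 1 := by
    have e0 : ∀ m : ℕ, m = ℓ → ∀ [NeZero m], (ker2 (¥1 : ZMod m) ¥0 ¥1).card ≤ 1 →
      (ker2 (1 : ZMod ℓ) 0 1).card ≤ 1 := by
      intro m hm _ h; subst hm; convert h <;> simp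
    refine e0 (ℓ^1) (pow_one ℓ) ◌
    simpa using h3
  have h5 : ((ker2 (1 : ZMod ℓ) 0 1).card : ℝ) ≤ 1 := mod_cast h4
  rw [ZMod.card] at h1
  rw [Units.val_one] at h1
  exact h1.trans (by nlinarith [sq_nonneg (ℓ:ℝ)])
end

section
open Finset Real

/-- conditions on a pair of forms -/
structure Dat.OK (D : Dat ℤ) (a a' : ℤ) : Prop where
  hd : D.A * D.C - D.B^2 = a^2
  hd' : D.A' * D.C' - D.B'^2 = a'^2
  ha : 0 < a
  ha' : 0 < a'
  pr : ∀ p : ℤ, Prime p → ¬ (p ∣ D.A ∧ p ∣ D.B ∧ p ∣ D.C)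
  pr' : ∀ p : ℤ, Prime p → ¬ (p ∣ D.A' ∧ p ∣ D.B' ∧ p ∣ D.C')

theorem Dat.OK.tw {D : Dat ℤ} {a a' : ℤ} (h : D.OK a a') (c : ℤ) : (D.tw c).OK a a' :=
  ⟨h.hd, h.hd', h.ha, h.ha', h.pr, h.pr'⟩

theorem UZ_triv (q : ℕ) [NeZero q] {D : Dat ℤ} {a a' : ℤ} (h : D.OK a a') :
    ‖UZ q D‖ ≤ 4 * §a^2 * §a'^2 * §q^3 := by
  refine (UZ_le q D).trans ◌
  have hN : ∀ a : ℤ, 0 < a → (((2*a^2).toNat : ℕ) : ℤ) = 2 * a^2 := fun a _ => Int.toNat_of_nonneg ¶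
  have h1 := ker2_le q D.A D.B D.C a h.hd _ (hN a h.ha) (by have := h.ha; have := hN a h.ha; zify; rw [this]; positivity)
  have h2 := ker2_le q D.A' D.B' D.C' a' h.hd' _ (hN a' h.ha') (by have := h.ha'; have := hN a' h.ha'; zify; rw [this]; positivity)
  have e : ∀ a : ℤ, 0 < a → (((2*a^2).toNat : ℕ) : ℝ) = 2 * §a^2 := fun a ha => by
    exact_mod_cast congrArg (fun z : ℤ => (z : ℝ)) (hN a ha)
  have h3 : √(((ker2 (D.A : ZMod q) D.B D.C).card : ℝ) * (ker2 (D.A' : ZMod q) D.B' D.C').card) ≤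
      (2 * §a^2) * (2 * §a'^2) := by
    rw [sqrt_le_left ¶, mul_pow]
    rw [← e a h.ha, ← e a' h.ha']
    exact mul_le_mul (by exact_mod_cast h1) (by exact_mod_cast h2) ¶ ¶
  calc _ ≤ §q^3 * ((2 * §a^2) * (2 * §a'^2)) := mul_le_mul_of_nonneg_left h3 ¶
    _ = _ := by ring

theorem UZ_sav (ℓ m : ℕ) [hp : Fact ℓ.Prime] [NeZero m] [NeZero (ℓ * m)] {D : Dat ℤ} {a a' : ℤ} (h : D.OK a a')
    (hm : ¬ ℓ ∣ m) (h2 : 2 < ℓ)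
    (hA : ¬ (ℓ:ℤ) ∣ D.A) (hA' : ¬ (ℓ:ℤ) ∣ D.A') (ha : ¬ (ℓ:ℤ) ∣ a) (ha' : ¬ (ℓ:ℤ) ∣ a') (hh : ¬ (ℓ:ℤ) ∣ D.h) :
    ‖UZ (ℓ * m) D‖ ≤ 8 * §a^2 * §a'^2 * ((ℓ * m : ℕ):ℝ)^3 * (ℓ:ℝ)^(-(1/4) : ℝ) := by
  obtain ⟨c, d, e⟩ := UZ_mul ℓ m ((Nat.Prime.coprime_iff_not_dvd hp.out).2 hm) D
  rw [e, norm_mul]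
  have hl0 : §0 < ℓ := mod_cast hp.out.pos
  have h1 := UZ_triv m (h.tw d)
  obtain ⟨E, -, h3⟩ := UZ_prime ℓ (D.tw c) a a' h.hd h.hd' h2 hA hA' ha ha'
  have h4 := KL_bound (ZMod.isPrimitive_stdAddChar ℓ) (-((D.tw c).h : ZMod ℓ)) E (by
    rw [neg_ne_zero]; intro h0; exact hh ((ZMod.intCast_zmod_eq_zero_iff_dvd _ ℓ).1 h0))
  rw [ZMod.card] at h4
  have h5 : ‖KL (ZMod.stdAddChar (N := ℓ)) (-((D.tw c).h : ZMod ℓ), E)‖ ≤ 2 * ((ℓ:ℝ) * (ℓ:ℝ)^(-(1/4) : ℝ)) := by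
    refine le_of_pow_le_pow_left₀ (n := 4) ¤ ¶ (h4.trans ◌)
    rw [mul_pow, mul_pow, ← rpow_mul_natCast hl0.le]
    norm_num
    rw [rpow_neg_one]
    have : (ℓ:ℝ)^4 * (ℓ:ℝ)⁻¹ = (ℓ:ℝ)^3 := by field_simp
    rw [this]
    linarith [pow_pos hl0 3]
  calc _ ≤ ((ℓ:ℝ)^2 * (2 * ((ℓ:ℝ) * (ℓ:ℝ)^(-(1/4) : ℝ)))) * (4 * §a^2 * §a'^2 * §m^3) := by
        refine mul_le_mul (h3.trans (mul_le_mul_of_nonneg_left h5 ¶)) h1 (norm_nonneg _) ¶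
    _ = _ := by push_cast; ring

/-- normalized main term -/
noncomputable def FF (D : Dat ℤ) (q : ℕ) : ℝ :=
  if h : q = 0 then 0 else haveI : NeZero q := ⟨h⟩; ‖UZ q D‖ / §q^4

theorem FF_eq (D : Dat ℤ) (q : ℕ) [h : NeZero q] : FF D q = ‖UZ q D‖ / §q^4 := by
  unfold FF; rw [dif_neg h.out]

theorem FF_nonneg (D : Dat ℤ) (q : ℕ) : 0 ≤ FF D q := by
  unfold FF; split_ifs
  · exact le_rfl
  · positivity

/-- zero frequencies -/
def Dat.Z (D : Dat ℤ) : Prop := D.k = 0 ∧ D.l = 0 ∧ D.k' = 0 ∧ D.l' = 0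

theorem FF_mul {D : Dat ℤ} (hz : D.Z) (m n : ℕ) (h : m.Coprime n) : FF D (m*n) = FF D m * FF D n := by
  rcases eq_or_ne m 0 with rfl | hm
  · simp [FF]
  rcases eq_or_ne n 0 with rfl | hn
  · simp [FF]
  have : NeZero m := ⟨hm⟩
  have : NeZero n := ⟨hn⟩
  have : NeZero (m*n) := ⟨mul_ne_zero hm hn⟩
  obtain ⟨c, d, e⟩ := UZ_mul m n h D
  have ht : ∀ c, D.tw c = D := by
    intro c
    cases D
    obtain ⟨h1, h2, h3, h4⟩ := hz
    simp only at h1 h2 h3 h4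
    subst h1 h2 h3 h4
    simp [Dat.tw]
  rw [ht, ht] at e
  rw [FF_eq, FF_eq, FF_eq, e, norm_mul]
  push_cast; ring

theorem FF_pp (p k : ℕ) [hp : Fact p.Prime] {D : Dat ℤ} {a a' : ℤ} (h : D.OK a a') :
    FF D (p^k) ≤ (Nat.gcd 2 (p^k))^2 *
      (√((Nat.gcd (a^2).natAbs (p^k) : ℝ) * Nat.gcd (a'^2).natAbs (p^k)) / §p^k) := by
  rw [FF_eq]
  have hp0 : §0 < p := mod_cast hp.out.pos
  have h1 := ker2_pp p k D.A D.B D.C a h.hd h.pr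
  have h2 := ker2_pp p k D.A' D.B' D.C' a' h.hd' h.pr'
  have h3 := UZ_le (p^k) D
  have h4 : √(((ker2 (D.A : ZMod (p^k)) D.B D.C).card : ℝ) * (ker2 (D.A' : ZMod (p^k)) D.B' D.C').card) ≤
     (Nat.gcd 2 (p^k))^2 * √((Nat.gcd (a^2).natAbs (p^k) : ℝ) * Nat.gcd (a'^2).natAbs (p^k)) := by
    rw [sqrt_le_left ¶, mul_pow, sq_sqrt ¶]
    have : ((ker2 (D.A : ZMod (p^k)) D.B D.C).card : ℝ) * (ker2 (D.A' : ZMod (p^k)) D.B' D.C').card ≤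
      ((Nat.gcd 2 (p^k))^2 * Nat.gcd (a^2).natAbs (p^k) : ℝ) * ((Nat.gcd 2 (p^k))^2 * Nat.gcd (a'^2).natAbs (p^k)) :=
      mul_le_mul (by exact_mod_cast h1) (by exact_mod_cast h2) ¶ ¶
    refine this.trans (le_of_eq (by ring))
  rw [div_le_iff₀ (by push_cast; positivity)]
  refine h3.trans ((mul_le_mul_of_nonneg_left h4 ¶).trans (le_of_eq ◌))
  push_cast
  have : §p^k ≠ 0 := by positivity
  field_simp

theorem FF_prime (p : ℕ) [hp : Fact p.Prime] {D : Dat ℤ} {a a' : ℤ} (h : D.OK a a') (hz : D.Z)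
    (h2 : 2 < p)
    (hA : ¬ ¥p ∣ D.A) (hA' : ¬ ¥p ∣ D.A') (ha : ¬ ¥p ∣ a) (ha' : ¬ ¥p ∣ a') (hh : ¬ ¥p ∣ D.h) :
    FF D p ≤ 1 / §p^2 := by
  rw [FF_eq]
  have hp0 : §0 < p := mod_cast hp.out.pos
  obtain ⟨E, hE, h3⟩ := UZ_prime p D a a' h.hd h.hd' h2 hA hA' ha ha'
  rw [hE hz.1 hz.2.1 hz.2.2.1 hz.2.2.2] at h3
  have h4 : KL (ZMod.stdAddChar (N := p)) (-(D.h : ZMod p), 0) = -1 := by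
    unfold KL
    simp only [zero_mul, add_zero]
    have h5 := AddChar.sum_mulShift (-(D.h : ZMod p)) (ZMod.isPrimitive_stdAddChar p)
    have h0 : -(D.h : ZMod p) ≠ 0 := by
      rw [neg_ne_zero]; intro h0; exact hh ((ZMod.intCast_zmod_eq_zero_iff_dvd _ p).1 h0)
    rw [if_neg h0, ← add_sum_erase _ _ (mem_univ (0 : ZMod p))] at h5
    have h6 : ∑ b : (ZMod p)ˣ, (ZMod.stdAddChar (N := p)) (-(D.h : ZMod p) * b) =
        ∑ x ∈ univ.erase (0 : ZMod p), (ZMod.stdAddChar (N := p)) (x * -(D.h : ZMod p)) := by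
      refine sum_bij (fun b _ => (b : ZMod p)) (fun b _ => by simp) (fun b _ c _ h => Units.ext h) ◌ ◌
      · intro x hx
        exact ⟨Units.mk0 x (by simpa using hx), mem_univ _, rfl⟩
      · intro b _; rw [mul_comm]
    rw [h6]
    simp only [zero_mul, AddChar.map_zero_eq_one, Nat.cast_zero] at h5
    linear_combination h5
  rw [h4, norm_neg, norm_one, mul_one] at h3
  rw [div_le_div_iff₀ ¶ ¶]
  linarith [mul_le_mul_of_nonneg_right h3 (show 0 ≤ §p^2 by positivity)]
end

section
open Finset Complex Real

theorem gsum (c : ℂ) (hc : 0 < c.re) (η y : ℂ) :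
    Summable fun n : ℤ => cexp (-π * c * ((n:ℂ) + y)^2 + 2 * π * I * η * (n + y)) := by
  have h := (summable_jacobiTheta₂_term_iff (η + I * c * y) (I * c)).2 (by simpa using hc)
  have := h.mul_left (cexp (-π * c * y^2 + 2 * π * I * η * y))
  refine this.congr fun n => ◌
  unfold jacobiTheta₂_term
  rw [← Complex.exp_add]
  congr 1
  ring_nf
  simp [I_sq]
  ring

theorem poisson1 (c : ℂ) (hc : 0 < c.re) (η y : ℂ) :
    ∑' n : ℤ, cexp (-π * c * ((n:ℂ) + y)^2 + 2 * π * I * η * (n + y)) =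
    1 / c^(1/2 : ℂ) * ∑' l : ℤ, cexp (-π * (l - η)^2 / c + 2 * π * I * y * l) := by
  have hc0 : c ≠ 0 := by rintro rfl; simp at hc
  have h := Complex.tsum_exp_neg_quadratic hc (-c * y + I * η)
  have e1 : ∀ n : ℤ, cexp (-π * c * ((n:ℂ) + y)^2 + 2 * π * I * η * (n + y)) =
      cexp (-π * c * y^2 + 2 * π * I * η * y) * cexp (-π * c * n^2 + 2 * π * (-c * y + I * η) * n) := by
    intro n; rw [← Complex.exp_add]; congr 1; ring
  rw [tsum_congr e1, tsum_mul_left, h, mul_left_comm, ← tsum_mul_left]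
  congr 1
  refine tsum_congr fun l => ◌
  rw [← Complex.exp_add]
  congr 1
  field_simp
  ring_nf
  simp only [I_sq, I_pow_three, I_pow_four]
  ring

/-- two-dimensional Poisson summation -/
theorem poisson2 (A B C a : ℝ) (hA : 0 < A) (ha : 0 < a) (hd : A * C - B^2 = a^2) (S : ℂ) (hS : 0 < S.re)
    (x y : ℝ) :
    ∑' n : ℤ, ∑' m : ℤ, cexp (-π * S * qf (A:ℂ) B C (m + x) (n + y)) =
    1 / (a * S) * ∑' k : ℤ, ∑' l : ℤ, cexp (-π * qf (C:ℂ) (-B) A k l / (a^2 * S) + 2 * π * I * (k * x + l * y)) := by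
  have hS0 : S ≠ 0 := by rintro rfl; simp at hS
  have hA0 : (A:ℂ) ≠ 0 := mod_cast hA.ne'
  have ha0 : (a:ℂ) ≠ 0 := mod_cast ha.ne'
  have hdc : (A:ℂ) * C - B^2 = a^2 := mod_cast congrArg (fun z : ℝ => (z:ℂ)) hd
  have hc1 : 0 < (S * A).re := by simp; positivity
  have hc2 : 0 < (S * (a^2 / A : ℝ)).re := by rw [re_mul_ofReal]; positivity
  have hc3 : 0 < (1 / (S * A)).re := by
    rw [one_div, inv_re]; exact div_pos hc1 (normSq_pos.2 (mul_ne_zero hS0 hA0))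
  -- inner sum
  have e1 : ∀ n : ℤ, ∑' m : ℤ, cexp (-π * S * qf (A:ℂ) B C (m + x) (n + y)) =
      1 / (S * A)^(1/2 : ℂ) * ∑' k : ℤ, (cexp (-π * k^2 / (S * A) + 2 * π * I * x * k) *
        cexp (-π * (S * (a^2 / A : ℝ)) * ((n:ℂ) + y)^2 + 2 * π * I * (B / A * k) * (n + y))) := by
    intro n
    have := poisson1 (S * A) hc1 0 (x + B / A * (n + y))
    have e : ∀ m : ℤ, cexp (-π * S * qf (A:ℂ) B C (m + x) (n + y)) = cexp (-π * (S * (a^2 / A : ℝ)) * ((n:ℂ) + y)^2) *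
        cexp (-π * (S * A) * ((m:ℂ) + (x + B / A * (n + y)))^2 + 2 * π * I * 0 * (m + (x + B / A * (n + y)))) := by
      intro m; rw [← Complex.exp_add]; congr 1
      unfold qf
      push_cast
      rw [← hdc]
      field_simp
      ring
    rw [tsum_congr e, tsum_mul_left, this, mul_left_comm, ← tsum_mul_left]
    congr 1
    refine tsum_congr fun k => ◌
    rw [← Complex.exp_add, ← Complex.exp_add]
    congr 1
    ring
  rw [tsum_congr e1, tsum_mul_left]
  -- swap
  have hsum : Summable (Function.uncurry fun (n k : ℤ) => cexp (-π * k^2 / (S * A) + 2 * π * I * x * k) *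
        cexp (-π * (S * (a^2 / A : ℝ)) * ((n:ℂ) + y)^2 + 2 * π * I * (B / A * k) * (n + y))) := by
    have s1 := (gsum (1 / (S * A)) hc3 x 0).norm
    have s2 := (gsum (S * (a^2 / A : ℝ)) hc2 0 y).norm
    refine Summable.of_norm ((s2.mul_of_nonneg s1 (fun _ => norm_nonneg _) (fun _ => norm_nonneg _)).congr ◌)
    rintro ⟨n, k⟩
    simp only [Function.uncurry]
    rw [norm_mul, mul_comm]
    congr 1
    · congr 2; ring
    · rw [Complex.norm_exp, Complex.norm_exp]
      congr 1
      simp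
  rw [← hsum.tsum_comm]
  have e2 : ∀ k : ℤ, ∑' n : ℤ, (cexp (-π * k^2 / (S * A) + 2 * π * I * x * k) *
        cexp (-π * (S * (a^2 / A : ℝ)) * ((n:ℂ) + y)^2 + 2 * π * I * (B / A * k) * (n + y))) =
      1 / (S * (a^2 / A : ℝ))^(1/2 : ℂ) * ∑' l : ℤ, cexp (-π * qf (C:ℂ) (-B) A k l / (a^2 * S) + 2 * π * I * (k * x + l * y)) := by
    intro k
    rw [tsum_mul_left, poisson1 _ hc2, mul_left_comm, ← tsum_mul_left]
    congr 1
    refine tsum_congr fun l => ◌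
    rw [← Complex.exp_add]
    congr 1
    have hC : (C:ℂ) = (a^2 + B^2) / A := by field_simp; linear_combination hdc
    unfold qf
    rw [hC]
    push_cast
    field_simp
    ring
  rw [tsum_congr e2, tsum_mul_left, ← mul_assoc]
  congr 1
  have key : ∀ r : ℝ, 0 < r → (S * r)^(1/2 : ℂ) = S^(1/2 : ℂ) * (√r : ℝ) := by
    intro r hr
    have hr0 : (r:ℂ) ≠ 0 := mod_cast hr.ne'
    rw [cpow_def_of_ne_zero (mul_ne_zero hS0 hr0), log_mul_ofReal r hr S hS0, cpow_def_of_ne_zero hS0, sqrt_eq_rpow,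
      rpow_def_of_pos hr, ofReal_exp, ← Complex.exp_add]
    congr 1
    push_cast; ring
  rw [key A hA, key _ ¶]
  have hs : S^(1/2 : ℂ) * S^(1/2 : ℂ) = S := by
    rw [← cpow_add _ _ hS0]; norm_num
  have hr : √A * √(a^2/A) = a := by
    rw [← sqrt_mul hA.le, mul_div_cancel₀ _ hA.ne', sqrt_sq ha.le]
  rw [one_div_mul_one_div]
  congr 1
  have : ((√A : ℝ) : ℂ) * (√(a^2/A) : ℝ) = a := mod_cast hr
  linear_combination (S^(1/2 : ℂ))^2 * this + a * hs
end

section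
open Finset Complex Real

theorem qf_low (A B C a x y : ℝ) (hd : A * C - B^2 = a^2) : a^2 * (x^2+y^2) ≤ (A + C) * qf A B C x y := by
  unfold qf; nlinarith [sq_nonneg (A*x+B*y), sq_nonneg (B*x+C*y)]

theorem qsum (A B C a : ℝ) (hA : 0 < A) (ha : 0 < a) (hd : A * C - B^2 = a^2) (S : ℂ) (hS : 0 < S.re) (x y : ℝ) :
    Summable fun u : ℤ × ℤ => cexp (-π * S * qf (A:ℂ) B C (u.1 + x) (u.2 + y)) := by
  have hC : 0 < C := by by_contra h; nlinarith [sq_nonneg B, pow_pos ha 2, not_lt.1 h]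
  set c : ℝ := S.re * (a^2 / (A + C)) with hc
  have hc0 : 0 < c := by positivity
  have s1 := (gsum (c:ℂ) (by simpa using hc0) 0 x).norm
  have s2 := (gsum (c:ℂ) (by simpa using hc0) 0 y).norm
  refine Summable.of_norm_bounded (s1.mul_of_nonneg s2 (fun _ => norm_nonneg _) (fun _ => norm_nonneg _)) ◌
  rintro ⟨m, n⟩
  rw [← norm_mul, ← Complex.exp_add, Complex.norm_exp, Complex.norm_exp, Real.exp_le_exp]
  have e1 : (-π * S * qf (A:ℂ) B C (m + x) (n + y)).re = -π * S.re * qf A B C (m + x) (n + y) := by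
    have : qf (A:ℂ) B C (m + x) (n + y) = ((qf A B C (m + x) (n + y) : ℝ) : ℂ) := by unfold qf; push_cast; ring
    rw [this, re_mul_ofReal]; congr 1; rw [← ofReal_neg, re_ofReal_mul]
  have e2 : (-π * (c:ℂ) * ((m:ℂ) + x)^2 + 2 * π * I * 0 * (m + x) + (-π * (c:ℂ) * ((n:ℂ) + y)^2 + 2 * π * I * 0 * (n + y))).re
      = -π * c * ((m+x)^2 + (n+y)^2) := by
    rw [← ofReal_re (-π * c * ((m+x)^2 + (n+y)^2))]; congr 1; push_cast; ring
  simp only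
  rw [e1, e2]
  have := qf_low A B C a (m+x) (n+y) hd
  have h3 : a^2 / (A + C) * ((m+x)^2 + (n+y)^2) ≤ qf A B C (m + x) (n + y) := by
    rw [div_mul_eq_mul_div, div_le_iff₀ ¶]; linarith
  have := mul_le_mul_of_nonneg_left h3 (mul_nonneg pi_pos.le hS.le)
  rw [hc]; linarith

noncomputable def Th (A B C : ℤ) (t : ℂ) : ℂ := ∑' u : ℤ × ℤ, cexp (-π * t * (qf A B C u.1 u.2 : ℤ))

theorem Th_summable (A B C a : ℤ) (hA : 0 < A) (ha : 0 < a) (hd : A * C - B^2 = a^2) (t : ℂ) (ht : 0 < t.re) :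
    Summable fun u : ℤ × ℤ => cexp (-π * t * (qf A B C u.1 u.2 : ℤ)) := by
  have := qsum A B C a (by exact_mod_cast hA) (by exact_mod_cast ha) (by exact_mod_cast hd) t ht 0 0
  refine this.congr fun u => ◌
  congr 2; unfold qf; push_cast; ring

theorem dual_summable (A B C a : ℤ) (hA : 0 < A) (ha : 0 < a) (hd : A * C - B^2 = a^2) (q : ℕ) (hq : 0 < q) (s : ℂ) (hs : 0 < s.re) :
    Summable fun u : ℤ × ℤ => cexp (-π * (qf C (-B) A u.1 u.2 : ℤ) / (s * q^2 * a^2)) := by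
  have hC : 0 < C := by by_contra h; nlinarith [sq_nonneg B, pow_pos ha 2, not_lt.1 h]
  have hs0 : s ≠ 0 := by rintro rfl; simp at hs
  have hre : 0 < (1 / (s * q^2 * a^2)).re := by
    have e : 1 / (s * q^2 * a^2) = s⁻¹ * ((1 / (q^2*a^2) : ℝ) : ℂ) := by push_cast; field_simp
    rw [e, re_mul_ofReal, inv_re]
    have : 0 < normSq s := normSq_pos.2 hs0
    have : §0 < a := mod_cast ha
    positivity
  refine (Th_summable C (-B) A a hC ha £ _ hre).congr fun u => ◌
  congr 1; ring

theorem Th_formula (A B C a : ℤ) (hA : 0 < A) (ha : 0 < a) (hd : A * C - B^2 = a^2) (q : ℕ) [NeZero q] (b : ZMod q)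
    (s : ℂ) (hs : 0 < s.re) :
    Th A B C (s - 2 * I * (b.val / q)) = 1 / (q^2 * a * s) * ∑' u : ℤ × ℤ,
      GS ZMod.stdAddChar (A : ZMod q) B C b (u.1 : ZMod q) (u.2 : ZMod q) * cexp (-π * (qf C (-B) A u.1 u.2 : ℤ) / (s * q^2 * a^2)) := by
  have hq : 0 < q := Nat.pos_of_ne_zero (NeZero.ne q)
  have hqc : (q:ℂ) ≠ 0 := mod_cast hq.ne'
  have hs0 : s ≠ 0 := by rintro rfl; simp at hs
  have ha' : §0 < a := mod_cast ha
  have hA' : §0 < A := mod_cast hA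
  have hd' : §A * C - §B^2 = §a^2 := mod_cast hd
  have ha0 : (a:ℂ) ≠ 0 := mod_cast ha.ne'
  have ht : 0 < (s - 2 * I * (b.val / q)).re := by
    have : (2 * I * ((b.val:ℂ) / q)).re = 0 := by
      rw [show (2 * I * ((b.val:ℂ) / q)) = I * ((2 * b.val / q : ℝ) : ℂ) by push_cast; ring]; simp
    rw [sub_re, this]; simpa using hs
  have hS : 0 < (s * q^2).re := by
    rw [show s * (q:ℂ)^2 = s * ((q^2 : ℝ) : ℂ) by push_cast; rfl, re_mul_ofReal]; positivity
  have hsum := Th_summable A B C a hA ha hd _ ht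
  obtain ⟨E, hE⟩ : ∃ E : (ZMod q × ZMod q) × (ℤ × ℤ) ≃ ℤ × ℤ, ∀ r m, E (r, m) = (m.1 * q + r.1.val, m.2 * q + r.2.val) := by
    have inj : ∀ (m m' : ℤ) (r r' : ZMod q), m * q + r.val = m' * q + r'.val → r = r' ∧ m = m' := by
      intro m m' r r' h
      have h1 := congrArg (fun z : ℤ => (z : ZMod q)) h
      simp at h1
      refine ⟨h1, ◌⟩
      rw [h1] at h
      exact mul_right_cancel₀ (by exact_mod_cast hq.ne') (add_right_cancel h)
    have sur : ∀ z : ℤ, ∃ (m : ℤ) (r : ZMod q), m * q + r.val = z := by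
      intro z
      refine ⟨z / q, (z : ZMod q), ◌⟩
      rw [ZMod.val_intCast]; exact Int.ediv_mul_add_emod z q
    refine ⟨Equiv.ofBijective (fun p => (p.2.1 * q + p.1.1.val, p.2.2 * q + p.1.2.val)) ⟨◌, ◌⟩, fun r m => rfl⟩
    · rintro ⟨⟨r1, r2⟩, m1, m2⟩ ⟨⟨r1', r2'⟩, m1', m2'⟩ h
      simp only [Prod.mk.injEq] at h
      obtain ⟨rfl, rfl⟩ := inj _ _ _ _ h.1
      obtain ⟨rfl, rfl⟩ := inj _ _ _ _ h.2
      rfl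
    · rintro ⟨z1, z2⟩
      obtain ⟨m1, r1, h1⟩ := sur z1
      obtain ⟨m2, r2, h2⟩ := sur z2
      exact ⟨((r1, r2), (m1, m2)), Prod.ext h1 h2⟩
  have hdual := dual_summable A B C a hA ha hd q hq s hs
  have hdual2 : ∀ r : ZMod q × ZMod q, Summable fun u : ℤ × ℤ => ZMod.stdAddChar (b * qf (A : ZMod q) B C r.1 r.2 + (u.1 : ZMod q) * r.1 + (u.2 : ZMod q) * r.2) *
        cexp (-π * (qf C (-B) A u.1 u.2 : ℤ) / (s * q^2 * a^2)) := fun r =>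
    Summable.of_norm (hdual.norm.congr fun u => by rw [norm_mul, AddChar.norm_apply, one_mul])
  unfold Th
  rw [← E.tsum_eq]
  refine (((E.summable_iff (f := fun u : ℤ × ℤ => cexp (-π * (s - 2 * I * (b.val / q)) * (qf A B C u.1 u.2 : ℤ)))).2 hsum).tsum_prod.trans ◌)
  rw [tsum_fintype]
  simp only [Function.comp_apply]
  have e1 : ∀ r : ZMod q × ZMod q, ∀ m : ℤ × ℤ, cexp (-π * (s - 2 * I * (b.val / q)) * (qf A B C (E (r,m)).1 (E (r,m)).2 : ℤ)) =
      ZMod.stdAddChar (b * qf (A : ZMod q) B C r.1 r.2) *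
      cexp (-π * (s * q^2) * qf ((§A):ℂ) (§B:ℂ) (§C:ℂ) (m.1 + (r.1.val / q : ℝ)) (m.2 + (r.2.val / q : ℝ))) := by
    intro r m
    have hb : b * qf (A : ZMod q) B C r.1 r.2 = ((b.val * qf A B C (E (r,m)).1 (E (r,m)).2 : ℤ) : ZMod q) := by
      rw [hE]; unfold qf; push_cast; simp
    rw [hb, ZMod.stdAddChar_coe, ← Complex.exp_add]
    congr 1
    rw [hE]; unfold qf; push_cast
    field_simp
    ring
  rw [sum_congr rfl fun r _ => (tsum_congr (e1 r))]
  have e2 : ∀ r : ZMod q × ZMod q, ∑' m : ℤ × ℤ, ZMod.stdAddChar (b * qf (A : ZMod q) B C r.1 r.2) *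
      cexp (-π * (s * q^2) * qf ((§A):ℂ) (§B:ℂ) (§C:ℂ) (m.1 + (r.1.val / q : ℝ)) (m.2 + (r.2.val / q : ℝ))) =
      1 / (q^2 * a * s) * ∑' u : ℤ × ℤ, ZMod.stdAddChar (b * qf (A : ZMod q) B C r.1 r.2 + (u.1 : ZMod q) * r.1 + (u.2 : ZMod q) * r.2) *
        cexp (-π * (qf C (-B) A u.1 u.2 : ℤ) / (s * q^2 * a^2)) := by
    intro r
    have hs2 := qsum A B C a hA' ha' hd' _ hS (r.1.val / q : ℝ) (r.2.val / q : ℝ)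
    rw [tsum_mul_left, ← (Equiv.prodComm ℤ ℤ).tsum_eq]
    have hs3 := ((Equiv.prodComm ℤ ℤ).summable_iff.2 hs2).tsum_prod
    simp only [Function.comp_def, Equiv.prodComm_apply, Prod.swap_prod_mk, Prod.fst_swap, Prod.snd_swap] at hs3 ⊢
    rw [hs3, poisson2 A B C a hA' ha' hd' _ hS, (hdual2 r).tsum_prod, mul_left_comm, ← tsum_mul_left]
    simp_rw [← tsum_mul_left]
    have e0 : (1 : ℂ) / ((§a:ℂ) * (s * q^2)) = 1 / (q^2 * a * s) := by push_cast; congr 1; ring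
    rw [e0]
    refine tsum_congr fun k => tsum_congr fun l => ◌
    have hb : (k : ZMod q) * r.1 + l * r.2 = ((k * r.1.val + l * r.2.val : ℤ) : ZMod q) := by push_cast; simp
    rw [add_assoc (b * _), AddChar.map_add_eq_mul, hb, ZMod.stdAddChar_coe, mul_assoc (ZMod.stdAddChar _), ← Complex.exp_add, mul_assoc]
    congr 3
    unfold qf; push_cast; field_simp; ring
  rw [sum_congr rfl fun r _ => e2 r, ← mul_sum, ← Summable.tsum_finsetSum]
  · congr 1
    refine tsum_congr fun u => ◌
    rw [GS, sum_mul]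
  · exact fun r _ => hdual2 r
end

section
open Finset Complex Real

theorem gauss_sum_le (y : ℝ) (hy : 0 < y) :
    Summable (fun k : ℤ => Real.exp (-y * §k^2)) ∧ ∑' k : ℤ, Real.exp (-y * §k^2) ≤ 1 + 2 / y := by
  set r := Real.exp (-y) with hr
  have hr0 : 0 < r := Real.exp_pos _
  have hr1 : r < 1 := by rw [hr, Real.exp_lt_one_iff]; linarith
  have hg := hasSum_geometric_of_lt_one hr0.le hr1
  have h1 : HasSum (fun n : ℕ => r ^ (¥n).natAbs) (1 - r)⁻¹ := by simpa using hg
  have h2 : HasSum (fun n : ℕ => r ^ (-(¥n+1)).natAbs) (r * (1 - r)⁻¹) := by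
    refine (hg.mul_left r).congr_fun fun n => ◌
    rw [← pow_succ', Int.natAbs_neg]; congr 1
  have h3 := HasSum.of_nat_of_neg_add_one (f := fun k : ℤ => r ^ k.natAbs) h1 h2
  have hb : ∀ k : ℤ, Real.exp (-y * §k^2) ≤ r ^ k.natAbs := by
    intro k
    rw [hr, ← Real.exp_nat_mul, Real.exp_le_exp]
    have : §k.natAbs ≤ §k^2 := by
      have : (k.natAbs : ℤ) ≤ k^2 := by
        rw [← Int.natAbs_sq]; exact_mod_cast Nat.le_self_pow two_ne_zero k.natAbs
      calc §k.natAbs = ((k.natAbs : ℤ) : ℝ) := (Int.cast_natCast _).symm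
        _ ≤ ((k^2 : ℤ) : ℝ) := Int.cast_le.2 this
        _ = §k^2 := by push_cast; rfl
    nlinarith
  have hs : Summable (fun k : ℤ => Real.exp (-y * §k^2)) :=
    Summable.of_nonneg_of_le (fun _ => (Real.exp_pos _).le) hb h3.summable
  refine ⟨hs, (hs.tsum_le_tsum hb h3.summable).trans ◌⟩
  rw [h3.tsum_eq]
  have e : (1 - r)⁻¹ + r * (1 - r)⁻¹ = 1 + 2 * (r / (1 - r)) := by
    have : 1 - r ≠ 0 := by linarith
    field_simp; ring
  rw [e, div_eq_mul_one_div 2 y]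
  have : r / (1 - r) ≤ 1 / y := by
    rw [div_le_div_iff₀ £ hy]
    have h5 := Real.add_one_le_exp y
    have h6 : r * Real.exp y = 1 := by rw [hr, ← Real.exp_add]; simp
    nlinarith
  linarith

def Dat.fr (D : Dat ℤ) (u u' : ℤ × ℤ) : Dat ℤ := ⟨D.A, D.B, D.C, u.1, u.2, D.A', D.B', D.C', u'.1, u'.2, D.h⟩

theorem dual_norm (A B C a : ℤ) (hA : 0 < A) (ha : 0 < a) (hd : A * C - B^2 = a^2) (q : ℕ) (hq : 0 < q) (s : ℂ) (hs : 0 < s.re)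
    (T : ℝ) (hT : §A + C ≤ T) (u : ℤ × ℤ) :
    ‖cexp (-π * (qf C (-B) A u.1 u.2 : ℤ) / (s * q^2 * a^2))‖ ≤
      Real.exp (-(Real.pi * s.re / (normSq s * q^2 * T)) * (u.1:ℝ)^2) * Real.exp (-(Real.pi * s.re / (normSq s * q^2 * T)) * (u.2:ℝ)^2) := by
  have hC : 0 < C := by by_contra h; nlinarith [sq_nonneg B, pow_pos ha 2, not_lt.1 h]
  have hs0 : s ≠ 0 := by rintro rfl; simp at hs
  have hn : 0 < normSq s := normSq_pos.2 hs0
  have ha' : §0 < a := mod_cast ha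
  have hA' : §0 < A := mod_cast hA
  have hC' : §0 < C := mod_cast hC
  have hT0 : 0 < T := by linarith
  rw [Complex.norm_exp, ← Real.exp_add, Real.exp_le_exp]
  have e : -π * ((qf C (-B) A u.1 u.2 : ℤ) : ℂ) / (s * q^2 * a^2) =
      s⁻¹ * ((-(π * (qf C (-B) A u.1 u.2 : ℤ) / (q^2 * a^2)) : ℝ) : ℂ) := by
    push_cast
    have : (a:ℂ) ≠ 0 := mod_cast ha.ne'
    field_simp
  rw [e, re_mul_ofReal, inv_re]
  have hl := qf_low (C:ℝ) (-B) A a u.1 u.2 (by have : (A:ℝ) * C - (B:ℝ)^2 = (a:ℝ)^2 := mod_cast hd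
                                               linarith)
  have e2 : ((qf C (-B) A u.1 u.2 : ℤ) : ℝ) = qf §C (-B) A u.1 u.2 := by unfold qf; push_cast; ring
  rw [e2]
  set F := qf §C (-B) A u.1 u.2
  have hF : §a^2 * (§u.1^2 + §u.2^2) ≤ T * F := by
    refine hl.trans (mul_le_mul_of_nonneg_right £ ◌)
    by_contra h
    have : 0 ≤ §a^2 * (§u.1^2 + §u.2^2) := by positivity
    nlinarith [not_le.1 h]
  have h4 : (§u.1^2 + §u.2^2) / T ≤ F / a^2 := by
    rw [div_le_div_iff₀ hT0 ¶]; linarith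
  have h5 := mul_le_mul_of_nonneg_left h4 (by positivity : 0 ≤ π * s.re / (normSq s * q^2))
  have e3 : s.re / normSq s * -(π * F / (q^2 * a^2)) = -(π * s.re / (normSq s * q^2) * (F / a^2)) := by
    field_simp
  have e4 : -(π * s.re / (normSq s * q^2 * T)) * §u.1^2 + -(π * s.re / (normSq s * q^2 * T)) * §u.2^2 =
      -(π * s.re / (normSq s * q^2) * ((§u.1^2 + §u.2^2) / T)) := by field_simp; ring
  rw [e3, e4]; linarith

theorem pair_point {D : Dat ℤ} {a a' : ℤ} (h : D.OK a a') (hA : 0 < D.A) (hA' : 0 < D.A') (q : ℕ) [NeZero q]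
    (s : ℂ) (hs : 0 < s.re) (T : ℝ) (hT : §D.A + D.C ≤ T) (hT' : §D.A' + D.C' ≤ T) (U : ℝ)
    (hU : ∀ u u', ‖UZ q (D.fr u u')‖ ≤ U) :
    ‖∑ b : (ZMod q)ˣ, ZMod.stdAddChar (-((D.h : ZMod q) * (b : ZMod q))) * (Th D.A D.B D.C (s - 2 * I * ((b : ZMod q).val / q)) *
      starRingEnd ℂ (Th D.A' D.B' D.C' (s - 2 * I * ((b : ZMod q).val / q))))‖ ≤
    1 / (q^4 * a * a' * normSq s) * (‖UZ q (D.fr 0 0)‖ + U * ((1 + 2 / (π * s.re / (normSq s * q^2 * T)))^4 - 1)) := by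
  have hq : 0 < q := Nat.pos_of_ne_zero (NeZero.ne q)
  have hs0 : s ≠ 0 := by rintro rfl; simp at hs
  have hn : 0 < normSq s := normSq_pos.2 hs0
  have hU0 : 0 ≤ U := (norm_nonneg _).trans (hU 0 0)
  have hC : 0 < D.C := by by_contra h0; nlinarith [sq_nonneg D.B, pow_pos h.ha 2, not_lt.1 h0, h.hd]
  have hT0 : 0 < T := by
    have : §0 < D.A := mod_cast hA
    have : §0 < D.C := mod_cast hC
    linarith
  set y := π * s.re / (normSq s * q^2 * T) with hy
  have hy0 : 0 < y := by positivity
  obtain ⟨hs1, hs2⟩ := gauss_sum_le y hy0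
  set φ := fun k : ℤ => Real.exp (-y * §k^2)
  set σ := ∑' k, φ k with hσ
  have hφ0 : ∀ k, 0 ≤ φ k := fun k => (Real.exp_pos _).le
  set E := fun u : ℤ × ℤ => cexp (-π * (qf D.C (-D.B) D.A u.1 u.2 : ℤ) / (s * q^2 * a^2)) with hE
  set E' := fun u : ℤ × ℤ => cexp (-π * (qf D.C' (-D.B') D.A' u.1 u.2 : ℤ) / (s * q^2 * a'^2)) with hE'
  have hEs : Summable E := dual_summable _ _ _ a hA h.ha h.hd q hq s hs
  have hEs' : Summable E' := dual_summable _ _ _ a' hA' h.ha' h.hd' q hq s hs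
  have hEn : ∀ u, ‖E u‖ ≤ φ u.1 * φ u.2 := fun u => dual_norm _ _ _ a hA h.ha h.hd q hq s hs T hT u
  have hEn' : ∀ u, ‖E' u‖ ≤ φ u.1 * φ u.2 := fun u => dual_norm _ _ _ a' hA' h.ha' h.hd' q hq s hs T hT' u
  -- sums
  have hφ2 : HasSum (fun u : ℤ × ℤ => φ u.1 * φ u.2) (σ * σ) :=
    hs1.hasSum.mul hs1.hasSum (hs1.mul_of_nonneg hs1 hφ0 hφ0)
  have hφ4 : HasSum (fun p : (ℤ × ℤ) × (ℤ × ℤ) => (φ p.1.1 * φ p.1.2) * (φ p.2.1 * φ p.2.2)) ((σ * σ) * (σ * σ)) := by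
    have n0 : 0 ≤ fun u : ℤ × ℤ => φ u.1 * φ u.2 := fun _ => mul_nonneg (hφ0 _) (hφ0 _)
    have h := hφ2.summable.mul_of_nonneg hφ2.summable n0 n0
    have h' := hφ2.mul hφ2 h
    exact h'
  let G := fun (b : (ZMod q)ˣ) (u : ℤ × ℤ) => GS ZMod.stdAddChar (D.A : ZMod q) D.B D.C b (u.1 : ZMod q) (u.2 : ZMod q)
  let G' := fun (b : (ZMod q)ˣ) (u : ℤ × ℤ) => GS ZMod.stdAddChar (D.A' : ZMod q) D.B' D.C' b (u.1 : ZMod q) (u.2 : ZMod q)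
  have GSb : ∀ (A B C b k l : ZMod q), ‖GS ZMod.stdAddChar A B C b k l‖ ≤ (Fintype.card (ZMod q × ZMod q) : ℝ) := by
    intro A B C b k l
    refine (norm_sum_le _ _).trans ◌
    simp only [AddChar.norm_apply]; simp
  have sG : ∀ b, Summable fun u => ‖G b u * E u‖ := fun b =>
    Summable.of_nonneg_of_le (fun _ => norm_nonneg _) (fun u => by
      rw [norm_mul]; exact mul_le_mul_of_nonneg_right (GSb _ _ _ _ _ _) (norm_nonneg _)) (hEs.norm.mul_left _)
  have sG' : ∀ b, Summable fun u => ‖starRingEnd ℂ (G' b u * E' u)‖ := fun b =>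
    Summable.of_nonneg_of_le (fun _ => norm_nonneg _) (fun u => by
      rw [RCLike.norm_conj, norm_mul]; exact mul_le_mul_of_nonneg_right (GSb _ _ _ _ _ _) (norm_nonneg _)) (hEs'.norm.mul_left _)
  have key : ∑ b : (ZMod q)ˣ, ZMod.stdAddChar (-((D.h : ZMod q) * (b : ZMod q))) * (Th D.A D.B D.C (s - 2 * I * ((b : ZMod q).val / q)) *
      starRingEnd ℂ (Th D.A' D.B' D.C' (s - 2 * I * ((b : ZMod q).val / q)))) =
      ((1 / (q^4 * a * a' * normSq s) : ℝ) : ℂ) * ∑' p : (ℤ × ℤ) × (ℤ × ℤ), UZ q (D.fr p.1 p.2) * (E p.1 * starRingEnd ℂ (E' p.2)) := by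
    have t1 : ∀ b : (ZMod q)ˣ, ZMod.stdAddChar (-((D.h : ZMod q) * (b : ZMod q))) * (Th D.A D.B D.C (s - 2 * I * ((b : ZMod q).val / q)) *
      starRingEnd ℂ (Th D.A' D.B' D.C' (s - 2 * I * ((b : ZMod q).val / q)))) =
      ((1 / (q^4 * a * a' * normSq s) : ℝ) : ℂ) * ∑' p : (ℤ × ℤ) × (ℤ × ℤ), ZMod.stdAddChar (-((D.h : ZMod q) * (b : ZMod q))) *
        (G b p.1 * E p.1 * starRingEnd ℂ (G' b p.2 * E' p.2)) := by
      intro b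
      rw [Th_formula _ _ _ a hA h.ha h.hd q b s hs, Th_formula _ _ _ a' hA' h.ha' h.hd' q b s hs, map_mul, conj_tsum,
        mul_mul_mul_comm, tsum_mul_tsum_of_summable_norm (sG b) (sG' b), tsum_mul_left, mul_left_comm]
      congr 1
      push_cast
      rw [← Complex.mul_conj s]
      simp only [map_div₀, map_mul, map_one, map_pow, map_natCast, map_intCast]
      rw [div_mul_div_comm]
      congr 1 <;> ring
    rw [sum_congr rfl fun b _ => t1 b, ← mul_sum, ← Summable.tsum_finsetSum]
    · congr 1
      refine tsum_congr fun p => ◌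
      unfold UZ US
      rw [sum_mul]
      refine sum_congr rfl fun b _ => ◌
      simp only [Dat.map, Dat.fr, G, G', map_mul]
      ring
    · intro b _
      have := summable_mul_of_summable_norm (sG b) (sG' b)
      exact this.mul_left _
  rw [key, norm_mul, norm_real, Real.norm_eq_abs]
  have ha' : §0 < a := mod_cast h.ha
  have ha'' : §0 < a' := mod_cast h.ha'
  rw [abs_of_nonneg ¶]
  refine mul_le_mul_of_nonneg_left ◌ ¶
  have φ01 : φ 0 = 1 := by simp [φ]
  have hb := (hφ4.mul_left U).add (hasSum_ite_eq (0 : (ℤ × ℤ) × (ℤ × ℤ)) (‖UZ q (D.fr 0 0)‖ - U))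
  clear_value φ σ E E'
  refine (tsum_of_norm_bounded (f := fun p : (ℤ × ℤ) × (ℤ × ℤ) => UZ q (D.fr p.1 p.2) * (E p.1 * starRingEnd ℂ (E' p.2))) hb ◌).trans ◌
  · intro p
    rw [norm_mul, norm_mul, RCLike.norm_conj]
    have h1 := mul_le_mul (hEn p.1) (hEn' p.2) (norm_nonneg _) (mul_nonneg (hφ0 _) (hφ0 _))
    split_ifs with hp
    · subst hp
      simp only [Prod.fst_zero, Prod.snd_zero, φ01] at h1 ⊢
      have := mul_le_mul_of_nonneg_left h1 (norm_nonneg (UZ q (D.fr 0 0)))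
      linarith
    · rw [add_zero]
      exact mul_le_mul (hU _ _) h1 ¶ hU0
  · have hσ0 : 0 ≤ σ := hσ ▸ tsum_nonneg hφ0
    have : (σ * σ) * (σ * σ) ≤ (1 + 2 / y)^4 := by
      rw [show (σ * σ) * (σ * σ) = σ^4 by ring]; exact pow_le_pow_left₀ hσ0 hs2 4
    linarith [mul_le_mul_of_nonneg_left this hU0]
end

section
open Finset MeasureTheory Real

/-- index set of Farey arcs -/
def farey (Q : ℕ) : Finset (ℕ × ℕ) := (Icc 1 Q ×ˢ range Q).filter fun t => t.2 < t.1 ∧ t.2.Coprime t.1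

theorem mem_farey (Q : ℕ) (t : ℕ × ℕ) : t ∈ farey Q ↔ 1 ≤ t.1 ∧ t.1 ≤ Q ∧ t.2 < t.1 ∧ t.2.Coprime t.1 := by
  simp [farey]; omega

noncomputable def arc (Q : ℕ) (t : ℕ × ℕ) (i : ℝ) : Set ℝ := Set.Icc (§t.2/t.1 + i - 1/(t.1*Q)) (§t.2/t.1 + i + 1/(t.1*Q))

theorem cover_le {ι : Type*} (S : Finset ι) (l r : ι → ℝ) (g : ℝ → ℝ) (hg : Continuous g) (h0 : ∀ x, 0 ≤ g x)
    (h : ∀ x ∈ Set.Icc §0 1, ∃ t ∈ S, x ∈ Set.Icc (l t) (r t)) :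
    ∫ x in Set.Icc §0 1, g x ≤ ∑ t ∈ S, ∫ x in Set.Icc (l t) (r t), g x := by
  have hi : ∀ a b : ℝ, Integrable ((Set.Icc a b).indicator g) := fun a b =>
    (integrable_indicator_iff measurableSet_Icc).2 (hg.continuousOn.integrableOn_Icc)
  simp only [← integral_indicator measurableSet_Icc]
  rw [← integral_finsetSum _ (fun t _ => hi _ _)]
  refine integral_mono (hi _ _) (integrable_finsetSum _ fun t _ => hi _ _) fun x => ◌
  have hn : ∀ t ∈ S, 0 ≤ (Set.Icc (l t) (r t)).indicator g x := fun t _ => Set.indicator_nonneg (fun x _ => h0 x) x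
  by_cases hx : x ∈ Set.Icc §0 1
  · obtain ⟨t, ht, hxt⟩ := h x hx
    rw [Set.indicator_of_mem hx]
    refine le_trans ◌ (single_le_sum hn ht)
    rw [Set.indicator_of_mem hxt]
  · rw [Set.indicator_of_notMem hx]; exact sum_nonneg hn

theorem overlap_le {ι : Type*} (S : Finset ι) (l r : ι → ℝ) (g : ℝ → ℝ) (hg : Continuous g) (h0 : ∀ x, 0 ≤ g x) (N : ℕ) (a b : ℝ)
    (hs : ∀ t ∈ S, a ≤ l t ∧ r t ≤ b)
    (h : ∀ (x : ℝ) (S' : Finset ι), S' ⊆ S → (∀ t ∈ S', x ∈ Set.Icc (l t) (r t)) → S'.card ≤ N) :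
    ∑ t ∈ S, ∫ x in Set.Icc (l t) (r t), g x ≤ N * ∫ x in Set.Icc a b, g x := by
  classical
  have hi : ∀ a b : ℝ, Integrable ((Set.Icc a b).indicator g) := fun a b =>
    (integrable_indicator_iff measurableSet_Icc).2 (hg.continuousOn.integrableOn_Icc)
  simp only [← integral_indicator measurableSet_Icc]
  rw [← integral_finsetSum _ (fun t _ => hi _ _), ← integral_const_mul]
  refine integral_mono (integrable_finsetSum _ fun t _ => hi _ _) ((hi _ _).const_mul _) fun x => ◌
  simp only
  by_cases hx : x ∈ Set.Icc a b
  · have h1 := h x (S.filter fun t => x ∈ Set.Icc (l t) (r t)) (filter_subset _ _) (fun t ht => (mem_filter.1 ht).2)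
    rw [Set.indicator_of_mem hx]
    have h2 : ∑ t ∈ S, (Set.Icc (l t) (r t)).indicator g x = ((S.filter fun t => x ∈ Set.Icc (l t) (r t)).card : ℝ) * g x := by
      rw [← nsmul_eq_mul, ← sum_const, sum_filter]
      refine sum_congr rfl fun t _ => ◌
      rw [Set.indicator_apply]
    rw [h2]
    exact mul_le_mul_of_nonneg_right (by exact_mod_cast h1) (h0 x)
  · rw [Set.indicator_of_notMem hx, mul_zero]
    refine (sum_eq_zero fun t ht => Set.indicator_of_notMem (fun hxt => hx ◌) _).le
    exact ⟨(hs t ht).1.trans hxt.1, hxt.2.trans (hs t ht).2⟩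

theorem farey_lower (Q : ℕ) (hQ : 0 < Q) (g : ℝ → ℝ) (hg : Continuous g) (h0 : ∀ x, 0 ≤ g x) (hp : ∀ x, g (x + 1) = g x) :
    ∫ x in Set.Icc §0 1, g x ≤ 2 * ∑ t ∈ farey Q, ∫ x in arc Q t 0, g x := by
  have hsh : ∀ t, ∫ x in arc Q t 1, g x = ∫ x in arc Q t 0, g x := by
    intro t
    have hle : §t.2/t.1 - 1/(t.1*Q) ≤ §t.2/t.1 + 1/(t.1*Q) := by
      have : §0 ≤ 1/(t.1*Q) := by positivity
      linarith
    unfold arc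
    rw [integral_Icc_eq_integral_Ioc, integral_Icc_eq_integral_Ioc, ← intervalIntegral.integral_of_le £,
      ← intervalIntegral.integral_of_le £]
    have := intervalIntegral.integral_comp_add_right (a := §t.2/t.1 + 0 - 1/(t.1*Q)) (b := §t.2/t.1 + 0 + 1/(t.1*Q)) g 1
    simp only [hp] at this
    rw [this]; congr 1 <;> ring
  have := cover_le (farey Q ×ˢ ({0, 1} : Finset ℝ)) (fun p => §p.1.2/p.1.1 + p.2 - 1/(p.1.1*Q)) (fun p => §p.1.2/p.1.1 + p.2 + 1/(p.1.1*Q)) g hg h0 ◌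
  · refine this.trans ◌
    rw [sum_product, mul_sum]
    refine sum_le_sum fun t _ => ◌
    rw [sum_pair zero_ne_one]
    have e1 := hsh t
    unfold arc at e1 ⊢
    simp only; rw [e1]; linarith
  · rintro x ⟨hx0, hx1⟩
    obtain ⟨r, hr, hrd⟩ := exists_rat_abs_sub_le_and_den_le x hQ
    have hd : §0 < r.den := mod_cast r.den_pos
    have hQ' : §0 < Q := mod_cast hQ
    have hr2 : |x - r| ≤ 1 / (r.den * Q) := hr.trans (by
      apply one_div_le_one_div_of_le ¶; linarith)
    have hr3 : |x * r.den - r.num| < 1 := by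
      have e : x * r.den - r.num = (x - r) * r.den := by
        rw [sub_mul]; congr 1; rw [Rat.cast_def]; field_simp
      rw [e, abs_mul, abs_of_pos hd]
      have := mul_le_mul_of_nonneg_right hr hd.le
      refine this.trans_lt ◌
      rw [div_mul_eq_mul_div, one_mul, div_lt_one ¶]
      nlinarith
    rw [abs_lt] at hr3
    have hn0 : 0 ≤ r.num := by
      have : (-1:ℝ) < r.num := by nlinarith
      have : (-1:ℤ) < r.num := mod_cast this
      omega
    have hn1 : r.num ≤ r.den := by
      have : §r.num < r.den + 1 := by nlinarith
      have : ¥r.num < r.den + 1 := mod_cast this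
      omega
    rw [abs_le] at hr2
    have hrr : §r = r.num / r.den := Rat.cast_def r
    rcases eq_or_lt_of_le hn1 with h | h
    · have hden : r.den = 1 := by
        have := r.reduced
        rw [h, Int.natAbs_natCast, Nat.coprime_self] at this
        exact this
      refine ⟨((1, 0), 1), ◌, ◌⟩
      · simp [mem_farey]; omega
      · rw [hden] at hr2 hrr h
        rw [h] at hrr
        simp at hr2 hrr
        rw [hrr] at hr2
        constructor <;> simp <;> linarith
    · have hnat : (r.num.toNat : ℤ) = r.num := Int.toNat_of_nonneg hn0
      have hnr : ((r.num.toNat : ℕ):ℝ) = r.num := mod_cast congrArg (fun z : ℤ => §z) hnat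
      refine ⟨((r.den, r.num.toNat), 0), ◌, ◌⟩
      · simp only [mem_product, mem_farey, mem_insert, true_or, and_true]
        refine ⟨r.den_pos, hrd, by omega, ◌⟩
        have := r.reduced
        rwa [show r.num.natAbs = r.num.toNat by omega] at this
      · simp only [hnr, ← hrr]
        constructor <;> linarith

theorem farey_upper (Q : ℕ) (hQ : 0 < Q) (g : ℝ → ℝ) (hg : Continuous g) (h0 : ∀ x, 0 ≤ g x) (hp : ∀ x, g (x + 1) = g x) :
    ∑ t ∈ farey Q, ∫ x in arc Q t 0, g x ≤ 27 * ∫ x in Set.Icc §0 1, g x := by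
  have hQ' : §1 ≤ Q := mod_cast hQ
  have := overlap_le (farey Q) (fun t => §t.2/t.1 + 0 - 1/(t.1*Q)) (fun t => §t.2/t.1 + 0 + 1/(t.1*Q)) g hg h0 9 (-1) 2 ◌ ◌
  · refine this.trans ◌
    have hper : Function.Periodic g 1 := hp
    have e : ∫ x in Set.Icc (-1:ℝ) 2, g x = 3 * ∫ x in Set.Icc §0 1, g x := by
      rw [integral_Icc_eq_integral_Ioc, integral_Icc_eq_integral_Ioc, ← intervalIntegral.integral_of_le ¤,
      ← intervalIntegral.integral_of_le ¤]
      have := hper.intervalIntegral_add_zsmul_eq 3 (-1) (fun _ _ => hg.intervalIntegrable _ _)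
      norm_num at this
      rw [this]
      congr 1
      have := hper.intervalIntegral_add_eq (-1) 0
      simpa using this
    rw [e]; push_cast; linarith
  · intro t ht
    rw [mem_farey] at ht
    have h1 : §1 ≤ t.1 := mod_cast ht.1
    have h2 : §t.2 / t.1 ≤ 1 := by rw [div_le_one £]; exact_mod_cast ht.2.2.1.le
    have h3 : §1/(t.1*Q) ≤ 1 := by rw [div_le_one ¶]; nlinarith
    have h4 : §0 ≤ §t.2 / t.1 := by positivity
    constructor <;> linarith
  · intro x S' hS hx
    have hinj : Set.InjOn (fun t : ℕ × ℕ => ((t.1 : ZMod 3), (t.2 : ZMod 3))) S' := by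
      have key : ∀ t ∈ S', |§t.1 * x - t.2| ≤ 1 / Q ∧ 1 ≤ t.1 ∧ t.1 ≤ Q ∧ t.2.Coprime t.1 := by
        intro t ht
        have hm := (mem_farey Q t).1 (hS ht)
        refine ⟨◌, hm.1, hm.2.1, hm.2.2.2⟩
        have h1 : §0 < t.1 := mod_cast hm.1
        obtain ⟨ha, hb⟩ := hx t ht
        have e : §t.1 * x - t.2 = t.1 * (x - t.2/t.1) := by field_simp
        rw [e, abs_mul, abs_of_pos h1]
        have h5 : |x - §t.2/t.1| ≤ 1/(t.1*Q) := abs_le.2 ⟨by linarith, by linarith⟩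
        calc _ ≤ §t.1 * (1/(t.1*Q)) := mul_le_mul_of_nonneg_left h5 h1.le
          _ = 1 / Q := by field_simp
      intro t ht t' ht' h
      obtain ⟨k1, k2, k3, k4⟩ := key t ht
      obtain ⟨l1, l2, l3, l4⟩ := key t' ht'
      simp only [Prod.mk.injEq] at h
      have hdet : |(¥t.1 * t'.2 - t'.1 * t.2 : ℤ)| ≤ 2 := by
        have : |(§t.1 * t'.2 - t'.1 * t.2)| ≤ 2 := by
          have e : (§t.1 * t'.2 - t'.1 * t.2) = t'.1 * (t.1 * x - t.2) - t.1 * (t'.1 * x - t'.2) := by ring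
          rw [e]
          refine (abs_sub _ _).trans ◌
          rw [abs_mul, abs_mul, Nat.abs_cast, Nat.abs_cast]
          have c1 : §t.1 ≤ Q := mod_cast k3
          have c2 : §t'.1 ≤ Q := mod_cast l3
          have hq : §Q * (1/Q) = 1 := by field_simp
          have d1 := mul_le_mul c2 k1 (abs_nonneg _) ¶
          have d2 := mul_le_mul c1 l1 (abs_nonneg _) ¶
          linarith
        exact_mod_cast this
      have h3 : ¥3 ∣ (¥t.1 * t'.2 - t'.1 * t.2 : ℤ) := by
        rw [show ¥3 = ((3:ℕ):ℤ) by rfl, ← ZMod.intCast_zmod_eq_zero_iff_dvd]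
        push_cast; rw [h.1, h.2]; ring
      rw [abs_le] at hdet
      have h4 : ¥t.1 * t'.2 = t'.1 * t.2 := by omega
      have h5 : t.1 * t'.2 = t'.1 * t.2 := mod_cast h4
      have d1 : t.1 ∣ t'.1 := (k4.symm).dvd_of_dvd_mul_right (Dvd.intro _ h5)
      have d2 : t'.1 ∣ t.1 := (l4.symm).dvd_of_dvd_mul_right (Dvd.intro _ h5.symm)
      have e1 := Nat.dvd_antisymm d1 d2
      refine Prod.ext e1 ◌
      rw [e1] at h5
      exact (Nat.eq_of_mul_eq_mul_left ¢ h5).symm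
    have := card_le_card_of_injOn (t := univ) _ (fun _ _ => mem_coe.2 (mem_univ _)) hinj
    simpa [ZMod.card] using this
end

section
open Finset Complex MeasureTheory Real

noncomputable def ee (n : ℤ) (θ : ℝ) : ℂ := cexp (2 * π * I * n * θ)

noncomputable def th (A B C : ℤ) (X θ : ℝ) : ℂ := Th A B C (2 / X - 2 * I * θ)

theorem norm_ee (n : ℤ) (θ : ℝ) : ‖ee n θ‖ = 1 := by
  unfold ee
  rw [show 2 * π * I * n * θ = ((2 * π * n * θ : ℝ) : ℂ) * I by push_cast; ring]
  exact Complex.norm_exp_ofReal_mul_I _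

theorem ee_cont (n : ℤ) : Continuous (ee n) := by unfold ee; fun_prop

theorem ee_per (n : ℤ) (θ : ℝ) : ee n (θ + 1) = ee n θ := by
  unfold ee
  rw [show 2 * π * I * n * ((θ + 1 : ℝ) : ℂ) = 2 * π * I * n * θ + n * (2 * π * I) by push_cast; ring, Complex.exp_add,
    Complex.exp_int_mul_two_pi_mul_I, mul_one]

theorem th_eq (A B C : ℤ) (X θ : ℝ) : th A B C X θ =
    ∑' u : ℤ × ℤ, ((Real.exp (-2 * π / X * (qf A B C u.1 u.2 : ℤ)) : ℝ) : ℂ) * ee (qf A B C u.1 u.2) θ := by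
  unfold th Th ee
  refine tsum_congr fun u => ◌
  rw [ofReal_exp, ← Complex.exp_add]; congr 1; push_cast; ring

theorem th_wsum (A B C a : ℤ) (hA : 0 < A) (ha : 0 < a) (hd : A * C - B^2 = a^2) (X : ℝ) (hX : 0 < X) :
    Summable fun u : ℤ × ℤ => Real.exp (-2 * π / X * (qf A B C u.1 u.2 : ℤ)) := by
  have := (Th_summable A B C a hA ha hd ((2 / X : ℝ) : ℂ) (by rw [ofReal_re]; positivity)).norm
  refine this.congr fun u => ◌
  rw [Complex.norm_exp]; congr 1
  rw [show -(π : ℂ) * ((2 / X : ℝ) : ℂ) * ((qf A B C u.1 u.2 : ℤ) : ℂ) = ((-π * (2 / X) * (qf A B C u.1 u.2 : ℤ) : ℝ) : ℂ) by push_cast; ring, ofReal_re]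
  ring

theorem psi_cont {ι : Type*} (w : ι → ℝ) (hw : Summable w) (h0 : ∀ i, 0 ≤ w i) (n : ι → ℤ) :
    Continuous fun θ => ∑' i, (w i : ℂ) * ee (n i) θ := by
  refine continuous_tsum (fun i => continuous_const.mul (ee_cont _)) hw fun i θ => ◌
  rw [norm_mul, norm_ee, mul_one, norm_real, Real.norm_of_nonneg (h0 i)]

theorem th_cont (A B C a : ℤ) (hA : 0 < A) (ha : 0 < a) (hd : A * C - B^2 = a^2) (X : ℝ) (hX : 0 < X) : Continuous (th A B C X) := by
  rw [show th A B C X = _ from funext (th_eq A B C X)]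
  exact psi_cont _ (th_wsum A B C a hA ha hd X hX) (fun _ => (Real.exp_pos _).le) _

theorem th_per (A B C : ℤ) (X θ : ℝ) : th A B C X (θ + 1) = th A B C X θ := by
  simp only [th_eq, ee_per]

theorem parseval {ι : Type*} [Countable ι] (w : ι → ℝ) (hw : Summable w) (h0 : ∀ i, 0 ≤ w i) (n : ι → ℤ) :
    HasSum (fun p : ι × ι => if n p.1 = n p.2 then w p.1 * w p.2 else 0)
      (∫ θ in Set.Icc §0 1, ‖∑' i, (w i : ℂ) * ee (n i) θ‖^2) := by
  set F : ι × ι → ℝ → ℂ := fun p θ => ((w p.1 * w p.2 : ℝ) : ℂ) * ee (n p.1 - n p.2) θ with hF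
  have hww : Summable fun p : ι × ι => w p.1 * w p.2 := hw.mul_of_nonneg hw h0 h0
  have hcF : ∀ p, Continuous (F p) := fun p => continuous_const.mul (ee_cont _)
  have hnF : ∀ p θ, ‖F p θ‖ = w p.1 * w p.2 := fun p θ => by
    simp only [hF]
    rw [norm_mul, norm_ee, mul_one, norm_real, Real.norm_of_nonneg (mul_nonneg (h0 _) (h0 _))]
  have h1 := hasSum_integral_of_summable_integral_norm (μ := volume.restrict (Set.Icc §0 1)) (F := F)
    (fun p => (hcF p).continuousOn.integrableOn_Icc) (by simpa only [hnF, integral_const, Measure.real, Measure.restrict_apply_univ, Real.volume_Icc, sub_zero, ENNReal.toReal_ofReal zero_le_one, one_smul] using hww)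
  have e1 : ∀ p : ι × ι, ∫ θ in Set.Icc §0 1, F p θ = ((if n p.1 = n p.2 then w p.1 * w p.2 else 0 : ℝ) : ℂ) := by
    intro p
    simp only [hF]
    rw [integral_const_mul]
    split_ifs with h
    · rw [h, sub_self]; simp [ee]
    · have hk : (n p.1 - n p.2 : ℤ) ≠ 0 := sub_ne_zero.2 h
      have hk' : ((n p.1 - n p.2 : ℤ) : ℂ) ≠ 0 := mod_cast hk
      have h2 : (2 * π * I * (n p.1 - n p.2 : ℤ) : ℂ) ≠ 0 := mul_ne_zero Complex.two_pi_I_ne_zero hk'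
      rw [integral_Icc_eq_integral_Ioc, ← intervalIntegral.integral_of_le zero_le_one]
      unfold ee
      rw [integral_exp_mul_complex h2]
      have := Complex.exp_int_mul_two_pi_mul_I (n p.1 - n p.2)
      rw [ofReal_one, mul_one, mul_comm (2 * π * I : ℂ), this]; simp
  have e2 : ∀ θ, ∑' p, F p θ = ((‖∑' i, (w i : ℂ) * ee (n i) θ‖^2 : ℝ) : ℂ) := by
    intro θ
    have hn : Summable fun i => ‖(w i : ℂ) * ee (n i) θ‖ := hw.congr fun i => by
      rw [norm_mul, norm_ee, mul_one, norm_real, Real.norm_of_nonneg (h0 i)]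
    have hn' : Summable fun i => ‖starRingEnd ℂ ((w i : ℂ) * ee (n i) θ)‖ := by simpa only [RCLike.norm_conj] using hn
    rw [← Complex.normSq_eq_norm_sq, ← Complex.mul_conj, conj_tsum, tsum_mul_tsum_of_summable_norm hn hn']
    refine tsum_congr fun p => ◌
    simp only [hF]
    rw [map_mul, conj_ofReal, mul_mul_mul_comm, ofReal_mul]
    congr 1
    unfold ee
    rw [← Complex.exp_conj, ← Complex.exp_add]
    congr 1
    simp only [map_mul, conj_I, conj_ofReal, map_ofNat, map_intCast]
    push_cast; ring
  simp only [e1, e2] at h1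
  rw [integral_complex_ofReal] at h1
  exact_mod_cast h1

theorem farey_sum (Q : ℕ) {M : Type*} [AddCommMonoid M] (F : ℕ → ℕ → M) :
    ∑ t ∈ farey Q, F t.1 t.2 = ∑ q ∈ Icc 1 Q, ∑ b ∈ (range q).filter (fun b => b.Coprime q), F q b := by
  rw [sum_sigma']
  refine sum_bij' (fun t _ => ⟨t.1, t.2⟩) (fun t _ => (t.1, t.2)) ◌ ◌ ◌ ◌ ◌
  · intro t ht; rw [mem_farey] at ht; simp; omega
  · intro t ht; simp only [mem_sigma, mem_Icc, mem_filter, mem_range] at ht; rw [mem_farey]; simp only; tauto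
  all_goals intros; rfl

theorem unit_sum (q : ℕ) [NeZero q] {M : Type*} [AddCommMonoid M] (F : ℕ → M) :
    ∑ b ∈ (range q).filter (fun b => b.Coprime q), F b = ∑ b : (ZMod q)ˣ, F (b : ZMod q).val := by
  symm
  refine sum_bij' (fun b _ => (b : ZMod q).val) (fun b hb => ZMod.unitOfCoprime b (mem_filter.1 hb).2) ◌ ◌ ◌ ◌ ◌
  · intro b _
    rw [mem_filter, mem_range]
    exact ⟨ZMod.val_lt _, ZMod.val_coe_unit_coprime b⟩
  · intros; exact mem_univ _
  · intro b _; ext; simp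
  · intro b hb; rw [mem_filter, mem_range] at hb
    simp [ZMod.val_natCast, Nat.mod_eq_of_lt hb.1]
  · intros; rfl
end

section
open Finset Complex MeasureTheory Real

theorem lor_int (X δ : ℝ) (hX : 0 < X) : ∫ β in (-δ)..δ, (4/X^2+4*β^2)⁻¹ ≤ π * X / 4 := by
  have e : ∀ β : ℝ, (4/X^2+4*β^2)⁻¹ = X^2/4 * (1 / (1 + (X*β)^2)) := by
    intro β
    have : 0 < 1 + (X*β)^2 := by positivity
    have h2 : 0 < 4/X^2+4*β^2 := by positivity
    field_simp
  simp only [e]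
  rw [intervalIntegral.integral_const_mul, intervalIntegral.integral_comp_mul_left (fun x => 1/(1+x^2)) hX.ne', integral_one_div_one_add_sq, smul_eq_mul]
  have h1 := Real.arctan_lt_pi_div_two (X*δ)
  have h2 := Real.neg_pi_div_two_lt_arctan (X*(-δ))
  have : X^2/4*(X⁻¹*(Real.arctan (X*δ) - Real.arctan (X*(-δ)))) = X/4*(Real.arctan (X*δ) - Real.arctan (X*(-δ))) := by
    field_simp
  rw [this]
  nlinarith

theorem ee_add (n : ℤ) (x y : ℝ) : ee n (x + y) = ee n x * ee n y := by
  unfold ee; rw [← Complex.exp_add]; congr 1; push_cast; ring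

theorem ee_std (h : ℤ) (q : ℕ) [NeZero q] (b : ZMod q) : ee (-h) (§b.val / q) = ZMod.stdAddChar (-((h : ZMod q) * b)) := by
  have : -((h : ZMod q) * b) = ((-h * (b.val : ℤ) : ℤ) : ZMod q) := by push_cast; rw [ZMod.natCast_zmod_val]; ring
  rw [this, ZMod.stdAddChar_coe]
  unfold ee; congr 1; push_cast; ring

theorem arc_int (Q : ℕ) (q b : ℕ) (g : ℝ → ℂ) : ∫ θ in arc Q (q,b) 0, g θ = 
    ∫ β in (-(1/(§q*Q)))..(1/(§q*Q)), g (§b/q + β) := by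
  have h0 : §0 ≤ 1/(§q*Q) := by positivity
  rw [intervalIntegral.integral_comp_add_left (fun x => g x), arc, integral_Icc_eq_integral_Ioc, ← intervalIntegral.integral_of_le £]
  simp only [add_zero]; rfl

theorem pw4 (T w : ℝ) (hT1 : 1 ≤ T) (hw0 : 0 ≤ w) (hw4 : w ≤ 4*T) : (1+w)^4-1 ≤ 160*T^3*w := by
  have h1 : w^2 ≤ (4*T)^2 := by gcongr
  have h2 : w^3 ≤ (4*T)^3 := by gcongr
  have h3 : T ≤ T^3 := le_self_pow₀ hT1 ¤
  have h4 : T^2 ≤ T^3 := pow_le_pow_right₀ hT1 ¤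
  have h5 : 1 ≤ T^3 := one_le_pow₀ hT1
  have : 4+6*w+4*w^2+w^3 ≤ 160*T^3 := by linarith [mul_pow 4 T 2, mul_pow 4 T 3]
  calc (1+w)^4-1 = (4+6*w+4*w^2+w^3)*w := by ring
    _ ≤ _ := by gcongr

set_option maxHeartbeats 800000 in
theorem pair_q {D : Dat ℤ} {a a' : ℤ} (h : D.OK a a') (hA : 0 < D.A) (hA' : 0 < D.A') (Q q : ℕ) [NeZero q] (hq : q ≤ Q)
    (T : ℝ) (hT1 : 1 ≤ T) (hT : §D.A+D.C ≤ T) (hT' : §D.A'+D.C' ≤ T) (U : ℝ) (hU : ∀ u u', ‖UZ q (D.fr u u')‖ ≤ U * q^3) :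
    ‖∑ b : (ZMod q)ˣ, ∫ θ in arc Q (q, (b : ZMod q).val) 0, ee (-D.h) θ * (th D.A D.B D.C (§Q^2) θ * starRingEnd ℂ (th D.A' D.B' D.C' (§Q^2) θ))‖
      ≤ π * §Q^2 / 4 / (a * a') * FF (D.fr 0 0) q + 320 * T^4 * Q * U := by
  have hq0 : 0 < q := Nat.pos_of_ne_zero (NeZero.ne q)
  have hQ0 : 0 < Q := by omega
  have hqr : §0 < q := mod_cast hq0
  have hQr : §0 < Q := mod_cast hQ0
  have hqQ : §q ≤ Q := mod_cast hq
  have ha : §1 ≤ a := mod_cast h.ha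
  have ha' : §1 ≤ a' := mod_cast h.ha'
  have hU0 : 0 ≤ U := by
    have := (norm_nonneg _).trans (hU 0 0)
    exact nonneg_of_mul_nonneg_left this ¶
  set X : ℝ := §Q^2 with hX
  have hX0 : 0 < X := by positivity
  set δ : ℝ := 1/(§q*Q) with hδ
  have hδ0 : 0 ≤ δ := by positivity
  set g : ℝ → ℂ := fun θ => ee (-D.h) θ * (th D.A D.B D.C X θ * starRingEnd ℂ (th D.A' D.B' D.C' X θ)) with hg
  have hgc : Continuous g := (ee_cont _).mul ((th_cont _ _ _ a hA h.ha h.hd X hX0).mul (Complex.continuous_conj.comp (th_cont _ _ _ a' hA' h.ha' h.hd' X hX0)))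
  simp only [arc_int]
  rw [← intervalIntegral.integral_finsetSum (f := fun (b : (ZMod q)ˣ) (β : ℝ) => g (((b:ZMod q).val : ℝ)/q + β)) 
    (fun b _ => Continuous.intervalIntegrable (by fun_prop) _ _)]
  have key : ∀ β ∈ Set.Ioc (-δ) δ, ‖∑ b : (ZMod q)ˣ, g (((b:ZMod q).val : ℝ)/q + β)‖ ≤ 
      FF (D.fr 0 0) q / (a*a') * (4/X^2+4*β^2)⁻¹ + 160 * U * T^4 * X * q := by
    intro β hβ
    have hs : §0 < (2 / (X:ℂ) - 2 * I * β).re := by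
      rw [show (2 / (X:ℂ) - 2 * I * β) = ((2/X : ℝ):ℂ) - ((2 * β : ℝ) : ℂ) * I by push_cast; ring]
      simp; positivity
    have hre : (2 / (X:ℂ) - 2 * I * β).re = 2 / X := by
      rw [show (2 / (X:ℂ) - 2 * I * β) = ((2/X : ℝ):ℂ) - ((2 * β : ℝ) : ℂ) * I by push_cast; ring]
      simp
    have hN : normSq (2 / (X:ℂ) - 2 * I * β) = 4/X^2+4*β^2 := by
      rw [show (2 / (X:ℂ) - 2 * I * β) = ((2/X : ℝ):ℂ) + ((-2 * β : ℝ) : ℂ) * I by push_cast; ring, normSq_add_mul_I]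
      ring
    have hp := pair_point h hA hA' q (2 / (X:ℂ) - 2 * I * β) hs T hT hT' _ hU
    rw [hN, hre] at hp
    have e1 : ∑ b : (ZMod q)ˣ, g (((b:ZMod q).val : ℝ)/q + β) = ee (-D.h) β * ∑ b:(ZMod q)ˣ, ZMod.stdAddChar (-((D.h:ZMod q)*(b:ZMod q))) * (Th D.A D.B D.C (2 / (X:ℂ) - 2 * I * β-2*I*((b:ZMod q).val/q)) * starRingEnd ℂ (Th D.A' D.B' D.C' (2 / (X:ℂ) - 2 * I * β-2*I*((b:ZMod q).val/q)))) := by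
      rw [mul_sum]
      refine sum_congr rfl fun b _ => ◌
      have e2 : 2 / (X:ℂ) - 2 * I * β-2*I*((b:ZMod q).val/q) = 2 / (X:ℂ) - 2 * I * ((((b:ZMod q).val : ℝ)/q + β : ℝ)) := by push_cast; ring
      rw [e2]
      simp only [hg, th]
      rw [ee_add, ee_std]
      ring
    rw [e1, norm_mul, norm_ee, one_mul]
    refine hp.trans ◌
    set N := 4/X^2+4*β^2 with hNN
    have hN0 : 0 < N := by positivity
    have hNX : N * q^2 * X ≤ 8 := by
      have hb : β^2 ≤ δ^2 := sq_le_sq' hβ.1.le hβ.2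
      have h3 : δ^2 * (q^2 * X) = 1 := by rw [hδ, hX]; field_simp
      have h4 : 4/X^2 * (q^2*X) ≤ 4 := by
        rw [show 4/X^2 * (q^2*X) = 4 * (q^2 / X) by field_simp]
        have : §q^2 / X ≤ 1 := by rw [div_le_one hX0]; exact pow_le_pow_left₀ hqr.le hqQ 2
        linarith
      have h5 : β^2 * (q^2*X) ≤ 1 := by rw [← h3]; gcongr
      rw [hNN]; linarith
    set w := 2/(π*(2/X)/(N*q^2*T)) with hw
    have hpi := pi_gt_three
    have hwe : w = N*q^2*X*T/π := by rw [hw]; field_simp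
    have hw0 : 0 ≤ w := by rw [hwe]; positivity
    have hw1 : w ≤ N*q^2*X*T/3 := by rw [hwe]; gcongr
    have hw4 : w ≤ 4*T := by
      refine hw1.trans ◌
      have : N*q^2*X*T ≤ 8*T := by gcongr
      linarith
    have hpw : (1+w)^4-1 ≤ 160*T^3*w := pw4 T w hT1 hw0 hw4
    have hpw2 : (1+w)^4-1 ≤ 160*T^4*X*q^2*N := by
      refine hpw.trans ◌
      calc 160*T^3*w ≤ 160*T^3*(N*q^2*X*T) := by
            gcongr
            refine hw1.trans ◌
            have : 0 ≤ N*q^2*X*T := by positivity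
            linarith
        _ = _ := by ring
    rw [FF_eq, mul_add]
    have haa : 1 ≤ §a*a' := by nlinarith
    refine add_le_add (le_of_eq ◌) ◌
    · field_simp
    · calc 1/(§q^4*a*a'*N)*(U*q^3*((1+w)^4-1)) ≤ 1/(§q^4*a*a'*N)*(U*q^3*(160*T^4*X*q^2*N)) := by gcongr
        _ = (160 * U * T^4 * X * q) / (a*a') := by field_simp
        _ ≤ _ := div_le_self ¶ haa
  have hci : Continuous fun β : ℝ => (4/X^2+4*β^2)⁻¹ := by
    refine Continuous.inv₀ (by fun_prop) fun β => ◌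
    positivity
  refine (intervalIntegral.norm_integral_le_of_norm_le £ (Filter.Eventually.of_forall key) ◌).trans ◌
  · exact ((continuous_const.mul hci).add continuous_const).intervalIntegrable _ _
  · rw [intervalIntegral.integral_add (f := fun β => FF (D.fr 0 0) q / (a*a') * (4/X^2+4*β^2)⁻¹) (Continuous.intervalIntegrable (continuous_const.mul hci) _ _) (continuous_const.intervalIntegrable _ _), intervalIntegral.integral_const_mul, intervalIntegral.integral_const]
    have := lor_int X δ hX0
    have hF : 0 ≤ FF (D.fr 0 0) q / (a*a') := div_nonneg (FF_nonneg _ _) ¶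
    refine add_le_add ◌ (le_of_eq ◌)
    · calc _ ≤ FF (D.fr 0 0) q / (a*a') * (π * X / 4) := by gcongr
        _ = _ := by ring
    · rw [smul_eq_mul, hδ, hX]; field_simp; ring

theorem pair_arcs {D : Dat ℤ} {a a' : ℤ} (h : D.OK a a') (hA : 0 < D.A) (hA' : 0 < D.A') (Q : ℕ)
    (T : ℝ) (hT1 : 1 ≤ T) (hT : §D.A+D.C ≤ T) (hT' : §D.A'+D.C' ≤ T) (U : ℕ → ℝ) 
    (hU : ∀ q [NeZero q], ∀ u u', ‖UZ q (D.fr u u')‖ ≤ U q * q^3) :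
    ‖∑ t ∈ farey Q, ∫ θ in arc Q t 0, ee (-D.h) θ * (th D.A D.B D.C (§Q^2) θ * starRingEnd ℂ (th D.A' D.B' D.C' (§Q^2) θ))‖
      ≤ π * §Q^2 / 4 / (a * a') * ∑ q ∈ Icc 1 Q, FF (D.fr 0 0) q + 320 * T^4 * Q * ∑ q ∈ Icc 1 Q, U q := by
  rw [farey_sum Q (fun q b => ∫ θ in arc Q (q,b) 0, ee (-D.h) θ * (th D.A D.B D.C (§Q^2) θ * starRingEnd ℂ (th D.A' D.B' D.C' (§Q^2) θ)))]
  rw [mul_sum, mul_sum, ← sum_add_distrib]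
  refine (norm_sum_le _ _).trans (sum_le_sum fun q hq => ◌)
  rw [mem_Icc] at hq
  have : NeZero q := ⟨by omega⟩
  rw [unit_sum]
  exact pair_q h hA hA' Q q hq.2 T hT1 hT hT' (U q) (hU q)
end

section
open Finset Complex MeasureTheory Real

structure Circ where
  (A B C a : ℤ)
  hA : 0 < A
  ha : 0 < a
  hd : A * C - B^2 = a^2
  pr : ∀ p : ℤ, Prime p → ¬ (p ∣ A ∧ p ∣ B ∧ p ∣ C)

namespace Circ
def f (c : Circ) (u : ℤ × ℤ) : ℤ := qf c.A c.B c.C u.1 u.2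
noncomputable def th (c : Circ) (X θ : ℝ) : ℂ := _root_.th c.A c.B c.C X θ
def pd (c c' : Circ) : Dat ℤ := ⟨c.A, c.B, c.C, 0, 0, c'.A, c'.B, c'.C, 0, 0, c.a - c'.a⟩
theorem ok (c c' : Circ) : (c.pd c').OK c.a c'.a := ⟨c.hd, c'.hd, c.ha, c'.ha, c.pr, c'.pr⟩
theorem thc (c : Circ) (X : ℝ) (hX : 0 < X) : Continuous (c.th X) := th_cont _ _ _ c.a c.hA c.ha c.hd X hX
noncomputable def cross (Q : ℕ) (c c' : Circ) : ℝ :=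
  ‖∑ t ∈ farey Q, ∫ θ in arc Q t 0, ee (-(c.a - c'.a)) θ * (c.th (§Q^2) θ * starRingEnd ℂ (c'.th (§Q^2) θ))‖
end Circ

noncomputable def Psi {ι : Type*} [Fintype ι] (c : ι → Circ) (ω : ι → ℝ) (X θ : ℝ) : ℂ := ∑ v, (ω v : ℂ) * (ee (-(c v).a) θ * (c v).th X θ)

section
variable {ι : Type*} [Fintype ι] (c : ι → Circ) (ω : ι → ℝ)

theorem Psi_cont (X : ℝ) (hX : 0 < X) : Continuous (Psi c ω X) :=
  continuous_finsetSum _ fun v _ => continuous_const.mul ((ee_cont _).mul ((c v).thc X hX))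

theorem Psi_pt (X θ : ℝ) : ‖Psi c ω X θ‖^2 ≤
    (∑ p ∈ (univ : Finset (ι × ι)).filter (fun p => (c p.1).a ≠ (c p.2).a), ((ω p.1 * ω p.2 : ℝ):ℂ) *
      (ee (-((c p.1).a - (c p.2).a)) θ * ((c p.1).th X θ * starRingEnd ℂ ((c p.2).th X θ)))).re +
    ∑ p ∈ (univ : Finset (ι × ι)).filter (fun p => (c p.1).a = (c p.2).a), ω p.1^2 * ‖(c p.1).th X θ‖^2 := by
  set z : ι → ℂ := fun v => (ω v : ℂ) * (ee (-(c v).a) θ * (c v).th X θ) with hz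
  have e0 : ‖Psi c ω X θ‖^2 = (∑ p : ι × ι, z p.1 * starRingEnd ℂ (z p.2)).re := by
    have : ∑ p : ι × ι, z p.1 * starRingEnd ℂ (z p.2) = Psi c ω X θ * starRingEnd ℂ (Psi c ω X θ) := by
      unfold Psi; rw [map_sum, sum_mul_sum, Fintype.sum_prod_type]
    rw [this, Complex.mul_conj, ofReal_re, Complex.normSq_eq_norm_sq]
  rw [e0, ← sum_filter_add_sum_filter_not univ (fun p : ι × ι => (c p.1).a ≠ (c p.2).a), add_re]
  have ez : ∀ p : ι × ι, z p.1 * starRingEnd ℂ (z p.2) = ((ω p.1 * ω p.2 : ℝ):ℂ) *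
      (ee (-((c p.1).a - (c p.2).a)) θ * ((c p.1).th X θ * starRingEnd ℂ ((c p.2).th X θ))) := by
    intro p
    have : ee (-((c p.1).a - (c p.2).a)) θ = ee (-(c p.1).a) θ * starRingEnd ℂ (ee (-(c p.2).a) θ) := by
      unfold ee
      rw [← Complex.exp_conj, ← Complex.exp_add]
      congr 1
      simp only [map_mul, conj_I, conj_ofReal, map_ofNat, map_intCast]
      push_cast; ring
    rw [this]; simp only [hz, map_mul, conj_ofReal]; push_cast; ring
  refine add_le_add (le_of_eq (by simp only [ez])) ◌
  simp only [not_not]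
  set S := (univ : Finset (ι × ι)).filter (fun p => (c p.1).a = (c p.2).a) with hS
  have nz : ∀ v, ‖z v‖ = |ω v| * ‖(c v).th X θ‖ := fun v => by
    simp only [hz, norm_mul, norm_ee, one_mul, norm_real, Real.norm_eq_abs]
  have h1 : (∑ p ∈ S, z p.1 * starRingEnd ℂ (z p.2)).re ≤ ∑ p ∈ S, (‖z p.1‖^2/2 + ‖z p.2‖^2/2) := by
    rw [re_sum]
    refine sum_le_sum fun p _ => (re_le_norm _).trans ◌
    rw [norm_mul, RCLike.norm_conj]
    linarith [sq_nonneg (‖z p.1‖ - ‖z p.2‖)]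
  have h2 : ∑ p ∈ S, ‖z p.2‖^2/2 = ∑ p ∈ S, ‖z p.1‖^2/2 := by
    refine sum_nbij' Prod.swap Prod.swap ◌ ◌ ◌ ◌ ◌ <;> simp [hS, eq_comm]
  rw [sum_add_distrib, h2, ← sum_add_distrib] at h1
  refine h1.trans (le_of_eq (sum_congr rfl fun p _ => ◌))
  rw [nz, mul_pow, sq_abs]; ring

theorem second_moment (hω : ∀ v, 0 ≤ ω v) (Q : ℕ) (hQ : 0 < Q) :
    ∫ θ in Set.Icc §0 1, ‖Psi c ω (§Q^2) θ‖^2 ≤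
      2 * (∑ p ∈ (univ : Finset (ι × ι)).filter (fun p => (c p.1).a ≠ (c p.2).a), ω p.1 * ω p.2 * (c p.1).cross Q (c p.2)) +
      54 * ∑ p ∈ (univ : Finset (ι × ι)).filter (fun p => (c p.1).a = (c p.2).a), ω p.1^2 * ∫ θ in Set.Icc §0 1, ‖(c p.1).th (§Q^2) θ‖^2 := by
  set X : ℝ := §Q^2 with hX
  have hX0 : 0 < X := by positivity
  have tc := fun v => (c v).thc X hX0
  have tp : ∀ v θ, (c v).th X (θ+1) = (c v).th X θ := fun v θ => th_per _ _ _ _ _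
  have hP := Psi_cont c ω X hX0
  refine (farey_lower Q hQ (fun θ => ‖Psi c ω X θ‖^2) (by fun_prop) (fun _ => by positivity) (fun θ => by simp only [Psi, tp, ee_per])).trans ◌
  set H : ι × ι → ℝ → ℂ := fun p θ => ((ω p.1 * ω p.2 : ℝ):ℂ) *
      (ee (-((c p.1).a - (c p.2).a)) θ * ((c p.1).th X θ * starRingEnd ℂ ((c p.2).th X θ))) with hH
  have hHc : ∀ p, Continuous (H p) := fun p => continuous_const.mul ((ee_cont _).mul ((tc _).mul (Complex.continuous_conj.comp (tc _))))
  set S := (univ : Finset (ι × ι)).filter (fun p => (c p.1).a = (c p.2).a) with hS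
  set S' := (univ : Finset (ι × ι)).filter (fun p => (c p.1).a ≠ (c p.2).a) with hS'
  set G : ℝ → ℝ := fun θ => ∑ p ∈ S, ω p.1^2 * ‖(c p.1).th X θ‖^2 with hG
  have hGc : Continuous G := continuous_finsetSum _ fun p _ => continuous_const.mul ((tc _).norm.pow 2)
  have hSc : Continuous fun θ => ∑ p ∈ S', H p θ := continuous_finsetSum _ fun p _ => hHc p
  have io : ∀ (t : ℕ × ℕ) {E : Type} [NormedAddCommGroup E] {g : ℝ → E}, Continuous g → IntegrableOn g (arc Q t 0) := fun t _ _ g hg => hg.continuousOn.integrableOn_Icc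
  have h1 : ∑ t ∈ farey Q, ∫ θ in arc Q t 0, ‖Psi c ω X θ‖^2 ≤ (∑ p ∈ S', ∑ t ∈ farey Q, ∫ θ in arc Q t 0, H p θ).re + ∑ t ∈ farey Q, ∫ θ in arc Q t 0, G θ := by
    rw [sum_comm, re_sum, ← sum_add_distrib]
    refine sum_le_sum fun t _ => ◌
    rw [← integral_finsetSum _ (fun p _ => io t (hHc p))]
    have := integral_re (𝕜 := ℂ) (io t hSc)
    rw [show (∫ θ in arc Q t 0, ∑ p ∈ S', H p θ).re = ∫ θ in arc Q t 0, (∑ p ∈ S', H p θ).re from this.symm]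
    rw [← integral_add (f := fun θ => (∑ p ∈ S', H p θ).re) (io t (Complex.continuous_re.comp hSc)) (io t hGc)]
    exact integral_mono (io t (by fun_prop)) (io t ((Complex.continuous_re.comp hSc).add hGc)) (fun θ => Psi_pt c ω X θ)
  have h2 : (∑ p ∈ S', ∑ t ∈ farey Q, ∫ θ in arc Q t 0, H p θ).re ≤ ∑ p ∈ S', ω p.1 * ω p.2 * (c p.1).cross Q (c p.2) := by
    refine (re_le_norm _).trans ((norm_sum_le _ _).trans (le_of_eq (sum_congr rfl fun p _ => ◌)))
    simp only [hH, integral_const_mul, ← mul_sum]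
    rw [norm_mul, norm_real, Real.norm_of_nonneg (mul_nonneg (hω _) (hω _))]
    rfl
  have h3 := farey_upper Q hQ G hGc (fun θ => sum_nonneg fun p _ => by positivity) (fun θ => by simp only [hG, tp])
  have h4 : ∫ θ in Set.Icc §0 1, G θ = ∑ p ∈ S, ω p.1^2 * ∫ θ in Set.Icc §0 1, ‖(c p.1).th X θ‖^2 := by
    simp only [hG]
    rw [integral_finsetSum (f := fun (p : ι × ι) (θ : ℝ) => ω p.1^2 * ‖(c p.1).th X θ‖^2) _ (fun p _ => (Continuous.continuousOn (by have := tc p.1; fun_prop)).integrableOn_Icc)]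
    simp only [integral_const_mul]
  rw [h4] at h3
  linarith

/-- Cauchy–Schwarz -/
theorem cs_bound (hω : ∀ v, 0 ≤ ω v) (X : ℝ) (hX : 0 < X) (E : Finset (ι × (ℤ × ℤ))) (N : Finset ℤ)
    (hE : ∀ i ∈ E, (c i.1).f i.2 - (c i.1).a ∈ N) (hf : ∀ i ∈ E, ((c i.1).f i.2 : ℝ) ≤ 2 * X) :
    (∑ i ∈ E, ω i.1)^2 ≤ N.card * (Real.exp (8*π) * ∫ θ in Set.Icc §0 1, ‖Psi c ω X θ‖^2) := by
  classical
  set w : ι × (ℤ × ℤ) → ℝ := fun i => ω i.1 * Real.exp (-2 * π / X * ((c i.1).f i.2 : ℤ)) with hw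
  set n : ι × (ℤ × ℤ) → ℤ := fun i => (c i.1).f i.2 - (c i.1).a with hn
  have hw0 : ∀ i, 0 ≤ w i := fun i => mul_nonneg (hω _) (Real.exp_pos _).le
  have hsv := fun v => th_wsum _ _ _ (c v).a (c v).hA (c v).ha (c v).hd X hX
  have hws : Summable w := by
    rw [summable_prod_of_nonneg hw0]
    exact ⟨fun v => Summable.mul_left (ω v) (f := fun u : ℤ × ℤ => Real.exp (-2 * π / X * ((c v).f u : ℤ))) (hsv v), Summable.of_finite⟩
  have hP : ∀ θ, Psi c ω X θ = ∑' i, (w i : ℂ) * ee (n i) θ := by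
    intro θ
    have hs : Summable fun i => (w i : ℂ) * ee (n i) θ := by
      refine Summable.of_norm (hws.congr fun i => ◌)
      rw [norm_mul, norm_ee, mul_one, norm_real, Real.norm_of_nonneg (hw0 i)]
    rw [hs.tsum_prod, tsum_fintype]
    unfold Psi
    refine sum_congr rfl fun v _ => ◌
    rw [Circ.th, th_eq, ← tsum_mul_left, ← tsum_mul_left]
    refine tsum_congr fun u => ◌
    simp only [hw, hn]
    have : ee ((c v).f u - (c v).a) θ = ee (-(c v).a) θ * ee ((c v).f u) θ := by
      unfold ee; rw [← Complex.exp_add]; congr 1; push_cast; ring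
    rw [this]; simp only [Circ.f]; push_cast; ring
  have hpar := parseval w hws hw0 n
  simp only [← hP] at hpar
  have h1 := sum_le_hasSum (E ×ˢ E) (fun p _ => by split_ifs; exacts [mul_nonneg (hw0 _) (hw0 _), le_rfl]) hpar
  have hwl : ∀ i ∈ E, ω i.1 ≤ Real.exp (4*π) * w i := by
    intro i hi
    simp only [hw]
    rw [mul_left_comm, ← Real.exp_add]
    refine le_mul_of_one_le_right (hω _) (Real.one_le_exp ◌)
    have := hf i hi
    have h2 : 2 * π / X * ((c i.1).f i.2:ℝ) ≤ 2 * π / X * (2*X) := by gcongr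
    rw [show 2 * π / X * (2*X) = 4*π by field_simp; ring] at h2
    rw [show -2 * π / X * ((c i.1).f i.2:ℝ) = -(2 * π / X * ((c i.1).f i.2:ℝ)) by ring]
    linarith
  have h2 : ∑ k ∈ N, (∑ i ∈ E with n i = k, ω i.1)^2 ≤ Real.exp (8*π) * ∑ p ∈ E ×ˢ E, if n p.1 = n p.2 then w p.1 * w p.2 else 0 := by
    have e : ∀ k, (∑ i ∈ E with n i = k, ω i.1)^2 = ∑ p ∈ E ×ˢ E, if n p.1 = k ∧ n p.2 = k then ω p.1.1 * ω p.2.1 else 0 := by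
      intro k
      rw [sq, sum_mul_sum, ← sum_product', ← filter_product, sum_filter]
    simp only [e]
    rw [sum_comm, mul_sum]
    refine sum_le_sum fun p hp => ◌
    rw [mem_product] at hp
    by_cases hpp : n p.1 = n p.2
    · rw [if_pos hpp, sum_eq_single (n p.1)]
      · rw [if_pos ⟨rfl, hpp.symm⟩, show 8*π = 4*π+4*π by ring, Real.exp_add]
        calc _ ≤ (Real.exp (4*π) * w p.1) * (Real.exp (4*π) * w p.2) :=
              mul_le_mul (hwl _ hp.1) (hwl _ hp.2) (hω _) (mul_nonneg (Real.exp_pos _).le (hw0 _))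
          _ = _ := by ring
      · intro k _ hk; rw [if_neg]; rintro ⟨h, -⟩; exact hk h.symm
      · intro h; exact absurd (hE _ hp.1) h
    · rw [if_neg hpp, sum_eq_zero]; · simp
      intro k _; rw [if_neg]; rintro ⟨h, h'⟩; exact hpp (h.trans h'.symm)
  have h3 : ∑ i ∈ E, ω i.1 = ∑ k ∈ N, ∑ i ∈ E with n i = k, ω i.1 := (sum_fiberwise_of_maps_to hE _).symm
  rw [h3]
  refine (sq_sum_le_card_mul_sum_sq).trans ◌
  refine mul_le_mul_of_nonneg_left (h2.trans (mul_le_mul_of_nonneg_left h1 (Real.exp_pos _).le)) ¶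
end
end

section
open Finset Real

theorem euler_bound (F : ℕ → ℝ) (h0 : ∀ n, 0 ≤ F n) (h1 : F 1 ≤ 1) (hm : ∀ m n : ℕ, m.Coprime n → F (m*n) ≤ F m * F n) (N : ℕ) :
    ∑ n ∈ Icc 1 N, F n ≤ ∏ p ∈ (range (N+1)).filter Nat.Prime, (1 + ∑ i ∈ Icc 1 N, F (p^i)) := by
  have hdec : ∀ k : ℕ, DecidablePred fun n : ℕ => ∀ p, p.Prime → p ∣ n → p < k := fun k => Classical.decPred _
  have key : ∀ k : ℕ, ∑ n ∈ (Icc 1 N).filter (fun n => ∀ p, p.Prime → p ∣ n → p < k), F n ≤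
      ∏ p ∈ (range k).filter Nat.Prime, (1 + ∑ i ∈ Icc 1 N, F (p^i)) := by
    intro k
    induction k with
    | zero =>
      simp only [range_zero, filter_empty, prod_empty]
      refine (sum_le_sum_of_subset_of_nonneg (t := {1}) ◌ fun _ _ _ => h0 _).trans (by simpa using h1)
      intro n hn
      rw [mem_filter] at hn
      rw [mem_singleton]
      by_contra h
      obtain ⟨p, hp, hpn⟩ := Nat.exists_prime_and_dvd h
      exact absurd (hn.2 p hp hpn) ¢
    | succ k ih =>
      by_cases hk : k.Prime
      · rw [range_add_one, filter_insert, if_pos hk, prod_insert (by simp)]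
        refine le_trans ◌ (mul_le_mul_of_nonneg_left ih (by have := sum_nonneg (s := Icc 1 N) fun i _ => h0 (k^i); linarith))
        have e : (1 + ∑ i ∈ Icc 1 N, F (k^i)) ≥ F 1 + ∑ i ∈ Icc 1 N, F (k^i) := by linarith
        have e2 : F 1 + ∑ i ∈ Icc 1 N, F (k^i) = ∑ i ∈ range (N+1), F (k^i) := by
          rw [sum_range_eq_add_Ico _ (Nat.succ_pos N), pow_zero]; rfl
        rw [e2] at e
        set S := (Icc 1 N).filter (fun n => ∀ p, p.Prime → p ∣ n → p < k) with hS
        refine le_trans ◌ (mul_le_mul_of_nonneg_right e (sum_nonneg fun i _ => h0 _))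
        rw [sum_mul_sum, ← sum_product']
        set T := (Icc 1 N).filter (fun n => ∀ p, p.Prime → p ∣ n → p < k+1) with hT
        have hle : ∀ n ∈ T, F n ≤ F (k^(n.factorization k)) * F (n / k^(n.factorization k)) := by
          intro n hn
          rw [hT, mem_filter, mem_Icc] at hn
          have hc : (k^(n.factorization k)).Coprime (n / k^(n.factorization k)) :=
            Nat.Coprime.pow_left _ (Nat.coprime_ordCompl hk ¢)
          have := hm _ _ hc
          rwa [Nat.ordProj_mul_ordCompl_eq_self] at this
        refine (sum_le_sum hle).trans ◌
        have hinj : Set.InjOn (fun n : ℕ => (n.factorization k, n / k^(n.factorization k))) (T : Set ℕ) := by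
          intro m _ n _ hmn
          simp only [Prod.mk.injEq] at hmn
          rw [← Nat.ordProj_mul_ordCompl_eq_self m k, ← Nat.ordProj_mul_ordCompl_eq_self n k, hmn.2, hmn.1]
        rw [← sum_image (f := fun x : ℕ × ℕ => F (k^x.1) * F x.2) hinj]
        refine sum_le_sum_of_subset_of_nonneg ◌ fun _ _ _ => mul_nonneg (h0 _) (h0 _)
        intro x hx
        obtain ⟨n, hn, rfl⟩ := mem_image.1 hx
        rw [hT, mem_filter, mem_Icc] at hn
        have hn0 : n ≠ 0 := by omega
        rw [mem_product, mem_range, hS, mem_filter, mem_Icc]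
        refine ⟨◌, ⟨Nat.ordCompl_pos k hn0, (Nat.ordCompl_le n k).trans hn.1.2⟩, ◌⟩
        · have := Nat.factorization_lt k hn0; simp only; omega
        · intro p hp hpn
          have h3 := hn.2 p hp (hpn.trans (Nat.ordCompl_dvd n k))
          rcases Nat.lt_succ_iff_lt_or_eq.1 h3 with h | rfl
          · exact h
          · exact absurd hpn (Nat.not_dvd_ordCompl hp hn0)
      · rw [range_add_one, filter_insert, if_neg hk]
        refine le_trans (le_of_eq ◌) ih
        congr 1
        ext n
        simp only [mem_filter, and_congr_right_iff]
        intro _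
        refine forall_congr' fun p => forall_congr' fun hp => forall_congr' fun _ => ◌
        have : p ≠ k := fun h => hk (h ▸ hp)
        omega
  refine le_trans (le_of_eq ◌) (key (N+1))
  congr 1
  ext n
  simp only [mem_filter, mem_Icc]
  exact ⟨fun h => ⟨h, fun p _ hd => Nat.lt_succ_of_le ((Nat.le_of_dvd ¢ hd).trans h.2)⟩, fun h => h.1⟩

theorem euler_exp (F : ℕ → ℝ) (h0 : ∀ n, 0 ≤ F n) (h1 : F 1 ≤ 1) (hm : ∀ m n : ℕ, m.Coprime n → F (m*n) ≤ F m * F n) (N : ℕ)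
    (E : ℕ → ℝ) (hE : ∀ p, p.Prime → ∑ i ∈ Icc 1 N, F (p^i) ≤ E p) :
    ∑ n ∈ Icc 1 N, F n ≤ exp (∑ p ∈ (range (N+1)).filter Nat.Prime, E p) := by
  refine (euler_bound F h0 h1 hm N).trans ◌
  rw [exp_sum]
  refine prod_le_prod (fun p _ => by have := sum_nonneg (s := Icc 1 N) fun i _ => h0 (p^i); linarith) fun p hp => ◌
  have := hE p (mem_filter.1 hp).2
  have := add_one_le_exp (E p)
  linarith

/-- products over finite sets of primes with small exceptional set -/
theorem prod_small (S : Finset ℕ) (g : ℕ → ℝ) (M : ℝ) (P : ℕ) (hM : 1 ≤ M) (h0 : ∀ p ∈ S, 0 ≤ g p) (h1 : ∀ p ∈ S, P ≤ p → g p ≤ 1)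
    (h2 : ∀ p ∈ S, p < P → g p ≤ M) : ∏ p ∈ S, g p ≤ M^P := by
  calc ∏ p ∈ S, g p ≤ ∏ p ∈ S, (if p < P then M else 1) := prod_le_prod h0 fun p hp => by
        split_ifs with h
        · exact h2 p hp h
        · exact h1 p hp (not_lt.1 h)
    _ = M^(S.filter (· < P)).card := by rw [prod_ite]; simp
    _ ≤ M^P := pow_le_pow_right₀ hM (by
        calc _ ≤ (range P).card := card_le_card fun p hp => by simpa using (mem_filter.1 hp).2
          _ = P := card_range P)

theorem div_bound (ε : ℝ) (hε : 0 < ε) : ∃ C : ℝ, 1 ≤ C ∧ ∀ n : ℕ, n ≠ 0 → §n.divisors.card ≤ C * §n^ε := by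
  have hl := log_pos (one_lt_two)
  set M : ℝ := 1 + 1/(ε * log 2) with hM
  have hM1 : 1 ≤ M := by have : 0 < 1/(ε * log 2) := by positivity
                         linarith
  obtain ⟨P, hP⟩ := exists_nat_ge (§2^(1/ε))
  refine ⟨M^P, one_le_pow₀ hM1, fun n hn => ◌⟩
  have hn0 : §0 < n := mod_cast Nat.pos_of_ne_zero hn
  rw [← div_le_iff₀ ¶]
  have e1 : §n^ε = ∏ p ∈ n.primeFactors, (§p^(n.factorization p))^ε := by
    rw [finsetProd_rpow _ _ fun i _ => by positivity]
    congr 1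
    conv_lhs => rw [← Nat.prod_factorization_pow_eq_self hn]
    rw [Finsupp.prod, Nat.support_factorization]; push_cast; rfl
  rw [Nat.card_divisors hn, e1]
  push_cast
  rw [← prod_div_distrib]
  have hpp : ∀ p ∈ n.primeFactors, §2 ≤ p := fun p hp => by exact_mod_cast (Nat.prime_of_mem_primeFactors hp).two_le
  refine prod_small _ _ M P hM1 (fun p hp => by have := hpp p hp; positivity) (fun p hp hPp => ◌) (fun p hp _ => ◌)
  · have h2 := hpp p hp
    rw [div_le_one ¶]
    have h3 : §2 ≤ §p^ε := by
      calc §2 = (§2^(1/ε))^ε := by rw [← rpow_mul ¤]; field_simp; simp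
        _ ≤ §p^ε := by gcongr; exact hP.trans (by exact_mod_cast hPp)
    rw [← rpow_natCast, ← rpow_mul ¶, mul_comm, rpow_mul ¶, rpow_natCast]
    calc ((n.factorization p : ℝ) + 1) ≤ 2^(n.factorization p) := mod_cast Nat.lt_two_pow_self
      _ ≤ _ := by gcongr
  · have h2 := hpp p hp
    rw [div_le_iff₀ ¶]
    set v := n.factorization p
    have h3 : 1 + ε * log 2 * v ≤ (§p^v)^ε := by
      calc _ ≤ exp (ε * log 2 * v) := by linarith [add_one_le_exp (ε * log 2 * v)]
        _ = (§2^v)^ε := by rw [← rpow_natCast, ← rpow_mul ¤, rpow_def_of_pos ¤]; ring_nf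
        _ ≤ _ := by gcongr
    have : M * (1 + ε * log 2 * v) ≥ v + 1 := by
      have e : M * (1 + ε * log 2 * v) = 1 + v + (1/(ε * log 2) + ε * log 2 * v) := by rw [hM]; field_simp; ring
      have : 0 ≤ 1/(ε * log 2) + ε * log 2 * v := by positivity
      linarith
    nlinarith
end

section
open Finset Real

theorem geo_le (r : ℝ) (h0 : 0 ≤ r) (h1 : r ≤ 3/4) (k N : ℕ) : ∑ i ∈ Icc k N, r^i ≤ 4 * r^k := by
  have h2 : ∑ i ∈ Icc k N, r^i ≤ ∑ i ∈ range (N+1), r^k * r^i := by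
    have hinj : Set.InjOn (fun i => i - k) (Icc k N : Set ℕ) := by
      intro i hi j hj h
      simp only [coe_Icc, Set.mem_Icc] at hi hj h; omega
    have e : ∑ i ∈ Icc k N, r^i = ∑ i ∈ Icc k N, r^k * r^(i-k) := sum_congr rfl fun i hi => by
      rw [mem_Icc] at hi; rw [← pow_add]; congr 1; omega
    rw [e, ← sum_image (f := fun i => r^k * r^i) hinj]
    refine sum_le_sum_of_subset_of_nonneg ◌ fun _ _ _ => by positivity
    intro x hx
    obtain ⟨i, hi, rfl⟩ := mem_image.1 hx
    rw [mem_Icc] at hi; rw [mem_range]; omega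
  refine h2.trans ◌
  rw [← mul_sum, mul_comm]
  gcongr
  have h3 := (summable_geometric_of_lt_one h0 £).sum_le_tsum (range (N+1)) (fun _ _ => by positivity)
  rw [tsum_geometric_of_lt_one h0 £] at h3
  refine h3.trans ◌
  rw [inv_le_comm₀ £ ¤]; linarith

theorem rp_le (p : ℕ) (hp : p.Prime) (s : ℝ) (hs : 1/2 ≤ s) : §p^(-s) ≤ 3/4 := by
  have h2 : §2 ≤ p := mod_cast hp.two_le
  calc §p^(-s) ≤ §p^½ := rpow_le_rpow_of_exponent_le £ £
    _ ≤ §2^½ := rpow_le_rpow_of_nonpos ¤ h2 ¤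
    _ ≤ 3/4 := by
      rw [rpow_neg ¤, inv_le_comm₀ ¶ ¤, ← sqrt_eq_rpow]
      refine le_sqrt_of_sq_le ¤

def exc (Z q : ℕ) : Prop := ∀ l : ℕ, l.Prime → Z < l → l ∣ q → l^2 ∣ q

theorem exc_mul (Z m n : ℕ) (h : m.Coprime n) (he : exc Z (m*n)) : exc Z m := by
  intro l hl hZ hd
  have := he l hl hZ (hd.mul_right n)
  refine Nat.Coprime.dvd_of_dvd_mul_right ◌ this
  exact Nat.Coprime.pow_left _ (h.coprime_dvd_left hd)

open Classical in
theorem exc_rankin (Z Q : ℕ) (σ : ℝ) (hσ : 3/4 ≤ σ) : (((Icc 1 Q).filter (exc Z)).card : ℝ) ≤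
    §Q^σ * exp (4 * ∑ p ∈ Icc 1 Z, §p^(-σ) + 4 * ∑' p : ℕ, §p^(-(3/2):ℝ)) := by
  set F : ℕ → ℝ := fun n => if exc Z n then §n^(-σ) else 0 with hF
  have h0 : ∀ n, 0 ≤ F n := fun n => by simp only [hF]; split_ifs <;> positivity
  have hs : Summable fun p : ℕ => §p^(-(3/2):ℝ) := summable_nat_rpow.2 ¤
  have hE := euler_exp F h0 (by simp only [hF]; split_ifs <;> simp) (fun m n h => by
    simp only [hF]
    by_cases he : exc Z (m*n)
    · rw [if_pos he, if_pos (exc_mul Z m n h he), if_pos (exc_mul Z n m h.symm (by rwa [mul_comm])), Nat.cast_mul, mul_rpow ¶ ¶]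
    · rw [if_neg he]; exact mul_nonneg (h0 m) (h0 n)) Q (fun p => (if p ≤ Z then 4*§p^(-σ) else 0) + 4*§p^(-(3/2):ℝ)) (fun p hp => by
    have hr := rp_le p hp σ £
    have hp0 : §0 < p := mod_cast hp.pos
    have hp1 : §1 ≤ p := mod_cast hp.one_le
    have hFp : ∀ i, F (p^i) ≤ (§p^(-σ))^i := fun i => by
      simp only [hF]
      split_ifs
      · rw [← rpow_natCast, ← rpow_mul hp0.le, Nat.cast_pow, ← rpow_natCast, ← rpow_mul hp0.le, mul_comm]
      · positivity
    by_cases hpZ : p ≤ Z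
    · rw [if_pos hpZ]
      have := (sum_le_sum fun i _ => hFp i).trans (geo_le _ ¶ hr 1 Q)
      rw [pow_one] at this
      have : 0 ≤ 4*§p^(-(3/2):ℝ) := by positivity
      linarith
    · rw [if_neg hpZ, zero_add]
      have h2 : ∑ i ∈ Icc 1 Q, F (p^i) ≤ ∑ i ∈ Icc 2 Q, (§p^(-σ))^i := by
        refine le_trans (le_of_eq (Eq.symm ◌)) (sum_le_sum fun i _ => hFp i)
        refine sum_subset (Finset.Icc_subset_Icc_left ¤) fun i hi hi2 => ◌
        have : i = 1 := by rw [mem_Icc] at hi hi2; omega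
        rw [this, pow_one]
        simp only [hF]
        rw [if_neg]
        intro he
        have := Nat.le_of_dvd hp.pos (he p hp ¢ dvd_rfl)
        nlinarith [hp.two_le]
      refine h2.trans ((geo_le _ ¶ hr 2 Q).trans ◌)
      rw [← rpow_natCast, ← rpow_mul hp0.le]
      refine mul_le_mul_of_nonneg_left (rpow_le_rpow_of_exponent_le hp1 ◌) ¤
      push_cast; linarith)
  calc (((Icc 1 Q).filter (exc Z)).card : ℝ) = ∑ n ∈ (Icc 1 Q).filter (exc Z), 1 := by simp
    _ ≤ ∑ n ∈ (Icc 1 Q).filter (exc Z), §Q^σ * F n := by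
        refine sum_le_sum fun n hn => ◌
        rw [mem_filter, mem_Icc] at hn
        have hn0 : §0 < n := mod_cast hn.1.1
        simp only [hF]
        rw [if_pos hn.2, rpow_neg hn0.le, ← div_eq_mul_inv, one_le_div ¶]
        gcongr; exact_mod_cast hn.1.2
    _ ≤ ∑ n ∈ Icc 1 Q, §Q^σ * F n := sum_le_sum_of_subset_of_nonneg (filter_subset _ _) fun n _ _ => mul_nonneg ¶ (h0 n)
    _ = §Q^σ * ∑ n ∈ Icc 1 Q, F n := by rw [mul_sum]
    _ ≤ _ := by
      gcongr
      refine hE.trans (exp_le_exp.2 ◌)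
      rw [sum_add_distrib, ← mul_sum]
      refine add_le_add ◌ (mul_le_mul_of_nonneg_left (hs.sum_le_tsum _ fun _ _ => by positivity) ¤)
      rw [mul_sum, ← sum_filter]
      refine sum_le_sum_of_subset_of_nonneg ◌ fun _ _ _ => by positivity
      intro p hp
      rw [mem_filter, mem_filter] at hp
      rw [mem_Icc]; exact ⟨hp.1.2.one_le, hp.2⟩

open Classical in
theorem exc_small (m M : ℕ) (hm : 2 ≤ m) : ∃ Q0 : ℕ, ∀ Q ≥ Q0, (((Icc 1 Q).filter (exc ⌊log Q^m⌋₊)).card : ℝ) ≤ Q / log Q^M := by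
  set C0 := 4 * ∑' p : ℕ, §p^(-(3/2):ℝ) with hC0
  have hC00 : 0 ≤ C0 := mul_nonneg ¤ (tsum_nonneg fun _ => by positivity)
  have hm0 : §2 ≤ m := mod_cast hm
  have ev1 : ∀ᶠ L : ℝ in Filter.atTop, log L ≤ L^(1/4:ℝ) := by
    filter_upwards [(isLittleO_log_rpow_atTop (r := 1/4) ¤).bound one_pos, Filter.eventually_ge_atTop 1] with L h h1
    rw [one_mul, norm_of_nonneg (log_nonneg h1), norm_of_nonneg ¶] at h
    exact h
  have ev2 := (tendsto_rpow_atTop (y := (1/4:ℝ)) ¤).eventually_ge_atTop (2*m*(4 + 4*m + C0 + M))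
  have hL : Filter.Tendsto (fun Q : ℕ => log Q) Filter.atTop Filter.atTop := tendsto_log_atTop.comp tendsto_natCast_atTop_atTop
  obtain ⟨Q0, hQ0⟩ := Filter.eventually_atTop.1 (((hL.eventually (ev1.and ev2)).and (hL.eventually_ge_atTop 1)).and (Filter.eventually_ge_atTop 1))
  refine ⟨Q0, fun Q hQ => ◌⟩
  obtain ⟨⟨⟨h1, h2⟩, hL1⟩, hQ1⟩ := hQ0 Q hQ
  have hQr : §0 < Q := mod_cast hQ1
  set L := log Q with hLd
  have hL0 : 0 < L := by linarith
  set Z := ⌊L^m⌋₊ with hZ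
  have hZL : §Z ≤ L^m := Nat.floor_le ¶
  have hZ1 : 1 ≤ Z := Nat.le_floor (by simpa using one_le_pow₀ hL1)
  have hi : (1/(2*m):ℝ) ≤ 1/4 := by rw [div_le_div_iff₀ ¶ ¤]; linarith
  refine (exc_rankin Z Q (1-1/(2*m)) £).trans ◌
  have hsum : ∑ p ∈ Icc 1 Z, §p^(-(1-1/(2*m)):ℝ) ≤ L^(1/2:ℝ) * (1 + m * log L) := by
    have hh : ∑ p ∈ Icc 1 Z, §p^(-(1-1/(2*m)):ℝ) ≤ ∑ p ∈ Icc 1 Z, L^(1/2:ℝ) * (p:ℝ)⁻¹ := by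
      refine sum_le_sum fun p hp => ◌
      rw [mem_Icc] at hp
      have hp0 : §0 < p := mod_cast hp.1
      rw [show (-(1-1/(2*m)):ℝ) = 1/(2*m) + -1 by ring, rpow_add hp0, rpow_neg_one]
      gcongr
      calc §p^(1/(2*m):ℝ) ≤ (L^m)^(1/(2*m):ℝ) := by gcongr; exact le_trans (by exact_mod_cast hp.2) hZL
        _ = L^(1/2:ℝ) := by rw [← rpow_natCast, ← rpow_mul hL0.le]; congr 1; field_simp
    refine hh.trans ◌
    rw [← mul_sum]
    gcongr
    have := harmonic_le_one_add_log Z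
    rw [harmonic_eq_sum_Icc] at this
    push_cast at this
    refine this.trans ◌
    gcongr
    calc log Z ≤ log (L^m) := log_le_log (by exact_mod_cast hZ1) hZL
      _ = _ := by rw [log_pow]
  have hQs : §Q^(1-1/(2*m):ℝ) = Q * exp (-(L/(2*m))) := by
    rw [sub_eq_add_neg, rpow_add hQr, rpow_one, rpow_def_of_pos hQr]
    congr 2; rw [← hLd]; ring
  have hLM : L^M = exp (M * log L) := by rw [mul_comm, ← rpow_natCast, rpow_def_of_pos hL0]
  rw [hQs, hLM, div_eq_mul_inv §Q, ← exp_neg, mul_assoc, ← exp_add]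
  gcongr
  set y := L^(1/4:ℝ) with hy
  have hy1 : 1 ≤ y := one_le_rpow hL1 ¤
  have e2 : L^(1/2:ℝ) = y^2 := by rw [hy, ← rpow_natCast, ← rpow_mul hL0.le]; norm_num
  have e4 : L = y^4 := by rw [hy, ← rpow_natCast, ← rpow_mul hL0.le]; norm_num
  rw [e2] at hsum
  have hlog : 0 ≤ log L := log_nonneg hL1
  have h5 : y^2 * (1 + m * log L) ≤ y^2 + m * y^3 := by
    have : y^2 * (m * log L) ≤ y^2 * (m*y) := by gcongr
    linarith
  have h6 : (4 + 4*m + C0 + M) * y^3 ≤ L/(2*m) := by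
    rw [le_div_iff₀ ¶, e4]
    have := mul_le_mul_of_nonneg_right h2 (pow_nonneg (zero_le_one.trans hy1) 3)
    linarith
  have h7 : y^2 ≤ y^3 := pow_le_pow_right₀ hy1 ¤
  have h8 : 1 ≤ y^3 := one_le_pow₀ hy1
  have h9 : y ≤ y^3 := le_self_pow₀ hy1 ¤
  have h10 : C0 ≤ C0 * y^3 := le_mul_of_one_le_right hC00 h8
  have h11 : M * log L ≤ M * y^3 := by gcongr; exact h1.trans h9
  linarith
end

section
open Finset Real

theorem Circ.hC (c : Circ) : 0 < c.C := by
  by_contra h0; nlinarith [sq_nonneg c.B, pow_pos c.ha 2, not_lt.1 h0, c.hd, c.hA]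

theorem Circ.a_le (c : Circ) : c.a ≤ c.A + c.C := by
  have := c.hd; have := c.hA; have := c.hC; have := c.ha
  nlinarith [sq_nonneg c.B]

theorem not_dvd_of_lt (l : ℕ) (Z : ℕ) (hl : Z < l) (x : ℤ) (hx : x ≠ 0) (hZ : |x| ≤ Z) : ¬ ¥l ∣ x := by
  intro h
  have := Int.le_of_dvd (abs_pos.2 hx) ((dvd_abs _ _).2 h)
  omega

open Classical in
theorem cross_le (c c' : Circ) (hne : c.a ≠ c'.a) (Q Z : ℕ) (T : ℝ) (hT1 : 1 ≤ T) (hT : §c.A + c.C ≤ T) (hT' : §c'.A + c'.C ≤ T)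
    (hZ2 : 2 ≤ Z) (hZ : T ≤ Z) : c.cross Q c' ≤ π * §Q^2 / 4 / (c.a * c'.a) * ∑ q ∈ Icc 1 Q, FF (c.pd c') q +
      2560 * T^8 * Q * (Q * §Z^¼ + ((Icc 1 Q).filter (exc Z)).card) := by
  have hZ0 : §0 < Z := mod_cast (by omega : 0 < Z)
  set U : ℕ → ℝ := fun q => 8 * T^4 * §Z^¼ + if exc Z q then 4 * T^4 else 0 with hUd
  have ha := c.ha; have ha' := c'.ha
  have har : §c.a ≤ T := le_trans (by exact_mod_cast c.a_le) hT
  have har' : §c'.a ≤ T := le_trans (by exact_mod_cast c'.a_le) hT'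
  have ha0 : §0 < c.a := mod_cast ha
  have ha0' : §0 < c'.a := mod_cast ha'
  have zz : ∀ x : ℤ, §x ≤ T → x ≤ Z := fun x hx => by exact_mod_cast hx.trans hZ
  have hS := zz (c.A + c.C) (by push_cast; exact hT)
  have hS' := zz (c'.A + c'.C) (by push_cast; exact hT')
  have h1 := c.hA; have h2 := c.hC; have h1' := c'.hA; have h2' := c'.hC; have h3 := c.a_le; have h3' := c'.a_le
  have haa : §c.a^2 * §c'.a^2 ≤ T^4 := by
    calc §c.a^2 * §c'.a^2 ≤ T^2 * T^2 := by gcongr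
      _ = T^4 := by ring
  have hp := pair_arcs (c.ok c') c.hA c'.hA Q T hT1 hT hT' U (by
    intro q hq u u'
    have hok : ((c.pd c').fr u u').OK c.a c'.a := ⟨c.hd, c'.hd, c.ha, c'.ha, c.pr, c'.pr⟩
    have hq0 : §0 < §q^3 := by have := Nat.pos_of_ne_zero hq.out; positivity
    by_cases he : exc Z q
    · have := UZ_triv q hok
      simp only [hUd]; rw [if_pos he]
      refine this.trans ◌
      gcongr
      have : 0 ≤ 8 * T^4 * §Z^¼ := by positivity
      linarith
    · simp only [hUd]; rw [if_neg he, add_zero]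
      unfold exc at he
      push Not at he
      obtain ⟨l, hl, hlZ, ⟨m, rfl⟩, hl2⟩ := he
      have hm : ¬ l ∣ m := fun h => hl2 (by rw [sq]; exact mul_dvd_mul_left l h)
      have : NeZero m := ⟨fun h => hq.out (by rw [h, mul_zero])⟩
      have : Fact l.Prime := ⟨hl⟩
      have := UZ_sav l m hok hm ¢ (not_dvd_of_lt l Z hlZ c.A ¢ (by rw [abs_of_pos h1]; omega))
        (not_dvd_of_lt l Z hlZ c'.A ¢ (by rw [abs_of_pos h1']; omega)) (not_dvd_of_lt l Z hlZ _ ¢ (by rw [abs_of_pos ha]; omega))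
        (not_dvd_of_lt l Z hlZ _ ¢ (by rw [abs_of_pos ha']; omega)) (not_dvd_of_lt l Z hlZ (c.a - c'.a) (sub_ne_zero.2 hne) (by rw [abs_le]; omega))
      refine this.trans ◌
      have hlr : §l^¼ ≤ §Z^¼ := rpow_le_rpow_of_nonpos hZ0 (by exact_mod_cast hlZ.le) ¤
      calc _ = 8 * (§c.a^2 * §c'.a^2) * §l^¼ * ((l*m:ℕ):ℝ)^3 := by ring
        _ ≤ _ := by gcongr)
  refine hp.trans (add_le_add le_rfl ◌)
  simp only [hUd]
  rw [sum_add_distrib, sum_const, Nat.card_Icc, ← sum_filter, sum_const, nsmul_eq_mul, nsmul_eq_mul]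
  have : 0 ≤ T^8 * Q * (((Icc 1 Q).filter (exc Z)).card : ℝ) := by positivity
  rw [show Q + 1 - 1 = Q by omega]
  linarith
end

section
open Finset Real

noncomputable def RR (n : ℕ) : ℝ := ∏ p ∈ n.primeFactors, (1 + §p^¼)
noncomputable def PP (n : ℕ) : ℝ := ∏ p ∈ n.primeFactors, (1 + 5 * §p^½)

theorem PP_pos (n : ℕ) : 0 < PP n := prod_pos fun p _ => by positivity

theorem PP_mul (m n : ℕ) (hm : m ≠ 0) (hn : n ≠ 0) : PP (m*n) ≤ PP m * PP n := by
  unfold PP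
  rw [Nat.primeFactors_mul hm hn, ← prod_union_inter]
  refine le_mul_of_one_le_right (prod_nonneg fun p _ => by positivity) ◌
  refine one_le_prod fun p _ => ◌
  have : §0 ≤ 5 * §p^½ := by positivity
  linarith

theorem PP_RR : ∃ C : ℝ, 1 ≤ C ∧ ∀ n, PP n^6 ≤ C * RR n := by
  obtain ⟨P, hP⟩ := exists_nat_ge (§100^4)
  refine ⟨(6^6)^P, one_le_pow₀ ¤, fun n => ◌⟩
  have hR : 0 < RR n := prod_pos fun p _ => by positivity
  rw [← div_le_iff₀ hR]
  unfold PP RR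
  rw [← prod_pow, ← prod_div_distrib]
  have key : ∀ p ∈ n.primeFactors, §p^½ = (§p^¼)^2 ∧ 0 ≤ §p^¼ ∧ §p^¼ ≤ 1 := by
    intro p hp
    have : §1 ≤ p := mod_cast (Nat.prime_of_mem_primeFactors hp).one_le
    refine ⟨◌, by positivity, rpow_le_one_of_one_le_of_nonpos this ¤⟩
    rw [← rpow_natCast, ← rpow_mul ¶]; norm_num
  refine prod_small _ _ _ P ¤ (fun p _ => by positivity) (fun p hp hPp => ◌) (fun p hp _ => ◌)
  · obtain ⟨e, h0, -⟩ := key p hp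
    have h1 : §p^¼ ≤ 1/100 := by
      calc §p^¼ ≤ (§100^4)^¼ := rpow_le_rpow_of_nonpos ¤ (hP.trans (by exact_mod_cast hPp)) ¤
        _ = 1/100 := by rw [← rpow_natCast, ← rpow_mul ¤]; norm_num [rpow_neg_one]
    rw [e, div_le_one ¶]
    set t := §p^¼
    have h2 : 5*t^2 ≤ t/20 := by nlinarith
    calc (1+5*t^2)^6 ≤ (1+t/20)^6 := by gcongr
      _ ≤ (exp (t/20))^6 := by gcongr; linarith [add_one_le_exp (t/20)]
      _ = exp (3*t/10) := by rw [← exp_nat_mul]; ring_nf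
      _ ≤ 1 + t := by
        have := exp_bound_div_one_sub_of_interval (x := 3*t/10) ¶ £
        refine this.trans ◌
        rw [div_le_iff₀ £]; linarith
  · obtain ⟨e, h0, h1⟩ := key p hp
    rw [e]
    set t := §p^¼
    refine (div_le_self ¶ £).trans ◌
    have : 1+5*t^2 ≤ 6 := by nlinarith
    gcongr

theorem six (x1 x2 x3 x4 x5 x6 : ℝ) (h1 : 0 ≤ x1) (h2 : 0 ≤ x2) (h3 : 0 ≤ x3) (h4 : 0 ≤ x4) (h5 : 0 ≤ x5) (h6 : 0 ≤ x6) :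
    x1*x2*x3*x4*x5*x6 ≤ x1^6+x2^6+x3^6+x4^6+x5^6+x6^6 := by
  have c3 : ∀ u v w : ℝ, 0 ≤ u → 0 ≤ v → 0 ≤ w → u*v*w ≤ u^3+v^3+w^3 := fun u v w hu hv hw => by
    linarith [mul_nonneg (add_nonneg (add_nonneg hu hv) hw) (add_nonneg (add_nonneg (sq_nonneg (u-v)) (sq_nonneg (v-w))) (sq_nonneg (u-w))), mul_nonneg (mul_nonneg hu hv) hw]
  have c2 : ∀ u v : ℝ, (u*v)^3 ≤ u^6+v^6 := fun u v => by linarith [sq_nonneg (u^3-v^3), sq_nonneg (u^3+v^3)]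
  have := c3 (x1*x2) (x3*x4) (x5*x6) ¶ ¶ ¶
  have := c2 x1 x2; have := c2 x3 x4; have := c2 x5 x6
  calc x1*x2*x3*x4*x5*x6 = (x1*x2)*(x3*x4)*(x5*x6) := by ring
    _ ≤ _ := by linarith

theorem geo_shift (r : ℝ) (h0 : 0 ≤ r) (h1 : r ≤ 3/4) (G N : ℕ) : ∑ k ∈ range N, r^(k+1-G) ≤ G + 4 * r := by
  induction G generalizing N with
  | zero =>
    have := geo_le r h0 h1 1 N
    rw [pow_one] at this
    simp only [Nat.sub_zero, Nat.cast_zero, zero_add]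
    refine le_trans (le_of_eq ◌) this
    rw [range_eq_Ico, sum_Ico_add' (fun k => r^k) 0 N 1]; rfl
  | succ G ih =>
    cases N with
    | zero => simp; positivity
    | succ N =>
      rw [sum_range_succ']
      have e : ∀ k, k + 1 + 1 - (G+1) = k + 1 - G := fun k => by omega
      simp only [e]
      have := ih N
      have h2 : r^(0+1-(G+1)) = 1 := by rw [show 0+1-(G+1) = 0 by omega, pow_zero]
      rw [h2]; push_cast; linarith

theorem FF_loc (p : ℕ) (hp : p.Prime) (c c' : Circ) (k : ℕ) : FF (c.pd c') (p^k) ≤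
    (if p = 2 then 4 else 1) * (§p^½)^(k - 2 * (Int.gcd c.a c'.a).factorization p) := by
  have : Fact p.Prime := ⟨hp⟩
  have hp0 : §0 < p := mod_cast hp.pos
  have hp1 : §1 ≤ p := mod_cast hp.one_le
  refine (FF_pp p k (c.ok c')).trans ◌
  refine mul_le_mul ◌ ◌ ¶ (by split_ifs <;> norm_num)
  · split_ifs with h2
    · have : ((Nat.gcd 2 (p^k) : ℕ):ℝ) ≤ 2 := mod_cast Nat.gcd_le_left _ ¤
      nlinarith [Nat.cast_nonneg (α := ℝ) (Nat.gcd 2 (p^k))]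
    · have : Nat.gcd 2 (p^k) = 1 := Nat.Coprime.pow_right _ ((Nat.coprime_primes Nat.prime_two hp).2 (Ne.symm h2))
      rw [this]; norm_num
  · have key : ∀ x : ℤ, x ≠ 0 → ∃ j, Nat.gcd (x^2).natAbs (p^k) = p^j ∧ j ≤ k ∧ j ≤ 2 * x.natAbs.factorization p := by
      intro x hx
      obtain ⟨j, hj, e⟩ := (Nat.dvd_prime_pow hp).1 (Nat.gcd_dvd_right (x^2).natAbs (p^k))
      refine ⟨j, e, hj, ◌⟩
      have hd : p^j ∣ x.natAbs^2 := by rw [← e, ← Int.natAbs_pow]; exact Nat.gcd_dvd_left _ _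
      have := (hp.pow_dvd_iff_le_factorization (pow_ne_zero 2 (Int.natAbs_ne_zero.2 hx))).1 hd
      simpa using this
    obtain ⟨i, ei, hi, hi'⟩ := key c.a c.ha.ne'
    obtain ⟨j, ej, hj, hj'⟩ := key c'.a c'.ha.ne'
    have hg : (Int.gcd c.a c'.a).factorization p = min (c.a.natAbs.factorization p) (c'.a.natAbs.factorization p) := by
      rw [Int.gcd, Nat.factorization_gcd (Int.natAbs_ne_zero.2 c.ha.ne') (Int.natAbs_ne_zero.2 c'.ha.ne')]; rfl
    rw [ei, ej, hg]
    set G := min (c.a.natAbs.factorization p) (c'.a.natAbs.factorization p) with hG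
    rw [div_le_iff₀ ¶, sqrt_le_left ¶]
    have e2 : (§p^½)^2 = (p:ℝ)⁻¹ := by
      rw [← rpow_natCast, ← rpow_mul hp0.le]; norm_num [rpow_neg_one]
    rw [mul_pow, ← pow_mul, mul_comm (k - 2*G) 2, pow_mul, e2, inv_pow]
    push_cast
    rw [← div_eq_inv_mul, le_div_iff₀ ¶, ← pow_add, ← pow_add, ← pow_mul]
    refine pow_le_pow_right₀ hp1 ◌
    omega

theorem loc_le (p : ℕ) (hp : p.Prime) (c c' : Circ) (N n : ℕ) (hn : n = (c.a*c'.a*c.A*c'.A*(c.a-c'.a)).natAbs) :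
    1 + ∑ i ∈ Icc 1 N, FF (c.pd c') (p^i) ≤ exp (5 * (1/§p^2)) * (if p = 2 then 24 else 1) *
      (if p ∣ n then 1 + 5 * §p^½ else 1) * ((Int.gcd c.a c'.a).factorization p + 1)^3 := by
  have : Fact p.Prime := ⟨hp⟩
  have hp0 : §0 < p := mod_cast hp.pos
  have hp2 : §2 ≤ p := mod_cast hp.two_le
  set G := (Int.gcd c.a c'.a).factorization p with hG
  have hG1 : §1 ≤ (§G+1)^3 := one_le_pow₀ (by have := Nat.cast_nonneg (α := ℝ) G; linarith)
  have hexp : 1 + 5 * (1/§p^2) ≤ exp (5 * (1/§p^2)) := by linarith [add_one_le_exp (5 * (1/§p^2))]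
  have hexp1 : 1 ≤ exp (5 * (1/§p^2)) := one_le_exp ¶
  set r := §p^½ with hr
  have hr0 : 0 ≤ r := by positivity
  have hr1 : r ≤ 3/4 := rp_le p hp _ le_rfl
  by_cases hbad : p = 2 ∨ p ∣ n
  · have h1 : ∑ i ∈ Icc 1 N, FF (c.pd c') (p^i) ≤ (if p = 2 then 4 else 1) * ((2*G:ℕ) + 4*r) := by
      refine (sum_le_sum fun i _ => FF_loc p hp c c' i).trans ◌
      rw [← mul_sum]
      refine mul_le_mul_of_nonneg_left ◌ (by split_ifs <;> norm_num)
      refine le_trans (le_of_eq ◌) (geo_shift r hr0 hr1 (2*G) N)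
      rw [range_eq_Ico, sum_Ico_add' (fun k => r^(k - 2*G)) 0 N 1]; rfl
    have hGG : 1 + 2*§G ≤ (G+1)^3 := by
      have := Nat.cast_nonneg (α := ℝ) G
      linarith [pow_nonneg this 3, pow_nonneg this 2]
    have h2 : 1 + (2*§G + 4*r) ≤ (1+5*r)*(G+1)^3 := by nlinarith
    push_cast at h1
    by_cases hp2 : p = 2
    · rw [if_pos hp2] at h1 ⊢
      have h3 : (1+5*r)*(§G+1)^3 ≤ 6 * (G+1)^3 := by gcongr; linarith
      have h4 : §1 ≤ if p ∣ n then 1 + 5 * r else 1 := by split_ifs <;> linarith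
      calc _ ≤ 24 * (§G+1)^3 := by linarith
        _ ≤ exp (5 * (1/§p^2)) * 24 * (if p ∣ n then 1 + 5 * r else 1) * (§G+1)^3 := by
          gcongr
          nlinarith
    · rw [if_neg hp2] at h1 ⊢
      rw [if_pos (hbad.resolve_left hp2), mul_one]
      calc _ ≤ 1 * (1+5*r) * (§G+1)^3 := by linarith
        _ ≤ _ := by gcongr
  · push Not at hbad
    rw [if_neg hbad.1, if_neg hbad.2, mul_one, mul_one]
    have hnd : ∀ x : ℤ, x ∣ c.a*c'.a*c.A*c'.A*(c.a-c'.a) → ¬ ¥p ∣ x := fun x hx h =>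
      hbad.2 (by rw [hn]; exact Int.natCast_dvd.1 (h.trans hx))
    have ha := hnd c.a ⟨c'.a*c.A*c'.A*(c.a-c'.a), by ring⟩
    have ha' := hnd c'.a ⟨c.a*c.A*c'.A*(c.a-c'.a), by ring⟩
    have hF1 := FF_prime p (c.ok c') ⟨rfl, rfl, rfl, rfl⟩ (lt_of_le_of_ne hp.two_le (Ne.symm hbad.1)) (hnd c.A ⟨c.a*c'.a*c'.A*(c.a-c'.a), by ring⟩) (hnd c'.A ⟨c.a*c'.a*c.A*(c.a-c'.a), by ring⟩) ha ha' (hnd (c.a-c'.a) ⟨c.a*c'.a*c.A*c'.A, by ring⟩)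
    have hFk : ∀ k, FF (c.pd c') (p^k) ≤ (1/§p)^k := by
      intro k
      refine (FF_pp p k (c.ok c')).trans ◌
      have hcop : ∀ x : ℤ, ¬ ¥p ∣ x → Nat.gcd (x^2).natAbs (p^k) = 1 := fun x hx => by
        rw [Int.natAbs_pow]
        refine Nat.Coprime.pow _ _ (Nat.Coprime.symm ((Nat.Prime.coprime_iff_not_dvd hp).2 fun h => hx (Int.natCast_dvd.2 h)))
      rw [hcop _ ha, hcop _ ha', show Nat.gcd 2 (p^k) = 1 from Nat.Coprime.pow_right _ ((Nat.coprime_primes Nat.prime_two hp).2 (Ne.symm hbad.1))]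
      simp
    have hsum : ∑ i ∈ Icc 1 N, FF (c.pd c') (p^i) ≤ 5 * (1/§p^2) := by
      have h3 : ∑ i ∈ Icc 1 N, FF (c.pd c') (p^i) ≤ FF (c.pd c') p + ∑ i ∈ Icc 2 N, FF (c.pd c') (p^i) := by
        have : Icc 1 N ⊆ insert 1 (Icc 2 N) := fun i hi => by
          rw [mem_Icc] at hi; rw [mem_insert, mem_Icc]; omega
        refine (sum_le_sum_of_subset_of_nonneg this fun _ _ _ => FF_nonneg _ _).trans (le_of_eq ◌)
        rw [sum_insert (by simp), pow_one]
      have h4 := (sum_le_sum fun i (_ : i ∈ Icc 2 N) => hFk i).trans (geo_le (1/§p) ¶ (by rw [div_le_iff₀ hp0]; linarith) 2 N)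
      rw [one_div_pow] at h4
      linarith
    calc _ ≤ exp (5 * (1/§p^2)) * 1 := by linarith
      _ ≤ _ := by gcongr

theorem sing_series : ∃ C : ℝ, 1 ≤ C ∧ ∀ (c c' : Circ), c.a ≠ c'.a → ∀ Q : ℕ, ∑ q ∈ Icc 1 Q, FF (c.pd c') q ≤
    C * (RR c.a.natAbs + RR c'.a.natAbs + RR c.A.natAbs + RR c'.A.natAbs + RR (c.a-c'.a).natAbs + (Int.gcd c.a c'.a : ℝ)^⅛) := by
  obtain ⟨C1, hC1, h1⟩ := PP_RR
  obtain ⟨C2, hC2, h2⟩ := div_bound (1/144) ¤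
  have hs : Summable fun p : ℕ => 1/§p^2 := summable_one_div_nat_pow.2 ¤
  set C3 := exp (5 * ∑' p : ℕ, 1/§p^2) with hC3
  have hC31 : 1 ≤ C3 := one_le_exp (mul_nonneg ¤ (tsum_nonneg fun _ => by positivity))
  have hC218 : 1 ≤ C2^18 := one_le_pow₀ hC2
  refine ⟨C3 * 24 * (C1 * C2^18), by linarith [mul_le_mul hC31 (mul_le_mul hC1 hC218 zero_le_one ¶) ¤ ¶], fun c c' hne Q => ◌⟩
  set n := (c.a*c'.a*c.A*c'.A*(c.a-c'.a)).natAbs with hn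
  set g := Int.gcd c.a c'.a with hg
  have hg0 : g ≠ 0 := fun h => c.ha.ne' (Int.gcd_eq_zero_iff.1 h).1
  have na : ∀ x : ℤ, x ≠ 0 → x.natAbs ≠ 0 := fun x hx => Int.natAbs_ne_zero.2 hx
  have hh : c.a - c'.a ≠ 0 := sub_ne_zero.2 hne
  have n1 := na _ c.ha.ne'; have n2 := na _ c'.ha.ne'; have n3 := na _ c.hA.ne'; have n4 := na _ c'.hA.ne'; have n5 := na _ hh
  have hn0 : n ≠ 0 := by rw [hn]; exact na _ (by have := c.ha.ne'; have := c'.ha.ne'; have := c.hA.ne'; have := c'.hA.ne'; positivity)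
  have hPn : PP n ≤ PP c.a.natAbs * PP c'.a.natAbs * PP c.A.natAbs * PP c'.A.natAbs * PP (c.a-c'.a).natAbs := by
    have p0 := fun n => (PP_pos n).le
    rw [hn, Int.natAbs_mul, Int.natAbs_mul, Int.natAbs_mul, Int.natAbs_mul]
    refine (PP_mul _ _ ¶ n5).trans (mul_le_mul_of_nonneg_right ◌ (p0 _))
    refine (PP_mul _ _ ¶ n4).trans (mul_le_mul_of_nonneg_right ◌ (p0 _))
    refine (PP_mul _ _ ¶ n3).trans (mul_le_mul_of_nonneg_right ◌ (p0 _))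
    exact PP_mul _ _ n1 n2
  have hD : (§g.divisors.card^3)^6 ≤ C2^18 * §g^⅛ := by
    rw [← pow_mul]
    calc §g.divisors.card^(3*6) ≤ (C2 * §g^(1/144:ℝ))^18 := by gcongr; exact h2 g hg0
      _ = _ := by rw [mul_pow, ← rpow_natCast (§g^(1/144:ℝ)), ← rpow_mul ¶]; norm_num
  have hz : (c.pd c').Z := ⟨rfl, rfl, rfl, rfl⟩
  have hF1 : FF (c.pd c') 1 ≤ 1 := by
    have := FF_loc 3 Nat.prime_three c c' 0
    simpa using this
  refine (euler_bound _ (FF_nonneg _) hF1 (fun m n h => (FF_mul hz m n h).le) Q).trans ◌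
  set S := (range (Q+1)).filter Nat.Prime with hS
  refine (prod_le_prod (fun p _ => by have := sum_nonneg (s := Icc 1 Q) fun i _ => FF_nonneg (c.pd c') (p^i); linarith) fun p hp => loc_le p (mem_filter.1 hp).2 c c' Q n hn).trans ◌
  rw [prod_mul_distrib, prod_mul_distrib, prod_mul_distrib, ← exp_sum, ← mul_sum, prod_pow]
  have b1 : exp (5 * ∑ p ∈ S, 1/§p^2) ≤ C3 := exp_le_exp.2 (mul_le_mul_of_nonneg_left (hs.sum_le_tsum _ fun _ _ => by positivity) ¤)
  have b2 : ∏ p ∈ S, (if p = 2 then §24 else 1) ≤ 24 := by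
    rw [prod_ite_eq']; split_ifs <;> norm_num
  have b3 : ∏ p ∈ S, (if p ∣ n then 1 + 5 * §p^½ else 1) ≤ PP n := by
    rw [← prod_filter]
    unfold PP
    refine prod_le_prod_of_subset_of_one_le (fun p hp => ◌) (fun p _ => by positivity) (fun p _ _ => ◌)
    · rw [mem_filter, hS, mem_filter] at hp
      exact Nat.mem_primeFactors.2 ⟨hp.1.2, hp.2, hn0⟩
    · have : §0 ≤ 5 * §p^½ := by positivity
      linarith
  have b4 : ∏ p ∈ S, ((g.factorization p : ℝ) + 1) ≤ g.divisors.card := by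
    rw [Nat.card_divisors hg0]
    push_cast
    rw [← prod_filter_of_ne (s := S) (p := fun p => p ∈ g.primeFactors) (fun p _ h => by
      by_contra hp
      rw [← Nat.support_factorization, Finsupp.notMem_support_iff] at hp
      exact h (by rw [hp]; norm_num))]
    exact prod_le_prod_of_subset_of_one_le (fun p hp => (mem_filter.1 hp).2) (fun p _ => by positivity) (fun p _ _ => by linarith [Nat.cast_nonneg (α := ℝ) (g.factorization p)])
  have p0 := fun n => (PP_pos n).le
  have q0 : ∀ p ∈ S, §0 ≤ if p ∣ n then 1 + 5 * §p^½ else 1 := fun p _ => by split_ifs <;> positivity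
  have q1 : ∀ p ∈ S, §0 ≤ if p = 2 then §24 else 1 := fun p _ => by split_ifs <;> positivity
  have q2 : 0 ≤ ∏ p ∈ S, ((g.factorization p : ℝ) + 1) := prod_nonneg fun p _ => by positivity
  have fin : PP c.a.natAbs * PP c'.a.natAbs * PP c.A.natAbs * PP c'.A.natAbs * PP (c.a-c'.a).natAbs * §g.divisors.card^3 ≤
      (C1 * C2^18) * (RR c.a.natAbs + RR c'.a.natAbs + RR c.A.natAbs + RR c'.A.natAbs + RR (c.a-c'.a).natAbs + §g^⅛) := by
    refine (six _ _ _ _ _ _ (p0 _) (p0 _) (p0 _) (p0 _) (p0 _) ¶).trans ◌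
    have k : ∀ m, PP m^6 ≤ C1 * C2^18 * RR m := fun m => (h1 m).trans (by
      have : 0 ≤ RR m := prod_nonneg fun p _ => by positivity
      have : 0 ≤ C1 * RR m := by positivity
      nlinarith)
    have k2 : C2^18 * §g^⅛ ≤ C1 * C2^18 * §g^⅛ := by
      have : 0 ≤ C2^18 * §g^⅛ := by positivity
      nlinarith
    linarith [k c.a.natAbs, k c'.a.natAbs, k c.A.natAbs, k c'.A.natAbs, k (c.a-c'.a).natAbs]
  calc _ ≤ C3 * 24 * PP n * §g.divisors.card^3 := by
        refine mul_le_mul (mul_le_mul (mul_le_mul b1 b2 (prod_nonneg q1) ¶) b3 (prod_nonneg q0) ¶) (pow_le_pow_left₀ q2 b4 3) ¶ (mul_nonneg ¶ (p0 _))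
    _ ≤ C3 * 24 * (PP c.a.natAbs * PP c'.a.natAbs * PP c.A.natAbs * PP c'.A.natAbs * PP (c.a-c'.a).natAbs) * §g.divisors.card^3 := by gcongr
    _ = C3 * 24 * (PP c.a.natAbs * PP c'.a.natAbs * PP c.A.natAbs * PP c'.A.natAbs * PP (c.a-c'.a).natAbs * §g.divisors.card^3) := by ring
    _ ≤ C3 * 24 * ((C1 * C2^18) * (RR c.a.natAbs + RR c'.a.natAbs + RR c.A.natAbs + RR c'.A.natAbs + RR (c.a-c'.a).natAbs + §g^⅛)) := by gcongr
    _ = _ := by ring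
end

section
open Finset Real

/-- solutions of `q = c` modulo `m` -/
noncomputable def NN (κ β γ c : ℤ) (m : ℕ) : Finset (ℤ × ℤ) :=
  (Ico ¥0 m ×ˢ Ico ¥0 m).filter fun u => ¥m ∣ qf κ β γ u.1 u.2 - c

noncomputable def bx (V : ℕ) : Finset (ℤ × ℤ) := Icc ¥1 V ×ˢ Icc ¥1 V

theorem qf_mod (κ β γ x y x' y' m : ℤ) (h : m ∣ x - x') (h' : m ∣ y - y') : m ∣ qf κ β γ x y - qf κ β γ x' y' := by
  obtain ⟨s, hs⟩ := h
  obtain ⟨t, ht⟩ := h'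
  refine ⟨κ*s*(x+x') + 2*β*(s*y+x'*t) + γ*t*(y+y'), ◌⟩
  unfold qf
  rw [sub_eq_iff_eq_add] at hs ht
  subst hs ht; ring

theorem emod_sub (x m : ℤ) : m ∣ x % m - x := by rw [dvd_sub_comm]; exact Int.dvd_self_sub_emod

theorem card_mod (S : Finset ℤ) (m V : ℕ) (hm : 0 < m) (h0 : ∀ x ∈ S, 0 ≤ x ∧ x < V) (h : ∀ x ∈ S, ∀ y ∈ S, ¥m ∣ x - y) : S.card ≤ (V-1)/m + 1 := by
  have hm' : ¥0 < m := mod_cast hm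
  rw [← card_range ((V-1)/m+1)]
  refine card_le_card_of_injOn (fun x => (x / m).toNat) (fun x hx => ◌) fun x hx y hy hxy => ◌
  · obtain ⟨h1, h2⟩ := h0 x hx
    rw [coe_range, Set.mem_Iio, Nat.lt_succ_iff]
    zify [show 1 ≤ V by omega]
    rw [Int.toNat_of_nonneg (Int.ediv_nonneg h1 hm'.le)]
    exact Int.ediv_le_ediv hm' ¢
  · have h1 : x / m = y / m := by
      have := Int.ediv_nonneg (h0 x hx).1 hm'.le
      have := Int.ediv_nonneg (h0 y hy).1 hm'.le
      simp only at hxy; omega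
    have h2 : x % m = y % m := Int.emod_emod_of_dvd x (dvd_refl _) ▸ (Int.emod_emod_of_dvd x (dvd_refl _)).symm ▸ (Int.emod_eq_emod_iff_emod_sub_eq_zero.2 (Int.emod_eq_zero_of_dvd (h x hx y hy)))
    rw [← Int.mul_ediv_add_emod x m, ← Int.mul_ediv_add_emod y m, h1, h2]

theorem box_count (κ β γ c : ℤ) (m V : ℕ) (hm : 0 < m) (hV : m ≤ V) :
    (((bx V).filter fun u => ¥m ∣ qf κ β γ u.1 u.2 - c).card : ℝ) ≤ 4 * §V^2 * ((NN κ β γ c m).card / §m^2) := by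
  have hm' : ¥0 < m := mod_cast hm
  have key : ((bx V).filter fun u => ¥m ∣ qf κ β γ u.1 u.2 - c).card ≤ ((V/m+1)*(V/m+1)) * (NN κ β γ c m).card := by
    refine card_le_mul_card_image_of_maps_to (f := fun u : ℤ × ℤ => (u.1 % m, u.2 % m)) (fun u hu => ◌) _ fun b _ => ◌
    · rw [mem_filter] at hu
      refine mem_filter.2 ⟨mem_product.2 ⟨mem_Ico.2 ⟨Int.emod_nonneg _ hm'.ne', Int.emod_lt_of_pos _ hm'⟩, mem_Ico.2 ⟨Int.emod_nonneg _ hm'.ne', Int.emod_lt_of_pos _ hm'⟩⟩, ◌⟩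
      have := dvd_add (qf_mod κ β γ _ _ _ _ m (emod_sub u.1 m) (emod_sub u.2 m)) hu.2
      simpa using this
    · have cm : ∀ r : ℤ, ((Icc ¥1 V).filter fun x => x % m = r).card ≤ V/m+1 := fun r => by
        have := card_mod ((Icc ¥1 V).filter fun x => x % m = r) m (V+1) hm (fun x hx => by rw [mem_filter, mem_Icc] at hx; push_cast; omega) (fun x hx y hy => by
          rw [mem_filter] at hx hy
          exact Int.dvd_of_emod_eq_zero (Int.emod_eq_emod_iff_emod_sub_eq_zero.1 (hx.2.trans hy.2.symm)))
        simpa using this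
      refine le_trans (card_le_card (t := ((Icc ¥1 V).filter fun x => x % m = b.1) ×ˢ ((Icc ¥1 V).filter fun x => x % m = b.2)) fun u hu => ◌) ◌
      · rw [mem_filter, mem_filter, bx, mem_product] at hu
        rw [mem_product, mem_filter, mem_filter, ← hu.2]
        exact ⟨⟨hu.1.1.1, rfl⟩, hu.1.1.2, rfl⟩
      · rw [card_product]; exact Nat.mul_le_mul (cm _) (cm _)
  have h2 : ((V/m+1 : ℕ):ℝ) ≤ 2 * V / m := by
    have h1 : ((V/m : ℕ):ℝ) ≤ V / m := Nat.cast_div_le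
    have h3 : §1 ≤ V / m := by rw [one_le_div (by exact_mod_cast hm)]; exact_mod_cast hV
    push_cast
    rw [mul_div_assoc]; linarith
  calc _ ≤ ((V/m+1 : ℕ):ℝ) * ((V/m+1 : ℕ):ℝ) * (NN κ β γ c m).card := mod_cast key
    _ ≤ (2 * V / m) * (2 * V / m) * (NN κ β γ c m).card := by gcongr
    _ = _ := by ring

theorem NN_mul (κ β γ c : ℤ) (m n : ℕ) (hm : 0 < m) (hn : 0 < n) (h : m.Coprime n) :
    (NN κ β γ c (m*n)).card ≤ (NN κ β γ c m).card * (NN κ β γ c n).card := by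
  have hm' : ¥0 < m := mod_cast hm
  have hn' : ¥0 < n := mod_cast hn
  rw [← card_product]
  have hmap : ∀ (k : ℕ), 0 < k → k ∣ m*n → ∀ u ∈ NN κ β γ c (m*n), (u.1 % ¥k, u.2 % ¥k) ∈ NN κ β γ c k := by
    intro k hk hd u hu
    have hk' : ¥0 < k := mod_cast hk
    rw [NN, mem_filter] at hu
    refine mem_filter.2 ⟨mem_product.2 ⟨mem_Ico.2 ⟨Int.emod_nonneg _ hk'.ne', Int.emod_lt_of_pos _ hk'⟩, mem_Ico.2 ⟨Int.emod_nonneg _ hk'.ne', Int.emod_lt_of_pos _ hk'⟩⟩, ◌⟩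
    have := dvd_add (qf_mod κ β γ _ _ _ _ k (emod_sub u.1 k) (emod_sub u.2 k)) ((Int.natCast_dvd_natCast.2 hd).trans hu.2)
    simpa using this
  refine card_le_card_of_injOn (fun u => ((u.1 % ¥m, u.2 % ¥m), (u.1 % ¥n, u.2 % ¥n))) (fun u hu => ◌) fun u hu w hw huw => ◌
  · exact mem_coe.2 (mem_product.2 ⟨hmap m hm (dvd_mul_right _ _) u hu, hmap n hn (dvd_mul_left _ _) u hu⟩)
  · simp only [Prod.mk.injEq] at huw
    rw [mem_coe, NN, mem_filter, mem_product, mem_Ico, mem_Ico] at hu hw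
    have cr : ∀ x y : ℤ, x % m = y % m → x % n = y % n → 0 ≤ x → x < (m*n:ℕ) → 0 ≤ y → y < (m*n:ℕ) → x = y := fun x y h1 h2 hx hx' hy hy' => by
      have d1 := Int.dvd_of_emod_eq_zero (Int.emod_eq_emod_iff_emod_sub_eq_zero.1 h1)
      have d2 := Int.dvd_of_emod_eq_zero (Int.emod_eq_emod_iff_emod_sub_eq_zero.1 h2)
      have d3 := IsCoprime.mul_dvd (Nat.isCoprime_iff_coprime.2 h) d1 d2
      push_cast at hx' hy'
      have := Int.eq_zero_of_abs_lt_dvd d3 (by rw [abs_lt]; constructor <;> linarith)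
      linarith
    exact Prod.ext (cr _ _ huw.1.1 huw.2.1 hu.1.1.1 hu.1.1.2 hw.1.1.1 hw.1.1.2) (cr _ _ huw.1.2 huw.2.2 hu.1.2.1 hu.1.2.2 hw.1.2.1 hw.1.2.2)

theorem pow_split (p : ℤ) (hp : Prime p) (k : ℕ) : ∀ (u v : ℤ), p^k ∣ u*v → p^((k+1)/2) ∣ u ∨ p^((k+1)/2) ∣ v := by
  have gen : ∀ (n i j : ℕ) (u v : ℤ), i + j ≤ n → p^(i+j+1) ∣ u*v → p^(i+1) ∣ u ∨ p^(j+1) ∣ v := by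
    intro n
    induction n with
    | zero =>
      intro i j u v h hd
      obtain rfl : i = 0 := by omega
      obtain rfl : j = 0 := by omega
      simpa using hp.dvd_or_dvd (by simpa using hd)
    | succ n ih =>
      intro i j u v h hd
      by_contra! hc
      have h1 : p^i ∣ u := by
        rcases i with _ | i
        · simp
        · exact (ih i j u v ¢ ((pow_dvd_pow p ¢).trans hd)).resolve_right hc.2
      have h2 : p^j ∣ v := by
        rcases j with _ | j
        · simp
        · exact (ih i j u v ¢ ((pow_dvd_pow p ¢).trans hd)).resolve_left hc.1
      exact (succ_dvd_or_succ_dvd_of_succ_sum_dvd_mul hp h1 h2 hd).elim hc.1 hc.2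
  intro u v h
  rcases k with _ | k
  · simp
  · have := gen (k+1) (k/2) (k/2) u v ¢ ((pow_dvd_pow p ¢).trans h)
    rwa [show k/2+1 = (k+1+1)/2 by omega] at this

theorem NN_unit (κ β γ c : ℤ) (p k : ℕ) (hp : p.Prime) (hk : ¬ ¥p ∣ κ) :
    (NN κ β γ c (p^k)).card ≤ p^k * (2 * p^(k-(k+1)/2)) := by
  have hp' : Prime ¥p := Nat.prime_iff_prime_int.1 hp
  set R := p^((k+1)/2) with hR
  have hR0 : 0 < R := by rw [hR]; exact pow_pos hp.pos _
  have hk2 : (k+1)/2 ≤ k := by omega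
  have hPR : (p^k-1)/R + 1 = p^(k-(k+1)/2) := by
    have e : p^k = p^(k-(k+1)/2) * R := by rw [hR, ← pow_add]; congr 1; omega
    have h1 : 0 < p^(k-(k+1)/2) := pow_pos hp.pos _
    rw [e]
    obtain ⟨t, ht⟩ : ∃ t, p^(k-(k+1)/2) = t + 1 := ⟨_, (Nat.succ_pred_eq_of_pos h1).symm⟩
    rw [ht, show (t+1)*R - 1 = (R-1) + R*t by rw [add_mul, one_mul, mul_comm]; omega, Nat.add_mul_div_left _ _ hR0, Nat.div_eq_of_lt ¢]; omega
  have : (NN κ β γ c (p^k)).card ≤ (2 * p^(k-(k+1)/2)) * (Ico ¥0 (p^k:ℕ)).card := by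
    refine card_le_mul_card_image_of_maps_to (f := Prod.snd) (fun u hu => (mem_product.1 (mem_filter.1 hu).1).2) _ fun y _ => ◌
    set S := (NN κ β γ c (p^k)).filter (fun u => u.2 = y) with hS
    change S.card ≤ _
    rcases S.eq_empty_or_nonempty with h | ⟨u1, hu1⟩
    · rw [h]; simp
    · set S1 := (Ico ¥0 (p^k:ℕ)).filter fun x => ¥R ∣ x - u1.1
      set S2 := (Ico ¥0 (p^k:ℕ)).filter fun x => ¥R ∣ κ*(x+u1.1)+2*β*y
      have c1 : S1.card ≤ p^(k-(k+1)/2) := hPR ▸ card_mod S1 R _ hR0 (fun x hx => mem_Ico.1 (mem_filter.1 hx).1) (fun x hx z hz => by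
        have := dvd_sub (mem_filter.1 hx).2 (mem_filter.1 hz).2
        simpa using this)
      have c2 : S2.card ≤ p^(k-(k+1)/2) := hPR ▸ card_mod S2 R _ hR0 (fun x hx => mem_Ico.1 (mem_filter.1 hx).1) (fun x hx z hz => by
        have h1 := dvd_sub (mem_filter.1 hx).2 (mem_filter.1 hz).2
        have h2 : ¥R ∣ κ * (x - z) := by
          rwa [show κ * (x - z) = κ*(x+u1.1)+2*β*y - (κ*(z+u1.1)+2*β*y) by ring]
        refine IsCoprime.dvd_of_dvd_mul_left ◌ h2
        rw [hR]; push_cast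
        exact IsCoprime.pow_left ((Prime.coprime_iff_not_dvd hp').2 hk))
      rw [two_mul]
      refine le_trans ◌ (Nat.add_le_add c1 c2)
      refine le_trans ◌ (card_union_le _ _)
      refine card_le_card_of_injOn Prod.fst (fun u hu => ◌) fun u hu w hw h => Prod.ext h ((mem_filter.1 hu).2.trans (mem_filter.1 hw).2.symm)
      rw [mem_coe, hS, mem_filter, NN, mem_filter, mem_product] at hu
      rw [hS, mem_filter, NN, mem_filter] at hu1
      obtain ⟨⟨⟨h1, -⟩, h2⟩, h3⟩ := hu
      have h4 := dvd_sub h2 hu1.1.2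
      rw [h3, hu1.2] at h4
      rw [coe_union]
      push_cast at h4
      rcases pow_split p hp' k (u.1-u1.1) (κ*(u.1+u1.1)+2*β*y) (by
        rw [show (u.1-u1.1)*(κ*(u.1+u1.1)+2*β*y) = qf κ β γ u.1 y - c - (qf κ β γ u1.1 y - c) by unfold qf; ring]; exact h4) with h5 | h5
      · exact Or.inl (mem_coe.2 (mem_filter.2 ⟨h1, by rw [hR]; exact_mod_cast h5⟩))
      · exact Or.inr (mem_coe.2 (mem_filter.2 ⟨h1, by rw [hR]; exact_mod_cast h5⟩))
  rw [mul_comm, Int.card_Ico, sub_zero, Int.toNat_natCast] at this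
  exact this

theorem NN_pp (κ β γ c : ℤ) (hpr : ∀ p : ℤ, Prime p → ¬(p ∣ κ ∧ p ∣ γ ∧ p ∣ κ+2*β+γ)) (p k : ℕ) (hp : p.Prime) :
    (NN κ β γ c (p^k)).card ≤ p^k * (2 * p^(k-(k+1)/2)) := by
  by_cases h1 : ¥p ∣ κ
  swap
  · exact NN_unit κ β γ c p k hp h1
  by_cases h2 : ¥p ∣ γ
  swap
  · refine le_trans (card_le_card_of_injOn Prod.swap (fun u hu => ◌) fun u _ w _ h => Prod.swap_injective h) (NN_unit γ β κ c p k hp h2)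
    rw [mem_coe, NN, mem_filter, mem_product] at hu
    refine mem_coe.2 (mem_filter.2 ⟨mem_product.2 ⟨hu.1.2, hu.1.1⟩, ◌⟩)
    convert hu.2 using 1; simp only [qf, Prod.fst_swap, Prod.snd_swap]; ring
  · have h3 : ¬ ¥p ∣ κ+2*β+γ := fun h => hpr p (Nat.prime_iff_prime_int.1 hp) ⟨h1, h2, h⟩
    have hP : ¥0 < (p^k:ℕ) := mod_cast pow_pos hp.pos k
    refine le_trans (card_le_card_of_injOn (fun u => (u.1, (u.2-u.1) % (p^k:ℕ))) (fun u hu => ◌) fun u hu w hw h => ◌) (NN_unit (κ+2*β+γ) (β+γ) γ c p k hp h3)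
    · rw [mem_coe, NN, mem_filter, mem_product] at hu
      refine mem_coe.2 (mem_filter.2 ⟨mem_product.2 ⟨hu.1.1, mem_Ico.2 ⟨Int.emod_nonneg _ hP.ne', Int.emod_lt_of_pos _ hP⟩⟩, ◌⟩)
      have := dvd_add (qf_mod (κ+2*β+γ) (β+γ) γ u.1 _ u.1 _ (p^k:ℕ) ⟨0, by ring⟩ (emod_sub (u.2-u.1) (p^k:ℕ))) hu.2
      have e : ∀ t, qf (κ+2*β+γ) (β+γ) γ u.1 t - c = (qf (κ+2*β+γ) (β+γ) γ u.1 t - qf (κ+2*β+γ) (β+γ) γ u.1 (u.2-u.1)) + (qf κ β γ u.1 u.2 - c) := fun t => by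
        unfold qf; ring
      change ((p^k:ℕ):ℤ) ∣ qf (κ+2*β+γ) (β+γ) γ u.1 _ - c
      rw [e]; exact this
    · rw [mem_coe, NN, mem_filter, mem_product, mem_Ico, mem_Ico] at hu hw
      simp only [Prod.mk.injEq] at h
      have d := Int.dvd_of_emod_eq_zero (Int.emod_eq_emod_iff_emod_sub_eq_zero.1 h.2)
      rw [h.1, sub_sub_sub_cancel_right] at d
      have := Int.eq_zero_of_abs_lt_dvd d (by rw [abs_lt]; constructor <;> linarith [hu.1.2.1, hu.1.2.2, hw.1.2.1, hw.1.2.2])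
      exact Prod.ext h.1 £
end

section
open Finset Real

structure Pk where
  κ : ℤ
  β : ℤ
  γ : ℤ
  a0 : ℤ
  hκ : 0 < κ
  hγ : 0 < γ
  ha0 : a0 < 0
  hd : κ*γ-β^2 = a0^2
  pr : ∀ p : ℤ, Prime p → ¬(p ∣ κ ∧ p ∣ γ ∧ p ∣ κ+2*β+γ)

def Pk.q (P : Pk) (u : ℤ × ℤ) : ℤ := qf P.κ P.β P.γ u.1 u.2
def Pk.M (P : Pk) : ℕ := (P.κ + 2*|P.β| + P.γ - P.a0).toNat

theorem Pk.hM (P : Pk) : (P.M : ℤ) = P.κ + 2*|P.β| + P.γ - P.a0 := by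
  have := P.hκ; have := P.hγ; have := P.ha0; have := abs_nonneg P.β
  unfold Pk.M; omega

theorem Pk.q_nn (P : Pk) (u : ℤ × ℤ) : 0 ≤ P.q u := by
  have h : P.κ * P.q u = (P.κ*u.1+P.β*u.2)^2 + P.a0^2*u.2^2 := by rw [← P.hd]; unfold Pk.q qf; ring
  have h2 : 0 ≤ P.κ * P.q u := by rw [h]; positivity
  exact nonneg_of_mul_nonneg_right h2 P.hκ

theorem Pk.q_le (P : Pk) (V : ℕ) (u : ℤ × ℤ) (hu : u ∈ bx V) : P.q u - P.a0 ≤ P.M * V^2 := by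
  rw [bx, mem_product, mem_Icc, mem_Icc] at hu
  obtain ⟨⟨h1, h2⟩, h3, h4⟩ := hu
  have e1 : u.1^2 ≤ ¥V^2 := by gcongr
  have e2 : u.2^2 ≤ ¥V^2 := by gcongr
  have e3 : u.1*u.2 ≤ ¥V^2 := by nlinarith
  have e0 : 1 ≤ ¥V^2 := by nlinarith
  have := P.hκ; have := P.hγ; have := P.ha0
  have b := mul_le_mul (le_abs_self P.β) e3 ¶ (abs_nonneg _)
  rw [P.hM]; unfold Pk.q qf
  nlinarith [mul_le_mul_of_nonneg_left e1 P.hκ.le, mul_le_mul_of_nonneg_left e2 P.hγ.le]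

noncomputable def Pk.ρ (P : Pk) (c : ℤ) (m : ℕ) : ℝ := (NN P.κ P.β P.γ c m).card / §m^2

theorem ρ_nn (P : Pk) (c : ℤ) (m : ℕ) : 0 ≤ P.ρ c m := by unfold Pk.ρ; positivity
theorem ρ_zero (P : Pk) (c : ℤ) : P.ρ c 0 = 0 := by simp [Pk.ρ]
theorem ρ_mul (P : Pk) (c : ℤ) (m n : ℕ) (h : m.Coprime n) : P.ρ c (m*n) ≤ P.ρ c m * P.ρ c n := by
  rcases Nat.eq_zero_or_pos m with rfl | hm
  · simp [ρ_zero]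
  rcases Nat.eq_zero_or_pos n with rfl | hn
  · simp [ρ_zero]
  unfold Pk.ρ
  rw [div_mul_div_comm]; push_cast; rw [mul_pow]
  gcongr
  exact_mod_cast NN_mul P.κ P.β P.γ c m n hm hn h
theorem ρ_pp (P : Pk) (c : ℤ) (p k : ℕ) (hp : p.Prime) : P.ρ c (p^k) ≤ 2 * §p^(-((k+1)/2:ℕ):ℝ) := by
  have hp0 : §0 < p := mod_cast hp.pos
  unfold Pk.ρ
  rw [div_le_iff₀ (by push_cast; positivity), rpow_neg hp0.le, rpow_natCast]
  have h : ((NN P.κ P.β P.γ c (p^k)).card:ℝ) ≤ p^k * (2 * p^(k-(k+1)/2)) := mod_cast NN_pp P.κ P.β P.γ c P.pr p k hp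
  refine h.trans (le_of_eq ◌)
  rw [pow_sub₀ _ hp0.ne' ¢]; push_cast; ring
theorem ρ_one (P : Pk) (c : ℤ) : P.ρ c 1 ≤ 1 := by
  have : (NN P.κ P.β P.γ c 1).card ≤ 1 := (card_filter_le _ _).trans (by simp)
  simpa [Pk.ρ] using this

theorem euler_R : ∃ C : ℝ, 1 ≤ C ∧ ∀ F : ℕ → ℝ, (∀ n, 0 ≤ F n) → F 1 ≤ 1 → (∀ m n : ℕ, m.Coprime n → F (m*n) ≤ F m * F n) →
    (∀ p i : ℕ, p.Prime → 1 ≤ i → ∃ s : ℝ, F (p^i) ≤ 4 * §p^(-s) ∧ (5/8) * i ≤ s ∧ 5/4 ≤ s) → ∀ N, ∑ n ∈ Icc 1 N, F n ≤ C := by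
  have hs : Summable fun p : ℕ => 1/§p^(5/4:ℝ) := summable_one_div_nat_rpow.2 ¤
  refine ⟨exp (20 * ∑' p : ℕ, 1/§p^(5/4:ℝ)), one_le_exp (mul_nonneg ¤ (tsum_nonneg fun _ => by positivity)), fun F h0 h1 hm hF N => ◌⟩
  refine (euler_exp F h0 h1 hm N (fun p => 20 * (1/§p^(5/4:ℝ))) fun p hp => ◌).trans ◌
  · have hp1 : §1 ≤ p := mod_cast hp.one_le
    set r := §p^(-(5/8):ℝ) with hr
    have hr0 : 0 ≤ r := by positivity
    have e2 : 1/§p^(5/4:ℝ) = r^2 := by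
      rw [one_div, ← rpow_neg ¶, hr, ← rpow_natCast, ← rpow_mul ¶]; norm_num
    have ei : ∀ i : ℕ, r^i = §p^(-((5/8)*i):ℝ) := fun i => by
      rw [hr, ← rpow_natCast, ← rpow_mul ¶]; ring_nf
    have h3 : ∑ i ∈ Icc 1 N, F (p^i) ≤ F (p^1) + ∑ i ∈ Icc 2 N, F (p^i) := by
      have : Icc 1 N ⊆ insert 1 (Icc 2 N) := fun i hi => by
        rw [mem_Icc] at hi; rw [mem_insert, mem_Icc]; omega
      refine (sum_le_sum_of_subset_of_nonneg this fun _ _ _ => h0 _).trans (le_of_eq ◌)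
      rw [sum_insert (by simp)]
    have h4 : ∑ i ∈ Icc 2 N, F (p^i) ≤ 4 * (4 * r^2) := by
      refine le_trans ◌ (mul_le_mul_of_nonneg_left (geo_le r hr0 (rp_le p hp _ ¤) 2 N) ¤)
      rw [mul_sum]
      refine sum_le_sum fun i hi => ◌
      obtain ⟨s, hs, hs1, -⟩ := hF p i hp (by rw [mem_Icc] at hi; omega)
      refine hs.trans (mul_le_mul_of_nonneg_left ◌ ¤)
      rw [ei]; exact rpow_le_rpow_of_exponent_le hp1 £
    have h5 : F (p^1) ≤ 4 * r^2 := by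
      obtain ⟨s, hs, -, hs1⟩ := hF p 1 hp le_rfl
      refine hs.trans (mul_le_mul_of_nonneg_left ◌ ¤)
      rw [ei]; exact rpow_le_rpow_of_exponent_le hp1 (by push_cast; linarith)
    rw [e2]; linarith
  · rw [exp_le_exp, ← mul_sum]
    exact mul_le_mul_of_nonneg_left (hs.sum_le_tsum _ fun _ _ => by positivity) ¤

theorem RR_le (n : ℕ) (hn : n ≠ 0) : RR n ≤ ∑ d ∈ n.divisors, §d^¼ := by
  unfold RR
  rw [prod_one_add]
  have hp : ∀ t ∈ n.primeFactors.powerset, ∀ p ∈ t, p.Prime := fun t ht p hp => Nat.prime_of_mem_primeFactors (mem_powerset.1 ht hp)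
  have e : ∀ t ∈ n.primeFactors.powerset, ∏ p ∈ t, §p^¼ = ((∏ p ∈ t, p : ℕ):ℝ)^¼ := fun t ht => by
    rw [finsetProd_rpow _ _ (fun p _ => by positivity)]; push_cast; rfl
  rw [sum_congr rfl e, ← sum_image (s := n.primeFactors.powerset) (g := fun t => ∏ p ∈ t, p) (f := fun d : ℕ => §d^¼)]
  · refine sum_le_sum_of_subset_of_nonneg (fun d hd => ◌) fun _ _ _ => by positivity
    obtain ⟨t, ht, rfl⟩ := mem_image.1 hd
    exact Nat.mem_divisors.2 ⟨(prod_dvd_prod_of_subset _ _ _ (mem_powerset.1 ht)).trans (Nat.prod_primeFactors_dvd n), hn⟩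
  · intro t ht s hs h
    rw [← Nat.primeFactors_prod (hp t ht), ← Nat.primeFactors_prod (hp s hs)]
    exact congrArg _ h

theorem avg1 : ∃ C : ℝ, 1 ≤ C ∧ ∀ P : Pk, ∀ V : ℕ, P.M + 1 ≤ V → ∀ c : ℤ, |c| ≤ V^3 →
    ∑ v ∈ (bx V).filter (fun v => P.q v ≠ c), RR (P.q v - c).natAbs ≤ C * §V^2 := by
  obtain ⟨C1, hC1, h1⟩ := euler_R
  obtain ⟨C2, hC2, h2⟩ := div_bound (1/16) ¤
  refine ⟨4 * C1 + C2, by linarith, fun P V hV c hc => ◌⟩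
  have hV1 : §1 ≤ V := mod_cast (by omega : 1 ≤ V)
  set S := (bx V).filter (fun v => P.q v ≠ c) with hS
  have hbx : ((bx V).card : ℝ) = V^2 := by
    rw [bx, card_product, Int.card_Icc]; simp; ring
  have pt : ∀ v ∈ S, RR (P.q v - c).natAbs ≤ ∑ d ∈ Icc 1 V, (if ¥d ∣ P.q v - c then §d^¼ else 0) + C2 := by
    intro v hv
    rw [hS, mem_filter] at hv
    have hn0 : (P.q v - c).natAbs ≠ 0 := Int.natAbs_ne_zero.2 (sub_ne_zero.2 hv.2)
    set n := (P.q v - c).natAbs with hn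
    have hnV : §n ≤ §V^4 := by
      have : ¥n ≤ V^4 := by
        have q1 := P.q_le V v hv.1; have q2 := P.q_nn v; have := P.ha0
        have : |P.q v - c| ≤ ¥V^4 := by
          have hV2 : ¥P.M + 1 ≤ V := mod_cast hV
          have hV0 : ¥0 ≤ V := by positivity
          have hM0 : ¥0 ≤ P.M := by positivity
          rcases abs_le.1 hc with ⟨c1, c2⟩
          have e1 : ¥P.M*V^2 + V^3 ≤ V^4 := by
            linarith [mul_le_mul_of_nonneg_left hV2 (pow_nonneg hV0 3), pow_nonneg hV0 3, pow_nonneg hV0 2, mul_nonneg hM0 (pow_nonneg hV0 2), mul_le_mul_of_nonneg_left (by linarith : ¥1 ≤ V) (mul_nonneg hM0 (pow_nonneg hV0 2))]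
          rw [abs_le]; constructor <;> linarith [mul_nonneg hM0 (pow_nonneg hV0 2)]
        rwa [hn, Int.natCast_natAbs]
      exact_mod_cast this
    refine (RR_le n hn0).trans ◌
    rw [← sum_filter_add_sum_filter_not n.divisors (fun d => d ≤ V)]
    refine add_le_add ◌ ◌
    · rw [← sum_filter]
      refine sum_le_sum_of_subset_of_nonneg (fun d hd => ◌) fun _ _ _ => by positivity
      rw [mem_filter, Nat.mem_divisors] at hd
      exact mem_filter.2 ⟨mem_Icc.2 ⟨Nat.pos_of_dvd_of_pos hd.1.1 (Nat.pos_of_ne_zero hn0), hd.2⟩, Int.natCast_dvd.2 hd.1.1⟩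
    · calc _ ≤ ∑ d ∈ n.divisors.filter (fun d => ¬ d ≤ V), §V^¼ := sum_le_sum fun d hd => by
            refine rpow_le_rpow_of_nonpos £ ◌ ¤
            exact_mod_cast (not_le.1 (mem_filter.1 hd).2).le
        _ ≤ n.divisors.card * §V^¼ := by
            rw [sum_const, nsmul_eq_mul]
            gcongr; exact filter_subset _ _
        _ ≤ (C2 * ((§V^4)^(1/16:ℝ))) * §V^¼ := by
            gcongr
            exact (h2 n hn0).trans (by gcongr)
        _ = C2 := by
            rw [← rpow_natCast, ← rpow_mul ¶, mul_assoc, ← rpow_add £]; norm_num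
  refine (sum_le_sum pt).trans ◌
  rw [sum_add_distrib, sum_comm, sum_const, nsmul_eq_mul]
  have hcard : §S.card ≤ V^2 := by rw [← hbx]; exact_mod_cast card_filter_le _ _
  have hE := h1 (fun m => P.ρ c m * §m^¼) (fun m => mul_nonneg (ρ_nn _ _ _) ¶) (by simpa using ρ_one P c)
    (fun m n h => by
      push_cast; rw [mul_rpow ¶ ¶, mul_mul_mul_comm]
      exact mul_le_mul_of_nonneg_right (ρ_mul P c m n h) ¶)
    (fun p i hp hi => ⟨((i+1)/2:ℕ) + i/4, by
      have hp0 : §0 < p := mod_cast hp.pos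
      rw [neg_add, rpow_add hp0, ← mul_assoc]
      push_cast
      rw [← rpow_natCast, ← rpow_mul hp0.le, show §i * -(1/4) = -(i/4) by ring]
      refine mul_le_mul_of_nonneg_right ((ρ_pp P c p i hp).trans ◌) ¶
      exact mul_le_mul_of_nonneg_right ¤ ¶, by
      have : i ≤ 2*((i+1)/2) := by omega
      have : §i ≤ 2*((i+1)/2:ℕ) := mod_cast this
      linarith [Nat.cast_nonneg (α := ℝ) i], by
      have h1 : 5 ≤ 4*((i+1)/2) + i := by omega
      have : §5 ≤ 4*((i+1)/2:ℕ) + i := mod_cast h1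
      linarith⟩) V
  have hmain : ∑ d ∈ Icc 1 V, ∑ v ∈ S, (if ¥d ∣ P.q v - c then §d^¼ else 0) ≤ 4 * §V^2 * C1 := by
    refine le_trans ◌ (mul_le_mul_of_nonneg_left hE ¶)
    rw [mul_sum]
    refine sum_le_sum fun d hd => ◌
    rw [mem_Icc] at hd
    rw [← sum_filter, sum_const, nsmul_eq_mul, ← mul_assoc]
    refine mul_le_mul_of_nonneg_right (le_trans ◌ (box_count P.κ P.β P.γ c d V ¢ hd.2)) ¶
    exact_mod_cast card_le_card (filter_subset_filter _ (filter_subset _ _))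
  calc _ ≤ 4 * §V^2 * C1 + V^2 * C2 := add_le_add hmain (mul_le_mul_of_nonneg_right hcard £)
    _ = _ := by ring
end

section
open Finset Real

theorem bx_card (V : ℕ) : ((bx V).card : ℝ) = V^2 := by
  rw [bx, card_product, Int.card_Icc]; simp; ring

theorem big_count (P : Pk) (c : ℤ) (m W : ℕ) (hm : 0 < m) :
    (((bx W).filter fun u => ¥m ∣ P.q u - c).card : ℝ) ≤ W * (m.divisors.card * (P.M * (W / √m) + 1)) := by
  have hm' : §0 < m := mod_cast hm
  have hMκ : §P.κ ≤ P.M := by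
    have := P.hM; have := P.hγ; have := P.ha0; have := abs_nonneg P.β
    exact_mod_cast (by linarith : P.κ ≤ P.M)
  have hκ1 : §1 ≤ P.κ := mod_cast P.hκ
  have cm : ∀ (S : Finset ℤ) (k : ℕ), 0 < k → S ⊆ Icc ¥1 W → (∀ x ∈ S, ∀ y ∈ S, ¥k ∣ x - y) → √m ≤ P.M * k → §S.card ≤ P.M * (W / √m) + 1 := by
    intro S k hk hS hd hle
    have h1 := card_mod S k (W+1) hk (fun x hx => by have := mem_Icc.1 (hS hx); push_cast; omega) hd
    have hk' : §0 < k := mod_cast hk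
    calc §S.card ≤ ((W/k:ℕ):ℝ) + 1 := mod_cast h1
      _ ≤ §W/k + 1 := by gcongr; exact Nat.cast_div_le
      _ ≤ _ := by
        gcongr
        rw [← mul_div_assoc, div_le_div_iff₀ hk' ¶]
        calc §W * √m ≤ W * (P.M * k) := by gcongr
          _ = _ := by ring
  have row : ∀ y : ℤ, (((Icc ¥1 W).filter fun x => ¥m ∣ P.q (x,y) - c).card : ℝ) ≤ m.divisors.card * (P.M * (W / √m) + 1) := by
    intro y
    set S := (Icc ¥1 W).filter fun x => ¥m ∣ P.q (x,y) - c with hS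
    rcases S.eq_empty_or_nonempty with h | ⟨x1, hx1⟩
    · rw [h]; simp; positivity
    set T : ℕ → Finset ℤ := fun k => S.filter fun x => ¥k ∣ x - x1 ∧ ((m/k:ℕ):ℤ) ∣ P.κ*(x+x1)+2*P.β*y with hT
    have hsub : S ⊆ m.divisors.biUnion T := by
      intro x hx
      have hd := dvd_sub (mem_filter.1 hx).2 (mem_filter.1 hx1).2
      rw [show P.q (x,y) - c - (P.q (x1,y) - c) = (x-x1)*(P.κ*(x+x1)+2*P.β*y) by unfold Pk.q qf; ring] at hd
      set k := Int.gcd m (x-x1) with hk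
      have hkm : k ∣ m := mod_cast Int.gcd_dvd_left ¥m (x-x1)
      have hk0 : 0 < k := Nat.pos_of_dvd_of_pos hkm hm
      refine mem_biUnion.2 ⟨k, Nat.mem_divisors.2 ⟨hkm, hm.ne'⟩, mem_filter.2 ⟨hx, Int.gcd_dvd_right _ _, ◌⟩⟩
      obtain ⟨e, he⟩ := Int.gcd_dvd_right ¥m (x-x1)
      obtain ⟨f, hf⟩ := hkm
      have hco : IsCoprime ¥f e := by
        rw [Int.isCoprime_iff_gcd_eq_one]
        have h2 : Int.gcd m (x-x1) = k * Int.gcd f e := by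
          have h3 : Int.gcd (¥k*f) (¥k*e) = k * Int.gcd f e := by rw [Int.gcd_mul_left]; simp
          rw [← h3, ← Nat.cast_mul, ← hf, hk, ← he]
        rw [← hk] at h2
        exact Nat.eq_of_mul_eq_mul_left hk0 (by rw [← h2, mul_one])
      rw [hf, Nat.mul_div_cancel_left _ hk0]
      refine hco.dvd_of_dvd_mul_left (Int.dvd_of_mul_dvd_mul_left (a := k) (by exact_mod_cast hk0.ne') ◌)
      rw [he, ← hk] at hd
      rw [← mul_assoc, ← Nat.cast_mul, ← hf]; exact hd
    calc §S.card ≤ ∑ k ∈ m.divisors, ((T k).card:ℝ) := mod_cast (card_le_card hsub).trans card_biUnion_le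
      _ ≤ ∑ k ∈ m.divisors, (P.M * (W / √m) + 1) := sum_le_sum fun k hk => ◌
      _ = _ := by rw [sum_const, nsmul_eq_mul]
    obtain ⟨f, hf⟩ := (Nat.mem_divisors.1 hk).1
    have hk0 : 0 < k := Nat.pos_of_mem_divisors hk
    have hf0 : 0 < f := Nat.pos_of_ne_zero fun h => hm.ne' (by rw [hf, h, mul_zero])
    have hTs : T k ⊆ Icc ¥1 W := (filter_subset _ _).trans (filter_subset _ _)
    have hsq : ∀ t : ℕ, m ≤ t*t → √§m ≤ t := fun t ht => sqrt_le_iff.2 ⟨by positivity, by rw [sq]; exact_mod_cast ht⟩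
    rcases le_total f k with h | h
    · refine cm _ k hk0 hTs (fun x hx z hz => ◌) ((hsq k (by rw [hf]; gcongr)).trans (le_mul_of_one_le_left ¶ £))
      have := dvd_sub (mem_filter.1 hx).2.1 (mem_filter.1 hz).2.1
      rwa [sub_sub_sub_cancel_right] at this
    · set d := Int.gcd f P.κ with hd
      have hdf : d ∣ f := mod_cast Int.gcd_dvd_left ¥f P.κ
      obtain ⟨e, he⟩ := hdf
      have hd0 : 0 < d := Nat.pos_of_ne_zero fun h => hf0.ne' (by rw [he, h, zero_mul])
      have he0 : 0 < e := Nat.pos_of_ne_zero fun h => hf0.ne' (by rw [he, h, mul_zero])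
      obtain ⟨l, hl⟩ := Int.gcd_dvd_right ¥f P.κ
      refine cm _ e he0 hTs (fun x hx z hz => ◌) ◌
      · have h1 := dvd_sub (mem_filter.1 hx).2.2 (mem_filter.1 hz).2.2
        rw [hf, Nat.mul_div_cancel_left _ hk0, show P.κ*(x+x1)+2*P.β*y - (P.κ*(z+x1)+2*P.β*y) = P.κ*(x-z) by ring] at h1
        rw [hl, ← hd, he, mul_assoc] at h1
        push_cast at h1
        have h2 := Int.dvd_of_mul_dvd_mul_left (by exact_mod_cast hd0.ne') h1
        refine IsCoprime.dvd_of_dvd_mul_left ◌ h2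
        rw [Int.isCoprime_iff_gcd_eq_one]
        have h3 : Int.gcd f P.κ = d * Int.gcd e l := by
          have h4 : Int.gcd (¥d*e) (¥d*l) = d * Int.gcd e l := by rw [Int.gcd_mul_left]; simp
          rw [← h4, ← Nat.cast_mul, ← he, hd, ← hl]
        rw [← hd] at h3
        exact Nat.eq_of_mul_eq_mul_left hd0 (by rw [← h3, mul_one])
      · refine (hsq f (by rw [hf]; gcongr)).trans ◌
        have hdκ : §d ≤ P.M := le_trans (by exact_mod_cast Int.le_of_dvd P.hκ (Int.gcd_dvd_right ¥f P.κ)) hMκ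
        rw [he]; push_cast; gcongr
  have h := card_eq_sum_card_fiberwise (f := Prod.snd) (s := (bx W).filter fun u => ¥m ∣ P.q u - c) (t := Icc ¥1 W) (fun u hu => (mem_product.1 (mem_filter.1 hu).1).2)
  rw [h]; push_cast
  calc _ ≤ ∑ y ∈ Icc ¥1 W, (m.divisors.card * (P.M * (W / √m) + 1) : ℝ) := sum_le_sum fun y _ => by
        refine le_trans ◌ (row y)
        refine Nat.cast_le.2 (card_le_card_of_injOn Prod.fst (fun u hu => ◌) fun u hu w hw h => Prod.ext h ((mem_filter.1 hu).2.trans (mem_filter.1 hw).2.symm))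
        rw [mem_coe, mem_filter, mem_filter, bx, mem_product] at hu
        obtain ⟨⟨⟨h1, -⟩, h2⟩, rfl⟩ := hu
        exact mem_coe.2 (mem_filter.2 ⟨h1, h2⟩)
    _ = _ := by rw [sum_const, nsmul_eq_mul, Int.card_Icc]; simp

theorem avg2 : ∃ C : ℝ, 1 ≤ C ∧ ∀ P : Pk, ∃ V0 : ℕ, ∀ V W : ℕ, V0 ≤ V → V ≤ W →
    ∑ v ∈ bx V, ∑ w ∈ bx W, (Int.gcd (P.q v - P.a0) (P.q w - P.a0) : ℝ)^⅛ ≤ C * (§V^2 * §W^2) := by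
  obtain ⟨C1, hC1, h1⟩ := euler_R
  obtain ⟨C2, hC2, h2⟩ := div_bound (1/32) ¤
  refine ⟨16 * C1 + 1, by linarith, fun P => ◌⟩
  obtain ⟨V0, hV0⟩ := exists_nat_ge ((C2^2 * (2*P.M) * P.M)^16 + P.M + 1)
  refine ⟨V0, fun V W hV hW => ◌⟩
  have hVr : (C2^2 * (2*P.M) * P.M)^16 + P.M + 1 ≤ V := hV0.trans (by exact_mod_cast hV)
  have hMM : §0 ≤ P.M := by positivity
  have hpos : 0 ≤ (C2^2 * (2*P.M) * P.M)^16 := by positivity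
  have hV1 : §1 ≤ V := by linarith
  have hWV : §V ≤ W := mod_cast hW
  have hap : ∀ v, 0 < P.q v - P.a0 := fun v => by have := P.q_nn v; have := P.ha0; linarith
  have hM1 : §1 ≤ P.M := by
    have : 1 ≤ ¥P.M := by rw [P.hM]; have := P.hκ; have := P.hγ; have := P.ha0; have := abs_nonneg P.β; linarith
    exact_mod_cast this
  set I : ℕ → (ℤ × ℤ) → ℝ := fun m v => if ¥m ∣ P.q v - P.a0 then 1 else 0 with hI
  have hI0 : ∀ m v, 0 ≤ I m v := fun m v => by simp only [hI]; split_ifs <;> norm_num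
  have pt : ∀ v ∈ bx V, ∀ w ∈ bx W, (Int.gcd (P.q v - P.a0) (P.q w - P.a0) : ℝ)^⅛ ≤
      ∑ m ∈ Icc 1 V, §m^⅛ * (I m v * I m w) + ∑ m ∈ (P.q v - P.a0).natAbs.divisors.filter (fun m => V < m), §m^⅛ * I m w := by
    intro v _ w _
    set g := Int.gcd (P.q v - P.a0) (P.q w - P.a0) with hg
    have d1 : ¥g ∣ P.q v - P.a0 := Int.gcd_dvd_left _ _
    have d2 : ¥g ∣ P.q w - P.a0 := Int.gcd_dvd_right _ _
    have n1 : ∀ m ∈ Icc 1 V, 0 ≤ §m^⅛ * (I m v * I m w) := fun m _ => mul_nonneg ¶ (mul_nonneg (hI0 _ _) (hI0 _ _))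
    have n2 : ∀ m ∈ (P.q v - P.a0).natAbs.divisors.filter (fun m => V < m), 0 ≤ §m^⅛ * I m w := fun m _ => mul_nonneg ¶ (hI0 _ _)
    have hg0 : 0 < g := Nat.pos_of_ne_zero fun h => (hap v).ne' (Int.gcd_eq_zero_iff.1 h).1
    rcases le_or_gt g V with h | h
    · have := single_le_sum n1 (mem_Icc.2 ⟨hg0, h⟩)
      simp only [hI, if_pos d1, if_pos d2, mul_one] at this
      exact this.trans (le_add_of_nonneg_right (sum_nonneg n2))
    · have := single_le_sum n2 (mem_filter.2 ⟨Nat.mem_divisors.2 ⟨Int.natCast_dvd.1 d1, Int.natAbs_ne_zero.2 (hap v).ne'⟩, h⟩)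
      simp only [hI, if_pos d2, mul_one] at this
      exact this.trans (le_add_of_nonneg_left (sum_nonneg n1))
  have hsum : ∀ (m U : ℕ), ∑ v ∈ bx U, I m v = ((bx U).filter fun u => ¥m ∣ P.q u - P.a0).card := fun m U => by
    rw [sum_boole]
  have tail : ∀ v ∈ bx V, ∑ w ∈ bx W, ∑ m ∈ (P.q v - P.a0).natAbs.divisors.filter (fun m => V < m), §m^⅛ * I m w ≤ §W^2 := by
    intro v hv
    set n := (P.q v - P.a0).natAbs with hn
    have hn0 : n ≠ 0 := Int.natAbs_ne_zero.2 (hap v).ne'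
    have hnle : §n ≤ P.M * V^2 := by
      have := P.q_le V v hv
      have : ¥n ≤ P.M * V^2 := by rw [hn, Int.natCast_natAbs, abs_of_pos (hap v)]; exact this
      exact_mod_cast this
    have hdn : §n.divisors.card ≤ C2 * §V^(3/32:ℝ) := by
      refine (h2 n hn0).trans ◌
      gcongr
      calc §n^(1/32:ℝ) ≤ (§V^3)^(1/32:ℝ) := by
            gcongr
            refine hnle.trans ◌
            have : §P.M ≤ V := by linarith
            linarith [mul_le_mul_of_nonneg_right this (sq_nonneg §V)]
        _ = _ := by rw [← rpow_natCast, ← rpow_mul ¶]; norm_num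
    have term : ∀ m ∈ n.divisors.filter (fun m => V < m), §m^⅛ * ∑ w ∈ bx W, I m w ≤ §W^2 * (2*P.M) * P.M * (C2 * §V^(3/32:ℝ)) * §V^(-(3/8):ℝ) := by
      intro m hm
      rw [mem_filter, Nat.mem_divisors] at hm
      have hm0 : 0 < m := by omega
      have hmV : §V ≤ m := mod_cast hm.2.le
      have hmp : §0 < m := by linarith
      have hmn : §m ≤ n := mod_cast Nat.le_of_dvd (Nat.pos_of_ne_zero hn0) hm.1.1
      rw [hsum]
      have hsq : √§m ≤ P.M * W := by
        refine sqrt_le_iff.2 ⟨by positivity, hmn.trans (hnle.trans ◌)⟩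
        rw [mul_pow]
        gcongr
        nlinarith
      have h3 : P.M * (W / √m) + 1 ≤ (2*P.M) * (W / √§m) := by
        have : 1 ≤ P.M * (W / √§m) := by rw [← mul_div_assoc, one_le_div ¶]; exact hsq
        linarith
      have h4 : §m.divisors.card ≤ C2 * §V^(3/32:ℝ) :=
        le_trans (by exact_mod_cast card_le_card (Nat.divisors_subset_of_dvd hn0 hm.1.1)) hdn
      have e : §m^⅛ / √m = §m^(-(3/8):ℝ) := by
        rw [sqrt_eq_rpow, ← rpow_sub hmp]; norm_num
      have e2 : §m^(-(3/8):ℝ) ≤ §V^(-(3/8):ℝ) := rpow_le_rpow_of_nonpos £ hmV ¤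
      calc _ ≤ §m^⅛ * (W * ((C2 * §V^(3/32:ℝ)) * ((2*P.M) * (W / √§m)))) := by
            refine mul_le_mul_of_nonneg_left ((big_count P P.a0 m W hm0).trans ◌) ¶
            gcongr
        _ = §W^2 * (2*P.M) * 1 * (C2 * §V^(3/32:ℝ)) * (§m^⅛ / √m) := by ring
        _ ≤ _ := by rw [e]; gcongr
    rw [sum_comm]
    simp only [← mul_sum]
    refine (sum_le_sum term).trans ◌
    rw [sum_const, nsmul_eq_mul]
    calc _ ≤ (C2 * §V^(3/32:ℝ)) * (§W^2 * (2*P.M) * P.M * (C2 * §V^(3/32:ℝ)) * §V^(-(3/8):ℝ)) := by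
          gcongr
          exact le_trans (by exact_mod_cast card_filter_le _ _) hdn
      _ = §W^2 * (C2^2 * (2*P.M) * P.M * (§V^(3/32:ℝ) * §V^(3/32:ℝ) * §V^(-(3/8):ℝ))) := by ring
      _ ≤ §W^2 * 1 := by
          gcongr
          rw [← rpow_add £, ← rpow_add £]
          have e5 : C2^2 * (2*P.M) * P.M ≤ §V^(1/16:ℝ) := by
            calc C2^2 * (2*P.M) * P.M = ((C2^2 * (2*P.M) * P.M)^16)^(1/16:ℝ) := by
                  rw [← rpow_natCast _ 16, ← rpow_mul ¶]; norm_num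
              _ ≤ _ := by gcongr; linarith
          calc _ ≤ §V^(1/16:ℝ) * §V^(3/32+3/32+-(3/8):ℝ) := by gcongr
            _ = §V^(-(1/8):ℝ) := by rw [← rpow_add £]; norm_num
            _ ≤ 1 := rpow_le_one_of_one_le_of_nonpos hV1 ¤
      _ = _ := by ring
  have hE := h1 (fun m => P.ρ P.a0 m ^ 2 * §m^⅛) (fun m => mul_nonneg (sq_nonneg _) ¶) (by simpa [abs_of_nonneg (ρ_nn P P.a0 1)] using ρ_one P P.a0)
    (fun m n h => by
      push_cast; rw [mul_rpow ¶ ¶, mul_mul_mul_comm, ← mul_pow]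
      exact mul_le_mul_of_nonneg_right (pow_le_pow_left₀ (ρ_nn _ _ _) (ρ_mul P P.a0 m n h) 2) ¶)
    (fun p i hp hi => ⟨2*((i+1)/2:ℕ) - i/8, by
      have hp0 : §0 < p := mod_cast hp.pos
      rw [show -(2*(((i+1)/2:ℕ):ℝ) - i/8) = -(((i+1)/2:ℕ):ℝ)*2 + §i*(1/8) by ring, rpow_add hp0, ← mul_assoc, rpow_mul hp0.le]
      push_cast
      rw [← rpow_natCast §p i, ← rpow_mul hp0.le]
      refine mul_le_mul_of_nonneg_right ((pow_le_pow_left₀ (ρ_nn _ _ _) (ρ_pp P P.a0 p i hp) 2).trans (le_of_eq ◌)) ¶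
      rw [mul_pow]; norm_num, by
      have : i ≤ 2*((i+1)/2) := by omega
      have : §i ≤ 2*((i+1)/2:ℕ) := mod_cast this
      linarith [Nat.cast_nonneg (α := ℝ) i], by
      have h1 : 10 + i ≤ 16*((i+1)/2) := by omega
      have : §10 + i ≤ 16*((i+1)/2:ℕ) := mod_cast h1
      linarith⟩) V
  have main : ∑ v ∈ bx V, ∑ w ∈ bx W, ∑ m ∈ Icc 1 V, §m^⅛ * (I m v * I m w) ≤ 16 * (§V^2 * §W^2) * C1 := by
    have e : ∑ v ∈ bx V, ∑ w ∈ bx W, ∑ m ∈ Icc 1 V, §m^⅛ * (I m v * I m w) = ∑ m ∈ Icc 1 V, §m^⅛ * ((∑ v ∈ bx V, I m v) * ∑ w ∈ bx W, I m w) := by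
      rw [sum_congr rfl fun v _ => sum_comm, sum_comm]
      refine sum_congr rfl fun m _ => ◌
      rw [sum_mul_sum]; simp only [mul_sum]
    rw [e]
    refine le_trans ◌ (mul_le_mul_of_nonneg_left hE ¶)
    rw [mul_sum]
    refine sum_le_sum fun m hm => ◌
    rw [mem_Icc] at hm
    rw [hsum, hsum]
    have b1 := box_count P.κ P.β P.γ P.a0 m V ¢ hm.2
    have b2 := box_count P.κ P.β P.γ P.a0 m W ¢ (hm.2.trans hW)
    calc _ ≤ §m^⅛ * ((4 * §V^2 * P.ρ P.a0 m) * (4 * §W^2 * P.ρ P.a0 m)) := by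
          refine mul_le_mul_of_nonneg_left (mul_le_mul b1 b2 ¶ ◌) ¶
          have := ρ_nn P P.a0 m; positivity
      _ = _ := by ring
  calc _ ≤ ∑ v ∈ bx V, ∑ w ∈ bx W, (∑ m ∈ Icc 1 V, §m^⅛ * (I m v * I m w) + ∑ m ∈ (P.q v - P.a0).natAbs.divisors.filter (fun m => V < m), §m^⅛ * I m w) :=
        sum_le_sum fun v hv => sum_le_sum fun w hw => pt v hv w hw
    _ ≤ 16 * (§V^2 * §W^2) * C1 + ∑ v ∈ bx V, §W^2 := by
        simp only [sum_add_distrib]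
        exact add_le_add main (sum_le_sum tail)
    _ = _ := by rw [sum_const, nsmul_eq_mul, bx_card]; ring
end

section
open Finset Real

theorem exp_geo (y : ℝ) (hy : 0 < y) (N : ℕ) : ∑ n ∈ Icc 1 N, exp (-(n*y)) ≤ 1/y := by
  have h : ∀ N : ℕ, ∑ n ∈ Icc 1 N, exp (-(n*y)) ≤ 1/y * (1 - exp (-(N*y))) := by
    intro N
    induction N with
    | zero => simp
    | succ k ih =>
      rw [sum_Icc_succ_top ¢]
      have e : exp (-(k*y)) = exp y * exp (-((k+1:ℕ)*y)) := by
        rw [← exp_add]; congr 1; push_cast; ring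
      have h1 := add_one_le_exp y
      have h2 : y * exp (-((k+1:ℕ)*y)) ≤ exp (-(k*y)) - exp (-((k+1:ℕ)*y)) := by
        rw [e]; nlinarith [exp_pos (-((k+1:ℕ)*y))]
      have h3 : exp (-((k+1:ℕ)*y)) ≤ 1/y * (exp (-(k*y)) - exp (-((k+1:ℕ)*y))) := by
        rw [one_div, ← div_eq_inv_mul, le_div_iff₀ hy]; linarith
      linarith
  refine (h N).trans (mul_le_of_le_one_right ¶ ◌)
  linarith [exp_pos (-(N*y))]

theorem gauss_sum (z η : ℝ) (hz : 0 < z) (h0 : 0 ≤ η) (h1 : η ≤ 1/2) (N : ℕ) :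
    ∑ n ∈ Icc 1 N, exp (-(π * §n^2 * z)) ≤ 8 * z^(-(1/2+η)) := by
  have hp := pi_gt_three
  have hp4 := pi_le_four
  rcases le_total z 1 with h | h
  · have hs : 0 < √z := sqrt_pos.2 hz
    calc _ ≤ ∑ n ∈ Icc 1 N, exp 1 * exp (-(n*√z)) := sum_le_sum fun n _ => by
          rw [← exp_add, exp_le_exp]
          have e : z = √z^2 := (sq_sqrt hz.le).symm
          have : π * §n^2 * z = π * (n*√z)^2 := by rw [mul_pow, ← e]; ring
          rw [this]; nlinarith [sq_nonneg (n*√z - 1), sq_nonneg (n*√z)]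
      _ ≤ 8 * (1/√z) := by
          rw [← mul_sum]
          exact mul_le_mul (by linarith [exp_one_lt_d9]) (exp_geo _ hs N) ¶ ¤
      _ = 8 * z^½ := by rw [sqrt_eq_rpow, rpow_neg hz.le, one_div]
      _ ≤ _ := by gcongr 8 * ?_; exact rpow_le_rpow_of_exponent_ge hz h (by linarith)
  · calc _ ≤ ∑ n ∈ Icc 1 N, exp (-(n*z)) := sum_le_sum fun n hn => by
          rw [exp_le_exp]
          have : §1 ≤ n := mod_cast (mem_Icc.1 hn).1
          nlinarith [mul_pos hz hz, mul_nonneg (by linarith : §0 ≤ n-1) hz.le, mul_nonneg (sq_nonneg §n) hz.le]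
      _ ≤ 1/z := exp_geo z hz N
      _ = z^(-1:ℝ) := by rw [rpow_neg_one, one_div]
      _ ≤ z^(-(1/2+η)) := rpow_le_rpow_of_exponent_le h £
      _ ≤ _ := by linarith [rpow_pos_of_pos hz (-(1/2+η))]

def det2 (s t : ℤ × ℤ) : ℤ := s.1*t.2 - s.2*t.1
def mx (s : ℤ × ℤ) : ℕ := max s.1.natAbs s.2.natAbs

theorem det_zero (s t : ℤ × ℤ) (hs : IsCoprime s.1 s.2) (ht : IsCoprime t.1 t.2) (h : det2 s t = 0) : t = s ∨ t = -s := by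
  obtain ⟨p, q, hpq⟩ := hs
  unfold det2 at h
  have h1 : t.1 = s.1*(p*t.1+q*t.2) := by linear_combination (-t.1)*hpq - q*h
  have h2 : t.2 = s.2*(p*t.1+q*t.2) := by linear_combination (-t.2)*hpq + p*h
  have hu : IsUnit (p*t.1+q*t.2) := ht.isUnit_of_dvd' ⟨_, h1.trans (mul_comm _ _)⟩ ⟨_, h2.trans (mul_comm _ _)⟩
  rcases Int.isUnit_iff.1 hu with e | e <;> rw [e] at h1 h2
  · exact Or.inl (Prod.ext £ £)
  · exact Or.inr (Prod.ext (by rw [Prod.fst_neg]; linarith) (by rw [Prod.snd_neg]; linarith))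

theorem slope_count (T : Finset (ℤ × ℤ)) (d r : ℕ) (hd : 0 < d) (hc : ∀ s ∈ T, IsCoprime s.1 s.2)
    (hT : ∀ s ∈ T, ∀ t ∈ T, ¥d ∣ det2 s t) (hr : ∀ s ∈ T, mx s ≤ r) : §T.card ≤ 8 * (§r^2/d + 1) := by
  have hd' : §0 < d := mod_cast hd
  set ρ : ℝ := §r^2/d with hρ
  have hρ0 : 0 ≤ ρ := by positivity
  set sl : ℤ × ℤ → ℝ := fun s => if |s.2| ≤ |s.1| then §s.2/s.1 else §s.1/s.2 with hsl
  set F : ℤ × ℤ → (Bool × Bool) × ℤ := fun s => ((decide (|s.2| ≤ |s.1|), decide (0 < (if |s.2| ≤ |s.1| then s.1 else s.2))), ⌊sl s * ρ⌋) with hF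
  have hmaps : ∀ s ∈ T, F s ∈ (univ : Finset (Bool × Bool)) ×ˢ Icc (-(⌊ρ⌋+1)) ⌊ρ⌋ := by
    intro s hs
    have hb : |sl s| ≤ 1 := by
      simp only [hsl]; split_ifs with h
      · rw [abs_div]; exact div_le_one_of_le₀ (by exact_mod_cast h) (abs_nonneg _)
      · rw [abs_div]; exact div_le_one_of_le₀ (by exact_mod_cast (not_le.1 h).le) (abs_nonneg _)
    rw [abs_le] at hb
    refine mem_product.2 ⟨mem_univ _, mem_Icc.2 ⟨◌, Int.floor_le_floor (by nlinarith)⟩⟩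
    rw [Int.le_floor]; push_cast
    nlinarith [Int.lt_floor_add_one ρ]
  have key : ∀ x y x' y' : ℤ, x ≠ 0 → x' ≠ 0 → |x| ≤ r → |x'| ≤ r → ⌊§y/x*ρ⌋ = ⌊§y'/x'*ρ⌋ → ¥d ∣ x*y'-y*x' → x*y'-y*x' = 0 := by
    intro x y x' y' hx hx' hxr hxr' hfl hdv
    have h1 := Int.abs_sub_lt_one_of_floor_eq_floor hfl
    have hxR : §x ≠ 0 := mod_cast hx
    have hxR' : §x' ≠ 0 := mod_cast hx'
    refine Int.eq_zero_of_abs_lt_dvd hdv ◌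
    have e : §y/x*ρ - §y'/x'*ρ = -(x*y'-y*x') * ρ / (x*x') := by field_simp; ring
    rw [e, abs_div, div_lt_one ¶, abs_mul, abs_neg, abs_of_nonneg hρ0, abs_mul] at h1
    have b1 : |§x| ≤ r := mod_cast hxr
    have b2 : |§x'| ≤ r := mod_cast hxr'
    have h2 : |(§x*y'-y*x')| * ρ < d * ρ := by
      rw [hρ, mul_div_cancel₀ _ hd'.ne', ← hρ, sq]
      exact h1.trans_le (mul_le_mul b1 b2 (abs_nonneg _) ¶)
    exact_mod_cast lt_of_mul_lt_mul_right h2 hρ0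
  have hinj : Set.InjOn F T := by
    intro s hs t ht h
    simp only [hF, Prod.mk.injEq, decide_eq_decide] at h
    obtain ⟨⟨h1, h2⟩, h3⟩ := h
    have bs := max_le_iff.1 (hr s hs); have bt := max_le_iff.1 (hr t ht)
    have ns : ¬(s.1 = 0 ∧ s.2 = 0) := fun h => by have := hc s hs; rw [h.1, h.2] at this; exact absurd this not_isCoprime_zero_zero
    have nt : ¬(t.1 = 0 ∧ t.2 = 0) := fun h => by have := hc t ht; rw [h.1, h.2] at this; exact absurd this not_isCoprime_zero_zero
    have hdet : det2 s t = 0 := by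
      by_cases hle : |s.2| ≤ |s.1|
      · have hle' := h1.1 hle
        simp only [hsl, if_pos hle, if_pos hle'] at h3
        exact key _ _ _ _ (fun h => ns ⟨h, by rwa [h, abs_zero, abs_nonpos_iff] at hle⟩) (fun h => nt ⟨h, by rwa [h, abs_zero, abs_nonpos_iff] at hle'⟩) (by rw [Int.abs_eq_natAbs]; omega) (by rw [Int.abs_eq_natAbs]; omega) h3 (hT s hs t ht)
      · have hle' : ¬ |t.2| ≤ |t.1| := fun h => hle (h1.2 h)
        simp only [hsl, if_neg hle, if_neg hle'] at h3
        have := key s.2 s.1 t.2 t.1 (fun h => hle (by rw [h, abs_zero]; exact abs_nonneg _)) (fun h => hle' (by rw [h, abs_zero]; exact abs_nonneg _)) (by rw [Int.abs_eq_natAbs]; omega) (by rw [Int.abs_eq_natAbs]; omega) h3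
          (by have := hT s hs t ht; rw [← dvd_neg] at this; unfold det2 at this; rwa [show -(s.1*t.2-s.2*t.1) = s.2*t.1-s.1*t.2 by ring] at this)
        unfold det2; linarith
    rcases det_zero s t (hc s hs) (hc t ht) hdet with e | e
    · exact e.symm
    · rw [e, Prod.fst_neg, Prod.snd_neg] at h2
      exfalso; simp only [abs_neg] at h2
      split_ifs at h2 with hle
      · have : s.1 ≠ 0 := fun h => ns ⟨h, by rwa [h, abs_zero, abs_nonpos_iff] at hle⟩
        omega
      · have : s.2 ≠ 0 := fun h => hle (by rw [h, abs_zero]; exact abs_nonneg _)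
        omega
  have := card_le_card_of_injOn F (fun s hs => hmaps s hs) hinj
  rw [card_product, Int.card_Icc] at this
  have h4 : ((⌊ρ⌋ + 1 - -(⌊ρ⌋+1)).toNat : ℤ) = 2*⌊ρ⌋+2 := by
    have := Int.floor_nonneg.2 hρ0; omega
  have h5 : ¥T.card ≤ 4 * (2*⌊ρ⌋+2) := by rw [← h4]; exact_mod_cast this
  have h6 : §T.card ≤ 4 * (2*⌊ρ⌋+2) := mod_cast h5
  linarith [Int.floor_le ρ]

theorem prim_sum (T : Finset (ℤ × ℤ)) (d : ℕ) (hd : 0 < d) (Y η : ℝ) (hY : 1 ≤ Y) (h0 : 0 < η) (h1 : η ≤ 1/2) (hc : ∀ s ∈ T, IsCoprime s.1 s.2)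
    (hT : ∀ s ∈ T, ∀ t ∈ T, ¥d ∣ det2 s t) (hr : ∀ s ∈ T, Y ≤ mx s) :
    ∑ s ∈ T, §(mx s)^(-(2+2*η)) ≤ 64/(d*η) + 32/Y := by
  have hd' : §0 < d := mod_cast hd
  obtain ⟨K, hK⟩ : ∃ K, ∀ s ∈ T, Nat.log 2 (mx s) < K := ⟨T.sup (fun s => Nat.log 2 (mx s)) + 1, fun s hs => Nat.lt_succ_of_le (le_sup (f := fun s => Nat.log 2 (mx s)) hs)⟩
  rw [← sum_fiberwise_of_maps_to (t := range K) (g := fun s => Nat.log 2 (mx s)) (fun s hs => mem_range.2 (hK s hs))]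
  have fib : ∀ k ∈ range K, ∑ s ∈ T.filter (fun s => Nat.log 2 (mx s) = k), §(mx s)^(-(2+2*η)) ≤ 32/d * exp (-(k*η)) + 16/Y * (1/2)^k := by
    intro k _
    set U := T.filter (fun s => Nat.log 2 (mx s) = k)
    have hpos : ∀ s ∈ T, 0 < mx s := fun s hs => by have := hr s hs; exact_mod_cast (by linarith : §0 < mx s)
    have hlo : ∀ s ∈ U, 2^k ≤ mx s := fun s hs => (mem_filter.1 hs).2 ▸ Nat.pow_log_le_self 2 (hpos s (mem_filter.1 hs).1).ne'
    have hhi : ∀ s ∈ U, mx s < 2^(k+1) := fun s hs => (mem_filter.1 hs).2 ▸ Nat.lt_pow_succ_log_self ¤ _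
    rcases U.eq_empty_or_nonempty with h | ⟨s0, hs0⟩
    · rw [h, sum_empty]; positivity
    have hcard := slope_count U d (2^(k+1)) hd (fun s hs => hc s (mem_filter.1 hs).1) (fun s hs t ht => hT s (mem_filter.1 hs).1 t (mem_filter.1 ht).1) (fun s hs => (hhi s hs).le)
    have hYk : Y ≤ 2 * 2^k := by
      have h2 := (hr s0 (mem_filter.1 hs0).1).trans (Nat.cast_le.2 (hhi s0 hs0).le)
      push_cast at h2; rw [pow_succ] at h2; linarith
    have hterm : ∀ s ∈ U, §(mx s)^(-(2+2*η)) ≤ (1/4)^k * exp (-(k*η)) := fun s hs => by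
      calc §(mx s)^(-(2+2*η)) ≤ (§2^k)^(-(2+2*η)) := rpow_le_rpow_of_nonpos ¶ (by exact_mod_cast hlo s hs) £
        _ = (1/4)^k * (§2^k)^(-(2*η)) := by
            rw [neg_add, rpow_add ¶, rpow_neg ¶, rpow_two, one_div, inv_pow, ← pow_mul, mul_comm k 2, pow_mul]; norm_num
        _ ≤ _ := by
            gcongr
            rw [← rpow_natCast, ← rpow_mul ¤, rpow_def_of_pos ¤, exp_le_exp]
            nlinarith [log_two_gt_d9, mul_nonneg (Nat.cast_nonneg (α := ℝ) k) h0.le]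
    calc _ ≤ U.card * ((1/4)^k * exp (-(k*η))) := by
          rw [← nsmul_eq_mul]; exact sum_le_card_nsmul _ _ _ hterm
      _ ≤ (8 * (((2^(k+1):ℕ):ℝ)^2/d + 1)) * ((1/4)^k * exp (-(k*η))) := by gcongr
      _ = 32/d * exp (-(k*η)) * (4^k * (1/4)^k) + 8 * ((1/2)^k * (1/2)^k) * exp (-(k*η)) := by
          push_cast
          rw [show (§2^(k+1))^2 = 4*4^k by rw [← pow_mul, mul_comm, pow_mul, pow_succ]; norm_num; ring, ← mul_pow (1/2:ℝ)]; norm_num; ring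
      _ ≤ _ := by
          rw [← mul_pow]; norm_num
          have : §8 * (1/2)^k ≤ 16/Y := by
            rw [le_div_iff₀ £]
            calc §8*(1/2)^k*Y ≤ 8*(1/2)^k*(2*2^k) := by gcongr
              _ = 16 * ((1/2)^k*2^k) := by ring
              _ = 16 := by rw [← mul_pow]; norm_num
          calc 8 * ((1/2:ℝ)^k * (1/2)^k) * exp (-(k*η)) ≤ 8 * ((1/2:ℝ)^k * (1/2)^k) * 1 := by
                gcongr; rw [exp_le_one_iff]; have : 0 ≤ §k*η := by positivity
                linarith
            _ = 8 * (1/2)^k * (1/2)^k := by ring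
            _ ≤ _ := by gcongr
  refine (sum_le_sum fib).trans ◌
  rw [sum_add_distrib, ← mul_sum, ← mul_sum]
  have g1 : ∑ k ∈ range K, exp (-(k*η)) ≤ 2/η := by
    have := exp_geo η h0 K
    have h2 : ∑ k ∈ range K, exp (-(k*η)) ≤ ∑ k ∈ insert 0 (Icc 1 K), exp (-(k*η)) :=
      sum_le_sum_of_subset_of_nonneg (fun k hk => by rw [mem_range] at hk; rw [mem_insert, mem_Icc]; omega) fun _ _ _ => by positivity
    rw [sum_insert (by simp)] at h2
    simp only [Nat.cast_zero, zero_mul, neg_zero, exp_zero] at h2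
    have : 1 ≤ 1/η := by rw [one_le_div h0]; linarith
    have : 2/η = 1/η+1/η := by ring
    linarith
  have g2 : ∑ k ∈ range K, (1/2:ℝ)^k ≤ 2 := (summable_geometric_two.sum_le_tsum _ (fun _ _ => by positivity)).trans_eq tsum_geometric_two
  calc _ ≤ 32/d * (2/η) + 16/Y * 2 := by gcongr
    _ = _ := by field_simp; ring
end

section
open Finset Real

def gs (c : Circ) (s : ℤ × ℤ) : ℕ := Int.gcd (c.A*s.1+c.B*s.2) (c.B*s.1+c.C*s.2)

theorem gs_det (c : Circ) (s t : ℤ × ℤ) (d : ℕ) (h1 : d ∣ gs c s) (h2 : d ∣ gs c t) : ¥d ∣ det2 s t := by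
  have a1 := (Int.natCast_dvd_natCast.2 h1).trans (Int.gcd_dvd_left _ _)
  have a2 := (Int.natCast_dvd_natCast.2 h1).trans (Int.gcd_dvd_right _ _)
  have b1 := (Int.natCast_dvd_natCast.2 h2).trans (Int.gcd_dvd_left _ _)
  have b2 := (Int.natCast_dvd_natCast.2 h2).trans (Int.gcd_dvd_right _ _)
  have e1 : ¥d ∣ det2 s t * c.A := by
    have := dvd_sub (a1.mul_right t.2) (b1.mul_right s.2)
    rwa [show (c.A*s.1+c.B*s.2)*t.2 - (c.A*t.1+c.B*t.2)*s.2 = det2 s t * c.A by unfold det2; ring] at this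
  have e2 : ¥d ∣ det2 s t * c.B := by
    have := dvd_sub (b1.mul_right s.1) (a1.mul_right t.1)
    rwa [show (c.A*t.1+c.B*t.2)*s.1 - (c.A*s.1+c.B*s.2)*t.1 = det2 s t * c.B by unfold det2; ring] at this
  have e3 : ¥d ∣ det2 s t * c.C := by
    have := dvd_sub (b2.mul_right s.1) (a2.mul_right t.1)
    rwa [show (c.B*t.1+c.C*t.2)*s.1 - (c.B*s.1+c.C*s.2)*t.1 = det2 s t * c.C by unfold det2; ring] at this
  have hg : Int.gcd (Int.gcd c.A c.B) c.C = 1 := by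
    by_contra hne
    obtain ⟨p, hp, hpd⟩ := Nat.exists_prime_and_dvd hne
    have h := Int.natCast_dvd_natCast.2 hpd
    have h3 := h.trans (Int.gcd_dvd_left _ _)
    exact c.pr p (Nat.prime_iff_prime_int.1 hp) ⟨h3.trans (Int.gcd_dvd_left _ _), h3.trans (Int.gcd_dvd_right _ _), h.trans (Int.gcd_dvd_right _ _)⟩
  have h4 := Int.dvd_coe_gcd e1 e2
  rw [Int.gcd_mul_left] at h4; push_cast at h4
  have h5 : ¥d ∣ det2 s t * Int.gcd c.A c.B := by
    rw [← dvd_abs, abs_mul, abs_abs, ← abs_mul, dvd_abs] at h4; exact h4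
  have h6 := Int.dvd_coe_gcd h5 e3
  rw [Int.gcd_mul_left, hg, mul_one, Int.natCast_natAbs, dvd_abs] at h6
  exact h6

theorem gs_dvd (c : Circ) (s : ℤ × ℤ) (h : IsCoprime s.1 s.2) : gs c s ∣ (c.a^2).natAbs := by
  obtain ⟨p, q, hpq⟩ := h
  rw [← Int.natCast_dvd, ← c.hd]
  have a1 : (gs c s:ℤ) ∣ _ := Int.gcd_dvd_left _ _
  have a2 : (gs c s:ℤ) ∣ _ := Int.gcd_dvd_right (c.A*s.1+c.B*s.2) _
  have := dvd_add (a1.mul_right (p*c.C-q*c.B)) (a2.mul_right (q*c.A-p*c.B))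
  rwa [show (c.A*s.1+c.B*s.2)*(p*c.C-q*c.B) + (c.B*s.1+c.C*s.2)*(q*c.A-p*c.B) = c.A*c.C-c.B^2 by linear_combination (c.A*c.C-c.B^2)*hpq] at this

theorem gcd3 (x y z n : ℕ) (hx : x ∣ n) (hy : y ∣ n) (hz : z ∣ n) : x*y*z ∣ n * (x.gcd y * (x.gcd z * y.gcd z)) := by
  have h1 : (x.lcm y).gcd z ∣ x.gcd z * y.gcd z := by
    refine (Nat.gcd_dvd_gcd_of_dvd_left z (Nat.lcm_dvd_mul x y)).trans ◌
    rw [Nat.gcd_comm, Nat.gcd_comm x, Nat.gcd_comm y]; exact Nat.gcd_mul_right_dvd_mul_gcd z x y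
  have h2 : (x.lcm y).lcm z ∣ n := Nat.lcm_dvd (Nat.lcm_dvd hx hy) hz
  rw [← Nat.gcd_mul_lcm x y, mul_assoc, ← Nat.gcd_mul_lcm (x.lcm y) z, mul_left_comm n]
  refine Nat.mul_dvd_mul_left _ ◌
  rw [mul_comm]; exact Nat.mul_dvd_mul h2 h1

theorem gs_small (c : Circ) (ha : 64 ≤ c.a) (S : Finset (ℤ × ℤ)) (hc : ∀ s ∈ S, IsCoprime s.1 s.2) (hn : ∀ s ∈ S, ∀ t ∈ S, t = -s → t = s)
    (hg : ∀ s ∈ S, §c.a^(9/10:ℝ) < gs c s) (hY : ∀ s ∈ S, §(mx s) ≤ §c.a^(1/40:ℝ)) : S.card ≤ 2 := by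
  by_contra! h
  obtain ⟨s, hs, t, ht, u, hu, h1, h2, h3⟩ := two_lt_card.1 h
  have haR : §64 ≤ c.a := mod_cast ha
  set Y := §c.a^(1/40:ℝ)
  have pr : ∀ s ∈ S, ∀ t ∈ S, s ≠ t → (((gs c s).gcd (gs c t) : ℕ):ℝ) ≤ 2*Y^2 := by
    intro s hs t ht hne
    have hdv := gs_det c s t _ (Nat.gcd_dvd_left _ _) (Nat.gcd_dvd_right (gs c s) (gs c t))
    have hnz : det2 s t ≠ 0 := fun h => by
      rcases det_zero s t (hc s hs) (hc t ht) h with e | e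
      · exact hne e.symm
      · exact hne (hn s hs t ht e).symm
    have hle := Int.le_of_dvd (abs_pos.2 hnz) ((dvd_abs _ _).2 hdv)
    have hle' : (((gs c s).gcd (gs c t) : ℕ):ℝ) ≤ |(§s.1*t.2 - s.2*t.1)| := by unfold det2 at hle; exact_mod_cast hle
    have bd : ∀ s ∈ S, |§s.1| ≤ Y ∧ |§s.2| ≤ Y := fun s hs => by
      have h := hY s hs
      rw [mx, Nat.cast_max, max_le_iff, Nat.cast_natAbs, Nat.cast_natAbs] at h; exact_mod_cast h
    have h4 := mul_le_mul (bd s hs).1 (bd t ht).2 (abs_nonneg _) ¶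
    have h5 := mul_le_mul (bd s hs).2 (bd t ht).1 (abs_nonneg _) ¶
    rw [← abs_mul] at h4 h5
    have := abs_sub (§s.1*t.2) (s.2*t.1)
    linarith
  have ha2 : 0 < (c.a^2).natAbs := by have : c.a ≠ 0 := by omega
                                      positivity
  have hprod := Nat.le_of_dvd (Nat.mul_pos ha2 (by
    have := fun s hs => Nat.pos_of_dvd_of_pos (gs_dvd c s (hc s hs)) ha2
    have a := Nat.gcd_pos_of_pos_left (gs c t) (this s hs); have b := Nat.gcd_pos_of_pos_left (gs c u) (this s hs)
    have d := Nat.gcd_pos_of_pos_left (gs c u) (this t ht); positivity)) (gcd3 _ _ _ _ (gs_dvd c s (hc s hs)) (gs_dvd c t (hc t ht)) (gs_dvd c u (hc u hu)))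
  have hprod' : ((gs c s:ℝ) * gs c t * gs c u) ≤ §c.a^2 * (((gs c s).gcd (gs c t) : ℕ) * (((gs c s).gcd (gs c u) : ℕ) * ((gs c t).gcd (gs c u) : ℕ))) := by
    have : (((c.a^2).natAbs : ℕ):ℝ) = §c.a^2 := by rw [Nat.cast_natAbs, abs_of_nonneg ¶]; push_cast; rfl
    rw [← this]; exact_mod_cast hprod
  have hl : §c.a^(9/10:ℝ) * §c.a^(9/10:ℝ) * §c.a^(9/10:ℝ) < (gs c s:ℝ) * gs c t * gs c u := by
    gcongr
    exacts [hg s hs, hg t ht, hg u hu]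
  have hu' : §c.a^2 * (((gs c s).gcd (gs c t) : ℕ) * (((gs c s).gcd (gs c u) : ℕ) * ((gs c t).gcd (gs c u) : ℕ))) ≤ §c.a^2 * ((2*Y^2)*((2*Y^2)*(2*Y^2))) := by
    gcongr
    exacts [pr s hs t ht h1, pr s hs u hu h2, pr t ht u hu h3]
  have a0 : §0 < c.a := by linarith
  have e1 : §c.a^(9/10:ℝ) * §c.a^(9/10:ℝ) * §c.a^(9/10:ℝ) = §c.a^2 * (§c.a^(1/2:ℝ) * §c.a^(1/5:ℝ)) := by
    rw [← rpow_natCast, ← rpow_add a0, ← rpow_add a0, ← rpow_add a0, ← rpow_add a0]; norm_num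
  have e2 : (2*Y^2)*((2*Y^2)*(2*Y^2)) = 8 * §c.a^(3/20:ℝ) := by
    rw [show (2*Y^2)*((2*Y^2)*(2*Y^2)) = 8*Y^6 by ring, ← rpow_natCast Y, ← rpow_mul a0.le]; norm_num
  have e3 : §8 ≤ §c.a^(1/2:ℝ) := by
    rw [← sqrt_eq_rpow]; exact le_sqrt_of_sq_le £
  have e4 : §c.a^(3/20:ℝ) ≤ §c.a^(1/5:ℝ) := rpow_le_rpow_of_exponent_le £ ¤
  have e5 : §c.a^2 * (8 * §c.a^(3/20:ℝ)) ≤ §c.a^2 * (§c.a^(1/2:ℝ) * §c.a^(1/5:ℝ)) := by gcongr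
  rw [e1] at hl; rw [e2] at hu'; linarith

theorem gs_sum : ∃ C : ℝ, 0 < C ∧ ∀ c : Circ, 64 ≤ c.a → ∀ η : ℝ, 0 < η → η ≤ 1/2 → 1/η ≤ §c.a^(1/20:ℝ) → ∀ T : Finset (ℤ × ℤ),
    (∀ s ∈ T, IsCoprime s.1 s.2) → (∀ s ∈ T, (gs c s:ℤ) ≤ c.a) → ∑ s ∈ T, (gs c s:ℝ)/c.a * §(mx s)^(-(2+2*η)) ≤ C := by
  obtain ⟨D, hD, hdiv⟩ := div_bound (1/200) ¤
  refine ⟨96 + 4 + D*96, by linarith, fun c ha η h0 h1 hη T hc hg => ◌⟩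
  have haR : §64 ≤ c.a := mod_cast ha
  have a0 : §0 < c.a := by linarith
  set a : ℝ := (¥c.a:ℝ) with haa
  set Y := a^(1/40:ℝ) with hYd
  have hY1 : 1 ≤ Y := one_le_rpow £ ¤
  have hm1 : ∀ s ∈ T, §1 ≤ mx s := fun s hs => by
    have : mx s ≠ 0 := fun h => by
      have h' := max_le_iff.1 h.le
      have := hc s hs
      rw [Int.natAbs_eq_zero.1 (Nat.le_zero.1 h'.1), Int.natAbs_eq_zero.1 (Nat.le_zero.1 h'.2)] at this
      exact not_isCoprime_zero_zero this
    exact_mod_cast Nat.one_le_iff_ne_zero.2 this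
  have hga : ∀ s ∈ T, (gs c s:ℝ)/a ≤ 1 := fun s hs => by rw [div_le_one a0, haa]; exact_mod_cast hg s hs
  set F : ℤ × ℤ → ℝ := fun s => (gs c s:ℝ)/a * §(mx s)^(-(2+2*η)) with hF
  have hF1 : ∀ s ∈ T, F s ≤ 1 := fun s hs => mul_le_one₀ (hga s hs) ¶ (rpow_le_one_of_one_le_of_nonpos (hm1 s hs) £)
  rw [← sum_filter_add_sum_filter_not T (fun s => (gs c s:ℝ) ≤ a^(9/10:ℝ)), ← sum_filter_add_sum_filter_not (T.filter fun s => ¬ (gs c s:ℝ) ≤ a^(9/10:ℝ)) (fun s => §(mx s) ≤ Y), ← add_assoc]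
  refine add_le_add (add_le_add ◌ ◌) ◌
  · calc _ ≤ ∑ s ∈ T.filter (fun s => (gs c s:ℝ) ≤ a^(9/10:ℝ)), a^(-(1/10):ℝ) * §(mx s)^(-(2+2*η)) := by
          refine sum_le_sum fun s hs => ◌
          gcongr
          rw [div_le_iff₀ a0, ← rpow_add_one a0.ne']
          refine (mem_filter.1 hs).2.trans (le_of_eq ◌); norm_num
      _ ≤ a^(-(1/10):ℝ) * (64/((1:ℕ)*η)+32/1) := by
          rw [← mul_sum]
          gcongr
          exact prim_sum _ 1 one_pos 1 η le_rfl h0 h1 (fun s hs => hc s (mem_filter.1 hs).1) (fun s _ t _ => by simp) (fun s hs => hm1 s (mem_filter.1 hs).1)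
      _ ≤ a^(-(1/10):ℝ) * (96 * a^(1/20:ℝ)) := by
          gcongr
          have : §1 ≤ a^(1/20:ℝ) := one_le_rpow £ ¤
          rw [Nat.cast_one, one_mul, show 64/η = 64*(1/η) by ring]; linarith
      _ = 96 * a^(-(1/20):ℝ) := by rw [mul_left_comm, ← rpow_add a0]; norm_num
      _ ≤ 96 * 1 := by gcongr; exact rpow_le_one_of_one_le_of_nonpos £ ¤
      _ = 96 := by norm_num
  · set S := (T.filter fun s => ¬ (gs c s:ℝ) ≤ a^(9/10:ℝ)).filter (fun s => §(mx s) ≤ Y) with hS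
    have hST : ∀ s ∈ S, s ∈ T := fun s hs => (mem_filter.1 (mem_filter.1 hs).1).1
    have hcard : S.card ≤ 4 := by
      rw [← card_filter_add_card_filter_not (s := S) (fun s => 0 < s.1 ∨ s.1 = 0 ∧ 0 < s.2)]
      have := fun (p : ℤ × ℤ → Prop) [DecidablePred p] (hp : ∀ s, p s → p (-s) → -s = s) => gs_small c ha (S.filter p) (fun s hs => hc s (hST s (mem_filter.1 hs).1))
        (fun s hs t ht h => by have h3 := (mem_filter.1 ht).2; rw [h] at h3 ⊢; exact hp s (mem_filter.1 hs).2 h3) (fun s hs => not_le.1 (mem_filter.1 (mem_filter.1 (mem_filter.1 hs).1).1).2) (fun s hs => (mem_filter.1 (mem_filter.1 hs).1).2)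
      have A := this (fun s => 0 < s.1 ∨ s.1 = 0 ∧ 0 < s.2) (fun s h h' => by rw [Prod.fst_neg, Prod.snd_neg] at h'; omega)
      have B := this (fun s => ¬(0 < s.1 ∨ s.1 = 0 ∧ 0 < s.2)) (fun s h h' => by
        rw [Prod.fst_neg, Prod.snd_neg] at h'; exact Prod.ext (by rw [Prod.fst_neg]; omega) (by rw [Prod.snd_neg]; omega))
      omega
    calc ∑ s ∈ S, F s ≤ S.card • §1 := sum_le_card_nsmul _ _ _ fun s hs => hF1 s (hST s hs)
      _ ≤ 4 := by rw [nsmul_eq_mul, mul_one]; exact_mod_cast hcard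
  · set S := (T.filter fun s => ¬ (gs c s:ℝ) ≤ a^(9/10:ℝ)).filter (fun s => ¬§(mx s) ≤ Y) with hS
    have hST : ∀ s ∈ S, s ∈ T := fun s hs => (mem_filter.1 (mem_filter.1 hs).1).1
    have hn0 : (c.a^2).natAbs ≠ 0 := Int.natAbs_ne_zero.2 (pow_ne_zero 2 c.ha.ne')
    rw [← sum_fiberwise_of_maps_to (t := (c.a^2).natAbs.divisors) (g := gs c) (fun s hs => Nat.mem_divisors.2 ⟨gs_dvd c s (hc s (hST s hs)), hn0⟩)]
    have hdd : ((c.a^2).natAbs.divisors.card:ℝ) ≤ D * a^(1/100:ℝ) := by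
      refine (hdiv _ hn0).trans (le_of_eq ◌)
      rw [Nat.cast_natAbs, abs_of_nonneg ¶]; push_cast
      rw [← rpow_natCast, ← rpow_mul a0.le]; norm_num
    have fib : ∀ d ∈ (c.a^2).natAbs.divisors, ∑ s ∈ S.filter (fun s => gs c s = d), F s ≤ 96 * a^(-(1/40):ℝ) := by
      intro d hd
      have hd0 : 0 < d := Nat.pos_of_mem_divisors hd
      have hdR : §0 < d := mod_cast hd0
      rcases (S.filter (fun s => gs c s = d)).eq_empty_or_nonempty with h | ⟨s0, hs0⟩
      · rw [h, sum_empty]; positivity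
      have hda : §d/a ≤ 1 := by rw [← (mem_filter.1 hs0).2]; exact hga s0 (hST _ (mem_filter.1 hs0).1)
      calc _ = d/a * ∑ s ∈ S.filter (fun s => gs c s = d), §(mx s)^(-(2+2*η)) := by
            rw [mul_sum]; exact sum_congr rfl fun s hs => by simp only [hF]; rw [(mem_filter.1 hs).2]
        _ ≤ d/a * (64/(d*η)+32/Y) := by
            gcongr
            exact prim_sum _ d hd0 Y η hY1 h0 h1 (fun s hs => hc s (hST s (mem_filter.1 hs).1)) (fun s hs t ht => gs_det c s t d (by rw [(mem_filter.1 hs).2]) (by rw [(mem_filter.1 ht).2]))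
              (fun s hs => (not_le.1 (mem_filter.1 (mem_filter.1 hs).1).2).le)
        _ = 64 * (1/η) * a^(-1:ℝ) + d/a*(32 * a^(-(1/40):ℝ)) := by
            rw [rpow_neg_one, rpow_neg a0.le, ← hYd]; field_simp
        _ ≤ 64 * a^(1/20:ℝ) * a^(-1:ℝ) + 1*(32 * a^(-(1/40):ℝ)) := by gcongr
        _ ≤ 64 * a^(-(1/40):ℝ) + 1*(32 * a^(-(1/40):ℝ)) := by
            rw [mul_assoc, ← rpow_add a0]
            gcongr
            · linarith
            · norm_num
        _ = _ := by ring
    refine (sum_le_card_nsmul _ _ _ fib).trans ◌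
    rw [nsmul_eq_mul]
    calc _ ≤ (D * a^(1/100:ℝ)) * (96 * a^(-(1/40):ℝ)) := by gcongr
      _ = D*96 * a^(-(3/200):ℝ) := by rw [show (D * a^(1/100:ℝ)) * (96 * a^(-(1/40):ℝ)) = D*96*(a^(1/100:ℝ)*a^(-(1/40):ℝ)) by ring, ← rpow_add a0]; norm_num
      _ ≤ D*96*1 := by gcongr; exact rpow_le_one_of_one_le_of_nonpos £ ¤
      _ = _ := by ring
end

section
open Finset MeasureTheory Real

theorem inj_sum {α β : Type*} [DecidableEq β] (E : Finset α) (B : Finset β) (φ : α → β) (G : β → ℝ) (hG : ∀ b, 0 ≤ G b)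
    (hφ : ∀ x ∈ E, φ x ∈ B) (hi : ∀ x ∈ E, ∀ y ∈ E, φ x = φ y → x = y) : ∑ x ∈ E, G (φ x) ≤ ∑ b ∈ B, G b := by
  rw [← sum_image (f := G) (fun x hx y hy h => hi x hx y hy h)]
  exact sum_le_sum_of_subset_of_nonneg (image_subset_iff.2 hφ) fun b _ _ => hG b

theorem sgn_inj (x y : ℤ) (h1 : x.natAbs = y.natAbs) (h2 : decide (0 < x) = decide (0 < y)) : x = y := by
  rw [decide_eq_decide] at h2; omega

structure Circ.Red (c : Circ) : Prop where
  h64 : 64 ≤ c.a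
  h1 : c.a ≤ 2*c.A
  h2 : c.A ≤ c.a
  h3 : |2*c.B| ≤ c.A

theorem Circ.Red.low {c : Circ} (h : c.Red) (s : ℤ × ℤ) : §c.a/4 * §(mx s)^2 ≤ c.f s := by
  have hC : c.a ≤ c.C := by
    have := c.hd; have := h.h2; have := c.ha; have := c.hA
    by_contra hlt
    nlinarith [sq_nonneg c.B]
  have key : ∀ x y : ℤ, c.a * x^2 ≤ 4 * qf c.A c.B c.C x y ∧ c.a * y^2 ≤ 4 * qf c.A c.B c.C x y := by
    intro x y
    have hb := abs_le.1 (h.h3)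
    have := h.h1; have := h.h2; have := c.ha
    have h1 : -(c.A * |x*y|) ≤ 2*c.B*(x*y) := by
      have := neg_abs_le (2*c.B*(x*y)); rw [abs_mul] at this
      linarith [mul_le_mul_of_nonneg_right h.h3 (abs_nonneg (x*y))]
    have h2 : c.A * x^2 - c.A*|x*y| + c.A*y^2 ≤ qf c.A c.B c.C x y := by
      unfold qf; nlinarith [sq_nonneg y]
    rw [abs_mul] at h2
    have e1 := sq_abs x; have e2 := sq_abs y
    have p1 := mul_nonneg c.hA.le (sq_nonneg (2*|y| - |x|))
    have p2 := mul_nonneg c.hA.le (sq_nonneg (2*|x| - |y|))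
    constructor <;> nlinarith [mul_le_mul_of_nonneg_right h.h1 (sq_nonneg x), mul_le_mul_of_nonneg_right h.h1 (sq_nonneg y), mul_nonneg c.hA.le (sq_nonneg x), mul_nonneg c.hA.le (sq_nonneg y)]
  have k2 : ¥c.a * (mx s:ℤ)^2 ≤ 4 * c.f s := by
    rcases max_choice s.1.natAbs s.2.natAbs with e | e <;> rw [mx, e, Int.natAbs_sq]
    exacts [(key s.1 s.2).1, (key s.1 s.2).2]
  have : §c.a * §(mx s)^2 ≤ 4 * c.f s := mod_cast k2
  linarith

def bil (c : Circ) (s t : ℤ × ℤ) : ℤ := (c.A*s.1+c.B*s.2)*t.1 + (c.B*s.1+c.C*s.2)*t.2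
def ta (c : Circ) (s : ℤ × ℤ) : ℤ × ℤ := (-((c.B*s.1+c.C*s.2)/gs c s), (c.A*s.1+c.B*s.2)/gs c s)

theorem ta_spec (c : Circ) (s : ℤ × ℤ) (hs : IsCoprime s.1 s.2) : 0 < gs c s ∧ IsCoprime (ta c s).1 (ta c s).2 ∧ c.f (ta c s) * gs c s^2 = c.a^2 * c.f s ∧
    (gs c s:ℤ) * gs c (ta c s) = c.a^2 ∧ ∀ t, bil c s t = 0 → ∃ k : ℤ, t = k • ta c s := by
  set p := c.A*s.1+c.B*s.2 with hp
  set q := c.B*s.1+c.C*s.2 with hq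
  have hg0 : 0 < gs c s := Nat.pos_of_dvd_of_pos (gs_dvd c s hs) (Int.natAbs_pos.2 (pow_ne_zero 2 c.ha.ne'))
  obtain ⟨α, hα⟩ : (gs c s:ℤ) ∣ p := Int.gcd_dvd_left _ _
  obtain ⟨γ, hγ⟩ : (gs c s:ℤ) ∣ q := Int.gcd_dvd_right _ _
  have hgz : (gs c s:ℤ) ≠ 0 := mod_cast hg0.ne'
  have hta : ta c s = (-γ, α) := by
    unfold ta; rw [← hp, ← hq, hα, hγ, Int.mul_ediv_cancel_left _ hgz, Int.mul_ediv_cancel_left _ hgz]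
  have hco : IsCoprime α γ := by
    rw [Int.isCoprime_iff_gcd_eq_one]
    have : gs c s = gs c s * Int.gcd α γ := by
      conv_lhs => rw [gs, ← hp, ← hq, hα, hγ, Int.gcd_mul_left]
      simp
    exact Nat.eq_of_mul_eq_mul_left hg0 (by rw [← this, mul_one])
  rw [hta]
  refine ⟨hg0, hco.symm.neg_left, ◌, ◌, fun t ht => ◌⟩
  · have : c.f (-γ, α) * (gs c s:ℤ)^2 = qf c.A c.B c.C (-(gs c s*γ)) (gs c s*α) := by unfold Circ.f qf; ring
    rw [this, ← hα, ← hγ, ← c.hd, hp, hq]; unfold Circ.f qf; ring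
  · have h2 : gs c (-γ, α) * gs c s = (c.a^2).natAbs := by
      have e : Int.gcd (c.a^2 * -s.2) (c.a^2 * s.1) = (c.a^2).natAbs := by
        rw [Int.gcd_mul_left, Int.neg_gcd, Int.isCoprime_iff_gcd_eq_one.1 hs.symm, mul_one]
      rw [← e, gs, show (gs c s) = (gs c s:ℤ).natAbs by simp, mul_comm, ← Int.gcd_mul_left, ← c.hd]
      congr 1
      · linear_combination c.A*hγ - c.B*hα + c.A*hq - c.B*hp
      · linear_combination c.B*hγ - c.C*hα + c.B*hq - c.C*hp
    have h3 : ((gs c (-γ, α) * gs c s : ℕ):ℤ) = c.a^2 := by rw [h2, Int.natCast_natAbs, abs_of_nonneg (sq_nonneg _)]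
    rw [mul_comm]; exact_mod_cast h3
  · unfold bil at ht
    rw [← hp, ← hq, hα, hγ] at ht
    have h4 : α*t.1 + γ*t.2 = 0 := mul_left_cancel₀ hgz (by linear_combination ht)
    obtain ⟨x, y, hxy⟩ := hco
    refine ⟨x*t.2-y*t.1, Prod.ext ◌ ◌⟩
    · simp only [Prod.smul_fst, smul_eq_mul]; linear_combination (-t.1)*hxy + x*h4
    · simp only [Prod.smul_snd, smul_eq_mul]; linear_combination (-t.2)*hxy + y*h4

theorem prim_of (s : ℤ × ℤ) (hs : s ≠ 0) : ∃ (m : ℕ) (s0 : ℤ × ℤ), 0 < m ∧ IsCoprime s0.1 s0.2 ∧ s = ¥m • s0 := by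
  have h0 : 0 < Int.gcd s.1 s.2 := Nat.pos_of_ne_zero fun h => hs (Prod.ext (Int.gcd_eq_zero_iff.1 h).1 (Int.gcd_eq_zero_iff.1 h).2)
  refine ⟨Int.gcd s.1 s.2, (s.1/Int.gcd s.1 s.2, s.2/Int.gcd s.1 s.2), h0, ◌, ◌⟩
  · rw [Int.isCoprime_iff_gcd_eq_one]; exact Int.gcd_div_gcd_div_gcd h0
  · exact Prod.ext (Int.mul_ediv_cancel' (Int.gcd_dvd_left _ _)).symm (Int.mul_ediv_cancel' (Int.gcd_dvd_right _ _)).symm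

theorem f_smul (c : Circ) (k : ℤ) (s : ℤ × ℤ) : c.f (k • s) = k^2 * c.f s := by
  unfold Circ.f qf; simp only [Prod.smul_fst, Prod.smul_snd, smul_eq_mul]; ring

noncomputable def ww (c : Circ) (X : ℝ) (s : ℤ × ℤ) : ℝ := exp (-(π * (c.f s / X)))

def lo (c : Circ) (s : ℤ × ℤ) : Prop := ∃ (m : ℕ) (s0 : ℤ × ℤ), 0 < m ∧ IsCoprime s0.1 s0.2 ∧ s = ¥m • s0 ∧ (gs c s0:ℤ) ≤ c.a

theorem half_sum : ∃ C : ℝ, 0 < C ∧ ∀ c : Circ, c.Red → ∀ X : ℝ, 8 ≤ X → log X ≤ §c.a^(1/20:ℝ) → ∀ E : Finset ((ℤ × ℤ) × (ℤ × ℤ)),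
    (∀ x ∈ E, lo c x.1 ∧ x.2 ≠ 0 ∧ bil c x.1 x.2 = 0) → ∑ x ∈ E, ww c X x.1 * ww c X x.2 ≤ C * (X / c.a) := by
  obtain ⟨C, hC, h⟩ := gs_sum
  refine ⟨4096 * C, by positivity, fun c hr X hX hlog E hE => ◌⟩
  have hlX : 2 ≤ log X := by
    rw [le_log_iff_exp_le £]
    have e1 := exp_one_lt_d9
    rw [show §2 = 1+1 by norm_num, exp_add]; nlinarith [exp_pos 1]
  set η := 1/log X with hη
  have hη0 : 0 < η := by positivity
  have hη1 : η ≤ 1/2 := one_div_le_one_div_of_le ¤ hlX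
  have a64 : §64 ≤ c.a := mod_cast hr.h64
  have a0 : §0 < c.a := by linarith
  have ex : ∀ x : ((ℤ × ℤ) × (ℤ × ℤ)), ∃ (m : ℕ) (s0 : ℤ × ℤ) (k : ℤ), x ∈ E → 0 < m ∧ IsCoprime s0.1 s0.2 ∧ (gs c s0:ℤ) ≤ c.a ∧ k ≠ 0 ∧ x = (¥m • s0, k • ta c s0) := by
    intro x
    by_cases hx : x ∈ E
    · obtain ⟨⟨m, s0, hm, hs, e, hg⟩, h2, h3⟩ := hE x hx
      have hb : bil c s0 x.2 = 0 := by
        have : ¥m * bil c s0 x.2 = 0 := by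
          rw [← h3, e]; unfold bil; simp only [Prod.smul_fst, Prod.smul_snd, smul_eq_mul]; ring
        exact (mul_eq_zero.1 this).resolve_left (by exact_mod_cast hm.ne')
      obtain ⟨k, hk⟩ := (ta_spec c s0 hs).2.2.2.2 x.2 hb
      exact ⟨m, s0, k, fun _ => ⟨hm, hs, hg, fun h => h2 (by rw [hk, h, zero_smul]), Prod.ext e hk⟩⟩
    · exact ⟨0, 0, 0, fun h => absurd h hx⟩
  choose m s0 k hx using ex
  set N := E.sup m + E.sup (fun x => (k x).natAbs)
  set G : (ℤ × ℤ) × ℕ × ℕ × Bool → ℝ := fun b => exp (-(π * §b.2.1^2 * (c.f b.1/X))) * exp (-(π * §b.2.2.1^2 * (§c.a^2 * c.f b.1/((gs c b.1:ℝ)^2*X)))) with hG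
  have e1 : ∀ x ∈ E, ww c X x.1 * ww c X x.2 = G (s0 x, m x, (k x).natAbs, decide (0 < k x)) := by
    intro x hxE
    obtain ⟨hm, hs, hg, hk, e⟩ := hx x hxE
    obtain ⟨hg0, -, hf, -⟩ := ta_spec c (s0 x) hs
    have hgR : §0 < gs c (s0 x) := mod_cast hg0
    have hf' : (c.f (ta c (s0 x)):ℝ) = §c.a^2 * c.f (s0 x)/(gs c (s0 x):ℝ)^2 := by
      rw [eq_div_iff ¶]; exact_mod_cast hf
    have e' := congrArg Prod.fst e; have e'' := congrArg Prod.snd e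
    simp only [hG, ww]
    rw [e', e'', f_smul, f_smul]
    push_cast
    rw [hf', Nat.cast_natAbs, Int.cast_abs, sq_abs]
    congr 2 <;> field_simp
  rw [sum_congr rfl e1]
  refine (inj_sum E (E.image s0 ×ˢ Icc 1 N ×ˢ Icc 1 N ×ˢ univ) (fun x => (s0 x, m x, (k x).natAbs, decide (0 < k x))) G (fun b => by positivity) ◌ ◌).trans ◌
  · intro x hxE
    obtain ⟨hm, hs, hg, hk, e⟩ := hx x hxE
    have b1 := le_sup (f := m) hxE
    have b2 := le_sup (f := fun x => (k x).natAbs) hxE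
    simp only [mem_product, mem_Icc, mem_univ, and_true]
    exact ⟨mem_image_of_mem _ hxE, ⟨hm, by omega⟩, by omega, by omega⟩
  · intro x hxE y hyE he
    simp only [Prod.mk.injEq] at he
    rw [(hx x hxE).2.2.2.2, (hx y hyE).2.2.2.2, he.1, he.2.1, sgn_inj _ _ he.2.2.1 he.2.2.2]
  have hT : ∀ s ∈ E.image s0, IsCoprime s.1 s.2 ∧ (gs c s:ℤ) ≤ c.a := fun s hs => by
    obtain ⟨x, hxE, rfl⟩ := mem_image.1 hs; exact ⟨(hx x hxE).2.1, (hx x hxE).2.2.1⟩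
  rw [sum_product]
  have term : ∀ s ∈ E.image s0, ∑ b ∈ Icc 1 N ×ˢ Icc 1 N ×ˢ univ, G (s, b) ≤ 4096 * (X/c.a) * ((gs c s:ℝ)/c.a * §(mx s)^(-(2+2*η))) := by
    intro s hs
    obtain ⟨hs1, hs2⟩ := hT s hs
    have hmx : 0 < mx s := Nat.pos_of_ne_zero fun h => by
      have h' := max_le_iff.1 h.le
      rw [Int.natAbs_eq_zero.1 (Nat.le_zero.1 h'.1), Int.natAbs_eq_zero.1 (Nat.le_zero.1 h'.2)] at hs1
      exact not_isCoprime_zero_zero hs1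
    have hmR : §0 < mx s := mod_cast hmx
    have hgR : §0 < gs c s := mod_cast (ta_spec c s hs1).1
    have hlow := hr.low s
    have hf0 : §0 < c.f s := lt_of_lt_of_le ¶ hlow
    have z1 : 0 < (c.f s:ℝ)/X := by positivity
    have z2 : 0 < §c.a^2 * c.f s/((gs c s:ℝ)^2*X) := by positivity
    have e : ∑ b ∈ Icc 1 N ×ˢ Icc 1 N ×ˢ (univ : Finset Bool), G (s, b) = 2 * ((∑ n ∈ Icc 1 N, exp (-(π * §n^2 * (c.f s/X)))) *
        ∑ n ∈ Icc 1 N, exp (-(π * §n^2 * (§c.a^2 * c.f s/((gs c s:ℝ)^2*X))))) := by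
      rw [sum_product, sum_mul_sum, mul_sum]
      refine sum_congr rfl fun i _ => ◌
      rw [sum_product, mul_sum]
      refine sum_congr rfl fun j _ => ◌
      simp only [hG]; rw [sum_const]; simp
    rw [e]
    have s1 := gauss_sum _ η z1 hη0.le hη1 N
    have s2 := gauss_sum _ 0 z2 le_rfl ¤ N
    have r2 : (§c.a^2 * c.f s/((gs c s:ℝ)^2*X))^(-(1/2+0):ℝ) = gs c s/c.a * ((c.f s:ℝ)/X)^½ := by
      rw [show §c.a^2 * c.f s/((gs c s:ℝ)^2*X) = (c.a/gs c s)^2 * (c.f s/X) by field_simp, mul_rpow ¶ z1.le, add_zero, ← rpow_natCast, ← rpow_mul ¶]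
      norm_num [rpow_neg_one]
    have r3 : ((c.f s:ℝ)/X)^(-(1+η)) ≤ 32 * (X/c.a) * §(mx s)^(-(2+2*η)) := by
      calc ((c.f s:ℝ)/X)^(-(1+η)) ≤ (§c.a/4*§(mx s)^2/X)^(-(1+η)) := rpow_le_rpow_of_nonpos ¶ (by gcongr) £
        _ = §(mx s)^(-(2+2*η)) * ((4/§c.a)^(1+η) * (X * X^η)) := by
            rw [show §c.a/4*§(mx s)^2/X = §(mx s)^2 * ((4/§c.a)⁻¹ * X⁻¹) by field_simp, mul_rpow ¶ ¶, mul_rpow ¶ ¶, inv_rpow ¶, inv_rpow ¶, rpow_neg (x := 4/§c.a) ¶, rpow_neg (x := X) ¶, inv_inv, inv_inv,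
              ← rpow_one_add' ¶ ¶, ← rpow_natCast, ← rpow_mul hmR.le]
            congr 2; push_cast; ring
        _ ≤ §(mx s)^(-(2+2*η)) * ((4/§c.a)^§1 * (X * 3)) := by
            gcongr (mx s:ℝ)^(-(2+2*η)) * (?_ * (X * ?_))
            · exact rpow_le_rpow_of_exponent_ge ¶ (by rw [div_le_one a0]; linarith) £
            · rw [rpow_def_of_pos £, hη, mul_one_div_cancel ¶]; linarith [exp_one_lt_d9]
        _ = 12 * (X/c.a) * §(mx s)^(-(2+2*η)) := by rw [rpow_one]; ring
        _ ≤ _ := by gcongr; norm_num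
    calc _ ≤ 2 * ((8 * ((c.f s:ℝ)/X)^(-(1/2+η))) * (8 * (gs c s/c.a * ((c.f s:ℝ)/X)^½))) := by rw [← r2]; gcongr
      _ = 128 * (gs c s/c.a) * ((c.f s:ℝ)/X)^(-(1+η)) := by
          rw [show -(1+η) = -(1/2+η) + -(1/2) by ring, rpow_add z1]; ring
      _ ≤ 128 * (gs c s/c.a) * (32 * (X/c.a) * §(mx s)^(-(2+2*η))) := by gcongr
      _ = _ := by ring
  refine (sum_le_sum term).trans ◌
  rw [← mul_sum]
  have := h c hr.h64 η hη0 hη1 (by rw [hη, one_div_one_div]; exact hlog) (E.image s0) (fun s hs => (hT s hs).1) (fun s hs => (hT s hs).2)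
  calc _ ≤ 4096 * (X/c.a) * C := by gcongr
    _ = _ := by ring
end

section
open Finset MeasureTheory Real

theorem gauss1 (z : ℝ) (hz : 0 < z) (h1 : z ≤ 1) (U : Finset ℤ) : ∑ x ∈ U, exp (-(π * §x^2 * z)) ≤ 18 * z^½ := by
  set G : ℕ × Bool → ℝ := fun b => exp (-(π * §b.1^2 * z)) with hG
  have e : ∀ x ∈ U, exp (-(π * §x^2 * z)) = G (x.natAbs, decide (0 < x)) := fun x _ => by
    simp only [hG]; rw [Nat.cast_natAbs, Int.cast_abs, sq_abs]
  rw [sum_congr rfl e]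
  refine (inj_sum U (Icc 0 (U.sup Int.natAbs) ×ˢ univ) (fun x => (x.natAbs, decide (0 < x))) G (fun b => by positivity) ◌ ◌).trans ◌
  · intro x hx
    have := le_sup (f := Int.natAbs) hx
    simp only [mem_product, mem_Icc, mem_univ, and_true]; omega
  · intro x _ y _ h
    exact sgn_inj x y (Prod.ext_iff.1 h).1 (Prod.ext_iff.1 h).2
  have g := gauss_sum z 0 hz le_rfl ¤ (U.sup Int.natAbs)
  have h2 : 1 ≤ z^½ := one_le_rpow_of_pos_of_le_one_of_nonpos hz h1 ¤
  rw [sum_product, ← insert_Icc_add_one_left_eq_Icc (Nat.zero_le _), sum_insert (by simp)]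
  simp only [hG, sum_const, card_univ, Fintype.card_bool, nsmul_eq_mul]
  rw [← mul_sum]
  norm_num at g ⊢
  linarith

theorem W_sum (c : Circ) (hr : c.Red) (X : ℝ) (hX : 8 ≤ X) (haX : §c.a ≤ 8*X) (T : Finset (ℤ × ℤ)) : ∑ s ∈ T, ww c X s ≤ 2592 * (X/c.a) := by
  have a0 : §0 < c.a := mod_cast c.ha
  have X0 : 0 < X := by linarith
  set z := §c.a/(8*X) with hz
  have z0 : 0 < z := by positivity
  have z1 : z ≤ 1 := by rw [hz, div_le_one ¶]; exact haX
  set g : ℤ → ℝ := fun x => exp (-(π * §x^2 * z)) with hg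
  have hp : ∀ s, ww c X s ≤ g s.1 * g s.2 := by
    intro s
    simp only [ww, hg]
    rw [← exp_add, exp_le_exp]
    have h1 := hr.low s
    have m1 : §s.1^2 ≤ §(mx s)^2 := by
      rw [← sq_abs §s.1, ← Int.cast_abs, ← Nat.cast_natAbs]; have := le_max_left s.1.natAbs s.2.natAbs; unfold mx; gcongr
    have m2 : §s.2^2 ≤ §(mx s)^2 := by
      rw [← sq_abs §s.2, ← Int.cast_abs, ← Nat.cast_natAbs]; have := le_max_right s.1.natAbs s.2.natAbs; unfold mx; gcongr
    have h2 : (§s.1^2+§s.2^2) * z ≤ c.f s / X := by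
      rw [hz, le_div_iff₀ X0]
      calc _ = §c.a/8 * (§s.1^2+§s.2^2) := by field_simp
        _ ≤ §c.a/8 * (2*§(mx s)^2) := by gcongr; linarith
        _ ≤ _ := by linarith
    linarith [pi_pos, mul_le_mul_of_nonneg_left h2 pi_pos.le]
  calc ∑ s ∈ T, ww c X s ≤ ∑ s ∈ T, g s.1 * g s.2 := sum_le_sum fun s _ => hp s
    _ ≤ ∑ s ∈ T.image Prod.fst ×ˢ T.image Prod.snd, g s.1 * g s.2 := by
        refine sum_le_sum_of_subset_of_nonneg (fun s hs => ◌) fun s _ _ => by positivity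
        exact mem_product.2 ⟨mem_image_of_mem _ hs, mem_image_of_mem _ hs⟩
    _ = (∑ x ∈ T.image Prod.fst, g x) * ∑ y ∈ T.image Prod.snd, g y := by rw [sum_mul_sum, sum_product]
    _ ≤ (18 * z^½) * (18 * z^½) := by
        gcongr
        · exact gauss1 z z0 z1 _
        · exact gauss1 z z0 z1 _
    _ = 324 * (z^½ * z^½) := by ring
    _ = 2592 * (X/c.a) := by
        rw [← rpow_add z0]; norm_num [rpow_neg_one, hz]; ring

theorem lo_or (c : Circ) (s t : ℤ × ℤ) (hs : s ≠ 0) (ht : t ≠ 0) (hb : bil c s t = 0) : lo c s ∨ lo c t := by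
  obtain ⟨m, s0, hm, h0, e⟩ := prim_of s hs
  have hb0 : bil c s0 t = 0 := by
    have : ¥m * bil c s0 t = 0 := by
      rw [← hb, e]; unfold bil; simp only [Prod.smul_fst, Prod.smul_snd, smul_eq_mul]; ring
    exact (mul_eq_zero.1 this).resolve_left (by exact_mod_cast hm.ne')
  obtain ⟨g0, hc, -, hg, hk⟩ := ta_spec c s0 h0
  obtain ⟨k, rfl⟩ := hk t hb0
  rcases le_or_gt (gs c s0:ℤ) c.a with h | h
  · exact Or.inl ⟨m, s0, hm, h0, e, h⟩
  have h2 : (gs c (ta c s0):ℤ) ≤ c.a := by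
    have := c.ha
    by_contra hlt; nlinarith
  have hk0 : k ≠ 0 := fun h => ht (by rw [h, zero_smul])
  refine Or.inr ◌
  rcases lt_or_gt_of_ne hk0 with h' | h'
  · refine ⟨k.natAbs, -ta c s0, by omega, hc.neg_neg, ◌, ◌⟩
    · rw [Int.natCast_natAbs, abs_of_neg h', neg_smul_neg]
    · have : gs c (-ta c s0) = gs c (ta c s0) := by
        unfold gs; rw [← Int.gcd_neg, ← Int.neg_gcd]; simp only [Prod.fst_neg, Prod.snd_neg]; congr 1 <;> ring
      rwa [this]
  · exact ⟨k.natAbs, ta c s0, by omega, hc, by rw [Int.natCast_natAbs, abs_of_pos h'], h2⟩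

theorem diag_bound : ∃ C : ℝ, 0 < C ∧ ∀ c : Circ, c.Red → ∀ X : ℝ, 8 ≤ X → §c.a ≤ 8*X → log X ≤ §c.a^(1/20:ℝ) →
    ∫ θ in Set.Icc §0 1, ‖c.th X θ‖^2 ≤ C * (X/c.a) := by
  classical
  obtain ⟨C, hC, hs⟩ := half_sum
  refine ⟨2*2592 + 2*C, by positivity, fun c hr X hX haX hl => ◌⟩
  have X0 : 0 < X := by linarith
  have hpar := parseval _ (th_wsum _ _ _ c.a c.hA c.ha c.hd X X0) (fun u => (exp_pos _).le) c.f
  have ht : ∀ θ, c.th X θ = ∑' u : ℤ × ℤ, ((exp (-2 * π / X * (qf c.A c.B c.C u.1 u.2 : ℤ)) : ℝ) : ℂ) * ee (c.f u) θ := fun θ => th_eq _ _ _ _ _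
  simp only [← ht] at hpar
  refine hasSum_le_of_sum_le hpar fun E => ◌
  rw [← sum_filter]
  set φ : (ℤ × ℤ) × (ℤ × ℤ) → (ℤ × ℤ) × (ℤ × ℤ) := fun p => (p.1-p.2, p.1+p.2) with hφ
  set E' := E.filter (fun p => c.f p.1 = c.f p.2)
  set F := E'.image φ with hF
  set g : (ℤ × ℤ) × (ℤ × ℤ) → ℝ := fun x => ww c X x.1 * ww c X x.2 with hg
  have g0 : ∀ x, 0 ≤ g x := fun x => mul_nonneg (exp_pos _).le (exp_pos _).le
  have hinj : ∀ x ∈ E', ∀ y ∈ E', φ x = φ y → x = y := by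
    intro x _ y _ h
    simp only [hφ, Prod.ext_iff, Prod.fst_sub, Prod.snd_sub, Prod.fst_add, Prod.snd_add] at h ⊢
    omega
  have e1 : ∀ p ∈ E', exp (-2 * π / X * (qf c.A c.B c.C p.1.1 p.1.2 : ℤ)) * exp (-2 * π / X * (qf c.A c.B c.C p.2.1 p.2.2 : ℤ)) = g (φ p) := by
    intro p _
    simp only [hg, hφ, ww]
    rw [← exp_add, ← exp_add]; congr 1
    have : (c.f (p.1-p.2):ℝ) + c.f (p.1+p.2) = 2*(qf c.A c.B c.C p.1.1 p.1.2:ℤ) + 2*(qf c.A c.B c.C p.2.1 p.2.2:ℤ) := by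
      have : c.f (p.1-p.2) + c.f (p.1+p.2) = 2*qf c.A c.B c.C p.1.1 p.1.2 + 2*qf c.A c.B c.C p.2.1 p.2.2 := by
        unfold Circ.f qf; simp only [Prod.fst_sub, Prod.snd_sub, Prod.fst_add, Prod.snd_add]; ring
      exact_mod_cast this
    linear_combination (π/X) * this
  rw [sum_congr rfl e1]
  refine (inj_sum E' F φ g g0 (fun x hx => mem_image_of_mem _ hx) hinj).trans ◌
  have hFb : ∀ x ∈ F, bil c x.1 x.2 = 0 := by
    intro x hx
    obtain ⟨p, hp, rfl⟩ := mem_image.1 hx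
    have := (mem_filter.1 hp).2
    unfold Circ.f qf at this
    simp only [hφ, bil, Prod.fst_sub, Prod.snd_sub, Prod.fst_add, Prod.snd_add]; linear_combination this
  have w0 : ww c X 0 = 1 := by simp [ww, Circ.f, qf]
  have p1 : ∑ x ∈ F with x.1 = 0, g x ≤ 2592 * (X/c.a) := by
    have e : ∀ x ∈ F.filter fun x => x.1 = 0, g x = ww c X x.2 := fun x hx => by
      simp only [hg]; rw [(mem_filter.1 hx).2, w0, one_mul]
    rw [sum_congr rfl e]
    have := inj_sum (F.filter fun x => x.1 = 0) (F.image Prod.snd) Prod.snd (ww c X) (fun b => (exp_pos _).le) (fun x hx => mem_image_of_mem _ (mem_filter.1 hx).1)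
      fun x hx y hy h => Prod.ext ((mem_filter.1 hx).2.trans (mem_filter.1 hy).2.symm) h
    exact this.trans (W_sum c hr X hX haX _)
  have p2 : ∑ x ∈ F with x.2 = 0, g x ≤ 2592 * (X/c.a) := by
    have e : ∀ x ∈ F.filter fun x => x.2 = 0, g x = ww c X x.1 := fun x hx => by
      simp only [hg]; rw [(mem_filter.1 hx).2, w0, mul_one]
    rw [sum_congr rfl e]
    have := inj_sum (F.filter fun x => x.2 = 0) (F.image Prod.fst) Prod.fst (ww c X) (fun b => (exp_pos _).le) (fun x hx => mem_image_of_mem _ (mem_filter.1 hx).1)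
      fun x hx y hy h => Prod.ext h ((mem_filter.1 hx).2.trans (mem_filter.1 hy).2.symm)
    exact this.trans (W_sum c hr X hX haX _)
  have p3 : ∑ x ∈ F with lo c x.1 ∧ x.2 ≠ 0, g x ≤ C * (X/c.a) :=
    hs c hr X hX hl _ fun x hx => ⟨(mem_filter.1 hx).2.1, (mem_filter.1 hx).2.2, hFb x (mem_filter.1 hx).1⟩
  have p4 : ∑ x ∈ F with lo c x.2 ∧ x.1 ≠ 0, g x ≤ C * (X/c.a) := by
    refine le_trans (le_of_eq ◌) (hs c hr X hX hl ((F.filter fun x => lo c x.2 ∧ x.1 ≠ 0).image Prod.swap) fun x hx => ◌)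
    · rw [sum_image fun x _ y _ h => Prod.swap_injective h]
      exact sum_congr rfl fun x _ => mul_comm _ _
    · obtain ⟨y, hy, rfl⟩ := mem_image.1 hx
      refine ⟨(mem_filter.1 hy).2.1, (mem_filter.1 hy).2.2, ◌⟩
      rw [← hFb y (mem_filter.1 hy).1]; unfold bil; simp only [Prod.fst_swap, Prod.snd_swap]; ring
  have tot : ∑ x ∈ F, g x ≤ ∑ x ∈ F with x.1 = 0, g x + ∑ x ∈ F with x.2 = 0, g x + ∑ x ∈ F with lo c x.1 ∧ x.2 ≠ 0, g x + ∑ x ∈ F with lo c x.2 ∧ x.1 ≠ 0, g x := by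
    simp only [sum_filter]
    rw [← sum_add_distrib, ← sum_add_distrib, ← sum_add_distrib]
    refine sum_le_sum fun x hx => ◌
    have i0 : ∀ (P : Prop) [Decidable P], 0 ≤ if P then g x else 0 := fun P _ => by split_ifs; exacts [g0 x, le_rfl]
    have := i0 (x.1 = 0); have := i0 (x.2 = 0); have := i0 (lo c x.1 ∧ x.2 ≠ 0); have := i0 (lo c x.2 ∧ x.1 ≠ 0)
    by_cases h1 : x.1 = 0
    · rw [if_pos h1] at *; linarith
    by_cases h2 : x.2 = 0
    · rw [if_pos h2] at *; linarith
    rcases lo_or c _ _ h1 h2 (hFb x hx) with h | h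
    · rw [if_pos (show lo c x.1 ∧ x.2 ≠ 0 from ⟨h, h2⟩)] at *; linarith
    · rw [if_pos (show lo c x.2 ∧ x.1 ≠ 0 from ⟨h, h1⟩)] at *; linarith
  linarith
end

section
open Finset Real

theorem prod_count (N : ℕ) : ((((Icc 1 N ×ˢ Icc 1 N) ×ˢ (Icc 1 N ×ˢ Icc 1 N)).filter fun x : (ℕ × ℕ) × (ℕ × ℕ) => x.1.1*x.1.2 = x.2.1*x.2.2).card : ℝ) ≤ 2*§N^2*(1+log N) := by
  set B := (Icc 1 N ×ˢ Icc 1 N).sigma (fun p : ℕ × ℕ => Icc 1 (N/max p.1 p.2) ×ˢ Icc 1 (N/max p.1 p.2)) with hB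
  have h1 : (((Icc 1 N ×ˢ Icc 1 N) ×ˢ (Icc 1 N ×ˢ Icc 1 N)).filter fun x : (ℕ × ℕ) × (ℕ × ℕ) => x.1.1*x.1.2 = x.2.1*x.2.2) ⊆
      B.image fun y => ((y.2.1*y.1.1, y.1.2*y.2.2), (y.2.1*y.1.2, y.1.1*y.2.2)) := by
    rintro ⟨⟨a, b⟩, c, d⟩ hx
    simp only [mem_filter, mem_product, mem_Icc] at hx
    obtain ⟨⟨⟨⟨a1, a2⟩, b1, b2⟩, ⟨c1, c2⟩, d1, d2⟩, e⟩ := hx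
    obtain ⟨α, γ, hco, ea, ec⟩ := Nat.exists_coprime a c
    have g0 : 0 < Nat.gcd a c := Nat.gcd_pos_of_pos_left _ a1
    set g := Nat.gcd a c
    have e2 : α * b = γ * d := by
      have : g * (α * b) = g * (γ * d) := by rw [ea, ec] at e; linarith
      exact Nat.eq_of_mul_eq_mul_left g0 this
    obtain ⟨k, hk⟩ : α ∣ d := hco.dvd_of_dvd_mul_left ⟨b, e2.symm⟩
    have α0 : 0 < α := Nat.pos_of_ne_zero fun h => by rw [h] at ea; omega
    have γ0 : 0 < γ := Nat.pos_of_ne_zero fun h => by rw [h] at ec; omega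
    have hb : b = γ * k := Nat.eq_of_mul_eq_mul_left α0 (by rw [e2, hk]; ring)
    have k0 : 0 < k := Nat.pos_of_ne_zero fun h => by rw [h] at hk; omega
    have m0 : 0 < max α γ := lt_max_of_lt_left α0
    refine mem_image.2 ⟨⟨(α, γ), (g, k)⟩, ◌, ◌⟩
    · simp only [hB, mem_sigma, mem_product, mem_Icc]
      refine ⟨⟨⟨α0, by nlinarith⟩, γ0, by nlinarith⟩, ⟨g0, (Nat.le_div_iff_mul_le m0).2 ◌⟩, k0, (Nat.le_div_iff_mul_le m0).2 ◌⟩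
      · rcases max_choice α γ with h | h <;> rw [h] <;> linarith
      · rcases max_choice α γ with h | h <;> rw [h] <;> linarith
    · simp only [Prod.mk.injEq]; exact ⟨⟨by rw [mul_comm]; exact ea.symm, hb.symm⟩, by rw [mul_comm]; exact ec.symm, hk.symm⟩
  have h2 : §B.card ≤ ∑ p ∈ Icc 1 N ×ˢ Icc 1 N, §N^2 * ((if p.2 ≤ p.1 then 1/§p.1^2 else 0) + if p.1 ≤ p.2 then 1/§p.2^2 else 0) := by
    rw [hB, card_sigma]; push_cast
    refine sum_le_sum fun p _ => ◌
    rw [card_product, Nat.card_Icc, Nat.add_sub_cancel]; push_cast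
    have : ((N / max p.1 p.2 : ℕ):ℝ) ≤ N / (max p.1 p.2 : ℕ) := Nat.cast_div_le
    have h3 : ((N / max p.1 p.2 : ℕ):ℝ) * ((N / max p.1 p.2 : ℕ):ℝ) ≤ (N / (max p.1 p.2 : ℕ))*(N / (max p.1 p.2 : ℕ)) := by gcongr
    refine h3.trans ◌
    rcases le_total p.1 p.2 with h | h
    · rw [max_eq_right h, if_pos h]
      have : §0 ≤ if p.2 ≤ p.1 then 1/§p.1^2 else 0 := ite_nonneg (one_div_nonneg.2 (sq_nonneg _)) le_rfl
      calc _ = §N^2 * (0 + 1/§p.2^2) := by ring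
        _ ≤ _ := mul_le_mul_of_nonneg_left £ (sq_nonneg _)
    · rw [max_eq_left h, if_pos h]
      have : §0 ≤ if p.1 ≤ p.2 then 1/§p.2^2 else 0 := ite_nonneg (one_div_nonneg.2 (sq_nonneg _)) le_rfl
      calc _ = §N^2 * (1/§p.1^2 + 0) := by ring
        _ ≤ _ := mul_le_mul_of_nonneg_left £ (sq_nonneg _)
  have h4 : ∀ n ∈ Icc 1 N, ∑ m ∈ Icc 1 N, (if m ≤ n then 1/§n^2 else 0) = (n:ℝ)⁻¹ := by
    intro n hn
    rw [mem_Icc] at hn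
    rw [← sum_filter, sum_const, show (Icc 1 N).filter (fun m => m ≤ n) = Icc 1 n by ext m; simp only [mem_filter, mem_Icc]; omega, Nat.card_Icc, nsmul_eq_mul, Nat.add_sub_cancel]
    have : §n ≠ 0 := mod_cast (by omega : n ≠ 0)
    field_simp
  have h5 : ∑ n ∈ Icc 1 N, (n:ℝ)⁻¹ ≤ 1 + log N := by
    have := harmonic_le_one_add_log N
    rw [harmonic_eq_sum_Icc] at this; push_cast at this; exact this
  calc _ ≤ §B.card := mod_cast (card_le_card h1).trans card_image_le
    _ ≤ _ := h2
    _ = §N^2 * (∑ n ∈ Icc 1 N, (n:ℝ)⁻¹ + ∑ n ∈ Icc 1 N, (n:ℝ)⁻¹) := by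
        rw [← mul_sum, sum_add_distrib, sum_product, sum_product_right (f := fun p : ℕ × ℕ => if p.1 ≤ p.2 then 1/§p.2^2 else 0), sum_congr rfl h4]
    _ ≤ §N^2 * ((1+log N)+(1+log N)) := mul_le_mul_of_nonneg_left £ (sq_nonneg _)
    _ = _ := by ring

theorem mult (P : Pk) (W : ℕ) (hW : 1 ≤ W) : (((bx W ×ˢ bx W).filter fun p => P.q p.1 = P.q p.2).card : ℝ) ≤ 272*§P.M^2*§W^2*(1+log (2*P.M*W)) := by
  classical
  have hM := P.hM
  have := P.hκ; have := P.hγ; have a0n := P.ha0; have := abs_nonneg P.β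
  set N := 2*P.M*W with hN
  set E := (bx W ×ˢ bx W).filter fun p => P.q p.1 = P.q p.2 with hE
  set φ : (ℤ × ℤ) × (ℤ × ℤ) → (ℤ × ℤ) × (ℤ × ℤ) := fun p =>
    (((P.κ*p.1.1+P.β*p.1.2)-(P.κ*p.2.1+P.β*p.2.2), (P.κ*p.1.1+P.β*p.1.2)+(P.κ*p.2.1+P.β*p.2.2)), (P.a0*(p.2.2-p.1.2), P.a0*(p.2.2+p.1.2))) with hφ
  have hinj : ∀ x y, φ x = φ y → x = y := by
    intro x y h
    simp only [hφ, Prod.mk.injEq] at h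
    obtain ⟨⟨h1, h2⟩, h3, h4⟩ := h
    have h3' := mul_left_cancel₀ P.ha0.ne h3
    have h4' := mul_left_cancel₀ P.ha0.ne h4
    have e1 : x.1.2 = y.1.2 := by omega
    have e2 : x.2.2 = y.2.2 := by omega
    rw [e1, e2] at h1 h2
    have e3 : x.1.1 = y.1.1 := mul_left_cancel₀ P.hκ.ne' £
    have e4 : x.2.1 = y.2.1 := mul_left_cancel₀ P.hκ.ne' £
    exact Prod.ext (Prod.ext e3 e1) (Prod.ext e4 e2)
  have hI : ∀ x ∈ E, (φ x).1.1 * (φ x).1.2 = (φ x).2.1 * (φ x).2.2 ∧ (|(φ x).1.1| ≤ N ∧ |(φ x).1.2| ≤ N) ∧ |(φ x).2.1| ≤ N ∧ |(φ x).2.2| ≤ N := by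
    intro x hx
    simp only [hE, bx, mem_filter, mem_product, mem_Icc] at hx
    obtain ⟨⟨⟨⟨l1, u1⟩, l2, u2⟩, ⟨l3, u3⟩, l4, u4⟩, e⟩ := hx
    have hW0 : ¥0 < W := mod_cast hW
    have bd : ∀ s t : ℤ, 1 ≤ s → s ≤ W → 1 ≤ t → t ≤ W → |P.κ*s+P.β*t| ≤ (P.κ+|P.β|)*W := by
      intro s t h1 h2 h3 h4
      refine (abs_add_le _ _).trans ◌
      rw [abs_mul, abs_mul, abs_of_pos P.hκ, abs_of_pos (show 0 < s by omega), abs_of_pos (show 0 < t by omega), add_mul]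
      gcongr
    have b1 := bd _ _ l1 u1 l2 u2
    have b2 := bd _ _ l3 u3 l4 u4
    have hNz : ¥N = 2*P.M*W := by rw [hN]; push_cast; ring
    have key : 2*((P.κ+|P.β|)*W) ≤ ¥N := by rw [hNz]; nlinarith
    have key2 : |P.a0| * (2*W) ≤ ¥N := by rw [hNz, abs_of_neg a0n]; nlinarith
    refine ⟨◌, ⟨◌, ◌⟩, ◌, ◌⟩
    · have : P.κ * P.q x.1 = P.κ * P.q x.2 := by rw [e]
      unfold Pk.q qf at this
      have hd := P.hd
      simp only [hφ]; linear_combination this + (x.2.2^2-x.1.2^2) * hd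
    · exact (abs_sub _ _).trans £
    · exact (abs_add_le _ _).trans £
    · simp only [hφ]; rw [abs_mul]; exact (mul_le_mul_of_nonneg_left (abs_le.2 ⟨by linarith, by linarith⟩) (abs_nonneg _)).trans key2
    · simp only [hφ]; rw [abs_mul]; exact (mul_le_mul_of_nonneg_left (abs_le.2 ⟨by linarith, by linarith⟩) (abs_nonneg _)).trans key2
  have hN2 : 2 ≤ N := by
    have : 1 ≤ P.M := by omega
    rw [hN]; nlinarith
  have hN2R : §2 ≤ N := mod_cast hN2
  set Z : Finset (ℤ × ℤ) := ({0} ×ˢ Icc (-N:ℤ) N) ∪ (Icc (-N:ℤ) N ×ˢ {0}) with hZ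
  have hZc : §Z.card ≤ 5*N := by
    have h1 : Z.card ≤ (2*N+1) + (2*N+1) := by
      refine (card_union_le _ _).trans ◌
      rw [card_product, card_product, Int.card_Icc, card_singleton]; omega
    have : §Z.card ≤ (2*N+1) + (2*N+1) := mod_cast h1
    linarith
  have hmZ : ∀ s t : ℤ, s*t = 0 → |s| ≤ N → |t| ≤ N → (s, t) ∈ Z := by
    intro s t h h1 h2
    rw [abs_le] at h1 h2
    simp only [hZ, mem_union, mem_product, mem_singleton, mem_Icc]
    rcases mul_eq_zero.1 h with h | h
    · exact Or.inl ⟨h, h2⟩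
    · exact Or.inr ⟨h1, h⟩
  have c1 : ((E.filter fun x => (φ x).1.1 * (φ x).1.2 = 0).card:ℝ) ≤ (5*N)*(5*N) := by
    have : (E.filter fun x => (φ x).1.1 * (φ x).1.2 = 0).card ≤ (Z ×ˢ Z).card := by
      refine card_le_card_of_injOn φ (fun x hx => ◌) fun x _ y _ h => hinj x y h
      obtain ⟨hx, h0⟩ := mem_filter.1 (mem_coe.1 hx)
      obtain ⟨h1, ⟨h2, h3⟩, h4, h5⟩ := hI x hx
      exact mem_coe.2 (mem_product.2 ⟨hmZ _ _ h0 h2 h3, hmZ _ _ (h1 ▸ h0) h4 h5⟩)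
    calc _ ≤ (((Z ×ˢ Z).card:ℕ):ℝ) := mod_cast this
      _ = §Z.card*Z.card := by rw [card_product]; push_cast; ring
      _ ≤ _ := by gcongr
  set S := ((Icc 1 N ×ˢ Icc 1 N) ×ˢ (Icc 1 N ×ˢ Icc 1 N)).filter fun x : (ℕ × ℕ) × (ℕ × ℕ) => x.1.1*x.1.2 = x.2.1*x.2.2 with hS
  have c2 : ((E.filter fun x => ¬ (φ x).1.1 * (φ x).1.2 = 0).card:ℝ) ≤ S.card * 16 := by
    have : (E.filter fun x => ¬ (φ x).1.1 * (φ x).1.2 = 0).card ≤ (S ×ˢ (univ : Finset ((Bool × Bool) × (Bool × Bool)))).card := by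
      refine card_le_card_of_injOn (fun x => ((((φ x).1.1.natAbs, (φ x).1.2.natAbs), ((φ x).2.1.natAbs, (φ x).2.2.natAbs)),
        ((decide (0 < (φ x).1.1), decide (0 < (φ x).1.2)), (decide (0 < (φ x).2.1), decide (0 < (φ x).2.2))))) (fun x hx => ◌) fun x _ y _ h => hinj x y ◌
      · obtain ⟨hx, h0⟩ := mem_filter.1 (mem_coe.1 hx)
        obtain ⟨h1, ⟨h2, h3⟩, h4, h5⟩ := hI x hx
        have h0' := h0; rw [h1] at h0'
        rw [mul_eq_zero, not_or] at h0 h0'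
        simp only [mem_coe, hS, mem_filter, mem_product, mem_Icc, mem_univ, and_true]
        have nb : ∀ z : ℤ, ¬ z = 0 → |z| ≤ N → 1 ≤ z.natAbs ∧ z.natAbs ≤ N := fun z h h' => by rw [abs_le] at h'; omega
        refine ⟨⟨⟨nb _ h0.1 h2, nb _ h0.2 h3⟩, nb _ h0'.1 h4, nb _ h0'.2 h5⟩, ◌⟩
        rw [← Int.natAbs_mul, ← Int.natAbs_mul, h1]
      · simp only [Prod.mk.injEq] at h
        obtain ⟨⟨⟨h1, h2⟩, h3, h4⟩, ⟨k1, k2⟩, k3, k4⟩ := h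
        exact Prod.ext (Prod.ext (sgn_inj _ _ h1 k1) (sgn_inj _ _ h2 k2)) (Prod.ext (sgn_inj _ _ h3 k3) (sgn_inj _ _ h4 k4))
    calc _ ≤ (((S ×ˢ (univ : Finset ((Bool × Bool) × (Bool × Bool)))).card:ℕ):ℝ) := mod_cast this
      _ = _ := by rw [card_product]; simp
  have h0 := prod_count N
  have hl : 0 ≤ log N := log_nonneg £
  have hNe : §N = 2*P.M*W := by rw [hN]; push_cast; ring
  have h1 : §E.card = (E.filter fun x => (φ x).1.1 * (φ x).1.2 = 0).card + (E.filter fun x => ¬ (φ x).1.1 * (φ x).1.2 = 0).card := by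
    exact_mod_cast (card_filter_add_card_filter_not _).symm
  rw [← hNe, h1]
  have e : 272*§P.M^2*§W^2 = 68*§N^2 := by rw [hNe]; ring
  rw [e]
  linarith [mul_nonneg (sq_nonneg §N) hl]

theorem inv_sq_sum (R : ℕ) : ∑ d ∈ Icc 2 R, 1/§d^2 ≤ 2/3 := by
  have h : ∀ n : ℕ, ∑ d ∈ Icc 2 (n+1), 1/§d^2 ≤ 2/3 - 1/(§n+3/2) := by
    intro n
    induction n with
    | zero => norm_num
    | succ n ih =>
      rw [sum_Icc_succ_top ¢]
      have : 1/((n+1+1:ℕ):ℝ)^2 ≤ 1/(§n+3/2) - 1/(§n+5/2) := by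
        rw [div_sub_div _ _ ¶ ¶, div_le_div_iff₀ ¶ ¶]
        push_cast; linarith
      push_cast at this ih ⊢
      rw [show §n+1+3/2 = n+5/2 by ring]
      linarith
  rcases R with _ | n
  · norm_num
  · have : 0 ≤ 1/(§n+3/2) := by positivity
    linarith [h n]

theorem cop_box (V K : ℕ) : §V^2/3 - K*V ≤ ((bx V).filter fun u => IsCoprime u.1 u.2 ∧ ¥K < u.1).card := by
  classical
  set D : ℕ → Finset (ℤ × ℤ) := fun d => (Icc ¥1 (V/d:ℕ) ×ˢ Icc ¥1 (V/d:ℕ)).image (fun u => (¥d*u.1, ¥d*u.2)) with hD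
  have h1 : bx V ⊆ (((bx V).filter fun u => IsCoprime u.1 u.2 ∧ ¥K < u.1) ∪ (Icc 2 V).biUnion D) ∪ (Icc ¥1 K ×ˢ Icc ¥1 V) := by
    intro u hu
    have hu' := hu
    simp only [bx, mem_product, mem_Icc] at hu'
    obtain ⟨⟨l1, u1⟩, l2, u2⟩ := hu'
    rw [mem_union, mem_union]
    by_cases hK : ¥K < u.1
    swap
    · right; simp only [mem_product, mem_Icc]; omega
    by_cases hc : IsCoprime u.1 u.2
    · exact Or.inl (Or.inl (mem_filter.2 ⟨hu, hc, hK⟩))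
    left; right
    rw [Int.isCoprime_iff_gcd_eq_one] at hc
    have g0 : 0 < Int.gcd u.1 u.2 := Int.gcd_pos_of_ne_zero_left _ ¢
    obtain ⟨s, hs⟩ : (Int.gcd u.1 u.2:ℤ) ∣ u.1 := Int.gcd_dvd_left _ _
    obtain ⟨t, ht⟩ : (Int.gcd u.1 u.2:ℤ) ∣ u.2 := Int.gcd_dvd_right _ _
    set g := Int.gcd u.1 u.2
    have g0' : ¥0 < g := mod_cast g0
    have s0 : 0 < s := by by_contra h; nlinarith
    have t0 : 0 < t := by by_contra h; nlinarith
    refine mem_biUnion.2 ⟨g, mem_Icc.2 ⟨by omega, ◌⟩, mem_image.2 ⟨(s, t), ◌, Prod.ext hs.symm ht.symm⟩⟩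
    · have : ¥g ≤ V := by nlinarith
      exact_mod_cast this
    · simp only [mem_product, mem_Icc]; push_cast
      exact ⟨⟨by omega, (Int.le_ediv_iff_mul_le g0').2 £⟩, by omega, (Int.le_ediv_iff_mul_le g0').2 £⟩
  have h2 := (card_le_card h1).trans ((card_union_le _ _).trans (Nat.add_le_add_right (card_union_le _ _) _))
  have h3 : (((Icc 2 V).biUnion D).card:ℝ) ≤ §V^2*(2/3) := by
    calc _ ≤ ((∑ d ∈ Icc 2 V, (D d).card : ℕ):ℝ) := mod_cast card_biUnion_le
      _ ≤ ∑ d ∈ Icc 2 V, §V^2*(1/§d^2) := by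
          push_cast
          refine sum_le_sum fun d _ => ◌
          have : (D d).card ≤ (V/d)*(V/d) := by
            refine card_image_le.trans ◌
            rw [card_product, Int.card_Icc, add_sub_cancel_right, Int.toNat_natCast]
          calc ((D d).card:ℝ) ≤ ((V/d:ℕ):ℝ)*((V/d:ℕ):ℝ) := mod_cast this
            _ ≤ (§V/d)*(§V/d) := by gcongr <;> exact Nat.cast_div_le
            _ = _ := by ring
      _ ≤ _ := by rw [← mul_sum]; gcongr; exact inv_sq_sum V
  have h4 : ((Icc ¥1 K ×ˢ Icc ¥1 V).card:ℝ) = K*V := by rw [card_product, Int.card_Icc, Int.card_Icc]; simp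
  have h5 : ((bx V).card:ℝ) ≤ ((bx V).filter fun u => IsCoprime u.1 u.2 ∧ ¥K < u.1).card + ((Icc 2 V).biUnion D).card + (Icc ¥1 K ×ˢ Icc ¥1 V).card := mod_cast h2
  rw [bx_card] at h5
  linarith
end

section
open Finset Real

noncomputable def EE (P : Pk) (v w : ℤ × ℤ) : ℝ := RR (P.q v - P.a0).natAbs + RR (P.q w - P.a0).natAbs + RR (P.q v).natAbs + RR (P.q w).natAbs +
  (if P.q v = P.q w then 0 else RR (P.q v - P.q w).natAbs) + (Int.gcd (P.q v - P.a0) (P.q w - P.a0) : ℝ)^⅛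

theorem RR_nn (n : ℕ) : 0 ≤ RR n := prod_nonneg fun _ _ => by positivity

theorem EE_nn (P : Pk) (v w : ℤ × ℤ) : 0 ≤ EE P v w := by
  unfold EE
  have h : 0 ≤ if P.q v = P.q w then 0 else RR (P.q v - P.q w).natAbs := by split_ifs; exacts [le_rfl, RR_nn _]
  have := RR_nn (P.q v - P.a0).natAbs; have := RR_nn (P.q w - P.a0).natAbs; have := RR_nn (P.q v).natAbs; have := RR_nn (P.q w).natAbs
  positivity

theorem nasc (x y : ℤ) : (x-y).natAbs = (y-x).natAbs := by omega

theorem EE_symm (P : Pk) (v w : ℤ × ℤ) : EE P v w = EE P w v := by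
  unfold EE
  rw [Int.gcd_comm, nasc (P.q v) (P.q w)]
  by_cases h : P.q v = P.q w
  · rw [if_pos h, if_pos h.symm]; ring
  · rw [if_neg h, if_neg (Ne.symm h)]; ring

theorem Pk.q_pos (P : Pk) (V : ℕ) (u : ℤ × ℤ) (hu : u ∈ bx V) : 0 < P.q u := by
  simp only [bx, mem_product, mem_Icc] at hu
  have h : P.κ * P.q u = (P.κ*u.1+P.β*u.2)^2 + P.a0^2*u.2^2 := by rw [← P.hd]; unfold Pk.q qf; ring
  have := P.ha0.ne; have h2 : 0 < u.2 := by omega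
  have h3 : 0 < P.κ * P.q u := by rw [h]; have : 0 < P.a0^2 := by positivity
                                  positivity
  exact pos_of_mul_pos_right h3 P.hκ.le

theorem avgE : ∃ C : ℝ, 1 ≤ C ∧ ∀ P : Pk, ∃ V0 : ℕ, ∀ V W : ℕ, V0 ≤ V → V0 ≤ W → ∑ v ∈ bx V, ∑ w ∈ bx W, EE P v w ≤ C * (§V^2*§W^2) := by
  obtain ⟨C1, hC1, h1⟩ := avg1
  obtain ⟨C2, hC2, h2⟩ := avg2
  refine ⟨5*C1+C2, by linarith, fun P => ◌⟩
  obtain ⟨V0, h2⟩ := h2 P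
  refine ⟨V0 + P.M + 1, fun V W => ?_⟩
  have main : ∀ V W : ℕ, V0 + P.M + 1 ≤ V → V ≤ W → ∑ v ∈ bx V, ∑ w ∈ bx W, EE P v w ≤ (5*C1+C2) * (§V^2*§W^2) := by
    intro V W hV hW
    have hM := P.hM
    have := P.hκ; have := P.hγ; have a0n := P.ha0; have := abs_nonneg P.β
    have av : ∀ U : ℕ, V0+P.M+1 ≤ U → ∑ v ∈ bx U, RR (P.q v - P.a0).natAbs ≤ C1*§U^2 ∧ ∑ v ∈ bx U, RR (P.q v).natAbs ≤ C1*§U^2 := by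
      intro U hU
      have hU1 : ¥1 ≤ U := by omega
      have e1 := h1 P U (by omega) P.a0 (by rw [abs_of_neg a0n]; have : (P.M:ℤ) ≤ U := by omega
                                            have : ¥U ≤ U^3 := le_self_pow₀ hU1 ¤
                                            linarith)
      have e2 := h1 P U ¢ 0 (by simp)
      rw [filter_true_of_mem fun v _ => by have := P.q_nn v; omega] at e1
      rw [filter_true_of_mem fun v hv => (P.q_pos U v hv).ne'] at e2
      simp only [sub_zero] at e2
      exact ⟨e1, e2⟩
    obtain ⟨v1, v2⟩ := av V hV
    obtain ⟨w1, w2⟩ := av W (hV.trans hW)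
    have d : ∀ v ∈ bx V, ∑ w ∈ bx W, (if P.q v = P.q w then 0 else RR (P.q v - P.q w).natAbs) ≤ C1*§W^2 := by
      intro v hv
      have := h1 P W ¢ (P.q v) (by
        rw [abs_of_nonneg (P.q_nn v)]
        have a := P.q_le V v hv
        have b : ¥P.M * ¥V^2 ≤ W * ¥W^2 := by gcongr; omega
        linarith)
      rw [sum_filter] at this
      refine le_trans (le_of_eq (sum_congr rfl fun w _ => ◌)) this
      by_cases h : P.q v = P.q w
      · rw [if_pos h, if_neg (by simp [h])]
      · rw [if_neg h, if_pos (Ne.symm h), nasc]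
    have g := h2 V W ¢ hW
    unfold EE
    simp only [sum_add_distrib, sum_const, nsmul_eq_mul, bx_card]
    rw [← mul_sum, ← mul_sum]
    have d' := sum_le_sum d
    rw [sum_const, nsmul_eq_mul, bx_card] at d'
    have V2 : 0 ≤ §V^2 := by positivity
    have W2 : 0 ≤ §W^2 := by positivity
    linarith [mul_le_mul_of_nonneg_left v1 W2, mul_le_mul_of_nonneg_left v2 W2, mul_le_mul_of_nonneg_left w1 V2, mul_le_mul_of_nonneg_left w2 V2]
  intro hV hW
  rcases le_total V W with h | h
  · exact main V W hV h
  · rw [sum_comm, mul_comm (§V^2)]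
    exact le_trans (le_of_eq (sum_congr rfl fun v _ => sum_congr rfl fun w _ => EE_symm P _ _)) (main W V hW h)

theorem Circ.Red.C_le {c : Circ} (h : c.Red) : 4*c.C ≤ 9*c.a := by
  have hd := c.hd; have := c.hA; have := c.ha; have h1 := h.h1; have h2 := h.h2; have h3 := abs_le.1 h.h3
  by_contra hlt
  push Not at hlt
  have : 4*c.B^2 ≤ c.A^2 := by nlinarith
  nlinarith [mul_pos c.hA (sub_pos.2 hlt)]

/-- first moment for one circle -/
theorem first_one (c : Circ) (hr : c.Red) (Q : ℕ) (hQ : 20000*c.a ≤ ¥Q^2) : ∃ U : Finset (ℤ × ℤ), §Q^2/(80*c.a) ≤ U.card ∧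
    ∀ u ∈ U, IsCoprime u.1 u.2 ∧ 1 ≤ c.f u - c.a ∧ c.f u ≤ ¥Q^2 := by
  have a0 : §0 < c.a := mod_cast c.ha
  have hQR : 20000*§c.a ≤ §Q^2 := mod_cast hQ
  set y := §Q^2/(5*c.a) with hy
  have y1 : 4000 ≤ y := by rw [hy, le_div_iff₀ ¶]; linarith
  have s1 : 63 ≤ √y := le_sqrt_of_sq_le £
  set R := ⌊√y⌋₊ with hR
  have r1 : §R ≤ √y := Nat.floor_le ¶
  have r2 : √y < R + 1 := Nat.lt_floor_add_one _
  have ys := sq_sqrt (show 0 ≤ y by linarith)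
  refine ⟨(bx R).filter fun u => IsCoprime u.1 u.2 ∧ ((2:ℕ):ℤ) < u.1, ◌, fun u hu => ◌⟩
  · refine le_trans ◌ (cop_box R 2)
    have : (Q:ℝ)^2/(80*c.a) = y/16 := by rw [hy]; field_simp; ring
    rw [this]; push_cast
    nlinarith
  · obtain ⟨h1, h2, h3⟩ := mem_filter.1 hu
    simp only [bx, mem_product, mem_Icc] at h1
    obtain ⟨⟨l1, u1⟩, l2, u2⟩ := h1
    have hm : 3 ≤ mx u := le_max_of_le_left ¢
    refine ⟨h2, ◌, ◌⟩
    · have := hr.low u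
      have m3 : (9:ℝ) ≤ (mx u:ℝ)^2 := by have : (3:ℝ) ≤ mx u := mod_cast hm
                                         nlinarith
      have a64 : §64 ≤ c.a := mod_cast hr.h64
      have : §1 ≤ c.f u - c.a := by nlinarith
      exact_mod_cast this
    · have hR2 : 5*c.a*¥R^2 ≤ ¥Q^2 := by
        have : 5*§c.a*§R^2 ≤ §Q^2 := by
          calc _ ≤ 5*§c.a*(√y)^2 := by gcongr
            _ = _ := by rw [ys, hy]; field_simp
        exact_mod_cast this
      have e1 : u.1^2 ≤ ¥R^2 := by gcongr
      have e2 : u.2^2 ≤ ¥R^2 := by gcongr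
      have e3 : u.1*u.2 ≤ ¥R^2 := by nlinarith
      have e4 : 0 ≤ u.1*u.2 := by nlinarith
      have hb := abs_le.1 hr.h3; have := hr.C_le; have := hr.h2; have := c.ha
      have : c.f u ≤ c.a*u.1^2 + c.a*(u.1*u.2) + 3*c.a*u.2^2 := by
        unfold Circ.f qf; nlinarith [sq_nonneg u.1, sq_nonneg u.2]
      linarith [mul_le_mul_of_nonneg_left e1 c.ha.le, mul_le_mul_of_nonneg_left e2 c.ha.le, mul_le_mul_of_nonneg_left e3 c.ha.le]
end

section
open Finset MeasureTheory Real

structure Sys (K : Set ℤ) where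
  P : Pk
  cc : ℤ × ℤ → Circ
  hA : ∀ u : ℤ × ℤ, IsCoprime u.1 u.2 → (cc u).A = P.q u
  ha : ∀ u : ℤ × ℤ, IsCoprime u.1 u.2 → (cc u).a = P.q u - P.a0
  hB : ∀ u : ℤ × ℤ, IsCoprime u.1 u.2 → |2*(cc u).B| ≤ (cc u).A
  hk : ∀ u : ℤ × ℤ, IsCoprime u.1 u.2 → ∀ z : ℤ × ℤ, IsCoprime z.1 z.2 → (cc u).f z - (cc u).a ∈ K

theorem sys_exists (v : Fin 4 → ℤ) (hv : IsRootQuadruple v) : Nonempty (Sys (curvatures v)) := by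
  obtain ⟨κ, β, γ, a0, h1, h2, h3, h4, h5, h6⟩ := geom v hv
  set P : Pk := ⟨κ, β, γ, a0, h1, h2, h3, h4, h5⟩ with hP
  have ex : ∀ u : ℤ × ℤ, IsCoprime u.1 u.2 → ∃ c : Circ, c.A = P.q u ∧ c.a = P.q u - P.a0 ∧ |2*c.B| ≤ c.A ∧ ∀ z : ℤ × ℤ, IsCoprime z.1 z.2 → c.f z - c.a ∈ curvatures v := by
    intro u hu
    obtain ⟨A, a, B, C, e1, e2, e3, e4, e5, e6⟩ := h6 u.1 u.2 hu
    have hq : A = P.q u := e1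
    have hk : κ * A = (κ*u.1+β*u.2)^2 + a0^2*u.2^2 := by rw [← h4, e1]; ring
    have a2 : 0 < a0^2 := by have := h3.ne; positivity
    have hA : 0 < A := by
      refine pos_of_mul_pos_right (◌ : 0 < κ * A) h1.le
      rw [hk]
      rcases eq_or_ne u.2 0 with h | h
      · have : u.1 ≠ 0 := fun h' => by rw [h, h'] at hu; exact not_isCoprime_zero_zero hu
        have := mul_ne_zero h1.ne' this; rw [h, mul_zero, add_zero]; positivity
      · positivity
    exact ⟨⟨A, B, C, a, hA, by omega, e3, e5⟩, hq, by rw [← hq]; exact e2, e4, fun z hz => e6 z.1 z.2 hz⟩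
  have : Nonempty Circ := (ex (1, 0) isCoprime_one_left).nonempty
  choose! cc hcc using ex
  exact ⟨⟨P, cc, fun u h => (hcc u h).1, fun u h => (hcc u h).2.1, fun u h => (hcc u h).2.2.1, fun u h => (hcc u h).2.2.2⟩⟩

open Classical in
noncomputable def vv (j : ℕ) : Finset (ℤ × ℤ) := (bx (16^j)).filter fun u => IsCoprime u.1 u.2 ∧ ((16^(j-1):ℕ):ℤ) < u.1
noncomputable def lam (j : ℕ) : ℝ := 1/(§16^j)^2/j
noncomputable def fam (J1 J2 : ℕ) : Finset (Σ _ : ℕ, ℤ × ℤ) := (Icc J1 J2).sigma fun j => vv j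

theorem lam_nn (j : ℕ) : 0 ≤ lam j := by unfold lam; positivity

theorem mem_fam {J1 J2 : ℕ} {i : Σ _ : ℕ, ℤ × ℤ} (h : i ∈ fam J1 J2) : (J1 ≤ i.1 ∧ i.1 ≤ J2) ∧ i.2 ∈ bx (16^i.1) ∧ IsCoprime i.2.1 i.2.2 ∧ ((16^(i.1-1):ℕ):ℤ) < i.2.1 := by
  simpa only [fam, vv, mem_sigma, mem_Icc, mem_filter] using h

theorem bx_of_q (P : Pk) (V : ℕ) (u : ℤ × ℤ) (h1 : 1 ≤ u.1) (h2 : 1 ≤ u.2) (hq : P.q u ≤ P.M * ¥V^2) : u ∈ bx (P.M*V) := by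
  have hM := P.hM
  have := P.hκ; have := P.hγ; have a0n := P.ha0; have := abs_nonneg P.β
  have k1 : P.κ * P.q u = (P.κ*u.1+P.β*u.2)^2 + P.a0^2*u.2^2 := by rw [← P.hd]; unfold Pk.q qf; ring
  have k2 : P.γ * P.q u = (P.γ*u.2+P.β*u.1)^2 + P.a0^2*u.1^2 := by rw [← P.hd]; unfold Pk.q qf; ring
  have a1 : 1 ≤ P.a0^2 := by nlinarith
  have bd : ∀ t s k : ℤ, 0 < k → k ≤ P.M → k * P.q u = s^2 + P.a0^2*t^2 → t ≤ P.M*V := by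
    intro t s k k0 kM e
    have q0 := P.q_nn u
    refine le_of_sq_le_sq ◌ ¶
    have : k * P.q u ≤ P.M * (P.M*¥V^2) := by gcongr
    linarith [sq_nonneg s, mul_nonneg (sub_nonneg.2 a1) (sq_nonneg t)]
  simp only [bx, mem_product, mem_Icc]; push_cast
  exact ⟨⟨h1, bd _ _ _ P.hγ ¢ k2⟩, h2, bd _ _ _ P.hκ ¢ k1⟩

theorem fam_fst {J1 J2 : ℕ} {i i' : Σ _ : ℕ, ℤ × ℤ} (h : i ∈ fam J1 J2) (h' : i' ∈ fam J1 J2) (e : i.2 = i'.2) : i = i' := by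
  have key : ∀ {i i' : Σ _ : ℕ, ℤ × ℤ}, i ∈ fam J1 J2 → i' ∈ fam J1 J2 → i.2 = i'.2 → i'.1 ≤ i.1 := by
    intro i i' h h' e
    by_contra hlt
    have m := mem_fam h; have m' := mem_fam h'
    simp only [bx, mem_product, mem_Icc] at m
    have h1 : (16^i.1:ℕ) ≤ 16^(i'.1-1) := Nat.pow_le_pow_right ¤ ¢
    have h2 := m.2.1.1.2
    have h3 := m'.2.2.2
    rw [← e] at h3
    omega
  exact Sigma.ext (le_antisymm (key h' h e.symm) (key h h' e)) (heq_of_eq e)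

/-- multiplicity sum -/
theorem diag_mult (P : Pk) (J1 J2 : ℕ) (hJ : 1 ≤ J1) : ∑ i ∈ fam J1 J2, ∑ i' ∈ fam J1 J2, (if P.q i.2 = P.q i'.2 then lam i.1^2 * (P.q i.2 - P.a0 : ℤ) else 0) ≤
    272*§P.M^5*(4+2*§P.M^2) * ∑ j ∈ Icc J1 J2, 1/§j := by
  classical
  have M1 : §1 ≤ P.M := by
    have hM := P.hM
    have := P.hκ; have := P.hγ; have a0n := P.ha0; have := abs_nonneg P.β
    exact_mod_cast (by omega : 1 ≤ P.M)
  conv_lhs => rw [fam, sum_sigma]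
  rw [mul_sum]
  refine sum_le_sum fun j hj => ◌
  have hj1 : §1 ≤ j := mod_cast hJ.trans (mem_Icc.1 hj).1
  set V := 16^j with hV
  have V1 : §1 ≤ V := mod_cast Nat.one_le_pow _ _ ¤
  have c1 : ∑ v ∈ vv j, ∑ i' ∈ fam J1 J2, (if P.q v = P.q i'.2 then lam j^2 * ((P.q v - P.a0 : ℤ):ℝ) else 0) ≤
      (((vv j ×ˢ fam J1 J2).filter fun p => P.q p.1 = P.q p.2.2).card:ℝ) * (lam j^2 * (P.M*§V^2)) := by
    rw [← sum_product', ← sum_filter, ← nsmul_eq_mul]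
    refine sum_le_card_nsmul _ _ _ fun p hp => ◌
    have hv := (mem_filter.1 (mem_product.1 (mem_filter.1 hp).1).1).1
    have := P.q_le V p.1 hv
    have h2 : ((P.q p.1 - P.a0:ℤ):ℝ) ≤ P.M*§V^2 := mod_cast this
    gcongr
  have c2 : ((vv j ×ˢ fam J1 J2).filter fun p => P.q p.1 = P.q p.2.2).card ≤ ((bx (P.M*V) ×ˢ bx (P.M*V)).filter fun p => P.q p.1 = P.q p.2).card := by
    refine card_le_card_of_injOn (fun p => (p.1, p.2.2)) (fun p hp => ◌) fun p hp p' hp' h => ◌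
    · obtain ⟨h1, h2⟩ := mem_filter.1 (mem_coe.1 hp)
      obtain ⟨h3, h4⟩ := mem_product.1 h1
      have hb := (mem_filter.1 h3).1
      have hb' := (mem_fam h4).2.1
      have hq := P.q_le V _ hb
      have := P.ha0
      simp only [bx, mem_product, mem_Icc] at hb hb'
      refine mem_coe.2 (mem_filter.2 ⟨mem_product.2 ⟨bx_of_q P V _ hb.1.1 hb.2.1 (by show P.q p.1 ≤ _; omega), bx_of_q P V _ hb'.1.1 hb'.2.1 (by rw [← h2]; omega)⟩, h2⟩)
    · have e := Prod.ext_iff.1 h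
      exact Prod.ext e.1 (fam_fst (mem_product.1 (mem_filter.1 (mem_coe.1 hp)).1).2 (mem_product.1 (mem_filter.1 (mem_coe.1 hp')).1).2 e.2)
  have c3 := mult P (P.M*V) (by have : §1 ≤ ((P.M*V:ℕ):ℝ) := by push_cast; nlinarith
                                exact_mod_cast this)
  have hl : 1 + log (2*P.M*(P.M*V:ℕ)) ≤ (4+2*§P.M^2)*j := by
    have e : (2*P.M*(P.M*V:ℕ):ℝ) = (2*§P.M^2)*§16^j := by rw [hV]; push_cast; ring
    rw [e, log_mul ¶ ¶, log_pow]
    have l1 := log_le_sub_one_of_pos (show 0 < 2*§P.M^2 by positivity)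
    have l2 : log 16 ≤ 3 := by
      rw [show §16 = 2^4 by norm_num, log_pow]; push_cast; linarith [log_two_lt_d9]
    nlinarith [mul_le_mul_of_nonneg_left l2 (show §0 ≤ j by linarith), sq_nonneg §P.M]
  refine c1.trans ◌
  calc _ ≤ (272*§P.M^2*((P.M*V:ℕ):ℝ)^2*((4+2*§P.M^2)*j)) * (lam j^2 * (P.M*§V^2)) := by
        gcongr
        exact (by exact_mod_cast c2 : §_ ≤ _).trans (c3.trans (by gcongr))
    _ = 272*§P.M^5*(4+2*§P.M^2) * (1/§j) := by
        have : §V = §16^j := by rw [hV]; push_cast; ring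
        unfold lam; rw [← this]; push_cast; field_simp
end

section
open Finset MeasureTheory Real

noncomputable def HH (J1 J2 : ℕ) : ℝ := ∑ j ∈ Icc J1 J2, 1/§j
noncomputable def om {K : Set ℤ} (S : Sys K) (i : Σ _ : ℕ, ℤ × ℤ) : ℝ := lam i.1 * (S.cc i.2).a

theorem off_sum : ∃ C : ℝ, 1 ≤ C ∧ ∀ P : Pk, ∃ V0 : ℕ, ∀ J1 J2 : ℕ, V0 ≤ 16^J1 →
    ∑ i ∈ fam J1 J2, ∑ i' ∈ fam J1 J2, lam i.1 * lam i'.1 * EE P i.2 i'.2 ≤ C * HH J1 J2^2 := by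
  classical
  obtain ⟨C, hC, h⟩ := avgE
  refine ⟨C, hC, fun P => ◌⟩
  obtain ⟨V0, h⟩ := h P
  refine ⟨V0, fun J1 J2 hJ => ◌⟩
  have e : ∀ g : (Σ _ : ℕ, ℤ × ℤ) → ℝ, ∑ i ∈ fam J1 J2, g i = ∑ j ∈ Icc J1 J2, ∑ v ∈ vv j, g ⟨j, v⟩ := fun g => by rw [fam, sum_sigma]
  simp only [e]
  have hV : ∀ j ∈ Icc J1 J2, V0 ≤ 16^j := fun j hj => hJ.trans (Nat.pow_le_pow_right ¤ (mem_Icc.1 hj).1)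
  calc _ = ∑ j ∈ Icc J1 J2, ∑ j' ∈ Icc J1 J2, lam j * lam j' * ∑ v ∈ vv j, ∑ v' ∈ vv j', EE P v v' := by
        refine sum_congr rfl fun j _ => ◌
        rw [sum_comm]
        refine sum_congr rfl fun j' _ => ◌
        simp only [mul_sum]
    _ ≤ ∑ j ∈ Icc J1 J2, ∑ j' ∈ Icc J1 J2, C * (1/§j * (1/§j')) := by
        refine sum_le_sum fun j hj => sum_le_sum fun j' hj' => ◌
        have h1 : ∑ v ∈ vv j, ∑ v' ∈ vv j', EE P v v' ≤ ∑ v ∈ bx (16^j), ∑ v' ∈ bx (16^j'), EE P v v' :=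
          (sum_le_sum fun v _ => sum_le_sum_of_subset_of_nonneg (filter_subset _ _) fun _ _ _ => EE_nn _ _ _).trans
            (sum_le_sum_of_subset_of_nonneg (filter_subset _ _) fun _ _ _ => sum_nonneg fun _ _ => EE_nn _ _ _)
        have h2 := h1.trans (h _ _ (hV j hj) (hV j' hj'))
        refine (mul_le_mul_of_nonneg_left h2 (mul_nonneg (lam_nn j) (lam_nn j'))).trans (le_of_eq ◌)
        unfold lam; push_cast; field_simp
    _ = _ := by
        simp only [← mul_sum]; rw [← sum_mul]; unfold HH; ring

open Classical in
theorem sec : ∃ C1 : ℝ, 1 ≤ C1 ∧ ∀ (K : Set ℤ) (S : Sys K), ∃ (CP : ℝ) (V0 : ℕ), 0 ≤ CP ∧ ∀ (J1 J2 Q Z : ℕ) (T : ℝ), 1 ≤ J1 → V0 ≤ 16^J1 → 3 ≤ Q → 1 ≤ T → 2 ≤ Z → T ≤ Z →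
    (∀ i ∈ fam J1 J2, (S.cc i.2).Red ∧ ((S.cc i.2).a:ℝ) ≤ 8*§Q^2 ∧ log (§Q^2) ≤ ((S.cc i.2).a:ℝ)^(1/20:ℝ) ∧ ((S.cc i.2).A:ℝ) + (S.cc i.2).C ≤ T) →
    ∫ θ in Set.Icc §0 1, ‖Psi (fun i : fam J1 J2 => S.cc i.1.2) (fun i => om S i.1) (§Q^2) θ‖^2 ≤
      §Q^2 * (C1 * HH J1 J2^2 + CP * HH J1 J2) + 2 * (∑ i ∈ fam J1 J2, om S i)^2 * (2560 * T^8 * Q * (Q * §Z^¼ + ((Icc 1 Q).filter (exc Z)).card)) := by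
  obtain ⟨C1, hC1, h1⟩ := off_sum
  obtain ⟨C2, hC2, h2⟩ := sing_series
  obtain ⟨C3, hC3, h3⟩ := diag_bound
  refine ⟨2*C2*C1, by nlinarith, fun K S => ◌⟩
  obtain ⟨V0, h1⟩ := h1 S.P
  refine ⟨54*C3*(272*§S.P.M^5*(4+2*§S.P.M^2)), V0, by positivity, fun J1 J2 Q Z T hJ hV hQ hT hZ hTZ hF => ◌⟩
  set F := fam J1 J2 with hFd
  set err := 2560 * T^8 * Q * (Q * §Z^¼ + ((Icc 1 Q).filter (exc Z)).card) with herr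
  have err0 : 0 ≤ err := by positivity
  have ap : ∀ i, §0 < (S.cc i).a := fun i => by exact_mod_cast (S.cc i).ha
  have om0 : ∀ i, 0 ≤ om S i := fun i => mul_nonneg (lam_nn _) (ap _).le
  have hQ3 : §3 ≤ Q := mod_cast hQ
  have pair : ∀ g : (Σ _ : ℕ, ℤ × ℤ) → (Σ _ : ℕ, ℤ × ℤ) → ℝ, ∑ p : F × F, g p.1 p.2 = ∑ i ∈ F, ∑ i' ∈ F, g i i' := by
    intro g
    rw [Fintype.sum_prod_type]
    rw [← sum_coe_sort F]
    exact sum_congr rfl fun i _ => sum_coe_sort F (fun i' => g i i')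
  refine (second_moment (fun i : F => S.cc i.1.2) (fun i => om S i.1) (fun i => om0 _) Q ¢).trans ◌
  have co : ∀ i : F, IsCoprime i.1.2.1 i.1.2.2 := fun i => (mem_fam i.2).2.2.1
  have off : ∑ p ∈ (univ : Finset (F × F)).filter (fun p => (S.cc p.1.1.2).a ≠ (S.cc p.2.1.2).a), om S p.1 * om S p.2 * (S.cc p.1.1.2).cross Q (S.cc p.2.1.2) ≤
      §Q^2 * C2 * (C1 * HH J1 J2^2) + (∑ i ∈ F, om S i)^2 * err := by
    calc _ ≤ ∑ p ∈ (univ : Finset (F × F)).filter (fun p => (S.cc p.1.1.2).a ≠ (S.cc p.2.1.2).a), (§Q^2 * C2 * (lam p.1.1.1 * lam p.2.1.1 * EE S.P p.1.1.2 p.2.1.2) + om S p.1 * om S p.2 * err) := by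
          refine sum_le_sum fun p hp => ◌
          have hne := (mem_filter.1 hp).2
          have hc := cross_le _ _ hne Q Z T hT (hF _ p.1.2).2.2.2 (hF _ p.2.2).2.2.2 hZ hTZ
          have hs := h2 _ _ hne Q
          have hEE : RR (S.cc p.1.1.2).a.natAbs + RR (S.cc p.2.1.2).a.natAbs + RR (S.cc p.1.1.2).A.natAbs + RR (S.cc p.2.1.2).A.natAbs + RR ((S.cc p.1.1.2).a-(S.cc p.2.1.2).a).natAbs + (Int.gcd (S.cc p.1.1.2).a (S.cc p.2.1.2).a : ℝ)^⅛ = EE S.P p.1.1.2 p.2.1.2 := by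
            rw [S.ha _ (co p.1), S.ha _ (co p.2)] at hne ⊢
            rw [S.hA _ (co p.1), S.hA _ (co p.2)]
            unfold EE; rw [if_neg (fun h => hne (by rw [h]))]; congr 4; ring
          rw [hEE] at hs
          have a1 := ap p.1.1.2; have a2 := ap p.2.1.2
          have hF0 := EE_nn S.P p.1.1.2 p.2.1.2
          have l1 := lam_nn p.1.1.1; have l2 := lam_nn p.2.1.1
          have hpi : π/4 ≤ 1 := by linarith [pi_le_four]
          calc om S p.1 * om S p.2 * (S.cc p.1.1.2).cross Q (S.cc p.2.1.2) ≤ om S p.1 * om S p.2 * (π * §Q^2 / 4 / (((S.cc p.1.1.2).a:ℝ)*((S.cc p.2.1.2).a:ℝ)) * (C2 * EE S.P p.1.1.2 p.2.1.2) + err) := by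
                refine mul_le_mul_of_nonneg_left (hc.trans ◌) (mul_nonneg (om0 _) (om0 _))
                gcongr
            _ = (π/4) * (§Q^2 * C2 * (lam p.1.1.1 * lam p.2.1.1 * EE S.P p.1.1.2 p.2.1.2)) + om S p.1 * om S p.2 * err := by
                simp only [om]; field_simp
            _ ≤ 1 * (§Q^2 * C2 * (lam p.1.1.1 * lam p.2.1.1 * EE S.P p.1.1.2 p.2.1.2)) + om S p.1 * om S p.2 * err := by gcongr
            _ = _ := by rw [one_mul]
      _ ≤ ∑ p : F × F, (§Q^2 * C2 * (lam p.1.1.1 * lam p.2.1.1 * EE S.P p.1.1.2 p.2.1.2) + om S p.1 * om S p.2 * err) := by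
          refine sum_le_sum_of_subset_of_nonneg (filter_subset _ _) fun p _ _ => ◌
          have := EE_nn S.P p.1.1.2 p.2.1.2; have := lam_nn p.1.1.1; have := lam_nn p.2.1.1; have := om0 p.1; have := om0 p.2
          positivity
      _ = §Q^2 * C2 * (∑ i ∈ F, ∑ i' ∈ F, lam i.1 * lam i'.1 * EE S.P i.2 i'.2) + (∑ i ∈ F, om S i)^2 * err := by
          rw [pair (fun i i' => §Q^2 * C2 * (lam i.1 * lam i'.1 * EE S.P i.2 i'.2) + om S i * om S i' * err), sq (∑ i ∈ F, om S i), sum_mul_sum]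
          simp only [sum_add_distrib, mul_sum, sum_mul]
      _ ≤ _ := by have := h1 J1 J2 hV; gcongr
  have dia : ∑ p ∈ (univ : Finset (F × F)).filter (fun p => (S.cc p.1.1.2).a = (S.cc p.2.1.2).a), om S p.1^2 * ∫ θ in Set.Icc §0 1, ‖(S.cc p.1.1.2).th (§Q^2) θ‖^2 ≤
      C3 * §Q^2 * (272*§S.P.M^5*(4+2*§S.P.M^2) * HH J1 J2) := by
    rw [sum_filter]
    calc _ ≤ ∑ p : F × F, C3 * §Q^2 * (if S.P.q p.1.1.2 = S.P.q p.2.1.2 then lam p.1.1.1^2 * (S.P.q p.1.1.2 - S.P.a0 : ℤ) else 0) := by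
          refine sum_le_sum fun p _ => ◌
          have e1 := S.ha _ (co p.1); have e2 := S.ha _ (co p.2)
          by_cases h : S.P.q p.1.1.2 = S.P.q p.2.1.2
          · rw [if_pos h, if_pos (by rw [e1, e2, h]), ← e1]
            obtain ⟨r1, r2, r3, -⟩ := hF _ p.1.2
            have d := h3 _ r1 (§Q^2) (by nlinarith) r2 r3
            have a1 := ap p.1.1.2
            calc _ ≤ om S p.1^2 * (C3 * (§Q^2/(S.cc p.1.1.2).a)) := by gcongr
              _ = _ := by simp only [om]; field_simp
          · rw [if_neg h, if_neg (by rw [e1, e2]; omega), mul_zero]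
      _ = C3 * §Q^2 * ∑ i ∈ F, ∑ i' ∈ F, (if S.P.q i.2 = S.P.q i'.2 then lam i.1^2 * (S.P.q i.2 - S.P.a0 : ℤ) else 0) := by
          rw [← mul_sum, pair (fun i i' => if S.P.q i.2 = S.P.q i'.2 then lam i.1^2 * (S.P.q i.2 - S.P.a0 : ℤ) else 0)]
      _ ≤ _ := by have := diag_mult S.P J1 J2 hJ; unfold HH; gcongr
  calc _ ≤ 2 * (§Q^2 * C2 * (C1 * HH J1 J2^2) + (∑ i ∈ F, om S i)^2 * err) + 54 * (C3 * §Q^2 * (272*§S.P.M^5*(4+2*§S.P.M^2) * HH J1 J2)) := by gcongr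
    _ = _ := by ring
end

section
open Finset MeasureTheory Real

theorem HH_lower (J : ℕ) (hJ : 1 ≤ J) (k : ℕ) : §k/2 ≤ HH J (2^k*J) := by
  induction k with
  | zero => simp only [Nat.cast_zero, zero_div]; unfold HH; positivity
  | succ k ih =>
    set n := 2^k*J with hn
    have h1 : J ≤ n := Nat.le_mul_of_pos_left _ ¶
    have e : 2^(k+1)*J = n+n := by rw [hn]; ring
    have hs : Icc J (n+n) = Icc J n ∪ Ioc n (n+n) := by ext x; simp only [mem_union, mem_Icc, mem_Ioc]; omega
    have hd : Disjoint (Icc J n) (Ioc n (n+n)) := disjoint_left.2 fun x hx hx' => by simp only [mem_Icc, mem_Ioc] at hx hx'; omega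
    have n0 : §0 < n := mod_cast (by omega : 0 < n)
    have h2 : §1/2 ≤ ∑ j ∈ Ioc n (n+n), 1/§j := by
      calc §1/2 = (Ioc n (n+n)).card • (1/(n+n:ℝ)) := by rw [Nat.card_Ioc, nsmul_eq_mul, Nat.add_sub_cancel]; field_simp; norm_num
        _ ≤ _ := card_nsmul_le_sum _ _ _ fun x hx => by
          have hx := mem_Ioc.1 hx
          have : §0 < x := mod_cast (by omega : 0 < x)
          exact one_div_le_one_div_of_le this (by exact_mod_cast hx.2)
    rw [e]; unfold HH at ih ⊢; rw [hs, sum_union hd]; push_cast; linarith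

open Classical in
theorem params (M n V0 : ℕ) (hM : 1 ≤ M) (hn : 1 ≤ n) : ∃ Q0 : ℕ, ∀ Q ≥ Q0, ∃ J Z : ℕ, ∃ T : ℝ, T = 4*M*(§16^(n*J))^3 ∧ 1 ≤ J ∧ V0 ≤ 16^J ∧ 3 ≤ Q ∧ 2 ≤ Z ∧ T ≤ Z ∧
    20000*T ≤ §Q^2 ∧ (2*log Q)^20*(256*M) ≤ (§16^J)^2 ∧ 256*M*(M+64:ℝ) ≤ (§16^J)^2 ∧
    5120*T^10*(Q*§Z^¼ + ((Icc 1 Q).filter (exc Z)).card) ≤ Q := by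
  set m := 4*(641*n)+1 with hm
  obtain ⟨Q1, hQ1⟩ := exc_small m (641*n) ¢
  have hlog : Filter.Tendsto (fun Q : ℕ => log Q) .atTop .atTop := tendsto_log_atTop.comp tendsto_natCast_atTop_atTop
  have hpow : ∀ᶠ Q : ℕ in .atTop, log Q^(64*n) ≤ §Q := by
    have := (isLittleO_log_rpow_rpow_atTop ((64*n:ℕ):ℝ) (zero_lt_one)).bound (zero_lt_one)
    filter_upwards [tendsto_natCast_atTop_atTop.eventually this, hlog.eventually_ge_atTop 0] with Q h h0
    rw [rpow_natCast, rpow_one, one_mul, norm_of_nonneg ¶, norm_of_nonneg ¶] at h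
    exact h
  obtain ⟨Q0, h0⟩ := Filter.eventually_atTop.1 (hpow.and ((hlog.eventually_ge_atTop (20000+4*M+V0:ℝ)).and ((Filter.eventually_ge_atTop (Q1+20000)))))
  refine ⟨Q0, fun Q hQ => ◌⟩
  obtain ⟨hp, hL, hQ'⟩ := h0 Q hQ
  have hex := hQ1 Q ¢
  set L := log Q
  have M1 : §1 ≤ M := mod_cast hM
  have V00 : §0 ≤ V0 := by positivity
  have L1 : §20000 ≤ L := by linarith
  have L2 : (4*M:ℝ) ≤ L := by linarith
  have L0 : 0 < L := by linarith
  have L1' : 1 ≤ L := by linarith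
  obtain ⟨J, hJ1, hJ2⟩ := exists_nat_pow_near (one_le_pow₀ L1' : 1 ≤ L^20) (by norm_num : §1 < 16)
  have hJ3 : §16^(J+1) ≤ L^21 := by
    rw [pow_succ, pow_succ L]; gcongr; linarith
  set T : ℝ := 4*M*(§16^(n*(J+1)))^3 with hT
  have hTL : T ≤ L^(64*n) := by
    calc T ≤ L^n * ((L^21)^n)^3 := by
          rw [hT, mul_comm n, pow_mul]; gcongr; exact L2.trans (le_self_pow₀ L1' ¢)
      _ = _ := by rw [← pow_mul, ← pow_mul, ← pow_add]; congr 1; ring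
  have T0 : 0 < T := by positivity
  have Z1 : L^(4*(641*n)) ≤ (⌊L^m⌋₊:ℝ) := by
    have := Nat.lt_floor_add_one (L^m)
    have h1 : L * 1 ≤ L * L^(4*(641*n)) := by gcongr; exact one_le_pow₀ L1'
    rw [hm, pow_succ] at *
    nlinarith [one_le_pow₀ L1' (n := 4*(641*n))]
  have Lbig : ∀ k : ℕ, k ≠ 0 → L ≤ L^k := fun k hk => le_self_pow₀ L1' hk
  have hTZ : T ≤ (⌊L^m⌋₊:ℝ) := hTL.trans ((pow_le_pow_right₀ L1' ¢).trans Z1)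
  have hsq : L^40 ≤ (§16^(J+1))^2 := by
    calc L^40 = (L^20)^2 := by ring
      _ ≤ _ := by gcongr
  have QR : §20000 ≤ Q := mod_cast (by omega : 20000 ≤ Q)
  refine ⟨J+1, ⌊L^m⌋₊, T, rfl, by omega, ◌, by omega, ◌, hTZ, ◌, ◌, ◌, ◌⟩
  · have : §V0 ≤ 16^(J+1) := by linarith [Lbig 20 ¤]
    exact_mod_cast this
  · have : §2 ≤ (⌊L^m⌋₊:ℝ) := by linarith [Lbig (4*(641*n)) ¢]
    exact_mod_cast this
  · nlinarith
  · refine le_trans ◌ hsq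
    calc (2*L)^20*(256*M) = L^20 * (2^20*64*(4*M)) := by ring
      _ ≤ L^20 * (L*L*L) := by
          have : (2^20*64:ℝ) ≤ L*L := by nlinarith
          gcongr
      _ ≤ L^20*L^20 := by gcongr; rw [← sq, ← pow_succ]; exact pow_le_pow_right₀ L1' ¤
      _ = _ := by ring
  · refine le_trans ◌ hsq
    calc 256*M*(M+64:ℝ) = 64*(4*M)*(M+64) := by ring
      _ ≤ L*L*L := by gcongr <;> linarith
      _ = L^3 := by ring
      _ ≤ _ := pow_le_pow_right₀ L1' ¤
  · have hZ : (⌊L^m⌋₊:ℝ)^¼ ≤ 1/L^(641*n) := by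
      refine (rpow_le_rpow_of_nonpos ¶ Z1 ¤).trans (le_of_eq ◌)
      rw [← rpow_natCast L (4*_), ← rpow_mul L0.le, ← rpow_natCast L (641*n), one_div (L^_), ← rpow_neg L0.le]; congr 1; push_cast; ring
    calc _ ≤ 5120*(L^(64*n))^10*(Q*(1/L^(641*n)) + Q/L^(641*n)) := by gcongr
      _ = Q * (10240 * (L^(640*n)/L^(641*n))) := by rw [← pow_mul, show 64*n*10 = 640*n by ring]; ring
      _ ≤ Q * (10240 * (1/L)) := by
          refine mul_le_mul_of_nonneg_left (mul_le_mul_of_nonneg_left ◌ ¤) £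
          rw [div_le_div_iff₀ ¶ L0, ← pow_succ, one_mul]
          exact pow_le_pow_right₀ L1' ¢
      _ ≤ Q * 1 := by gcongr; rw [mul_one_div, div_le_one L0]; linarith
      _ = _ := mul_one _
end

section
open Finset MeasureTheory Real

open Classical in
theorem first_mom {K : Set ℤ} (S : Sys K) (J1 J2 Q : ℕ) (hJ : 1 ≤ J1) (hQ : 0 < Q) (hF : ∀ i ∈ fam J1 J2, (S.cc i.2).Red ∧ 20000*(S.cc i.2).a ≤ ¥Q^2) :
    (§Q^2/320*HH J1 J2)^2 ≤ ((Icc ¥1 (Q^2)).filter (· ∈ K)).card * (exp (8*π) *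
      ∫ θ in Set.Icc §0 1, ‖Psi (fun i : fam J1 J2 => S.cc i.1.2) (fun i => om S i.1) (§Q^2) θ‖^2) := by
  set F := fam J1 J2 with hFd
  have ap : ∀ i, §0 < (S.cc i).a := fun i => by exact_mod_cast (S.cc i).ha
  have om0 : ∀ i, 0 ≤ om S i := fun i => mul_nonneg (lam_nn _) (ap _).le
  choose U hU using fun i : F => first_one _ (hF i.1 i.2).1 Q (hF i.1 i.2).2
  have hm : ∀ i ∈ ((univ : Finset F).sigma U).map (Equiv.sigmaEquivProd F (ℤ × ℤ)).toEmbedding, i.2 ∈ U i.1 := by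
    intro i hi
    obtain ⟨x, hx, rfl⟩ := mem_map.1 hi
    exact (mem_sigma.1 hx).2
  refine le_trans ◌ (cs_bound (fun i : F => S.cc i.1.2) (fun i => om S i.1) (fun i => om0 _) (§Q^2) ¶
    (((univ : Finset F).sigma U).map (Equiv.sigmaEquivProd F (ℤ × ℤ)).toEmbedding) _ (fun i hi => ◌) (fun i hi => ◌))
  · have hH : 0 ≤ HH J1 J2 := sum_nonneg fun _ _ => by positivity
    refine pow_le_pow_left₀ ¶ ◌ 2
    rw [sum_map, sum_sigma]
    simp only [Equiv.coe_toEmbedding, Equiv.sigmaEquivProd_apply, sum_const, nsmul_eq_mul]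
    calc §Q^2/320*HH J1 J2 ≤ ∑ i ∈ F, §Q^2/80*lam i.1 := by
          rw [hFd, fam, sum_sigma, HH, mul_sum]
          refine sum_le_sum fun j hj => ◌
          simp only [sum_const, nsmul_eq_mul]
          have j1 : 1 ≤ j := hJ.trans (mem_Icc.1 hj).1
          have hc := cop_box (16^j) (16^(j-1))
          have e : §16^j = 16^(j-1)*16 := by rw [← pow_succ]; congr 1; omega
          have hv : (§16^j)^2/4 ≤ (vv j).card := by
            refine le_trans ◌ (hc.trans (le_of_eq ◌))
            · push_cast; rw [e]; linarith [sq_nonneg (§16^(j-1))]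
            · unfold vv; congr
          have j0 : §0 < j := mod_cast j1
          calc §Q^2/320*(1/j) = (§16^j)^2/4 * (§Q^2/80*lam j) := by unfold lam; field_simp; norm_num
            _ ≤ _ := mul_le_mul_of_nonneg_right hv (mul_nonneg ¶ (lam_nn j))
      _ = ∑ i : F, §Q^2/80*lam i.1.1 := (sum_coe_sort F _).symm
      _ ≤ _ := sum_le_sum fun i _ => by
          have h := (hU i).1
          have := ap i.1.2
          rw [div_le_iff₀ ¶] at h
          have := mul_le_mul_of_nonneg_right h (lam_nn i.1.1)
          unfold om; linarith
  · obtain ⟨h1, h2, h3⟩ := (hU i.1).2 _ (hm i hi)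
    have := (S.cc i.1.1.2).ha
    exact mem_filter.2 ⟨mem_Icc.2 ⟨h2, by omega⟩, S.hk _ (mem_fam i.1.2).2.2.1 _ h1⟩
  · have h := ((hU i.1).2 _ (hm i hi)).2.2
    have : ((S.cc i.1.1.2).f i.2:ℝ) ≤ §Q^2 := mod_cast h
    linarith [sq_nonneg §Q]

theorem alg1 {Q H C1 CP s T R : ℝ} (Q0 : 0 ≤ Q) (H1 : CP + 1 ≤ H) (hCP : 0 ≤ CP) (s0 : 0 ≤ s) (hs : s ≤ T) (R0 : 0 ≤ R) (b : 5120*T^10*R ≤ Q) :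
    Q^2 * (C1 * H^2 + CP * H) + 2 * s^2 * (2560 * T^8 * Q * R) ≤ Q^2*((C1+2)*H^2) := by
  have T0 := s0.trans hs
  calc _ ≤ Q^2 * (C1 * H^2 + CP * H) + 2 * T^2 * (2560 * T^8 * Q * R) := by gcongr
    _ = Q^2 * (C1 * H^2 + CP * H) + Q*(5120*T^10*R) := by ring
    _ ≤ Q^2 * (C1 * H^2 + CP * H) + Q*Q := by gcongr
    _ = Q^2 * (C1 * H^2 + (CP * H + 1)) := by ring
    _ ≤ _ := by
      refine mul_le_mul_of_nonneg_left ◌ (sq_nonneg Q)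
      nlinarith

theorem alg2 {Q H C1 N E : ℝ} (Q0 : 0 < Q) (H0 : 0 < H) (C0 : 0 < C1 + 2) (E0 : 0 < E) (h : (Q^2/320*H)^2 ≤ N * (E * (Q^2*((C1+2)*H^2)))) :
    1/(320^2*(E*(C1+2)))*Q^2 ≤ N := by
  rw [one_div_mul_eq_div, div_le_iff₀ ¶]
  refine le_of_mul_le_mul_right ◌ (by positivity : 0 < Q^2*H^2/320^2)
  linarith

open Classical in
theorem density : ∃ c0 : ℝ, 0 < c0 ∧ ∀ (K : Set ℤ) (_ : Sys K), ∃ Q0 : ℕ, ∀ Q ≥ Q0, c0*§Q^2 ≤ ((Icc ¥1 (Q^2)).filter (· ∈ K)).card := by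
  obtain ⟨C1, hC1, h⟩ := sec
  refine ⟨1/(320^2*(exp (8*π)*(C1+2))), by positivity, fun K S => ◌⟩
  obtain ⟨CP, V0, hCP, h⟩ := h K S
  obtain ⟨k, hk⟩ := exists_nat_ge (2*CP+2)
  have hM := S.P.hM
  have p1 := S.P.hκ; have p2 := S.P.hγ; have a0n := S.P.ha0; have p3 := abs_nonneg S.P.β
  obtain ⟨Q0, hQ0⟩ := params S.P.M (2^k) V0 ¢ Nat.one_le_two_pow
  refine ⟨Q0, fun Q hQ => ◌⟩
  obtain ⟨J, Z, T, hT, hJ, hV, hQ3, hZ, hTZ, hTQ, b1, b2, b3⟩ := hQ0 Q hQ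
  have hH := HH_lower J hJ k
  set J2 := 2^k*J
  set H := HH J J2
  have M1 : §1 ≤ S.P.M := mod_cast (by omega : 1 ≤ S.P.M)
  set W : ℝ := 16^J2 with hW
  have W1 : 1 ≤ W := one_le_pow₀ ¤
  have W2 : S.P.M*W^2 ≤ T/4 := by
    rw [hT]; linarith [mul_le_mul_of_nonneg_left W1 (by positivity : 0 ≤ S.P.M*W^2)]
  have T1 : 1 ≤ T := by nlinarith [one_le_pow₀ W1 (n := 2)]
  have Q1 : §3 ≤ Q := mod_cast hQ3
  have key : ∀ i ∈ fam J J2, ((S.cc i.2).a:ℝ) ≤ S.P.M*(§16^i.1)^2 ∧ §16^i.1 ≤ W ∧ (§16^J)^2 ≤ 256*S.P.M*(S.cc i.2).A := by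
    intro i hi
    obtain ⟨⟨m1, m2⟩, m3, m4, m5⟩ := mem_fam hi
    have hq := S.P.q_le _ _ m3
    rw [← S.ha _ m4] at hq
    refine ⟨by exact_mod_cast hq, pow_le_pow_right₀ ¤ m2, ◌⟩
    have k2 : S.P.γ * S.P.q i.2 = (S.P.γ*i.2.2+S.P.β*i.2.1)^2 + S.P.a0^2*i.2.1^2 := by rw [← S.P.hd]; unfold Pk.q qf; ring
    rw [← S.hA _ m4] at k2
    have hA := (S.cc i.2).hA
    have a1 : 1 ≤ S.P.a0^2 := by nlinarith
    have h1 : i.2.1^2 ≤ S.P.M*(S.cc i.2).A := by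
      have : S.P.γ*(S.cc i.2).A ≤ S.P.M*(S.cc i.2).A := by gcongr; omega
      linarith [sq_nonneg (S.P.γ*i.2.2+S.P.β*i.2.1), mul_nonneg (sub_nonneg.2 a1) (sq_nonneg i.2.1)]
    have h2 : ¥16^J ≤ 16*i.2.1 := by
      have e : ¥16^i.1 = 16*16^(i.1-1) := by rw [← pow_succ']; congr 1; omega
      have := pow_le_pow_right₀ (by norm_num : ¥1 ≤ 16) m1
      push_cast at m5; linarith
    have h3 : (¥16^J)^2 ≤ (16*i.2.1)^2 := by gcongr
    have : (¥16^J)^2 ≤ 256*S.P.M*(S.cc i.2).A := by linarith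
    exact_mod_cast this
  have aT : ∀ i ∈ fam J J2, ((S.cc i.2).a:ℝ) ≤ T/4 := fun i hi => by
    obtain ⟨k1, k2, -⟩ := key i hi
    refine k1.trans (le_trans ◌ W2); gcongr
  have red : ∀ i ∈ fam J J2, (S.cc i.2).Red := fun i hi => by
    have hi' := (mem_fam hi).2.2.1
    have hk := b2.trans (key i hi).2.2
    have : (S.P.M+64:ℝ) ≤ (S.cc i.2).A := le_of_mul_le_mul_left hk ¶
    have : (S.P.M+64:ℤ) ≤ (S.cc i.2).A := mod_cast this
    have e1 := S.ha _ hi'; have e2 := S.hA _ hi'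
    exact ⟨by omega, by omega, by omega, S.hB _ hi'⟩
  have hs := h J J2 Q Z T hJ hV hQ3 T1 hZ hTZ fun i hi => ⟨red i hi, by linarith [aT i hi, sq_nonneg §Q], ◌, ◌⟩
  · have hf := first_mom S J J2 Q hJ ¢ fun i hi => ⟨red i hi, by
      have := aT i hi
      have : 20000*((S.cc i.2).a:ℝ) ≤ §Q^2 := by linarith
      exact_mod_cast this⟩
    have hsum : ∑ i ∈ fam J J2, om S i ≤ T := by
      rw [fam, sum_sigma]
      calc _ ≤ ∑ j ∈ Icc J J2, S.P.M*W^2 := sum_le_sum fun j hj => by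
            have hj' := mem_Icc.1 hj
            have j1 : §1 ≤ j := mod_cast hJ.trans hj'.1
            calc _ ≤ (vv j).card • §S.P.M := sum_le_card_nsmul _ _ _ fun u hu => by
                  have := (key ⟨j, u⟩ (by rw [fam]; exact mem_sigma.2 ⟨hj, hu⟩)).1
                  calc om S ⟨j, u⟩ ≤ lam j * (S.P.M*(§16^j)^2) := mul_le_mul_of_nonneg_left this (lam_nn j)
                    _ = S.P.M/j := by unfold lam; field_simp
                    _ ≤ S.P.M := div_le_self ¶ j1
              _ ≤ (§16^j)^2 * S.P.M := by
                  rw [nsmul_eq_mul]; gcongr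
                  refine le_trans (by exact_mod_cast card_filter_le _ _) ((bx_card (16^j)).le.trans (by push_cast; rfl))
              _ ≤ _ := by rw [mul_comm]; gcongr; exact pow_le_pow_right₀ ¤ hj'.2
        _ ≤ W * (S.P.M*W^2) := by
            rw [sum_const, nsmul_eq_mul]; gcongr
            have : (Icc J J2).card ≤ 16^J2 := by rw [Nat.card_Icc]; have := Nat.lt_pow_self (n := J2) (by norm_num : 1 < 16); omega
            rw [hW]; exact_mod_cast this
        _ ≤ T := by rw [hT]; linarith [mul_nonneg (by linarith : §0 ≤ S.P.M) (by positivity : 0 ≤ W^3)]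
    have s0 : 0 ≤ ∑ i ∈ fam J J2, om S i := sum_nonneg fun i _ => mul_nonneg (lam_nn _) (by exact_mod_cast (S.cc i.2).ha.le)
    have H1 : CP + 1 ≤ H := by linarith
    have int : ∫ θ in Set.Icc §0 1, ‖Psi (fun i : fam J J2 => S.cc i.1.2) (fun i => om S i.1) (§Q^2) θ‖^2 ≤ §Q^2*((C1+2)*H^2) := by
      exact hs.trans (alg1 ¶ H1 hCP s0 hsum ¶ b3)
    exact alg2 ¶ £ £ (exp_pos _) (hf.trans (by gcongr))
  · have hk := b1.trans (key i hi).2.2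
    have h1 := (red i hi).h2
    have h1' : ((S.cc i.2).A:ℝ) ≤ (S.cc i.2).a := mod_cast h1
    have : (2*log Q)^20 ≤ (S.cc i.2).a := by
      refine le_trans ◌ h1'
      refine le_of_mul_le_mul_right (hk.trans (le_of_eq ◌)) (by positivity : §0 < 256*S.P.M); ring
    rw [log_pow, one_div]
    have l0 := log_natCast_nonneg Q
    rw [le_rpow_inv_iff_of_pos ¶ (le_trans ¶ this) ¤]
    exact_mod_cast this
  · have hC := (red i hi).C_le; have h2 := (red i hi).h2; have := (S.cc i.2).ha
    have : ((S.cc i.2).A+(S.cc i.2).C:ℝ) ≤ 4*(S.cc i.2).a := mod_cast (by omega : (S.cc i.2).A+(S.cc i.2).C ≤ 4*(S.cc i.2).a)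
    linarith [aT i hi]

theorem curvatures_meet_dense_sets :
    ∃ τ : ℝ, 0 < τ ∧
      ∀ v : Fin 4 → ℤ, IsRootQuadruple v →
        ∃ X₀ : ℕ, ∀ X : ℕ, X₀ ≤ X →
          ∀ S : Finset ℕ, S ⊆ Finset.Icc 1 X → (1 - τ) * (X : ℝ) ≤ (S.card : ℝ) →
            ∃ n ∈ S, (n : ℤ) ∈ curvatures v := by
  classical
  obtain ⟨c0, h0, h⟩ := density
  refine ⟨c0/8, by positivity, fun v hv => ◌⟩
  obtain ⟨S⟩ := sys_exists v hv
  obtain ⟨Q0, h⟩ := h _ S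
  refine ⟨(Q0+1)*(Q0+1), fun X hX S hS hc => ◌⟩
  have hQ : Q0+1 ≤ X.sqrt := Nat.le_sqrt.2 hX
  have s1 := Nat.sqrt_le' X; have s2 := Nat.lt_succ_sqrt' X
  have hN := h X.sqrt ¢
  set Q := X.sqrt
  by_contra! hno
  have hd : Disjoint (S.map Nat.castEmbedding) ((Icc ¥1 (Q^2)).filter (· ∈ curvatures v)) := by
    refine disjoint_left.2 fun x hx hx' => ◌
    obtain ⟨n, hn, rfl⟩ := mem_map.1 hx
    exact hno n hn (mem_filter.1 hx').2
  have hsub : S.map Nat.castEmbedding ∪ (Icc ¥1 (Q^2)).filter (· ∈ curvatures v) ⊆ Icc ¥1 X := by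
    refine union_subset (fun x hx => ◌) fun x hx => ◌
    · obtain ⟨n, hn, rfl⟩ := mem_map.1 hx
      have := mem_Icc.1 (hS hn)
      rw [Nat.castEmbedding_apply, mem_Icc]; omega
    · have h1 := mem_Icc.1 (mem_filter.1 hx).1
      exact mem_Icc.2 ⟨h1.1, h1.2.trans (by exact_mod_cast s1)⟩
  have hcard := card_le_card hsub
  rw [card_union_of_disjoint hd, card_map, Int.card_Icc] at hcard
  have hcard' : §S.card + ((Icc ¥1 (Q^2)).filter (· ∈ curvatures v)).card ≤ X := by
    have : S.card + ((Icc ¥1 (Q^2)).filter (· ∈ curvatures v)).card ≤ X := by omega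
    exact_mod_cast this
  have hX4 : §X < 4*§Q^2 := by
    have : X < 4*Q^2 := by rw [Nat.succ_eq_add_one] at s2; nlinarith
    exact_mod_cast this
  have X0 : §0 ≤ X := by positivity
  nlinarith
end
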